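/- Let δ₂ = 0.044560, δ₃ = 0.074267, δ₄ = 0.103974, and δ_ℓ = 0.124821 for ℓ ≥ 5, and set θ_ℓ = ℓ − δ_ℓ. Let ℓ ≥ 2 be an integer and let α ≥ 1/2 and β ≥ 0 be real numbers with α, β ≤ 1. If α + β > 3/2 and β/(α + β − 3/2) ≤ θ_ℓ, then the quadruple (2, ℓ; α, β) is admissible: for every ε > 0 there exists M such that for every integer m ≥ M and every integer a with gcd(a,m) = 1, there exist primes p₁, p₂ ≤ m^{α+ε} and a positive integer s ≤ m^{β+ε} which is a product of at most ℓ primes (counted with multiplicity), such that p₁·p₂·s ≡ a (mod m). -/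

import Mathlib

/-- The Greaves sieve constants δ_ℓ. -/
noncomputable def greavesDelta (l : ℕ) : ℝ :=
  if l ≤ 2 then 0.044560
  else if l = 3 then 0.074267
  else if l = 4 then 0.103974
  else 0.124821

/-- θ_ℓ = ℓ - δ_ℓ. -/
noncomputable def greavesTheta (l : ℕ) : ℝ := l - greavesDelta l

section
open Filter Topology

/-- divisor bound -/
lemma div_bound (δ : ℝ) (hδ : 0 < δ) : ∃ C : ℝ, 0 < C ∧ ∀ n : ℕ, n ≠ 0 →
    (n.divisors.card : ℝ) ≤ C * (n : ℝ) ^ δ := by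
  obtain ⟨C0, hC0, hC⟩ : ∃ C0 : ℝ, 1 ≤ C0 ∧ ∀ v : ℕ, ((v : ℝ) + 1) ≤ C0 * (2 : ℝ) ^ (v * δ) := by
    refine ⟨1 + 1 / (δ * Real.log 2), ?_, ?_⟩
    · have : 0 < δ * Real.log 2 := mul_pos hδ (Real.log_pos (by norm_num))
      have : 0 < 1 / (δ * Real.log 2) := by positivity
      linarith
    · intro v
      have h2 : 0 < δ * Real.log 2 := mul_pos hδ (Real.log_pos (by norm_num))
      have : (2 : ℝ) ^ (v * δ) ≥ 1 + v * (δ * Real.log 2) := by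
        rw [Real.rpow_def_of_pos (by norm_num)]
        have := Real.add_one_le_exp (Real.log 2 * (v * δ))
        nlinarith
      have h3 : (0:ℝ) < 1 / (δ * Real.log 2) := by positivity
      have h4 : 1 / (δ * Real.log 2) * (δ * Real.log 2) = 1 := by field_simp
      have hv : (0:ℝ) ≤ v := by positivity
      calc (v:ℝ) + 1 ≤ (1 + 1 / (δ * Real.log 2)) * (1 + v * (δ * Real.log 2)) := by
            have : (1 + 1 / (δ * Real.log 2)) * (1 + v * (δ * Real.log 2)) =
              1 + v * (δ * Real.log 2) + 1 / (δ * Real.log 2) + v * (1 / (δ * Real.log 2) * (δ * Real.log 2)) := by ring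
            rw [this, h4]
            have : 0 ≤ v * (δ * Real.log 2) := by positivity
            linarith
        _ ≤ _ := by gcongr
  obtain ⟨P0, hP0⟩ : ∃ P0 : ℕ, ∀ p : ℕ, P0 ≤ p → (2 : ℝ) ≤ (p : ℝ) ^ δ := by
    have := (tendsto_rpow_atTop hδ).comp (tendsto_natCast_atTop_atTop (R := ℝ))
    obtain ⟨P0, h⟩ := (this.eventually_ge_atTop 2).exists_forall_of_atTop
    exact ⟨P0, fun p hp => h p hp⟩
  refine ⟨C0 ^ P0, by positivity, ?_⟩
  intro n hn
  rw [Nat.card_divisors hn]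
  have hn2 : (n : ℝ) ^ δ = ∏ p ∈ n.primeFactors, ((p : ℝ) ^ (n.factorization p * δ)) := by
    conv_lhs => rw [← Nat.prod_factorization_pow_eq_self hn]
    rw [Finsupp.prod, Nat.support_factorization]
    push_cast
    rw [← Real.finsetProd_rpow _ _ (fun i _ => by positivity)]
    refine Finset.prod_congr rfl fun p hp => ?_
    rw [Real.rpow_mul (by positivity), Real.rpow_natCast]
  have key : ∀ p ∈ n.primeFactors, ((n.factorization p : ℝ) + 1) ≤
      (if p < P0 then C0 else 1) * (p : ℝ) ^ (n.factorization p * δ) := by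
    intro p hp
    have hpp := Nat.prime_of_mem_primeFactors hp
    split_ifs with h
    · refine (hC _).trans ?_
      gcongr
      exact_mod_cast hpp.two_le
    · push Not at h
      have h2 := hP0 p h
      rw [one_mul, mul_comm, Real.rpow_mul (by positivity), Real.rpow_natCast]
      calc ((n.factorization p : ℝ) + 1) ≤ 2 ^ (n.factorization p) := by
            exact_mod_cast Nat.succ_le_of_lt (Nat.lt_two_pow_self)
        _ ≤ _ := by gcongr
  push_cast
  calc ∏ p ∈ n.primeFactors, ((n.factorization p : ℝ) + 1) ≤
      ∏ p ∈ n.primeFactors, ((if p < P0 then C0 else 1) * (p : ℝ) ^ (n.factorization p * δ)) :=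
        Finset.prod_le_prod (fun _ _ => by positivity) key
    _ = (∏ p ∈ n.primeFactors, (if p < P0 then C0 else 1)) * (n:ℝ) ^ δ := by
        rw [Finset.prod_mul_distrib, hn2]
    _ ≤ _ := by
        gcongr
        rw [← Finset.prod_filter, Finset.prod_const]
        apply pow_le_pow_right₀ hC0
        calc _ ≤ (Finset.range P0).card := Finset.card_le_card (by
                intro p hp; simp only [Finset.mem_filter] at hp; simpa using hp.2)
          _ = P0 := by simp

/-- constants and logs are eventually dominated by powers -/
lemma ev_const_le (C δ : ℝ) (hδ : 0 < δ) : ∀ᶠ m : ℕ in atTop, C ≤ (m : ℝ) ^ δ :=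
  ((tendsto_rpow_atTop hδ).comp (tendsto_natCast_atTop_atTop (R := ℝ))).eventually_ge_atTop C

lemma ev_log_le (C δ : ℝ) (hδ : 0 < δ) : ∀ᶠ m : ℕ in atTop, C * Real.log m ≤ (m : ℝ) ^ δ := by
  have h := (isLittleO_log_rpow_atTop hδ).comp_tendsto (tendsto_natCast_atTop_atTop (R := ℝ))
  have h2 := h.def (c := 1 / (|C| + 1)) (by positivity)
  filter_upwards [h2, eventually_ge_atTop 1] with m hm h1
  simp only [Function.comp] at hm
  have hl : 0 ≤ Real.log m := Real.log_nonneg (by exact_mod_cast h1)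
  have hp : 0 ≤ (m:ℝ) ^ δ := by positivity
  rw [Real.norm_of_nonneg hl, Real.norm_of_nonneg hp] at hm
  have : (|C| + 1) * Real.log m ≤ (m:ℝ)^δ := by
    have := mul_le_mul_of_nonneg_left hm (show 0 ≤ |C| + 1 by positivity)
    rwa [← mul_assoc, mul_one_div_cancel (by positivity), one_mul] at this
  nlinarith [le_abs_self C]

lemma ev_div (δ : ℝ) (hδ : 0 < δ) (k : ℝ) : ∀ᶠ m : ℕ in atTop, ∀ n : ℕ, n ≠ 0 →
    (n : ℝ) ≤ (m : ℝ) ^ k → (n.divisors.card : ℝ) ≤ (m : ℝ) ^ δ := by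
  have hk : 0 < 2 * (|k| + 1) := by positivity
  obtain ⟨C, hC, h⟩ := div_bound (δ / (2 * (|k| + 1))) (by positivity)
  filter_upwards [ev_const_le C (δ/2) (by positivity), eventually_ge_atTop 1] with m hm h1 n hn hnk
  have hm1 : (1:ℝ) ≤ m := by exact_mod_cast h1
  refine (h n hn).trans ?_
  calc C * (n:ℝ) ^ (δ / (2 * (|k| + 1))) ≤ (m:ℝ)^(δ/2) * ((m:ℝ)^(|k|+1)) ^ (δ / (2 * (|k| + 1))) := by
        gcongr
        exact hnk.trans (Real.rpow_le_rpow_of_exponent_le hm1 (by linarith [le_abs_self k]))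
    _ = (m:ℝ)^δ := by
        rw [← Real.rpow_mul (by positivity), ← Real.rpow_add (by positivity)]
        congr 1; field_simp; ring
end

section
open Filter Topology

section Fourier
variable {m : ℕ} [NeZero m]

noncomputable def ee (z : ZMod m) : ℂ := ZMod.stdAddChar z

lemma ee_norm (z : ZMod m) : ‖ee z‖ = 1 := by
  unfold ee; exact AddChar.norm_apply _ _

lemma ee_add (z w : ZMod m) : ee (z + w) = ee z * ee w := by
  unfold ee; exact AddChar.map_add_eq_mul _ _ _

lemma ee_zero : ee (0 : ZMod m) = 1 := by
  unfold ee; exact AddChar.map_zero_eq_one _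

lemma ee_conj (z : ZMod m) : starRingEnd ℂ (ee z) = ee (-z) := by
  unfold ee; rw [AddChar.map_neg_eq_conj]

lemma ee_sum (z : ZMod m) : ∑ h : ZMod m, ee (h * z) = if z = 0 then (m : ℂ) else 0 := by
  have := AddChar.sum_mulShift (ψ := (ZMod.stdAddChar : AddChar (ZMod m) ℂ)) z
    (ZMod.isPrimitive_stdAddChar m)
  unfold ee
  rw [this]; simp [ZMod.card]

/-- number of zeros of `h z = 0`. -/
def nz (h : ZMod m) : ℕ := (Finset.univ.filter (fun z : ZMod m => h * z = 0)).card

lemma bilin (X : (ZMod m)ˣ → ℝ) (V : (ZMod m)ˣ → ℂ) (h : ZMod m) :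
    ‖∑ x, ∑ y, (X x : ℂ) * V y * ee (h * (x : ZMod m) * (y : ZMod m))‖ ≤
      Real.sqrt (m * nz h) * Real.sqrt (∑ x, X x ^ 2) * Real.sqrt (∑ y, ‖V y‖ ^ 2) := by
  classical
  have h1 : ‖∑ x, ∑ y, (X x : ℂ) * V y * ee (h * (x : ZMod m) * (y : ZMod m))‖ ≤
      ∑ x, |X x| * ‖∑ y, V y * ee (h * (x : ZMod m) * (y : ZMod m))‖ := by
    refine (norm_sum_le _ _).trans (Finset.sum_le_sum fun x _ => ?_)
    have : ∑ y, (X x : ℂ) * V y * ee (h * (x : ZMod m) * (y : ZMod m)) = (X x : ℂ) * ∑ y, V y * ee (h * (x : ZMod m) * (y : ZMod m)) := by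
      rw [Finset.mul_sum]; exact Finset.sum_congr rfl fun _ _ => by ring
    rw [this, norm_mul, Complex.norm_real, Real.norm_eq_abs]
  have h2 : ∑ x, |X x| * ‖∑ y, V y * ee (h * (x : ZMod m) * (y : ZMod m))‖ ≤
      Real.sqrt (∑ x, |X x| ^ 2) * Real.sqrt (∑ x : (ZMod m)ˣ, ‖∑ y, V y * ee (h * (x : ZMod m) * (y : ZMod m))‖ ^ 2) :=
    Real.sum_mul_le_sqrt_mul_sqrt _ _ _
  have h3 : ∑ x : (ZMod m)ˣ, ‖∑ y, V y * ee (h * (x : ZMod m) * (y : ZMod m))‖ ^ 2 ≤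
      ∑ t : ZMod m, ‖∑ y : (ZMod m)ˣ, V y * ee (h * t * (y : ZMod m))‖ ^ 2 := by
    have := Finset.sum_map (Finset.univ : Finset (ZMod m)ˣ) ⟨fun u => (u : ZMod m), Units.val_injective⟩
      (fun t : ZMod m => ‖∑ y : (ZMod m)ˣ, V y * ee (h * t * (y : ZMod m))‖ ^ 2)
    simp only [Function.Embedding.coeFn_mk] at this
    rw [← this]
    exact Finset.sum_le_sum_of_subset_of_nonneg (Finset.subset_univ _) (fun _ _ _ => by positivity)
  have h4 : ((∑ t : ZMod m, ‖∑ y : (ZMod m)ˣ, V y * ee (h * t * (y : ZMod m))‖ ^ 2 : ℝ) : ℂ) =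
      ∑ y : (ZMod m)ˣ, ∑ y' : (ZMod m)ˣ, V y * starRingEnd ℂ (V y') *
        (if h * ((y : ZMod m) - (y' : ZMod m)) = 0 then (m : ℂ) else 0) := by
    push_cast
    have : ∀ t : ZMod m, ((‖∑ y : (ZMod m)ˣ, V y * ee (h * t * (y : ZMod m))‖ : ℂ)) ^ 2 =
        ∑ y : (ZMod m)ˣ, ∑ y' : (ZMod m)ˣ, V y * starRingEnd ℂ (V y') * ee (t * (h * ((y : ZMod m) - (y' : ZMod m)))) := by
      intro t
      rw [← Complex.mul_conj', map_sum, Finset.sum_mul_sum]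
      refine Finset.sum_congr rfl fun y _ => Finset.sum_congr rfl fun y' _ => ?_
      rw [map_mul, ee_conj]
      have : t * (h * ((y : ZMod m) - y')) = h * t * y + -(h * t * y') := by ring
      rw [this, ee_add]; ring
    simp_rw [this]
    rw [Finset.sum_comm]
    refine Finset.sum_congr rfl fun y _ => ?_
    rw [Finset.sum_comm]
    refine Finset.sum_congr rfl fun y' _ => ?_
    rw [← Finset.mul_sum, ee_sum]
  have h5 : ∑ t : ZMod m, ‖∑ y : (ZMod m)ˣ, V y * ee (h * t * (y : ZMod m))‖ ^ 2 ≤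
      (m * nz h) * ∑ y, ‖V y‖ ^ 2 := by
    have hcard : ∀ y : (ZMod m)ˣ, ((Finset.univ.filter
        (fun y' : (ZMod m)ˣ => h * ((y : ZMod m) - y') = 0)).card : ℝ) ≤ nz h := by
      intro y
      unfold nz
      norm_cast
      apply Finset.card_le_card_of_injOn (fun y' : (ZMod m)ˣ => (y : ZMod m) - y')
      · intro y' hy'; simp at hy'; simpa using hy'
      · intro y1 _ y2 _ h12
        have h13 : (y : ZMod m) - y1 = y - y2 := h12
        exact Units.ext (by simpa using h13)
    have hcard' : ∀ y : (ZMod m)ˣ, ((Finset.univ.filter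
        (fun y' : (ZMod m)ˣ => h * ((y' : ZMod m) - y) = 0)).card : ℝ) ≤ nz h := by
      intro y
      refine le_trans (le_of_eq ?_) (hcard y)
      congr 2
      ext y'
      simp only [Finset.mem_filter, Finset.mem_univ, true_and]
      rw [← neg_eq_zero, ← mul_neg, neg_sub]
    have e1 : ∑ t : ZMod m, ‖∑ y : (ZMod m)ˣ, V y * ee (h * t * (y : ZMod m))‖ ^ 2 ≤
        ∑ y : (ZMod m)ˣ, ∑ y' : (ZMod m)ˣ, (‖V y‖ ^ 2 + ‖V y'‖ ^ 2) / 2 *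
        (if h * ((y : ZMod m) - (y' : ZMod m)) = 0 then (m : ℝ) else 0) := by
      have hn : (0:ℝ) ≤ ∑ t : ZMod m, ‖∑ y : (ZMod m)ˣ, V y * ee (h * t * (y : ZMod m))‖ ^ 2 := by positivity
      have : ∑ t : ZMod m, ‖∑ y : (ZMod m)ˣ, V y * ee (h * t * (y : ZMod m))‖ ^ 2 =
        ‖((∑ t : ZMod m, ‖∑ y : (ZMod m)ˣ, V y * ee (h * t * (y : ZMod m))‖ ^ 2 : ℝ) : ℂ)‖ := by
        rw [Complex.norm_real, Real.norm_of_nonneg hn]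
      rw [this, h4]
      refine (norm_sum_le _ _).trans (Finset.sum_le_sum fun y _ => ?_)
      refine (norm_sum_le _ _).trans (Finset.sum_le_sum fun y' _ => ?_)
      rw [norm_mul, norm_mul, RCLike.norm_conj]
      split_ifs
      · rw [Complex.norm_natCast]
        have := two_mul_le_add_sq ‖V y‖ ‖V y'‖
        gcongr; linarith
      · simp
    refine e1.trans ?_
    have e2 : ∑ y : (ZMod m)ˣ, ∑ y' : (ZMod m)ˣ, (‖V y‖ ^ 2 + ‖V y'‖ ^ 2) / 2 *
        (if h * ((y : ZMod m) - (y' : ZMod m)) = 0 then (m : ℝ) else 0) =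
        ∑ y : (ZMod m)ˣ, ‖V y‖ ^ 2 / 2 * m * (Finset.univ.filter
          (fun y' : (ZMod m)ˣ => h * ((y : ZMod m) - y') = 0)).card +
        ∑ y : (ZMod m)ˣ, ‖V y‖ ^ 2 / 2 * m * (Finset.univ.filter
          (fun y' : (ZMod m)ˣ => h * ((y' : ZMod m) - y) = 0)).card := by
      have : ∀ y y' : (ZMod m)ˣ, (‖V y‖ ^ 2 + ‖V y'‖ ^ 2) / 2 *
        (if h * ((y : ZMod m) - y') = 0 then (m : ℝ) else 0) =
        ‖V y‖ ^ 2 / 2 * m * (if h * ((y : ZMod m) - y') = 0 then 1 else 0) +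
        ‖V y'‖ ^ 2 / 2 * m * (if h * ((y : ZMod m) - y') = 0 then 1 else 0) := by
        intro y y'; split_ifs <;> ring
      simp_rw [this, Finset.sum_add_distrib]
      congr 1
      · refine Finset.sum_congr rfl fun y _ => ?_
        rw [← Finset.mul_sum]; simp
      · rw [Finset.sum_comm]
        refine Finset.sum_congr rfl fun y _ => ?_
        rw [← Finset.mul_sum]; simp
    rw [e2, ← Finset.sum_add_distrib, Finset.mul_sum]
    refine Finset.sum_le_sum fun y _ => ?_
    have a1 := hcard y
    have a2 := hcard' y
    have : 0 ≤ ‖V y‖ ^ 2 / 2 * m := by positivity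
    nlinarith [mul_le_mul_of_nonneg_left a1 this, mul_le_mul_of_nonneg_left a2 this]
  refine h1.trans (h2.trans ?_)
  simp only [sq_abs]
  rw [mul_comm (Real.sqrt (m * nz h)), mul_assoc]
  gcongr
  rw [← Real.sqrt_mul (by positivity)]
  exact Real.sqrt_le_sqrt (h3.trans h5)

lemma abel_bound (b : ℕ → ℝ) (hb : Antitone b) (hb0 : ∀ n, 0 ≤ b n) (z : ℂ) (hz : ‖z‖ = 1)
    (n : ℕ) : ‖1 - z‖ * ‖∑ k ∈ Finset.range n, (b k : ℂ) * z ^ k‖ ≤ 2 * b 0 := by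
  have key : ∀ n : ℕ, (1 - z) * ∑ k ∈ Finset.range n, (b k : ℂ) * z ^ k =
      b 0 - b n * z ^ n - ∑ k ∈ Finset.range n, ((b k - b (k+1) : ℝ) : ℂ) * z ^ (k+1) := by
    intro n
    induction n with
    | zero => simp
    | succ n ih =>
      rw [Finset.sum_range_succ, mul_add, ih, Finset.sum_range_succ]
      push_cast; ring
  rw [← norm_mul, key]
  have h1 : ‖∑ k ∈ Finset.range n, ((b k - b (k+1) : ℝ) : ℂ) * z ^ (k+1)‖ ≤ b 0 - b n := by
    refine (norm_sum_le _ _).trans ?_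
    rw [← Finset.sum_range_sub' b n]
    refine Finset.sum_le_sum fun k _ => ?_
    rw [norm_mul, norm_pow, hz, one_pow, mul_one, Complex.norm_real, Real.norm_of_nonneg]
    linarith [hb (Nat.le_succ k)]
  have h2 : ‖(b n : ℂ) * z ^ n‖ = b n := by
    rw [norm_mul, norm_pow, hz, one_pow, mul_one, Complex.norm_real, Real.norm_of_nonneg (hb0 n)]
  have h3 : ‖(b 0 : ℂ)‖ = b 0 := by
    rw [Complex.norm_real, Real.norm_of_nonneg (hb0 0)]
  calc _ ≤ ‖(b 0 : ℂ) - b n * z ^ n‖ + _ := norm_sub_le _ _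
    _ ≤ ‖(b 0 : ℂ)‖ + ‖(b n : ℂ) * z ^ n‖ + (b 0 - b n) := by
        gcongr; exact norm_sub_le _ _
    _ = 2 * b 0 := by rw [h2, h3]; ring

lemma ee_natmul (h : ZMod m) (k : ℕ) : ee (h * (k : ZMod m)) = ee h ^ k := by
  unfold ee
  rw [mul_comm, ← nsmul_eq_mul, AddChar.map_nsmul_eq_pow]

lemma interval_bound (h : ZMod m) (A B : ℕ) (K : ℝ) (hK : 0 < K) (hKA : K ≤ A + 1) :
    ‖1 - ee h‖ * ‖∑ k ∈ Finset.Ioc A B, ((1 / (k:ℝ) : ℝ) : ℂ) * ee (h * (k : ZMod m))‖ ≤ 2 / K := by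
  have h1 : ∑ k ∈ Finset.Ioc A B, ((1 / (k:ℝ) : ℝ) : ℂ) * ee (h * (k : ZMod m)) =
      ee h ^ (A + 1) * ∑ k ∈ Finset.range (B - A), ((1 / ((A + 1 + k : ℕ):ℝ) : ℝ) : ℂ) * ee h ^ k := by
    rw [show Finset.Ioc A B = Finset.Ico (A+1) (B+1) by ext; simp,
      Finset.sum_Ico_eq_sum_range, Finset.mul_sum]
    rw [show B + 1 - (A + 1) = B - A by omega]
    refine Finset.sum_congr rfl fun k _ => ?_
    rw [ee_natmul, pow_add]; ring
  rw [h1, norm_mul, norm_pow, ee_norm, one_pow, one_mul]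
  have := abel_bound (fun k => 1 / ((A + 1 + k : ℕ):ℝ)) (by
      intro i j hij; simp only; gcongr) (fun n => by positivity) (ee h) (ee_norm h) (B - A)
  refine this.trans ?_
  simp only [add_zero]
  rw [mul_one_div]
  gcongr
  push_cast; linarith

end Fourier
end

section
open Filter Topology

section Fourier2
variable {m : ℕ} [NeZero m]

lemma nz_le (h : ZMod m) : nz h ≤ Nat.gcd h.val m := by
  have hm : 0 < m := Nat.pos_of_ne_zero (NeZero.ne m)
  set g := Nat.gcd h.val m with hg
  have hgp : 0 < g := Nat.gcd_pos_of_pos_right _ hm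
  have hgm : g ∣ m := Nat.gcd_dvd_right _ _
  have hq : 0 < m / g := Nat.div_pos (Nat.le_of_dvd hm hgm) hgp
  have key : ∀ z : ZMod m, h * z = 0 → m / g ∣ z.val := by
    intro z hz
    have h1 : ((h.val * z.val : ℕ) : ZMod m) = 0 := by
      push_cast; rw [ZMod.natCast_zmod_val, ZMod.natCast_zmod_val]; exact hz
    rw [ZMod.natCast_eq_zero_iff] at h1
    have h2 : m / g ∣ (h.val / g) * z.val := by
      have : g * (m / g) ∣ g * ((h.val / g) * z.val) := by
        rw [Nat.mul_div_cancel' hgm, ← mul_assoc, Nat.mul_div_cancel' (Nat.gcd_dvd_left _ _)]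
        exact h1
      exact Nat.dvd_of_mul_dvd_mul_left hgp this
    exact (Nat.Coprime.dvd_of_dvd_mul_left (Nat.Coprime.symm (Nat.coprime_div_gcd_div_gcd hgp)) h2)
  unfold nz
  conv_rhs => rw [← Finset.card_range g]
  apply Finset.card_le_card_of_injOn (fun z : ZMod m => z.val / (m / g))
  · intro z hz
    simp only [Finset.coe_filter, Finset.mem_univ, true_and, Set.mem_ofPred_eq] at hz
    simp only [Finset.coe_range, Set.mem_Iio]
    rw [Nat.div_lt_iff_lt_mul hq, Nat.mul_div_cancel' hgm]
    exact ZMod.val_lt z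
  · intro z1 h1 z2 h2 h12
    simp only [Finset.coe_filter, Finset.mem_univ, true_and, Set.mem_ofPred_eq] at h1 h2 h12
    apply ZMod.val_injective
    rw [← Nat.div_mul_cancel (key z1 h1), ← Nat.div_mul_cancel (key z2 h2), h12]

lemma one_sub_ee_ge (h : ZMod m) : 4 * (min (h.val : ℝ) (m - h.val)) / m ≤ ‖1 - ee h‖ := by
  have hm : (0:ℝ) < m := by exact_mod_cast Nat.pos_of_ne_zero (NeZero.ne m)
  have hv : (h.val : ℝ) ≤ m := by exact_mod_cast (ZMod.val_lt h).le
  have h0 : (0:ℝ) ≤ h.val := by positivity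
  rw [norm_sub_rev]
  unfold ee
  rw [ZMod.stdAddChar_apply, ZMod.toCircle_apply]
  have : (2 * (Real.pi:ℂ) * Complex.I * h.val / m) = Complex.I * ((2 * Real.pi * h.val / m : ℝ) : ℂ) := by
    push_cast; ring
  rw [this, Complex.norm_exp_I_mul_ofReal_sub_one, Real.norm_eq_abs, abs_mul, abs_two]
  rw [show 2 * Real.pi * h.val / m / 2 = Real.pi * h.val / m by ring]
  have hpi := Real.pi_pos
  rcases le_total (h.val : ℝ) (m - h.val) with hc | hc
  · rw [min_eq_left hc]
    have := Real.mul_le_sin (x := Real.pi * h.val / m) (by positivity) (by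
      rw [div_le_iff₀ hm]; nlinarith)
    have h2 : 2 / Real.pi * (Real.pi * h.val / m) = 2 * h.val / m := by field_simp
    rw [h2] at this
    have h3 := le_abs_self (Real.sin (Real.pi * h.val / m))
    have : 4 * (h.val:ℝ) / m = 2 * (2 * h.val / m) := by ring
    linarith
  · rw [min_eq_right hc]
    have := Real.mul_le_sin (x := Real.pi * (m - h.val) / m) (by
      apply div_nonneg _ hm.le; exact mul_nonneg hpi.le (by linarith)) (by
      rw [div_le_iff₀ hm]; nlinarith)
    have h2 : 2 / Real.pi * (Real.pi * (m - h.val) / m) = 2 * (m - h.val) / m := by field_simp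
    rw [h2] at this
    have h4 : Real.pi * (m - h.val) / m = Real.pi - Real.pi * h.val / m := by field_simp
    rw [h4, Real.sin_pi_sub] at this
    have h3 := le_abs_self (Real.sin (Real.pi * h.val / m))
    have : 4 * ((m:ℝ) - h.val) / m = 2 * (2 * (m - h.val) / m) := by ring
    linarith

lemma gcd_sum (m : ℕ) (hm : 0 < m) : ∑ j ∈ Finset.Ico 1 m, Real.sqrt (Nat.gcd j m) / j ≤
    m.divisors.card * (1 + Real.log m) := by
  have hH : ∑ i ∈ Finset.Icc 1 m, (1 / (i:ℝ)) ≤ 1 + Real.log m := by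
    have := harmonic_le_one_add_log m
    rw [harmonic_eq_sum_Icc] at this
    push_cast at this
    simpa using this
  have h1 : ∑ j ∈ Finset.Ico 1 m, Real.sqrt (Nat.gcd j m) / j ≤
      ∑ j ∈ Finset.Ico 1 m, ∑ g ∈ m.divisors, (if g ∣ j then Real.sqrt g / j else 0) := by
    refine Finset.sum_le_sum fun j _ => ?_
    have := Finset.single_le_sum (s := m.divisors) (f := fun g : ℕ => if g ∣ j then Real.sqrt g / j else 0)
      (fun g _ => by split_ifs <;> positivity)
      (show Nat.gcd j m ∈ m.divisors from Nat.mem_divisors.2 ⟨Nat.gcd_dvd_right _ _, hm.ne'⟩)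
    rw [if_pos (Nat.gcd_dvd_left _ _)] at this
    exact this
  refine h1.trans ?_
  rw [Finset.sum_comm]
  have h2 : ∀ g ∈ m.divisors, ∑ j ∈ Finset.Ico 1 m, (if g ∣ j then Real.sqrt g / j else 0) ≤
      1 + Real.log m := by
    intro g hg
    have hgp : 0 < g := Nat.pos_of_mem_divisors hg
    refine le_trans ?_ hH
    rw [← Finset.sum_filter]
    have : ∑ j ∈ Finset.Ico 1 m with g ∣ j, Real.sqrt g / j ≤
      ∑ i ∈ ((Finset.Ico 1 m).filter (fun i => g ∣ i)).image (fun j => j / g), (1 / (i:ℝ)) := by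
      rw [Finset.sum_image]
      · refine Finset.sum_le_sum fun j hj => ?_
        simp only [Finset.mem_filter, Finset.mem_Ico] at hj
        obtain ⟨i, rfl⟩ := hj.2
        rw [Nat.mul_div_cancel_left _ hgp]
        have hi : 0 < i := Nat.pos_of_ne_zero (by rintro rfl; simp at hj)
        push_cast
        have hg1 : (1:ℝ) ≤ g := by exact_mod_cast hgp
        have : Real.sqrt g ≤ g := by
          rw [Real.sqrt_le_left (by positivity)]; nlinarith
        rw [div_le_div_iff₀ (by positivity) (by positivity)]
        have hi' : (0:ℝ) < i := by exact_mod_cast hi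
        nlinarith
      · intro a ha b hb hab
        simp only [Finset.coe_filter, Set.mem_ofPred_eq] at ha hb
        simp only at hab
        rw [← Nat.div_mul_cancel ha.2, ← Nat.div_mul_cancel hb.2, hab]
    refine this.trans (Finset.sum_le_sum_of_subset_of_nonneg ?_ (fun _ _ _ => by positivity))
    intro i hi
    simp only [Finset.mem_image, Finset.mem_filter, Finset.mem_Ico] at hi
    obtain ⟨j, ⟨hj, hgj⟩, rfl⟩ := hi
    rw [Finset.mem_Icc]
    exact ⟨Nat.div_pos (Nat.le_of_dvd (by omega) hgj) hgp, (Nat.div_le_self _ _).trans hj.2.le⟩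
  refine (Finset.sum_le_sum h2).trans ?_
  rw [Finset.sum_const, nsmul_eq_mul]

lemma h_sum (hm : 2 ≤ m) : ∑ h ∈ (Finset.univ.erase (0 : ZMod m)), Real.sqrt (nz h) / ‖1 - ee h‖ ≤
    m / 2 * (m.divisors.card * (1 + Real.log m)) := by
  have hm0 : (0:ℝ) < m := by positivity
  have h1 : ∑ h ∈ (Finset.univ.erase (0 : ZMod m)), Real.sqrt (nz h) / ‖1 - ee h‖ ≤
      ∑ h ∈ (Finset.univ.erase (0 : ZMod m)), (m / 4 * (Real.sqrt (Nat.gcd h.val m) / h.val) +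
        m / 4 * (Real.sqrt (Nat.gcd (m - h.val) m) / ((m - h.val : ℕ):ℝ))) := by
    refine Finset.sum_le_sum fun h hh => ?_
    have hh0 : h ≠ 0 := by simpa using hh
    have hv1 : 0 < h.val := Nat.pos_of_ne_zero (by rwa [Ne, ZMod.val_eq_zero])
    have hv2 := ZMod.val_lt h
    have hg : Nat.gcd (m - h.val) m = Nat.gcd h.val m := by
      rw [Nat.gcd_comm, Nat.gcd_self_sub_right hv2.le, Nat.gcd_comm]
    rw [hg]
    have a1 := one_sub_ee_ge h
    have hv1' : (0:ℝ) < h.val := by exact_mod_cast hv1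
    have hv2' : (0:ℝ) < ((m - h.val : ℕ):ℝ) := by exact_mod_cast Nat.sub_pos_of_lt hv2
    have hc : ((m - h.val : ℕ):ℝ) = m - h.val := by rw [Nat.cast_sub hv2.le]
    rw [← hc] at a1
    have hmin : 0 < 4 * (min (h.val : ℝ) ((m - h.val : ℕ):ℝ)) / m := by positivity
    have hs : Real.sqrt (nz h) ≤ Real.sqrt (Nat.gcd h.val m) :=
      Real.sqrt_le_sqrt (by exact_mod_cast nz_le h)
    calc Real.sqrt (nz h) / ‖1 - ee h‖ ≤ Real.sqrt (Nat.gcd h.val m) /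
          (4 * (min (h.val : ℝ) ((m - h.val : ℕ):ℝ)) / m) := by gcongr
      _ = m / 4 * (Real.sqrt (Nat.gcd h.val m) / (min (h.val : ℝ) ((m - h.val : ℕ):ℝ))) := by
          field_simp
      _ ≤ _ := by
          rcases min_choice (h.val : ℝ) ((m - h.val : ℕ):ℝ) with hc | hc <;> rw [hc]
          · have : 0 ≤ m / 4 * (Real.sqrt (Nat.gcd h.val m) / ((m - h.val : ℕ):ℝ)) := by positivity
            linarith
          · have : 0 ≤ m / 4 * (Real.sqrt (Nat.gcd h.val m) / (h.val:ℝ)) := by positivity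
            linarith
  refine h1.trans ?_
  rw [Finset.sum_add_distrib, ← Finset.mul_sum, ← Finset.mul_sum]
  have b1 : ∑ h ∈ (Finset.univ.erase (0 : ZMod m)), (Real.sqrt (Nat.gcd h.val m) / h.val) =
      ∑ j ∈ Finset.Ico 1 m, Real.sqrt (Nat.gcd j m) / j := by
    refine Finset.sum_nbij' (fun h => h.val) (fun j => (j : ZMod m)) ?_ ?_ ?_ ?_ ?_
    · intro h hh
      have hh0 : h ≠ 0 := by simpa using hh
      have hv1 : 0 < h.val := Nat.pos_of_ne_zero (by rwa [Ne, ZMod.val_eq_zero])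
      simp only [Finset.mem_Ico]
      exact ⟨hv1, ZMod.val_lt h⟩
    · intro j hj
      simp only [Finset.mem_Ico] at hj
      simp only [Finset.mem_erase, Finset.mem_univ, and_true]
      rw [Ne, ZMod.natCast_eq_zero_iff]
      exact Nat.not_dvd_of_pos_of_lt (by omega) hj.2
    · intro h _; simp
    · intro j hj
      simp only [Finset.mem_Ico] at hj
      exact ZMod.val_cast_of_lt hj.2
    · intro h _; rfl
  have b2 : ∑ h ∈ (Finset.univ.erase (0 : ZMod m)), (Real.sqrt (Nat.gcd (m - h.val) m) / ((m - h.val : ℕ):ℝ)) =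
      ∑ j ∈ Finset.Ico 1 m, Real.sqrt (Nat.gcd j m) / j := by
    refine Finset.sum_nbij' (fun h => m - h.val) (fun j => ((m - j : ℕ) : ZMod m)) ?_ ?_ ?_ ?_ ?_
    · intro h hh
      have hh0 : h ≠ 0 := by simpa using hh
      have hv1 : 0 < h.val := Nat.pos_of_ne_zero (by rwa [Ne, ZMod.val_eq_zero])
      have := ZMod.val_lt h
      simp only [Finset.mem_Ico]
      omega
    · intro j hj
      simp only [Finset.mem_Ico] at hj
      simp only [Finset.mem_erase, Finset.mem_univ, and_true]
      rw [Ne, ZMod.natCast_eq_zero_iff]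
      exact Nat.not_dvd_of_pos_of_lt (by omega) (by omega)
    · intro h _
      have := ZMod.val_lt h
      rw [show m - (m - h.val) = h.val by omega]; simp
    · intro j hj
      simp only [Finset.mem_Ico] at hj
      rw [ZMod.val_cast_of_lt (by omega)]; omega
    · intro h _; rfl
  rw [b1, b2]
  have := gcd_sum m (by omega)
  calc _ = m / 2 * ∑ j ∈ Finset.Ico 1 m, Real.sqrt (Nat.gcd j m) / j := by ring
    _ ≤ _ := by gcongr

theorem fourier_main (hm : 2 ≤ m) {ι : Type*} (s : Finset ι) (y : ι → (ZMod m)ˣ) (w : ι → ℝ)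
    (A B : ι → ℕ) (K : ι → ℝ) (hK : ∀ i ∈ s, 0 < K i) (hKA : ∀ i ∈ s, K i ≤ A i + 1)
    (X : (ZMod m)ˣ → ℝ) (a : (ZMod m)ˣ) :
    |∑ x, ∑ i ∈ s, X x * w i * (∑ k ∈ Finset.Ioc (A i) (B i),
        if (k : ZMod m) * x * y i = a then 1 / (k:ℝ) else 0)
      - (1 / m) * (∑ x, X x) * (∑ i ∈ s, w i * ∑ k ∈ Finset.Ioc (A i) (B i), 1 / (k:ℝ))| ≤
    Real.sqrt m * (m.divisors.card * (1 + Real.log m)) * Real.sqrt (∑ x, X x ^ 2) *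
      Real.sqrt (∑ v, (∑ i ∈ s with y i = v, |w i| / K i) ^ 2) := by
  classical
  have hm0 : (0:ℝ) < m := by positivity
  set Vn : ℝ := Real.sqrt (∑ v, (∑ i ∈ s with y i = v, |w i| / K i) ^ 2) with hVn
  set Xn : ℝ := Real.sqrt (∑ x, X x ^ 2) with hXn
  let S : ι → ZMod m → ℂ := fun i h => ∑ k ∈ Finset.Ioc (A i) (B i), ((1 / (k:ℝ) : ℝ) : ℂ) * ee (h * (k : ZMod m))
  let T : ZMod m → ℂ := fun h => ∑ x : (ZMod m)ˣ, ∑ i ∈ s, (X x : ℂ) * (w i * S i h) *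
    ee (-h * ((a * x⁻¹ * (y i)⁻¹ : (ZMod m)ˣ) : ZMod m))
  have hdet : ∀ (x : (ZMod m)ˣ) (i : ι) (k : ℕ), (if (k : ZMod m) * x * y i = a then (1:ℂ) else 0) =
      (1 / m) * ∑ h : ZMod m, ee (h * (k : ZMod m)) * ee (-h * ((a * x⁻¹ * (y i)⁻¹ : (ZMod m)ˣ) : ZMod m)) := by
    intro x i k
    have h1 : ∀ h : ZMod m, ee (h * (k : ZMod m)) * ee (-h * ((a * x⁻¹ * (y i)⁻¹ : (ZMod m)ˣ) : ZMod m)) =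
        ee (h * ((k : ZMod m) - ((a * x⁻¹ * (y i)⁻¹ : (ZMod m)ˣ) : ZMod m))) := by
      intro h; rw [← ee_add]; congr 1; ring
    simp_rw [h1]
    rw [ee_sum]
    have h2 : ((k : ZMod m) * x * y i = a) ↔
      ((k : ZMod m) - ((a * x⁻¹ * (y i)⁻¹ : (ZMod m)ˣ) : ZMod m)) = 0 := by
      rw [sub_eq_zero, Units.val_mul, Units.val_mul, Units.eq_mul_inv_iff_mul_eq,
        Units.eq_mul_inv_iff_mul_eq]
      constructor <;> intro h <;> rw [← h] <;> ring
    have hmc : (m:ℂ) ≠ 0 := by exact_mod_cast (NeZero.ne m)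
    by_cases hc : (k : ZMod m) * x * y i = a
    · rw [if_pos hc, if_pos (h2.1 hc)]; field_simp
    · rw [if_neg hc, if_neg (fun h => hc (h2.2 h))]; simp
  have hmain : ((∑ x, ∑ i ∈ s, X x * w i * (∑ k ∈ Finset.Ioc (A i) (B i),
        if (k : ZMod m) * x * y i = a then 1 / (k:ℝ) else 0) : ℝ) : ℂ) = (1 / m) * ∑ h, T h := by
    have e1 : ∀ (x : (ZMod m)ˣ) (i : ι), ((∑ k ∈ Finset.Ioc (A i) (B i),
        (if (k : ZMod m) * x * y i = a then 1 / (k:ℝ) else 0) : ℝ) : ℂ) =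
        (1 / m) * ∑ h : ZMod m, S i h * ee (-h * ((a * x⁻¹ * (y i)⁻¹ : (ZMod m)ˣ) : ZMod m)) := by
      intro x i
      simp only [S, Finset.sum_mul]
      rw [Finset.sum_comm, Finset.mul_sum, Complex.ofReal_sum]
      refine Finset.sum_congr rfl fun k _ => ?_
      have := hdet x i k
      have e2 : ((if (k : ZMod m) * x * y i = a then 1 / (k:ℝ) else 0 : ℝ) : ℂ) =
        ((1 / (k:ℝ) : ℝ) : ℂ) * (if (k : ZMod m) * x * y i = a then (1:ℂ) else 0) := by
        split_ifs <;> simp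
      rw [e2, this, mul_left_comm]
      congr 1
      rw [Finset.mul_sum]
      simp only [mul_assoc]
    rw [Complex.ofReal_sum]
    simp only [Complex.ofReal_sum, Complex.ofReal_mul] at e1 ⊢
    simp_rw [e1]
    simp only [T]
    have sw : ∑ h : ZMod m, ∑ x : (ZMod m)ˣ, ∑ i ∈ s, (X x : ℂ) * (w i * S i h) *
        ee (-h * ((a * x⁻¹ * (y i)⁻¹ : (ZMod m)ˣ) : ZMod m)) =
        ∑ x : (ZMod m)ˣ, ∑ i ∈ s, ∑ h : ZMod m, (X x : ℂ) * (w i * S i h) *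
        ee (-h * ((a * x⁻¹ * (y i)⁻¹ : (ZMod m)ˣ) : ZMod m)) := by
      rw [Finset.sum_comm]
      refine Finset.sum_congr rfl fun x _ => ?_
      rw [Finset.sum_comm]
    rw [sw]
    simp only [Finset.mul_sum]
    refine Finset.sum_congr rfl fun x _ => Finset.sum_congr rfl fun i _ => Finset.sum_congr rfl fun h _ => ?_
    ring
  have hT0 : T 0 = ((∑ x, X x) * (∑ i ∈ s, w i * ∑ k ∈ Finset.Ioc (A i) (B i), 1 / (k:ℝ)) : ℝ) := by
    simp only [T, S, neg_zero, zero_mul, ee_zero, mul_one]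
    rw [Complex.ofReal_mul, Complex.ofReal_sum, Complex.ofReal_sum, Finset.sum_mul_sum]
    refine Finset.sum_congr rfl fun x _ => Finset.sum_congr rfl fun i _ => ?_
    rw [Complex.ofReal_mul, Complex.ofReal_sum]
  have hTh : ∀ h ∈ (Finset.univ.erase (0 : ZMod m)), ‖T h‖ ≤
      (2 * Real.sqrt m * Xn * Vn) * (Real.sqrt (nz h) / ‖1 - ee h‖) := by
    intro h hh
    have hh0 : h ≠ 0 := by simpa using hh
    have hne : 0 < ‖1 - ee h‖ := by
      rw [norm_pos_iff, sub_ne_zero]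
      intro h1
      have h2 : (ZMod.stdAddChar h : ℂ) = ZMod.stdAddChar (0 : ZMod m) := by
        rw [AddChar.map_zero_eq_one]; exact h1.symm
      exact hh0 (ZMod.injective_stdAddChar h2)
    let V : (ZMod m)ˣ → ℂ := fun v => ∑ i ∈ s with y i = v⁻¹, w i * S i h
    have e1 : T h = ∑ x, ∑ v, ((fun x => X x⁻¹) x : ℂ) * V v * ee ((-h * (a : ZMod m)) * (x : ZMod m) * (v : ZMod m)) := by
      simp only [T]
      rw [← Equiv.sum_comp (Equiv.inv (ZMod m)ˣ)]
      refine Finset.sum_congr rfl fun x _ => ?_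
      simp only [Equiv.inv_apply, inv_inv]
      rw [← Finset.sum_fiberwise s (fun i => (y i)⁻¹)]
      refine Finset.sum_congr rfl fun v _ => ?_
      simp only [V, Finset.mul_sum, Finset.sum_mul]
      refine Finset.sum_congr ?_ fun i hi => ?_
      · ext i; simp [inv_eq_iff_eq_inv]
      · simp only [Finset.mem_filter] at hi
        rw [hi.2]
        simp only [inv_inv, Units.val_mul]
        congr 2; ring
    have e2 := bilin (fun x => X x⁻¹) V (-h * (a : ZMod m))
    rw [e1]
    refine e2.trans ?_
    have e3 : nz (-h * (a : ZMod m)) = nz h := by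
      unfold nz
      refine Finset.card_nbij' (fun z => a * z) (fun z => (a⁻¹ : (ZMod m)ˣ) * z) ?_ ?_ ?_ ?_
      · intro z hz
        simp at hz ⊢; rw [← mul_assoc]; exact hz
      · intro z hz
        simp at hz ⊢
        rw [mul_assoc, Units.mul_inv_cancel_left]; exact hz
      · intro z _; simp
      · intro z _; simp
    have e4 : ∑ x : (ZMod m)ˣ, (fun x => X x⁻¹) x ^ 2 = ∑ x, X x ^ 2 :=
      Equiv.sum_comp (Equiv.inv (ZMod m)ˣ) (fun x => X x ^ 2)
    have e5 : ∑ v, ‖V v‖ ^ 2 ≤ (2 / ‖1 - ee h‖) ^ 2 * ∑ v, (∑ i ∈ s with y i = v, |w i| / K i) ^ 2 := by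
      rw [← Equiv.sum_comp (Equiv.inv (ZMod m)ˣ) (fun v => (∑ i ∈ s with y i = v, |w i| / K i) ^ 2), Finset.mul_sum]
      refine Finset.sum_le_sum fun v _ => ?_
      rw [← mul_pow]
      refine pow_le_pow_left₀ (norm_nonneg _) ?_ 2
      simp only [V, Equiv.inv_apply, Finset.mul_sum]
      refine (norm_sum_le _ _).trans (Finset.sum_le_sum fun i hi => ?_)
      simp only [Finset.mem_filter] at hi
      rw [norm_mul, Complex.norm_real, Real.norm_eq_abs]
      have := interval_bound h (A i) (B i) (K i) (hK i hi.1) (hKA i hi.1)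
      have h6 : ‖S i h‖ ≤ 2 / K i / ‖1 - ee h‖ := by
        rw [le_div_iff₀ hne, mul_comm]; exact this
      calc |w i| * ‖S i h‖ ≤ |w i| * (2 / K i / ‖1 - ee h‖) := by gcongr
        _ = _ := by ring
    rw [e3, e4]
    have e6 : Real.sqrt (∑ v, ‖V v‖ ^ 2) ≤ (2 / ‖1 - ee h‖) * Vn := by
      refine (Real.sqrt_le_sqrt e5).trans (le_of_eq ?_)
      rw [Real.sqrt_mul (by positivity), Real.sqrt_sq (by positivity)]
    calc _ ≤ Real.sqrt (m * nz h) * Xn * ((2 / ‖1 - ee h‖) * Vn) := by gcongr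
      _ = _ := by rw [Real.sqrt_mul (by positivity)]; ring
  have hfin : ((∑ x, ∑ i ∈ s, X x * w i * (∑ k ∈ Finset.Ioc (A i) (B i),
        if (k : ZMod m) * x * y i = a then 1 / (k:ℝ) else 0)
      - (1 / m) * (∑ x, X x) * (∑ i ∈ s, w i * ∑ k ∈ Finset.Ioc (A i) (B i), 1 / (k:ℝ)) : ℝ) : ℂ) =
      (1 / m) * ∑ h ∈ (Finset.univ.erase (0 : ZMod m)), T h := by
    rw [Complex.ofReal_sub, hmain, ← Finset.add_sum_erase _ _ (Finset.mem_univ (0 : ZMod m)), hT0]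
    push_cast; ring
  rw [← Real.norm_eq_abs, ← Complex.norm_real, hfin, norm_mul]
  have hs := h_sum (m := m) hm
  have : ‖∑ h ∈ (Finset.univ.erase (0 : ZMod m)), T h‖ ≤
      (2 * Real.sqrt m * Xn * Vn) * (m / 2 * (m.divisors.card * (1 + Real.log m))) := by
    refine (norm_sum_le _ _).trans ((Finset.sum_le_sum hTh).trans ?_)
    rw [← Finset.mul_sum]
    gcongr
  have h1m : ‖(1 / m : ℂ)‖ = 1 / m := by simp
  rw [h1m]
  calc _ ≤ 1 / (m:ℝ) * ((2 * Real.sqrt m * Xn * Vn) * (m / 2 * (m.divisors.card * (1 + Real.log m)))) := by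
        gcongr
    _ = _ := by field_simp
end Fourier2
end

section
open Filter Topology

lemma harm_block (A B : ℝ) (hA : 1 ≤ A) (hAB : A ≤ B) :
    |∑ k ∈ Finset.Ioc ⌊A⌋₊ ⌊B⌋₊, 1 / (k:ℝ) - Real.log (B / A)| ≤ 2 / A := by
  have hA0 : 0 < A := by linarith
  have hB0 : 0 < B := by linarith
  have ha : 1 ≤ ⌊A⌋₊ := Nat.one_le_floor_iff _ |>.2 hA
  have key : ∀ n : ℕ, ⌊A⌋₊ ≤ n → Real.log ((n + 1) / (⌊A⌋₊ + 1)) ≤ ∑ k ∈ Finset.Ioc ⌊A⌋₊ n, 1 / (k:ℝ) ∧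
      ∑ k ∈ Finset.Ioc ⌊A⌋₊ n, 1 / (k:ℝ) ≤ Real.log (n / ⌊A⌋₊) := by
    intro n hn
    induction n, hn using Nat.le_induction with
    | base =>
      have h0 : ((⌊A⌋₊:ℝ)) ≠ 0 := by positivity
      have h1 : ((⌊A⌋₊:ℝ) + 1) ≠ 0 := by positivity
      simp [div_self h0, div_self h1]
    | succ n hn ih =>
      have hn0 : (0:ℝ) < n := by exact_mod_cast (lt_of_lt_of_le ha hn)
      rw [← Finset.insert_Ioc_right_eq_Ioc_add_one hn, Finset.sum_insert (by simp)]
      have ha' : (0:ℝ) < ⌊A⌋₊ := by exact_mod_cast ha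
      push_cast
      constructor
      · have : Real.log (((n:ℝ) + 1 + 1) / (⌊A⌋₊ + 1)) = Real.log ((n+1)/(⌊A⌋₊+1)) + Real.log (1 + 1/(n+1)) := by
          rw [← Real.log_mul (by positivity) (by positivity)]; congr 1; field_simp
        rw [this]
        have := Real.log_le_sub_one_of_pos (x := 1 + 1/((n:ℝ)+1)) (by positivity)
        linarith [ih.1]
      · have : Real.log (((n:ℝ) + 1) / ⌊A⌋₊) = Real.log (n/⌊A⌋₊) - Real.log (n/(n+1)) := by
          rw [← Real.log_div (by positivity) (by positivity)]; congr 1; field_simp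
        rw [this]
        have := Real.log_le_sub_one_of_pos (x := (n:ℝ)/(n+1)) (by positivity)
        have e : (n:ℝ)/(n+1) - 1 = - (1/(n+1)) := by field_simp; ring
        linarith [ih.2]
  obtain ⟨k1, k2⟩ := key ⌊B⌋₊ (Nat.floor_le_floor hAB)
  have ha' : (1:ℝ) ≤ ⌊A⌋₊ := by exact_mod_cast ha
  have f1 := Nat.floor_le hA0.le
  have f2 := Nat.lt_floor_add_one A
  have f3 := Nat.floor_le hB0.le
  have f4 := Nat.lt_floor_add_one B
  have hb' : (1:ℝ) ≤ ⌊B⌋₊ := by exact_mod_cast (ha.trans (Nat.floor_le_floor hAB))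
  rw [abs_le]
  constructor
  · have : Real.log (B / A) - 1 / A ≤ Real.log ((⌊B⌋₊ + 1) / (⌊A⌋₊ + 1)) := by
      have h1 : Real.log (B / (A+1)) ≤ Real.log ((⌊B⌋₊ + 1) / (⌊A⌋₊ + 1)) := by
        apply Real.log_le_log (by positivity)
        gcongr
      have h2 : Real.log (B / (A+1)) = Real.log (B/A) - Real.log (1 + 1/A) := by
        rw [← Real.log_div (by positivity) (by positivity)]; congr 1; field_simp
      have := Real.log_le_sub_one_of_pos (x := 1 + 1/A) (by positivity)
      linarith
    have : 1/A ≤ 2/A := by gcongr; norm_num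
    linarith
  · have h1 : Real.log (⌊B⌋₊ / ⌊A⌋₊) ≤ Real.log (B / ⌊A⌋₊) := by
      apply Real.log_le_log (by positivity); gcongr
    have h2 : Real.log (B / ⌊A⌋₊) = Real.log (B/A) + Real.log (A/⌊A⌋₊) := by
      rw [← Real.log_mul (by positivity) (by positivity)]; congr 1; field_simp
    have h3 := Real.log_le_sub_one_of_pos (x := A/⌊A⌋₊) (by positivity)
    have h4 : A/⌊A⌋₊ - 1 ≤ 2 / A := by
      rw [div_sub_one (by positivity), div_le_div_iff₀ (by positivity) (by positivity)]
      nlinarith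
    linarith

lemma res_count (m : ℕ) [NeZero m] (S : Finset ℕ) (T : ℝ) (hT : ∀ n ∈ S, 0 < n ∧ (n:ℝ) ≤ T) (hT0 : 0 ≤ T)
    (r : ZMod m) : ((S.filter (fun n : ℕ => (n : ZMod m) = r)).card : ℝ) ≤ T / m + 1 := by
  have hm : 0 < m := Nat.pos_of_ne_zero (NeZero.ne m)
  have hm' : (0:ℝ) < m := by exact_mod_cast hm
  have : (S.filter (fun n : ℕ => (n : ZMod m) = r)).card ≤ (Finset.range (⌊T⌋₊ / m + 1)).card := by
    apply Finset.card_le_card_of_injOn (fun n => n / m)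
    · intro n hn
      simp only [Finset.coe_filter, Set.mem_ofPred_eq] at hn
      simp only [Finset.coe_range, Set.mem_Iio]
      have : n ≤ ⌊T⌋₊ := Nat.le_floor (hT n hn.1).2
      exact Nat.lt_succ_of_le (Nat.div_le_div_right this)
    · intro n1 h1 n2 h2 h12
      simp only [Finset.coe_filter, Set.mem_ofPred_eq] at h1 h2 h12
      have : (n1 : ZMod m) = n2 := h1.2.trans h2.2.symm
      rw [ZMod.natCast_eq_natCast_iff] at this
      rw [← Nat.div_add_mod n1 m, ← Nat.div_add_mod n2 m, h12, this]
  rw [Finset.card_range] at this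
  calc _ ≤ ((⌊T⌋₊ / m + 1 : ℕ):ℝ) := by exact_mod_cast this
    _ ≤ (⌊T⌋₊:ℝ) / m + 1 := by push_cast; gcongr; exact Nat.cast_div_le
    _ ≤ _ := by gcongr; exact Nat.floor_le hT0

/-- unit of a coprime natural number -/
noncomputable def uc (m x : ℕ) : (ZMod m)ˣ := if h : x.Coprime m then ZMod.unitOfCoprime x h else 1

lemma uc_coe {m x : ℕ} (h : x.Coprime m) : ((uc m x : (ZMod m)ˣ) : ZMod m) = x := by
  unfold uc; rw [dif_pos h]; simp

/-- power comparison helper -/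
lemma rp_pos {m : ℕ} (hm : 2 ≤ m) (t : ℝ) : 0 < (m:ℝ) ^ t := by positivity
lemma rp_mono {m : ℕ} (hm : 2 ≤ m) {s t : ℝ} (h : s ≤ t) : (m:ℝ) ^ s ≤ (m:ℝ) ^ t :=
  Real.rpow_le_rpow_of_exponent_le (by exact_mod_cast (by omega : 1 ≤ m)) h
lemma rp_add {m : ℕ} (hm : 2 ≤ m) (s t : ℝ) : (m:ℝ) ^ (s + t) = (m:ℝ) ^ s * (m:ℝ) ^ t :=
  Real.rpow_add (by positivity) s t
end

section
open Filter Topology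

lemma nsum_dvd (A B d : ℕ) (hd : 0 < d) (F : ℕ → ℝ) :
    ∑ n ∈ Finset.Ioc A B with d ∣ n, F n = ∑ k ∈ Finset.Ioc (A / d) (B / d), F (d * k) := by
  symm
  refine Finset.sum_nbij' (fun k => d * k) (fun n => n / d) ?_ ?_ ?_ ?_ ?_
  · intro k hk
    simp only [Finset.mem_Ioc, Finset.mem_filter] at hk ⊢
    refine ⟨⟨?_, ?_⟩, dvd_mul_right _ _⟩
    · have := (Nat.div_lt_iff_lt_mul hd).1 hk.1; linarith [mul_comm k d]
    · have := (Nat.le_div_iff_mul_le hd).1 hk.2; linarith [mul_comm k d]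
  · intro n hn
    simp only [Finset.mem_Ioc, Finset.mem_filter] at hn ⊢
    obtain ⟨k, rfl⟩ := hn.2
    rw [Nat.mul_div_cancel_left _ hd]
    exact ⟨(Nat.div_lt_iff_lt_mul hd).2 (by linarith [mul_comm k d]),
      (Nat.le_div_iff_mul_le hd).2 (by linarith [mul_comm k d])⟩
  · intro k _; exact Nat.mul_div_cancel_left _ hd
  · intro n hn
    simp only [Finset.mem_filter] at hn
    exact Nat.mul_div_cancel' hn.2
  · intro k _; rfl

lemma T_ident (m : ℕ) [NeZero m] (a0 : (ZMod m)ˣ) (XX YY DD : Finset ℕ) (wx wy cd : ℕ → ℝ)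
    (hX : ∀ x ∈ XX, x.Coprime m) (hY : ∀ x ∈ YY, x.Coprime m) (hD : ∀ x ∈ DD, x.Coprime m ∧ 0 < x)
    (A B : ℕ) :
    ∑ x ∈ XX, ∑ y ∈ YY, ∑ n ∈ Finset.Ioc A B, (if ((x * y * n : ℕ) : ZMod m) = (a0 : ZMod m) then
      wx x * wy y * (∑ d ∈ DD with d ∣ n, cd d) / n else 0) =
    ∑ r : (ZMod m)ˣ, ∑ i ∈ YY ×ˢ DD, (∑ x ∈ XX with uc m x = r, wx x) * (wy i.1 * cd i.2 / i.2) *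
      (∑ k ∈ Finset.Ioc (A / i.2) (B / i.2), if (k : ZMod m) * (r : ZMod m) * ((uc m i.1 * uc m i.2 : (ZMod m)ˣ) : ZMod m) = (a0 : ZMod m) then 1 / (k:ℝ) else 0) := by
  rw [← Finset.sum_fiberwise XX (fun x => uc m x)]
  refine Finset.sum_congr rfl fun r _ => ?_
  have rhs : ∀ (f g : ℕ × ℕ → ℝ), ∑ i ∈ YY ×ˢ DD, (∑ x ∈ XX with uc m x = r, wx x) * f i * g i =
      ∑ x ∈ XX with uc m x = r, ∑ i ∈ YY ×ˢ DD, wx x * f i * g i := by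
    intro f g
    simp only [Finset.sum_mul]
    rw [Finset.sum_comm]
  rw [rhs]
  refine Finset.sum_congr rfl fun x hx => ?_
  simp only [Finset.mem_filter] at hx
  rw [Finset.sum_product]
  refine Finset.sum_congr rfl fun y hy => ?_
  have e1 : ∀ n ∈ Finset.Ioc A B, (if ((x * y * n : ℕ) : ZMod m) = (a0 : ZMod m) then
      wx x * wy y * (∑ d ∈ DD with d ∣ n, cd d) / n else 0) =
      ∑ d ∈ DD, if d ∣ n then (if ((x * y * n : ℕ) : ZMod m) = (a0 : ZMod m) then
      wx x * wy y * cd d / n else 0) else 0 := by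
    intro n _
    rw [← Finset.sum_filter]
    split_ifs
    · rw [Finset.mul_sum, Finset.sum_div]
    · simp
  rw [Finset.sum_congr rfl e1, Finset.sum_comm]
  refine Finset.sum_congr rfl fun d hd => ?_
  have hd0 : (d:ℝ) ≠ 0 := by exact_mod_cast (hD d hd).2.ne'
  rw [← Finset.sum_filter, nsum_dvd A B d (hD d hd).2, Finset.mul_sum]
  refine Finset.sum_congr rfl fun k hk => ?_
  have : ((x * y * (d * k) : ℕ) : ZMod m) = (k : ZMod m) * (r : ZMod m) * ((uc m y * uc m d : (ZMod m)ˣ) : ZMod m) := by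
    rw [← hx.2, Units.val_mul, uc_coe (hX x hx.1), uc_coe (hY y hy), uc_coe (hD d hd).1]
    push_cast; ring
  simp only [this]
  split_ifs
  · push_cast
    rcases Nat.eq_zero_or_pos k with rfl | hk0
    · simp
    · field_simp
  · simp

/-- sum of squares is at most sup times l1 -/
lemma sq_sum_le {ι : Type*} (s : Finset ι) (f : ι → ℝ) (hf : ∀ i ∈ s, 0 ≤ f i) (S T : ℝ)
    (h1 : ∀ i ∈ s, f i ≤ S) (h2 : ∑ i ∈ s, f i ≤ T) (hS : 0 ≤ S) : ∑ i ∈ s, f i ^ 2 ≤ S * T := by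
  calc ∑ i ∈ s, f i ^ 2 ≤ ∑ i ∈ s, S * f i := Finset.sum_le_sum fun i hi => by
        rw [sq]; exact mul_le_mul_of_nonneg_right (h1 i hi) (hf i hi)
    _ = S * ∑ i ∈ s, f i := by rw [Finset.mul_sum]
    _ ≤ _ := by gcongr

lemma recip_sum (S : Finset ℕ) (T : ℕ) (hT : 1 ≤ T) (h : ∀ n ∈ S, 0 < n ∧ n ≤ T) :
    ∑ n ∈ S, 1 / (n:ℝ) ≤ 1 + Real.log T := by
  have := harmonic_le_one_add_log T
  rw [harmonic_eq_sum_Icc] at this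
  push_cast at this
  refine le_trans (Finset.sum_le_sum_of_subset_of_nonneg (t := Finset.Icc 1 T) ?_ (fun _ _ _ => by positivity)) (by simpa using this)
  intro n hn
  have := h n hn
  simp; omega

lemma ev_rec (κ : ℝ) (hκ : 0 < κ) (k : ℝ) : ∀ᶠ m : ℕ in atTop, ∀ S : Finset ℕ,
    (∀ n ∈ S, 0 < n ∧ (n:ℝ) ≤ (m:ℝ) ^ k) → ∑ n ∈ S, 1 / (n:ℝ) ≤ (m:ℝ) ^ κ := by
  filter_upwards [ev_const_le (2) (κ/2) (by positivity), ev_log_le (|k|+1) (κ/2) (by positivity), eventually_ge_atTop 3,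
    ev_const_le 2 (κ/2) (by positivity)] with m h1 h2 h3 h4 S hS
  have hm : 2 ≤ m := by omega
  have hlog : 1 ≤ Real.log m := by
    rw [Real.le_log_iff_exp_le (by positivity)]
    have : Real.exp 1 < 3 := lt_trans Real.exp_one_lt_d9 (by norm_num)
    have h3' : (3:ℝ) ≤ m := by exact_mod_cast h3
    linarith
  have hf : 1 ≤ ⌊(m:ℝ)^(|k|)⌋₊ := by
    rw [Nat.one_le_floor_iff]
    have := rp_mono hm (abs_nonneg k)
    simpa using this
  have := recip_sum S ⌊(m:ℝ)^(|k|)⌋₊ hf (fun n hn => ⟨(hS n hn).1, Nat.le_floor ((hS n hn).2.trans (rp_mono hm (le_abs_self k)))⟩)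
  have l1 : Real.log ⌊(m:ℝ)^(|k|)⌋₊ ≤ |k| * Real.log m := by
    rw [← Real.log_rpow (by positivity)]
    exact Real.log_le_log (by exact_mod_cast hf) (Nat.floor_le (by positivity))
  calc _ ≤ (|k|+1) * Real.log m := by nlinarith
    _ ≤ (m:ℝ)^(κ/2) := h2
    _ ≤ _ := rp_mono hm (by linarith)
end

section
open Filter Topology

set_option maxHeartbeats 2000000 in
theorem propT (a b c dd q κ : ℝ) (ha : 0 ≤ a) (ha1 : a ≤ 1) (hb : 0 ≤ b) (hb1 : b ≤ 1) (hc : 0 ≤ c) (hc1 : c ≤ 1)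
    (hq : 0 ≤ q) (hdd : 0 ≤ dd) (hκ : 0 < κ)
    (h1 : q + dd + 100 * κ < a + 2 * c - 2) (h2 : q + 100 * κ < a + b + 2 * c - 3) :
    ∀ᶠ m : ℕ in atTop, ∀ (a0 : (ZMod m)ˣ) (XX YY DD : Finset ℕ) (wx wy cd : ℕ → ℝ),
      (∀ x ∈ XX, x.Coprime m ∧ (m:ℝ) ^ a < x ∧ (x:ℝ) ≤ (m:ℝ) ^ (a + κ) ∧ |wx x| ≤ (m:ℝ) ^ κ / x) →
      (∀ y ∈ YY, y.Coprime m ∧ (m:ℝ) ^ b < y ∧ (y:ℝ) ≤ (m:ℝ) ^ (b + κ) ∧ |wy y| ≤ (m:ℝ) ^ κ / y) →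
      (∀ d ∈ DD, d.Coprime m ∧ 0 < d ∧ (d:ℝ) ≤ (m:ℝ) ^ dd ∧ |cd d| ≤ (m:ℝ) ^ κ) →
      ((DD.card : ℝ) ≤ (m:ℝ) ^ q) →
      |∑ x ∈ XX, ∑ y ∈ YY, ∑ n ∈ Finset.Ioc ⌊(m:ℝ) ^ c⌋₊ ⌊(m:ℝ) ^ (c + κ)⌋₊,
        (if ((x * y * n : ℕ) : ZMod m) = (a0 : ZMod m) then
          wx x * wy y * (∑ d ∈ DD with d ∣ n, cd d) / n else 0) -
        1 / m * (∑ x ∈ XX, wx x) * (∑ y ∈ YY, wy y) * (κ * Real.log m) * (∑ d ∈ DD, cd d / d)| ≤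
      (m:ℝ) ^ (-1 - κ) := by
  filter_upwards [ev_div κ hκ (b + κ + dd), ev_div κ hκ 1, ev_rec κ hκ (a + κ), ev_rec κ hκ (b + κ),
    ev_const_le 4 κ hκ, ev_log_le 2 κ hκ, eventually_ge_atTop 3] with m hdiv hdivm hrecA hrecB h4 hlg hm3
    a0 XX YY DD wx wy cd hX hY hD hcard
  classical
  have hm : 2 ≤ m := by omega
  have : NeZero m := ⟨by omega⟩
  have hm0 : (0:ℝ) < m := by positivity
  have hlog : 1 ≤ Real.log m := by
    rw [Real.le_log_iff_exp_le (by positivity)]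
    have : Real.exp 1 < 3 := lt_trans Real.exp_one_lt_d9 (by norm_num)
    have h3' : (3:ℝ) ≤ m := by exact_mod_cast hm3
    linarith
  have P := fun t => rp_pos hm t
  -- l1 bounds
  have l1X : ∑ x ∈ XX, |wx x| ≤ (m:ℝ) ^ (2 * κ) := by
    calc ∑ x ∈ XX, |wx x| ≤ ∑ x ∈ XX, (m:ℝ)^κ * (1 / (x:ℝ)) :=
          Finset.sum_le_sum fun x hx => by rw [mul_one_div]; exact (hX x hx).2.2.2
      _ = (m:ℝ)^κ * ∑ x ∈ XX, 1 / (x:ℝ) := by rw [Finset.mul_sum]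
      _ ≤ (m:ℝ)^κ * (m:ℝ)^κ := by
          gcongr
          refine hrecA XX fun n hn => ⟨?_, (hX n hn).2.2.1⟩
          have := (P a).trans (hX n hn).2.1
          exact_mod_cast this
      _ = _ := by rw [← rp_add hm]; congr 1; ring
  have l1Y : ∑ x ∈ YY, |wy x| ≤ (m:ℝ) ^ (2 * κ) := by
    calc ∑ x ∈ YY, |wy x| ≤ ∑ x ∈ YY, (m:ℝ)^κ * (1 / (x:ℝ)) :=
          Finset.sum_le_sum fun x hx => by rw [mul_one_div]; exact (hY x hx).2.2.2
      _ = (m:ℝ)^κ * ∑ x ∈ YY, 1 / (x:ℝ) := by rw [Finset.mul_sum]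
      _ ≤ (m:ℝ)^κ * (m:ℝ)^κ := by
          gcongr
          refine hrecB YY fun n hn => ⟨?_, (hY n hn).2.2.1⟩
          have := (P b).trans (hY n hn).2.1
          exact_mod_cast this
      _ = _ := by rw [← rp_add hm]; congr 1; ring
  have l1D : ∑ d ∈ DD, |cd d| ≤ (m:ℝ) ^ (κ + q) := by
    calc ∑ d ∈ DD, |cd d| ≤ ∑ d ∈ DD, (m:ℝ)^κ := Finset.sum_le_sum fun d hd => (hD d hd).2.2.2
      _ = DD.card * (m:ℝ)^κ := by rw [Finset.sum_const, nsmul_eq_mul]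
      _ ≤ (m:ℝ)^q * (m:ℝ)^κ := by gcongr
      _ = _ := by rw [← rp_add hm]; congr 1; ring
  set X : (ZMod m)ˣ → ℝ := fun r => ∑ x ∈ XX with uc m x = r, wx x with hXdef
  have sumX : ∑ r, X r = ∑ x ∈ XX, wx x := Finset.sum_fiberwise XX (fun x => uc m x) wx
  set Kf : ℕ × ℕ → ℝ := fun i => (m:ℝ) ^ c / i.2 with hKf
  set Wf : ℕ × ℕ → ℝ := fun i => wy i.1 * cd i.2 / i.2 with hWf
  have hfl : ∀ t : ℝ, ∀ d : ℕ, ⌊(m:ℝ) ^ t⌋₊ / d = ⌊(m:ℝ)^t / d⌋₊ := fun t d => by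
    rw [Nat.floor_div_natCast]
  have hfm := fourier_main hm (YY ×ˢ DD) (fun i => uc m i.1 * uc m i.2) Wf
    (fun i => ⌊(m:ℝ) ^ c⌋₊ / i.2) (fun i => ⌊(m:ℝ) ^ (c+κ)⌋₊ / i.2) Kf
    (by
      intro i hi
      rw [Finset.mem_product] at hi
      have := (hD i.2 hi.2).2.1
      have : (0:ℝ) < i.2 := by exact_mod_cast this
      simp only [hKf]; positivity)
    (by
      intro i hi
      simp only [hKf, hfl]
      exact (Nat.lt_floor_add_one _).le) X a0
  rw [T_ident m a0 XX YY DD wx wy cd (fun x hx => (hX x hx).1) (fun x hx => (hY x hx).1)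
    (fun x hx => ⟨(hD x hx).1, (hD x hx).2.1⟩)]
  -- X norm
  have X2 : ∑ r, X r ^ 2 ≤ (m:ℝ) ^ (5 * κ - a) := by
    have e : ∀ r, X r ^ 2 = |X r| ^ 2 := fun r => (sq_abs _).symm
    simp_rw [e]
    have := sq_sum_le Finset.univ (fun r => |X r|) (fun _ _ => abs_nonneg _) ((m:ℝ)^(3*κ - a)) ((m:ℝ)^(2*κ)) ?_ ?_ (P _).le
    · refine this.trans (le_of_eq ?_); rw [← rp_add hm]; congr 1; ring
    · intro r _
      have cnt := res_count m XX ((m:ℝ)^(a+κ)) (fun n hn => ⟨by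
        have := (P a).trans (hX n hn).2.1
        exact_mod_cast this, (hX n hn).2.2.1⟩) (P _).le (r : ZMod m)
      calc |X r| ≤ ∑ x ∈ XX with uc m x = r, |wx x| := Finset.abs_sum_le_sum_abs _ _
        _ ≤ ∑ x ∈ XX with uc m x = r, (m:ℝ)^κ / (m:ℝ)^a := by
            refine Finset.sum_le_sum fun x hx => ?_
            have hx := hX x (Finset.mem_filter.1 hx).1
            refine hx.2.2.2.trans ?_
            gcongr
            exact hx.2.1.le
        _ ≤ ∑ x ∈ XX.filter (fun x : ℕ => (x : ZMod m) = r), (m:ℝ)^κ / (m:ℝ)^a := by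
            refine Finset.sum_le_sum_of_subset_of_nonneg ?_ (fun _ _ _ => by positivity)
            intro x hx
            rw [Finset.mem_filter] at hx ⊢
            refine ⟨hx.1, ?_⟩
            rw [← hx.2, uc_coe (hX x hx.1).1]
        _ ≤ ((m:ℝ)^(a+κ) / m + 1) * ((m:ℝ)^κ / (m:ℝ)^a) := by
            rw [Finset.sum_const, nsmul_eq_mul]; gcongr
        _ ≤ (m:ℝ)^(2*κ) * (m:ℝ)^(κ - a) := by
            rw [Real.rpow_sub hm0 κ a]
            gcongr
            have : (m:ℝ)^(a+κ) / m ≤ (m:ℝ)^κ := by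
              rw [div_le_iff₀ hm0]
              calc (m:ℝ)^(a+κ) ≤ (m:ℝ)^(κ + 1) := rp_mono hm (by linarith)
                _ = _ := by rw [rp_add hm, Real.rpow_one]
            have h5 : (m:ℝ)^(2*κ) = (m:ℝ)^κ * (m:ℝ)^κ := by rw [← rp_add hm]; congr 1; ring
            rw [h5]; nlinarith
        _ = _ := by rw [← rp_add hm]; congr 1; ring
    · calc ∑ r, |X r| ≤ ∑ r, ∑ x ∈ XX with uc m x = r, |wx x| :=
            Finset.sum_le_sum fun r _ => Finset.abs_sum_le_sum_abs _ _
        _ = ∑ x ∈ XX, |wx x| := Finset.sum_fiberwise XX (fun x => uc m x) _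
        _ ≤ _ := l1X
  have Wi : ∀ i ∈ YY ×ˢ DD, |Wf i| / Kf i = |wy i.1| * |cd i.2| * (m:ℝ) ^ (-c) := by
    intro i hi
    rw [Finset.mem_product] at hi
    have : (0:ℝ) < i.2 := by exact_mod_cast (hD i.2 hi.2).2.1
    simp only [hKf, hWf, abs_div, abs_mul, abs_of_pos this]
    rw [Real.rpow_neg hm0.le]
    field_simp
  have V2 : ∑ v, (∑ i ∈ YY ×ˢ DD with uc m i.1 * uc m i.2 = v, |Wf i| / Kf i) ^ 2 ≤
      (((m:ℝ)^(b+κ+dd-1) + 1) * (m:ℝ)^(3*κ-b-c)) * (m:ℝ)^(3*κ+q-c) := by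
    refine sq_sum_le Finset.univ _ (fun v _ => Finset.sum_nonneg fun i hi => ?_) _ _ ?_ ?_ (by positivity)
    · rw [Wi i (Finset.mem_filter.1 hi).1]; positivity
    · intro v _
      have hcnt : (((YY ×ˢ DD).filter (fun i => uc m i.1 * uc m i.2 = v)).card : ℝ) ≤
          (m:ℝ)^κ * ((m:ℝ)^(b+κ+dd-1) + 1) := by
        set F := (YY ×ˢ DD).filter (fun i => uc m i.1 * uc m i.2 = v) with hF
        have memF : ∀ i ∈ F, 0 < i.1 ∧ 0 < i.2 ∧ ((i.1 * i.2 : ℕ):ℝ) ≤ (m:ℝ)^(b+κ+dd) ∧ ((i.1*i.2 : ℕ) : ZMod m) = v := by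
          intro i hi
          rw [hF, Finset.mem_filter, Finset.mem_product] at hi
          have y1 := hY _ hi.1.1
          have d1 := hD _ hi.1.2
          refine ⟨?_, d1.2.1, ?_, ?_⟩
          · have := (P b).trans y1.2.1
            exact_mod_cast this
          · push_cast; rw [rp_add hm]
            exact mul_le_mul y1.2.2.1 d1.2.2.1 (by positivity) (by positivity)
          · rw [← hi.2, Units.val_mul, uc_coe y1.1, uc_coe d1.1]; push_cast; rfl
        have c1 := Finset.card_le_mul_card_image (f := fun i : ℕ × ℕ => i.1 * i.2) F ⌊(m:ℝ)^κ⌋₊ (by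
          intro t ht
          rw [Finset.mem_image] at ht
          obtain ⟨i, hi, rfl⟩ := ht
          obtain ⟨i1, i2, i3, _⟩ := memF i hi
          apply Nat.le_floor
          refine le_trans ?_ (hdiv (i.1*i.2) (by positivity) i3)
          norm_cast
          apply Finset.card_le_card_of_injOn (fun j => j.2)
          · intro j hj
            simp only [Finset.coe_filter, Set.mem_ofPred_eq] at hj
            simp only [Finset.mem_coe, Nat.mem_divisors]
            exact ⟨hj.2 ▸ dvd_mul_left _ _, by positivity⟩
          · intro j hj k hk hjk
            simp only [Finset.coe_filter, Set.mem_ofPred_eq] at hj hk hjk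
            have : 0 < k.2 := (memF k hk.1).2.1
            have h3 := hj.2.trans hk.2.symm
            rw [hjk] at h3
            exact Prod.ext (Nat.eq_of_mul_eq_mul_right this h3) hjk)
        have c2 := res_count m (F.image (fun i : ℕ × ℕ => i.1 * i.2)) ((m:ℝ)^(b+κ+dd)) (by
          intro n hn
          rw [Finset.mem_image] at hn
          obtain ⟨i, hi, rfl⟩ := hn
          obtain ⟨i1, i2, i3, _⟩ := memF i hi
          exact ⟨by positivity, i3⟩) (P _).le (v : ZMod m)
        rw [Finset.filter_true_of_mem (by
          intro n hn
          rw [Finset.mem_image] at hn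
          obtain ⟨i, hi, rfl⟩ := hn
          exact (memF i hi).2.2.2)] at c2
        calc (F.card:ℝ) ≤ ⌊(m:ℝ)^κ⌋₊ * (F.image (fun i : ℕ × ℕ => i.1 * i.2)).card := by exact_mod_cast c1
          _ ≤ (m:ℝ)^κ * ((m:ℝ)^(b+κ+dd) / m + 1) := by
              gcongr
              exact Nat.floor_le (P κ).le
          _ = _ := by rw [Real.rpow_sub_one hm0.ne']
      calc ∑ i ∈ YY ×ˢ DD with uc m i.1 * uc m i.2 = v, |Wf i| / Kf i
          ≤ ∑ i ∈ YY ×ˢ DD with uc m i.1 * uc m i.2 = v, (m:ℝ)^(2*κ-b-c) := by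
            refine Finset.sum_le_sum fun i hi => ?_
            rw [Wi i (Finset.mem_filter.1 hi).1]
            rw [Finset.mem_filter, Finset.mem_product] at hi
            have y1 := hY _ hi.1.1
            have d1 := hD _ hi.1.2
            have : |wy i.1| ≤ (m:ℝ)^κ / (m:ℝ)^b := by
              refine y1.2.2.2.trans ?_
              gcongr
              exact y1.2.1.le
            calc |wy i.1| * |cd i.2| * (m:ℝ)^(-c) ≤ ((m:ℝ)^κ / (m:ℝ)^b) * (m:ℝ)^κ * (m:ℝ)^(-c) := by
                  gcongr; exact d1.2.2.2
              _ = _ := by rw [← Real.rpow_sub hm0, ← rp_add hm, ← rp_add hm]; congr 1; ring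
        _ ≤ ((m:ℝ)^κ * ((m:ℝ)^(b+κ+dd-1) + 1)) * (m:ℝ)^(2*κ-b-c) := by
            rw [Finset.sum_const, nsmul_eq_mul]; gcongr
        _ = _ := by
            have : (m:ℝ)^(3*κ-b-c) = (m:ℝ)^κ * (m:ℝ)^(2*κ-b-c) := by rw [← rp_add hm]; congr 1; ring
            rw [this]; ring
    · rw [Finset.sum_fiberwise, Finset.sum_congr rfl Wi, ← Finset.sum_mul, Finset.sum_product]
      dsimp only
      rw [← Finset.sum_mul_sum]
      calc _ ≤ (m:ℝ)^(2*κ) * (m:ℝ)^(κ+q) * (m:ℝ)^(-c) := by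
            gcongr
        _ = _ := by rw [← rp_add hm, ← rp_add hm]; congr 1; ring
  -- error of main term
  have main : |1 / (m:ℝ) * (∑ r, X r) * (∑ i ∈ YY ×ˢ DD, Wf i * ∑ k ∈ Finset.Ioc (⌊(m:ℝ) ^ c⌋₊ / i.2) (⌊(m:ℝ) ^ (c+κ)⌋₊ / i.2), 1 / (k:ℝ))
      - 1 / m * (∑ x ∈ XX, wx x) * (∑ y ∈ YY, wy y) * (κ * Real.log m) * (∑ d ∈ DD, cd d / d)| ≤ (m:ℝ)^(-1-κ) / 2 := by
    have e1 : (∑ y ∈ YY, wy y) * (∑ d ∈ DD, cd d / d) = ∑ i ∈ YY ×ˢ DD, Wf i := by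
      rw [Finset.sum_product, Finset.sum_mul_sum]
      simp only [hWf, mul_div_assoc]
    have e2 : 1 / (m:ℝ) * (∑ r, X r) * (∑ i ∈ YY ×ˢ DD, Wf i * ∑ k ∈ Finset.Ioc (⌊(m:ℝ) ^ c⌋₊ / i.2) (⌊(m:ℝ) ^ (c+κ)⌋₊ / i.2), 1 / (k:ℝ))
      - 1 / m * (∑ x ∈ XX, wx x) * (∑ y ∈ YY, wy y) * (κ * Real.log m) * (∑ d ∈ DD, cd d / d) =
      1 / m * (∑ x ∈ XX, wx x) * ∑ i ∈ YY ×ˢ DD, Wf i * (∑ k ∈ Finset.Ioc (⌊(m:ℝ) ^ c⌋₊ / i.2) (⌊(m:ℝ) ^ (c+κ)⌋₊ / i.2), 1 / (k:ℝ) - κ * Real.log m) := by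
      simp only [mul_sub, Finset.sum_sub_distrib, ← Finset.sum_mul]
      rw [← e1, sumX]; ring
    rw [e2, abs_mul, abs_mul, abs_of_pos (by positivity : 0 < 1 / (m:ℝ))]
    have b1 : |∑ x ∈ XX, wx x| ≤ (m:ℝ)^(2*κ) := (Finset.abs_sum_le_sum_abs _ _).trans l1X
    have b2 : |∑ i ∈ YY ×ˢ DD, Wf i * (∑ k ∈ Finset.Ioc (⌊(m:ℝ) ^ c⌋₊ / i.2) (⌊(m:ℝ) ^ (c+κ)⌋₊ / i.2), 1 / (k:ℝ) - κ * Real.log m)|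
        ≤ 2 * (m:ℝ)^(3*κ+q-c) := by
      calc _ ≤ ∑ i ∈ YY ×ˢ DD, 2 * (|wy i.1| * |cd i.2| * (m:ℝ) ^ (-c)) := by
            refine (Finset.abs_sum_le_sum_abs _ _).trans (Finset.sum_le_sum fun i hi => ?_)
            rw [← Wi i hi, abs_mul]
            rw [Finset.mem_product] at hi
            have d1 := hD _ hi.2
            have hd0 : (0:ℝ) < i.2 := by exact_mod_cast d1.2.1
            have hA : 1 ≤ (m:ℝ)^c / i.2 := by
              rw [one_le_div hd0]
              exact d1.2.2.1.trans (rp_mono hm (by linarith))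
            have hb := harm_block ((m:ℝ)^c / i.2) ((m:ℝ)^(c+κ) / i.2) hA (by
              gcongr ?_ / _; exact rp_mono hm (by linarith))
            have hlg2 : Real.log ((m:ℝ)^(c+κ) / i.2 / ((m:ℝ)^c / i.2)) = κ * Real.log m := by
              rw [← Real.log_rpow hm0]; congr 1
              rw [rp_add hm]; field_simp
            rw [hlg2] at hb
            rw [hfl, hfl]
            calc |Wf i| * _ ≤ |Wf i| * (2 / ((m:ℝ)^c / i.2)) := by gcongr
              _ = _ := by simp only [hKf]; ring
        _ = 2 * ((∑ x ∈ YY, |wy x|) * (∑ d ∈ DD, |cd d|) * (m:ℝ)^(-c)) := by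
            rw [← Finset.mul_sum, ← Finset.sum_mul, Finset.sum_product, Finset.sum_mul_sum]
        _ ≤ 2 * ((m:ℝ)^(2*κ) * (m:ℝ)^(κ+q) * (m:ℝ)^(-c)) := by
            gcongr
        _ = _ := by rw [← rp_add hm, ← rp_add hm]; congr 2; ring
    calc _ ≤ 1 / (m:ℝ) * (m:ℝ)^(2*κ) * (2 * (m:ℝ)^(3*κ+q-c)) := by gcongr
      _ = 2 * ((m:ℝ)^(-1:ℝ) * (m:ℝ)^(2*κ) * (m:ℝ)^(3*κ+q-c)) := by rw [Real.rpow_neg_one]; ring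
      _ = 2 * (m:ℝ)^(-1 + 2*κ + (3*κ+q-c)) := by rw [← rp_add hm, ← rp_add hm]
      _ ≤ 2 * (m:ℝ)^(-1-κ - κ) := by gcongr 2 * ?_; exact rp_mono hm (by linarith)
      _ ≤ _ := by
        rw [Real.rpow_sub hm0 (-1-κ) κ, le_div_iff₀ (by norm_num), mul_assoc, mul_comm, mul_assoc, div_mul_eq_mul_div, div_le_iff₀ (P κ)]
        have := P (-1-κ)
        nlinarith
  have err : Real.sqrt m * (m.divisors.card * (1 + Real.log m)) * Real.sqrt (∑ x, X x ^ 2) *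
      Real.sqrt (∑ v, (∑ i ∈ YY ×ˢ DD with uc m i.1 * uc m i.2 = v, |Wf i| / Kf i) ^ 2) ≤ (m:ℝ)^(-1-κ) / 2 := by
    have t1 : m.divisors.card * (1 + Real.log m) ≤ (m:ℝ)^(2*κ) := by
      have := hdivm m (by omega) (by simp)
      calc m.divisors.card * (1 + Real.log m) ≤ (m:ℝ)^κ * (m:ℝ)^κ := by
            gcongr; linarith
        _ = _ := by rw [← rp_add hm]; congr 1; ring
    have hsq : ∀ t : ℝ, Real.sqrt ((m:ℝ)^t) = (m:ℝ)^(t/2) := fun t => by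
      rw [Real.sqrt_eq_rpow, ← Real.rpow_mul hm0.le]; congr 1; ring
    have sX : Real.sqrt (∑ x, X x ^ 2) ≤ (m:ℝ)^((5*κ-a)/2) := by
      rw [← hsq]; exact Real.sqrt_le_sqrt X2
    have sV : Real.sqrt (∑ v, (∑ i ∈ YY ×ˢ DD with uc m i.1 * uc m i.2 = v, |Wf i| / Kf i) ^ 2) ≤
        (m:ℝ)^((-3 + a - 9*κ - 10*κ)/2) := by
      rw [← hsq]; refine Real.sqrt_le_sqrt (V2.trans ?_)
      calc (((m:ℝ)^(b+κ+dd-1) + 1) * (m:ℝ)^(3*κ-b-c)) * (m:ℝ)^(3*κ+q-c)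
          = (m:ℝ)^(b+κ+dd-1+(3*κ-b-c)+(3*κ+q-c)) + (m:ℝ)^(3*κ-b-c+(3*κ+q-c)) := by
            rw [rp_add hm, rp_add hm (b+κ+dd-1), rp_add hm (3*κ-b-c)]; ring
        _ ≤ (m:ℝ)^(-3+a-9*κ-10*κ-κ) + (m:ℝ)^(-3+a-9*κ-10*κ-κ) := by
            gcongr ?_ + ?_
            · exact rp_mono hm (by linarith)
            · exact rp_mono hm (by linarith)
        _ ≤ _ := by
            rw [Real.rpow_sub hm0 _ κ, ← two_mul, ← mul_div_assoc, div_le_iff₀ (P κ)]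
            have := P (-3+a-9*κ-10*κ)
            nlinarith
    rw [Real.sqrt_eq_rpow]
    calc _ ≤ (m:ℝ)^(1/2:ℝ) * (m:ℝ)^(2*κ) * (m:ℝ)^((5*κ-a)/2) * (m:ℝ)^((-3 + a - 9*κ - 10*κ)/2) := by
          gcongr
      _ = (m:ℝ)^(-1-5*κ) := by rw [← rp_add hm, ← rp_add hm, ← rp_add hm]; congr 1; ring
      _ ≤ (m:ℝ)^(-1-κ-κ) := rp_mono hm (by linarith)
      _ ≤ _ := by
        rw [Real.rpow_sub hm0 (-1-κ) κ, div_le_div_iff_of_pos_left (P _) (P _) (by norm_num)]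
        linarith
  have hf2 := hfm.trans err
  refine (abs_sub_le _ (1 / (m:ℝ) * (∑ r, X r) * (∑ i ∈ YY ×ˢ DD, Wf i * ∑ k ∈ Finset.Ioc (⌊(m:ℝ) ^ c⌋₊ / i.2) (⌊(m:ℝ) ^ (c+κ)⌋₊ / i.2), 1 / (k:ℝ))) _).trans ?_
  refine (add_le_add hf2 main).trans (le_of_eq ?_)
  ring
end

section
open Filter Topology

/-- prime sum -/
noncomputable def mert (n : ℕ) : ℝ := ∑ p ∈ Finset.Icc 1 n with p.Prime, Real.log p / p

lemma log_fact (n : ℕ) : Real.log (n.factorial) =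
    ∑ p ∈ Finset.Icc 1 n with p.Prime, (n.factorial.factorization p : ℝ) * Real.log p := by
  conv_lhs => rw [← Nat.prod_factorization_pow_eq_self (Nat.factorial_ne_zero n)]
  rw [Finsupp.prod, Nat.support_factorization]
  have : n.factorial.primeFactors = Finset.filter (fun p => p.Prime) (Finset.Icc 1 n) := by
    ext p
    simp only [Nat.mem_primeFactors, Finset.mem_filter, Finset.mem_Icc]
    constructor
    · rintro ⟨h1, h2, _⟩
      exact ⟨⟨h1.one_le, (h1.dvd_factorial).1 h2⟩, h1⟩
    · rintro ⟨h1, h2⟩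
      exact ⟨h2, (h2.dvd_factorial).2 h1.2, Nat.factorial_ne_zero n⟩
  rw [this]
  push_cast
  rw [Real.log_prod]
  · refine Finset.sum_congr rfl fun p _ => by rw [Real.log_pow]
  · intro p hp
    simp only [Finset.mem_filter] at hp
    have := hp.2.pos
    positivity

lemma mert_upper (n : ℕ) (hn : 1 ≤ n) : mert n ≤ Real.log n + Real.log 4 := by
  have hn0 : (0:ℝ) < n := by exact_mod_cast hn
  have h1 : Real.log (n.factorial) ≤ n * Real.log n := by
    rw [← Real.log_pow]
    apply Real.log_le_log (by positivity)
    exact_mod_cast Nat.factorial_le_pow n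
  have h2 : n * mert n - Chebyshev.theta n ≤ Real.log (n.factorial) := by
    rw [log_fact, mert, Finset.mul_sum, Chebyshev.theta_eq_sum_Icc, Nat.floor_natCast]
    have : ∑ p ∈ Finset.Icc 0 n with p.Prime, Real.log p = ∑ p ∈ Finset.Icc 1 n with p.Prime, Real.log p := by
      refine Finset.sum_congr ?_ fun _ _ => rfl
      ext p; simp only [Finset.mem_filter, Finset.mem_Icc]
      constructor
      · rintro ⟨h, hp⟩; exact ⟨⟨hp.one_le, h.2⟩, hp⟩
      · rintro ⟨h, hp⟩; exact ⟨⟨Nat.zero_le _, h.2⟩, hp⟩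
    rw [this, ← Finset.sum_sub_distrib]
    refine Finset.sum_le_sum fun p hp => ?_
    simp only [Finset.mem_filter, Finset.mem_Icc] at hp
    have hp0 : (0:ℝ) < p := by exact_mod_cast hp.2.pos
    have hl : 0 ≤ Real.log p := Real.log_natCast_nonneg p
    have h3 : n / p ≤ n.factorial.factorization p := by
      rw [Nat.factorization_factorial hp.2 (Nat.lt_add_one (Nat.log p n))]
      have hlog : 1 ≤ Nat.log p n := Nat.log_pos hp.2.one_lt hp.1.2
      have := Finset.single_le_sum (s := Finset.Ico 1 (Nat.log p n + 1)) (f := fun i => n / p ^ i) (fun _ _ => Nat.zero_le _) (show 1 ∈ Finset.Ico 1 (Nat.log p n + 1) from Finset.mem_Ico.2 ⟨le_rfl, by omega⟩)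
      simpa using this
    have h4 : (n:ℝ) / p - 1 ≤ (n.factorial.factorization p : ℝ) := by
      have : (n:ℝ) / p < (n / p : ℕ) + 1 := by
        rw [div_lt_iff₀ hp0]
        have := Nat.lt_mul_div_succ n hp.2.pos
        have h5 : (n:ℝ) < p * ((n / p : ℕ) + 1) := by exact_mod_cast this
        linarith
      have h6 : ((n / p : ℕ):ℝ) ≤ (n.factorial.factorization p : ℝ) := by exact_mod_cast h3
      linarith
    calc (n:ℝ) * (Real.log p / p) - Real.log p = (n / p - 1) * Real.log p := by ring
      _ ≤ _ := by gcongr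
  have h3 := Chebyshev.theta_le_log4_mul_x (x := (n:ℝ)) hn0.le
  have : (n:ℝ) * mert n ≤ n * (Real.log n + Real.log 4) := by nlinarith
  exact le_of_mul_le_mul_left this hn0

lemma mert_lower : ∃ C : ℝ, ∀ n : ℕ, 1 ≤ n → Real.log n - C ≤ mert n := by
  have hs : Summable (fun k : ℕ => 4 * (1 / (k:ℝ) ^ (3/2:ℝ))) :=
    (Real.summable_one_div_nat_rpow.2 (by norm_num)).mul_left _
  refine ⟨1 + ∑' k : ℕ, 4 * (1 / (k:ℝ) ^ (3/2:ℝ)), fun n hn => ?_⟩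
  have hn0 : (0:ℝ) < n := by exact_mod_cast hn
  have h1 : n * Real.log n - n ≤ Real.log (n.factorial) := by
    have := Real.pow_div_factorial_le_exp (x := (n:ℝ)) hn0.le n
    have hf : (0:ℝ) < n.factorial := by positivity
    have h2 := Real.log_le_log (by positivity) this
    rw [Real.log_div (by positivity) (by positivity), Real.log_exp, Real.log_pow] at h2
    linarith
  have h2 : Real.log (n.factorial) ≤ n * mert n + n * ∑' k : ℕ, 4 * (1 / (k:ℝ) ^ (3/2:ℝ)) := by
    rw [log_fact]
    have h3 : ∑ p ∈ Finset.Icc 1 n with p.Prime, 4 * (1 / (p:ℝ) ^ (3/2:ℝ)) ≤ ∑' k : ℕ, 4 * (1 / (k:ℝ) ^ (3/2:ℝ)) :=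
      hs.sum_le_tsum _ (fun _ _ => by positivity)
    refine le_trans ?_ (add_le_add_right (mul_le_mul_of_nonneg_left h3 hn0.le) _)
    rw [mert, Finset.mul_sum, Finset.mul_sum, ← Finset.sum_add_distrib]
    refine Finset.sum_le_sum fun p hp => ?_
    simp only [Finset.mem_filter, Finset.mem_Icc] at hp
    have hp2 : (2:ℝ) ≤ p := by exact_mod_cast hp.2.two_le
    have hp0 : (0:ℝ) < p := by linarith
    have hl : 0 ≤ Real.log p := Real.log_natCast_nonneg p
    have h4 : (n.factorial.factorization p : ℝ) ≤ n / (p - 1) := by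
      have h5 := Nat.factorization_factorial_le_div_pred hp.2 n
      calc (n.factorial.factorization p : ℝ) ≤ ((n / (p - 1) : ℕ) : ℝ) := by exact_mod_cast h5
        _ ≤ (n:ℝ) / ((p - 1 : ℕ):ℝ) := Nat.cast_div_le
        _ = _ := by rw [Nat.cast_sub hp.2.one_le]; simp
    have h6 : Real.log p ≤ 2 * (p:ℝ) ^ (1/2:ℝ) := by
      have := Real.log_le_rpow_div hp0.le (show (0:ℝ) < 1/2 by norm_num)
      linarith
    have h7 : (p:ℝ)^(3/2:ℝ) = p * (p:ℝ)^(1/2:ℝ) := by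
      rw [show (3/2:ℝ) = 1 + 1/2 by norm_num, Real.rpow_add hp0, Real.rpow_one]
    have h8 : (p:ℝ)^(1/2:ℝ) * (p:ℝ)^(1/2:ℝ) = p := by
      rw [← Real.rpow_add hp0]; norm_num
    have h9 : (0:ℝ) < (p:ℝ)^(1/2:ℝ) := by positivity
    calc (n.factorial.factorization p : ℝ) * Real.log p ≤ n / (p - 1) * Real.log p := by gcongr
      _ = n * (Real.log p / p) + n * (Real.log p / (p * (p - 1))) := by
          have : (p:ℝ) - 1 ≠ 0 := by linarith
          field_simp; ring
      _ ≤ _ := by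
          gcongr
          rw [mul_one_div, div_le_div_iff₀ (by nlinarith) (by positivity), h7]
          have : Real.log p * (p * (p:ℝ)^(1/2:ℝ)) ≤ 2 * (p:ℝ) ^ (1/2:ℝ) * (p * (p:ℝ)^(1/2:ℝ)) := by gcongr
          have e : 2 * (p:ℝ) ^ (1/2:ℝ) * (p * (p:ℝ)^(1/2:ℝ)) = 2 * p * p := by linear_combination 2 * (p:ℝ) * h8
          nlinarith
  have : (n:ℝ) * (Real.log n - (1 + ∑' k : ℕ, 4 * (1 / (k:ℝ) ^ (3/2:ℝ)))) ≤ n * mert n := by nlinarith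
  exact le_of_mul_le_mul_left this hn0

theorem mertens_interval : ∃ C : ℝ, 0 < C ∧ ∀ A B : ℝ, 1 ≤ A → A ≤ B →
    |∑ p ∈ Finset.Ioc ⌊A⌋₊ ⌊B⌋₊ with p.Prime, Real.log p / p - Real.log (B / A)| ≤ C := by
  obtain ⟨C, hC⟩ := mert_lower
  refine ⟨|C| + Real.log 4 + Real.log 2, by positivity, fun A B hA hAB => ?_⟩
  have hl : ∀ y : ℝ, 1 ≤ y → Real.log y - Real.log 2 ≤ Real.log ⌊y⌋₊ ∧ Real.log ⌊y⌋₊ ≤ Real.log y := by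
    intro y hy
    have h1 : (1:ℝ) ≤ ⌊y⌋₊ := by exact_mod_cast (Nat.one_le_floor_iff _ |>.2 hy)
    have h2 := Nat.lt_floor_add_one y
    constructor
    · rw [← Real.log_div (by positivity) (by norm_num)]
      exact Real.log_le_log (by positivity) (by linarith)
    · exact Real.log_le_log (by positivity) (Nat.floor_le (by linarith))
  have e : ∑ p ∈ Finset.Ioc ⌊A⌋₊ ⌊B⌋₊ with p.Prime, Real.log p / p = mert ⌊B⌋₊ - mert ⌊A⌋₊ := by
    rw [eq_sub_iff_add_eq', mert, mert, ← Finset.sum_union]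
    · refine Finset.sum_congr ?_ fun _ _ => rfl
      have := Nat.floor_le_floor hAB
      ext p; simp only [Finset.mem_union, Finset.mem_filter, Finset.mem_Ioc, Finset.mem_Icc]
      constructor
      · rintro (⟨h, hp⟩ | ⟨h, hp⟩)
        · exact ⟨⟨h.1, h.2.trans this⟩, hp⟩
        · exact ⟨⟨hp.one_le, h.2⟩, hp⟩
      · rintro ⟨h, hp⟩
        by_cases h3 : p ≤ ⌊A⌋₊
        · left; exact ⟨⟨h.1, h3⟩, hp⟩
        · right; exact ⟨⟨by omega, h.2⟩, hp⟩
    · rw [Finset.disjoint_left]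
      intro p hp hq
      simp only [Finset.mem_filter, Finset.mem_Ioc, Finset.mem_Icc] at hp hq
      omega
  have a1 := Nat.one_le_floor_iff _ |>.2 hA
  have b1 := Nat.one_le_floor_iff _ |>.2 (hA.trans hAB)
  have := hC _ a1
  have := hC _ b1
  have := mert_upper _ a1
  have := mert_upper _ b1
  have := hl A hA
  have := hl B (hA.trans hAB)
  have := le_abs_self C
  have h2 : 0 ≤ Real.log 2 := by positivity
  have h4 : 0 ≤ Real.log 4 := by positivity
  rw [e, Real.log_div (by linarith) (by linarith), abs_le]
  constructor <;> linarith
end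

section
open Filter Topology

/-- primes in the real interval (A,B] not dividing m -/
noncomputable def prs (m : ℕ) (A B : ℝ) : Finset ℕ :=
  (Finset.Ioc ⌊A⌋₊ ⌊B⌋₊).filter (fun p => p.Prime ∧ ¬ p ∣ m)

lemma mem_prs {m : ℕ} {A B : ℝ} (hA : 0 ≤ A) (hB : 0 ≤ B) {p : ℕ} :
    p ∈ prs m A B ↔ (A < p ∧ (p:ℝ) ≤ B) ∧ p.Prime ∧ ¬ p ∣ m := by
  simp only [prs, Finset.mem_filter, Finset.mem_Ioc, Nat.floor_lt hA, Nat.le_floor_iff hB]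

lemma bad_primes (δ η : ℝ) (hδ : 0 < δ) (hη : 0 < η) : ∀ᶠ m : ℕ in atTop, ∀ S : Finset ℕ,
    (∀ p ∈ S, p ∣ m ∧ (m:ℝ)^δ < p) → ∑ p ∈ S, Real.log p / p ≤ η ∧ ∑ p ∈ S, 1 / (p:ℝ) ≤ η := by
  filter_upwards [ev_div (δ/4) (by positivity) 1, ev_log_le 1 (δ/4) (by positivity),
    ev_const_le (1/η) (δ/4) (by positivity), eventually_ge_atTop 3] with m h1 h2 h3 hm3 S hS
  have hm : 2 ≤ m := by omega
  have hm0 : (0:ℝ) < m := by positivity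
  have hlog : 1 ≤ Real.log m := by
    rw [Real.le_log_iff_exp_le (by positivity)]
    have : Real.exp 1 < 3 := lt_trans Real.exp_one_lt_d9 (by norm_num)
    have h3' : (3:ℝ) ≤ m := by exact_mod_cast hm3
    linarith
  have hc : (S.card : ℝ) ≤ (m:ℝ)^(δ/4) := by
    refine le_trans ?_ (h1 m (by omega) (by simp))
    norm_cast
    apply Finset.card_le_card
    intro p hp
    exact Nat.mem_divisors.2 ⟨(hS p hp).1, by omega⟩
  have key : (S.card : ℝ) * (Real.log m / (m:ℝ)^δ) ≤ η := by
    calc (S.card : ℝ) * (Real.log m / (m:ℝ)^δ) ≤ (m:ℝ)^(δ/4) * ((m:ℝ)^(δ/4) / (m:ℝ)^δ) := by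
          gcongr; linarith
      _ = (m:ℝ)^(-(δ/4) - δ/4) := by
          rw [← Real.rpow_sub hm0, ← rp_add hm]; congr 1; ring
      _ ≤ (m:ℝ)^(-(δ/4)) := rp_mono hm (by linarith)
      _ ≤ η := by
          rw [Real.rpow_neg hm0.le, inv_le_comm₀ (by positivity) hη]
          simpa using h3
  constructor
  · refine le_trans (Finset.sum_le_card_nsmul S _ (Real.log m / (m:ℝ)^δ) fun p hp => ?_) (by rw [nsmul_eq_mul]; exact key)
    have h4 := hS p hp
    have hp0 : (0:ℝ) < p := lt_trans (by positivity) h4.2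
    gcongr
    · exact Nat.le_of_dvd (by omega) h4.1
    · exact h4.2.le
  · refine le_trans (Finset.sum_le_card_nsmul S _ (Real.log m / (m:ℝ)^δ) fun p hp => ?_) (by rw [nsmul_eq_mul]; exact key)
    have h4 := hS p hp
    have hp0 : (0:ℝ) < p := lt_trans (by positivity) h4.2
    gcongr
    exact h4.2.le

lemma plog_upper : ∃ C : ℝ, 0 < C ∧ ∀ m : ℕ, ∀ A B : ℝ, 1 ≤ A → A ≤ B →
    ∑ p ∈ prs m A B, Real.log p / p ≤ Real.log (B / A) + C := by
  obtain ⟨C, hC, h⟩ := mertens_interval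
  refine ⟨C, hC, fun m A B hA hAB => ?_⟩
  have := (abs_le.1 (h A B hA hAB)).2
  refine le_trans (Finset.sum_le_sum_of_subset_of_nonneg (t := Finset.filter (fun p => p.Prime) (Finset.Ioc ⌊A⌋₊ ⌊B⌋₊)) ?_ ?_) (by linarith)
  · intro p hp
    simp only [prs, Finset.mem_filter] at hp ⊢
    exact ⟨hp.1, hp.2.1⟩
  · intro p _ _
    exact div_nonneg (Real.log_natCast_nonneg p) (by positivity)

lemma plog_lower : ∃ C : ℝ, 0 < C ∧ ∀ δ : ℝ, 0 < δ → ∀ᶠ m : ℕ in atTop, ∀ A B : ℝ, (m:ℝ)^δ ≤ A → A ≤ B →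
    Real.log (B / A) - C ≤ ∑ p ∈ prs m A B, Real.log p / p := by
  obtain ⟨C, hC, h⟩ := mertens_interval
  refine ⟨C + 1, by linarith, fun δ hδ => ?_⟩
  filter_upwards [bad_primes δ 1 hδ one_pos, eventually_ge_atTop 2] with m hb hm A B hA hAB
  have hA1 : 1 ≤ A := le_trans (by simpa using rp_mono hm hδ.le) hA
  have := (abs_le.1 (h A B hA1 hAB)).1
  have hb' := (hb (Finset.filter (fun p => p ∣ m) (Finset.filter (fun p => p.Prime) (Finset.Ioc ⌊A⌋₊ ⌊B⌋₊))) (by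
    intro p hp
    simp only [Finset.mem_filter, Finset.mem_Ioc] at hp
    exact ⟨hp.2, hA.trans_lt ((Nat.floor_lt (by linarith)).1 hp.1.1.1)⟩)).1
  have e := Finset.sum_filter_add_sum_filter_not (Finset.filter (fun p => p.Prime) (Finset.Ioc ⌊A⌋₊ ⌊B⌋₊)) (fun p => p ∣ m) (fun p : ℕ => Real.log p / p)
  have e2 : (Finset.filter (fun p => p.Prime) (Finset.Ioc ⌊A⌋₊ ⌊B⌋₊)).filter (fun p => ¬ p ∣ m) = prs m A B := by
    rw [Finset.filter_filter]; rfl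
  rw [e2] at e
  linarith

lemma prs_union {m : ℕ} {A B D : ℝ} (hAB : A ≤ B) (hBD : B ≤ D) (f : ℕ → ℝ) :
    ∑ p ∈ prs m A D, f p = ∑ p ∈ prs m A B, f p + ∑ p ∈ prs m B D, f p := by
  simp only [prs, Finset.sum_filter]
  exact (Finset.sum_Ioc_consecutive _ (Nat.floor_le_floor hAB) (Nat.floor_le_floor hBD)).symm

lemma pinv_cell : ∃ C : ℝ, 0 < C ∧ ∀ s t : ℝ, 0 < s → s ≤ t → ∀ᶠ m : ℕ in atTop,
    (1 - s / t) - C / (s * Real.log m) ≤ ∑ p ∈ prs m ((m:ℝ)^s) ((m:ℝ)^t), 1 / (p:ℝ) ∧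
    ∑ p ∈ prs m ((m:ℝ)^s) ((m:ℝ)^t), 1 / (p:ℝ) ≤ (t / s - 1) + C / (s * Real.log m) := by
  obtain ⟨C1, hC1, h1⟩ := plog_upper
  obtain ⟨C2, hC2, h2⟩ := plog_lower
  refine ⟨C1 + C2, by linarith, fun s t hs hst => ?_⟩
  filter_upwards [h2 s hs, eventually_ge_atTop 3] with m h2 hm3
  have hm : 2 ≤ m := by omega
  have hm0 : (0:ℝ) < m := by positivity
  have hL : 0 < Real.log m := Real.log_pos (by exact_mod_cast hm)
  have hst' := rp_mono hm hst
  have e1 : (1:ℝ) ≤ (m:ℝ)^s := by simpa using rp_mono hm hs.le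
  have u := h1 m _ _ e1 hst'
  have l := h2 _ _ le_rfl hst'
  have ht : 0 < t := hs.trans_le hst
  have elog : Real.log ((m:ℝ)^t / (m:ℝ)^s) = (t - s) * Real.log m := by
    rw [← Real.rpow_sub hm0, Real.log_rpow hm0]
  rw [elog] at u l
  have bd : ∀ p ∈ prs m ((m:ℝ)^s) ((m:ℝ)^t), s * Real.log m * (1 / (p:ℝ)) ≤ Real.log p / p ∧
      Real.log p / p ≤ t * Real.log m * (1 / (p:ℝ)) := by
    intro p hp
    rw [mem_prs (by positivity) (by positivity)] at hp
    have hp0 : (0:ℝ) < p := lt_trans (by positivity) hp.1.1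
    rw [mul_one_div, mul_one_div, ← Real.log_rpow hm0, ← Real.log_rpow hm0]
    exact ⟨by gcongr; exact hp.1.1.le, by gcongr; exact hp.1.2⟩
  have b1 := Finset.sum_le_sum fun p hp => (bd p hp).1
  have b2 := Finset.sum_le_sum fun p hp => (bd p hp).2
  rw [← Finset.mul_sum] at b1 b2
  set S := ∑ p ∈ prs m ((m:ℝ)^s) ((m:ℝ)^t), 1 / (p:ℝ)
  constructor
  · have : (t - s) * Real.log m - C2 ≤ t * Real.log m * S := l.trans b2
    have h3 : (1 - s / t) - C2 / (t * Real.log m) ≤ S := by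
      rw [← mul_le_mul_iff_right₀ (by positivity : 0 < t * Real.log m)]
      refine le_trans (le_of_eq ?_) this
      field_simp
    have h4 : C2 / (t * Real.log m) ≤ (C1 + C2) / (s * Real.log m) := by gcongr; linarith
    linarith
  · have : s * Real.log m * S ≤ (t - s) * Real.log m + C1 := b1.trans u
    have h3 : S ≤ (t / s - 1) + C1 / (s * Real.log m) := by
      rw [← mul_le_mul_iff_right₀ (by positivity : 0 < s * Real.log m)]
      refine le_trans this (le_of_eq ?_)
      field_simp
    have h4 : C1 / (s * Real.log m) ≤ (C1 + C2) / (s * Real.log m) := by gcongr; linarith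
    linarith

lemma ev_log_ge (C : ℝ) : ∀ᶠ m : ℕ in atTop, C ≤ Real.log m :=
  (Real.tendsto_log_atTop.comp (tendsto_natCast_atTop_atTop (R := ℝ))).eventually_ge_atTop C

/-- Mertens' second theorem between powers of m -/
theorem pinv_asymp (s t η : ℝ) (hs : 0 < s) (hst : s ≤ t) (hη : 0 < η) : ∀ᶠ m : ℕ in atTop,
    |∑ p ∈ prs m ((m:ℝ)^s) ((m:ℝ)^t), 1 / (p:ℝ) - Real.log (t / s)| ≤ η := by
  obtain ⟨C, hC, h⟩ := pinv_cell
  have ht : 0 < t := hs.trans_le hst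
  set x := Real.log (t / s) with hx
  have hx0 : 0 ≤ x := Real.log_nonneg (by rw [le_div_iff₀ hs]; linarith)
  obtain ⟨N, hN⟩ := exists_nat_gt (2 * (x^2 + x + 1) / η + x + 1)
  have hN1 : 2 * (x^2 + x + 1) / η > 0 := by positivity
  have hN0 : (0:ℝ) < N := by linarith
  set r : ℕ → ℝ := fun i => s * Real.exp (x / N * i) with hr
  have rpos : ∀ i, s ≤ r i := fun i => by
    have : 1 ≤ Real.exp (x / N * i) := Real.one_le_exp (by positivity)
    simp only [hr]; nlinarith
  have rstep : ∀ i, r (i+1) = r i * Real.exp (x / N) := fun i => by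
    simp only [hr]; rw [mul_assoc, ← Real.exp_add]; congr 2; push_cast; ring
  have hy1 : x / N ≤ 1 := by rw [div_le_one hN0]; linarith
  have hy0 : 0 ≤ x / N := by positivity
  have rmono : ∀ i, r i ≤ r (i+1) := fun i => by
    rw [rstep]; have := Real.one_le_exp hy0; have := rpos i; nlinarith
  have hev : ∀ᶠ m : ℕ in atTop, ∀ i ∈ Finset.range N,
      (1 - r i / r (i+1)) - C / (r i * Real.log m) ≤ ∑ p ∈ prs m ((m:ℝ)^(r i)) ((m:ℝ)^(r (i+1))), 1 / (p:ℝ) ∧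
    ∑ p ∈ prs m ((m:ℝ)^(r i)) ((m:ℝ)^(r (i+1))), 1 / (p:ℝ) ≤ (r (i+1) / r i - 1) + C / (r i * Real.log m) := by
    rw [eventually_all_finset]
    intro i _
    exact h _ _ (hs.trans_le (rpos i)) (rmono i)
  filter_upwards [hev, ev_log_ge (2 * N * C / (s * η) + 1), eventually_ge_atTop 2] with m hc hlog hm
  have hL : 0 < Real.log m := Real.log_pos (by exact_mod_cast hm)
  have tot : ∀ n, ∑ p ∈ prs m ((m:ℝ)^(r 0)) ((m:ℝ)^(r n)), 1 / (p:ℝ) =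
      ∑ i ∈ Finset.range n, ∑ p ∈ prs m ((m:ℝ)^(r i)) ((m:ℝ)^(r (i+1))), 1 / (p:ℝ) := by
    intro n
    induction n with
    | zero => simp [prs]
    | succ n ih =>
      rw [Finset.sum_range_succ, ← ih]
      refine prs_union (rp_mono hm ?_) (rp_mono hm (rmono n)) _
      exact monotone_nat_of_le_succ rmono (Nat.zero_le n)
  have r0 : r 0 = s := by simp [hr]
  have rN : r N = t := by
    simp only [hr]
    rw [div_mul_cancel₀ _ hN0.ne', hx, Real.exp_log (by positivity)]; field_simp
  have tN := tot N
  rw [r0, rN] at tN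
  rw [tN]
  have cb : ∀ i, C / (r i * Real.log m) ≤ C / (s * Real.log m) := fun i => by
    gcongr; exact rpos i
  have q1 : ∀ i, r (i+1) / r i = Real.exp (x/N) := fun i => by
    rw [rstep]; have := hs.trans_le (rpos i); field_simp
  have q2 : ∀ i, r i / r (i+1) = Real.exp (-(x/N)) := fun i => by
    rw [rstep, Real.exp_neg]; have := hs.trans_le (rpos i); field_simp
  have ex1 := (abs_le.1 (Real.abs_exp_sub_one_sub_id_le (x := x/N) (by rw [abs_of_nonneg hy0]; exact hy1))).2
  have ex2 := (abs_le.1 (Real.abs_exp_sub_one_sub_id_le (x := -(x/N)) (by rw [abs_neg, abs_of_nonneg hy0]; exact hy1))).2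
  have up : ∑ i ∈ Finset.range N, ∑ p ∈ prs m ((m:ℝ)^(r i)) ((m:ℝ)^(r (i+1))), 1 / (p:ℝ) ≤
      N * (x/N + (x/N)^2 + C / (s * Real.log m)) := by
    refine le_trans (Finset.sum_le_card_nsmul _ _ (x/N + (x/N)^2 + C / (s * Real.log m)) fun i hi => ?_) (by rw [Finset.card_range, nsmul_eq_mul])
    have := (hc i hi).2
    rw [q1] at this
    linarith [cb i]
  have lo : N * (x/N - (x/N)^2 - C / (s * Real.log m)) ≤ ∑ i ∈ Finset.range N, ∑ p ∈ prs m ((m:ℝ)^(r i)) ((m:ℝ)^(r (i+1))), 1 / (p:ℝ) := by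
    refine le_trans (by rw [Finset.card_range, nsmul_eq_mul]) (Finset.card_nsmul_le_sum (Finset.range N) _ (x/N - (x/N)^2 - C / (s * Real.log m)) fun i hi => ?_)
    have := (hc i hi).1
    rw [q2] at this
    nlinarith [cb i]
  have e1 : (N:ℝ) * (x/N) = x := by field_simp
  have e2 : (N:ℝ) * (x/N)^2 ≤ η / 2 := by
    have : (N:ℝ) * (x/N)^2 = x^2 / N := by field_simp
    rw [this, div_le_iff₀ hN0]
    have : 2 * (x^2 + x + 1) / η ≤ N := by linarith
    rw [div_le_iff₀ hη] at this
    nlinarith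
  have e3 : (N:ℝ) * (C / (s * Real.log m)) ≤ η / 2 := by
    rw [mul_div_assoc', div_le_iff₀ (by positivity)]
    have : 2 * N * C / (s * η) ≤ Real.log m := by linarith
    rw [div_le_iff₀ (by positivity)] at this
    nlinarith
  rw [abs_le]
  constructor <;> nlinarith
end

section
open Filter Topology

/-- squarefree integers in [1,v] coprime to M -/
noncomputable def sqc (M : ℕ) (v : ℝ) : Finset ℕ :=
  (Finset.Icc 1 ⌊v⌋₊).filter (fun k => Squarefree k ∧ k.Coprime M)

noncomputable def GG (M : ℕ) (v : ℝ) : ℝ := ∑ k ∈ sqc M v, 1 / (k.totient : ℝ)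

lemma mem_sqc {M : ℕ} {v : ℝ} {k : ℕ} (hv : 0 ≤ v) :
    k ∈ sqc M v ↔ 0 < k ∧ (k:ℝ) ≤ v ∧ Squarefree k ∧ k.Coprime M := by
  simp only [sqc, Finset.mem_filter, Finset.mem_Icc, Nat.le_floor_iff hv, Nat.succ_le_iff]
  tauto

/-- product of the primes of n not dividing M -/
def rc (M n : ℕ) : ℕ := ∏ p ∈ n.primeFactors \ M.primeFactors, p

lemma rc_pf (M n : ℕ) : (rc M n).primeFactors = n.primeFactors \ M.primeFactors := by
  apply Nat.primeFactors_prod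
  intro p hp
  exact Nat.prime_of_mem_primeFactors (Finset.mem_sdiff.1 hp).1

lemma rc_ne (M n : ℕ) : rc M n ≠ 0 := by
  apply Finset.prod_ne_zero_iff.2
  intro p hp
  exact (Nat.prime_of_mem_primeFactors (Finset.mem_sdiff.1 hp).1).ne_zero

lemma rc_dvd (M n : ℕ) : rc M n ∣ n :=
  (Finset.prod_dvd_prod_of_subset _ _ _ Finset.sdiff_subset).trans (Nat.prod_primeFactors_dvd n)

lemma rc_sqf (M n : ℕ) : Squarefree (rc M n) := by
  unfold rc
  refine Finset.squarefree_prod_of_pairwise_isCoprime ?_ ?_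
  rotate_left
  · intro p hp
    exact (Nat.prime_of_mem_primeFactors (Finset.mem_sdiff.1 hp).1).prime.squarefree
  · intro p hp q hq hpq
    have hp := (Nat.prime_of_mem_primeFactors (Finset.mem_sdiff.1 (Finset.mem_coe.1 hp)).1)
    have hq := (Nat.prime_of_mem_primeFactors (Finset.mem_sdiff.1 (Finset.mem_coe.1 hq)).1)
    exact Nat.coprime_iff_isRelPrime.1 ((Nat.coprime_primes hp hq).2 hpq)

lemma rc_cop (M n : ℕ) (hM : M ≠ 0) : (rc M n).Coprime M := by
  rw [← Nat.disjoint_primeFactors (rc_ne M n) hM, rc_pf]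
  exact Finset.sdiff_disjoint

lemma tot_prod (n : ℕ) (hn : n ≠ 0) : (n:ℝ) / n.totient = ∏ p ∈ n.primeFactors, (1 - (p:ℝ)⁻¹)⁻¹ := by
  have h := Nat.totient_eq_mul_prod_factors n
  have h' : (n.totient : ℝ) = n * ∏ p ∈ n.primeFactors, (1 - (p:ℝ)⁻¹) := by
    have := congrArg (fun x : ℚ => (x:ℝ)) h
    push_cast at this
    exact this
  have hn' : (n:ℝ) ≠ 0 := by exact_mod_cast hn
  rw [h', Finset.prod_inv_distrib, div_mul_eq_div_div, div_self hn', one_div]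

lemma fn_sum (s : ℝ) (hs : 0 < s) (n : ℕ) :
    HasSum (fun j : Nat.factoredNumbers n.primeFactors => (((j:ℕ):ℝ)^(-s) : ℝ))
      (∏ p ∈ n.primeFactors, (1 - ((p:ℝ)^(-s)))⁻¹) := by
  let f : ℕ →* ℝ := { toFun := fun n => (n:ℝ)^(-s), map_one' := by simp, map_mul' := fun a b => by
                        push_cast; exact Real.mul_rpow (by positivity) (by positivity) }
  have := (EulerProduct.summable_and_hasSum_factoredNumbers_prod_filter_prime_geometric (f := f) (fun {p} hp => by
    show ‖(p:ℝ)^(-s)‖ < 1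
    rw [Real.norm_of_nonneg (by positivity)]
    exact Real.rpow_lt_one_of_one_lt_of_neg (by exact_mod_cast hp.one_lt) (by linarith)) n.primeFactors).2
  rw [Finset.filter_true_of_mem (fun p hp => Nat.prime_of_mem_primeFactors hp)] at this
  exact this

lemma gk_eq (k M : ℕ) (hk : k ≠ 0) (hM : M ≠ 0) (hc : k.Coprime M) :
    1 / (k.totient:ℝ) * (M / M.totient) = 1 / k * ∏ p ∈ (k*M).primeFactors, (1 - (p:ℝ)⁻¹)⁻¹ := by
  rw [← tot_prod _ (mul_ne_zero hk hM), Nat.totient_mul hc]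
  have : (k:ℝ) ≠ 0 := by exact_mod_cast hk
  push_cast
  field_simp

lemma GG_lower (M : ℕ) (hM : M ≠ 0) (v : ℝ) (hv : 1 ≤ v) :
    Real.log v ≤ GG M v * (M / M.totient) := by
  have h1 : Real.log v ≤ ∑ n ∈ Finset.Icc 1 ⌊v⌋₊, 1 / (n:ℝ) := by
    have := log_add_one_le_harmonic ⌊v⌋₊
    rw [harmonic_eq_sum_Icc] at this
    push_cast at this
    simp only [one_div]
    refine le_trans (Real.log_le_log (by linarith) ?_) this
    exact (Nat.lt_floor_add_one v).le
  refine h1.trans ?_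
  have hv0 : (0:ℝ) ≤ v := by linarith
  have hmaps : ∀ n ∈ Finset.Icc 1 ⌊v⌋₊, rc M n ∈ sqc M v := by
    intro n hn
    rw [mem_sqc hv0]
    rw [Finset.mem_Icc, Nat.le_floor_iff hv0] at hn
    refine ⟨Nat.pos_of_ne_zero (rc_ne _ _), le_trans ?_ hn.2, rc_sqf _ _, rc_cop _ _ hM⟩
    exact_mod_cast Nat.le_of_dvd hn.1 (rc_dvd _ _)
  rw [← Finset.sum_fiberwise_of_maps_to hmaps, GG, Finset.sum_mul]
  refine Finset.sum_le_sum fun k hk => ?_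
  rw [mem_sqc hv0] at hk
  obtain ⟨hk0, hkv, hsq, hc⟩ := hk
  rw [gk_eq k M hk0.ne' hM hc]
  have hs := fn_sum 1 one_pos (k*M)
  simp only [Real.rpow_neg_one] at hs
  have hinj : ∀ n ∈ (Finset.Icc 1 ⌊v⌋₊).filter (fun n => rc M n = k), n / k ∈ Nat.factoredNumbers (k*M).primeFactors ∧ n = k * (n/k) := by
    intro n hn
    rw [Finset.mem_filter, Finset.mem_Icc] at hn
    have hkn : k ∣ n := hn.2 ▸ rc_dvd M n
    have e : n = k * (n/k) := (Nat.mul_div_cancel' hkn).symm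
    refine ⟨?_, e⟩
    rw [Nat.mem_factoredNumbers_iff_primeFactors_subset]
    have h0 : n / k ≠ 0 := by intro h; rw [h, mul_zero] at e; omega
    refine ⟨h0, fun p hp => ?_⟩
    have hpn : p ∈ n.primeFactors := Nat.primeFactors_mono (Nat.div_dvd_of_dvd hkn) (by omega) hp
    rw [Nat.primeFactors_mul hk0.ne' hM, Finset.mem_union]
    by_cases hpM : p ∈ M.primeFactors
    · exact Or.inr hpM
    · left; rw [← hn.2, rc_pf]; exact Finset.mem_sdiff.2 ⟨hpn, hpM⟩
  have := sum_le_hasSum (((Finset.Icc 1 ⌊v⌋₊).filter (fun n => rc M n = k)).attach.image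
    (fun n => (⟨n.1 / k, (hinj n.1 n.2).1⟩ : Nat.factoredNumbers (k*M).primeFactors))) (fun i _ => by positivity) hs
  rw [Finset.sum_image] at this
  · have hk' : (0:ℝ) < k := by exact_mod_cast hk0
    rw [← Finset.sum_attach]
    calc _ = 1/(k:ℝ) * ∑ n ∈ ((Finset.Icc 1 ⌊v⌋₊).filter (fun n => rc M n = k)).attach, (((n.1/k:ℕ):ℝ))⁻¹ := by
          rw [Finset.mul_sum]
          refine Finset.sum_congr rfl fun n _ => ?_
          have e : ((n.1:ℕ):ℝ) = k * ((n.1/k : ℕ):ℝ) := by exact_mod_cast (hinj n.1 n.2).2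
          rw [e, one_div, one_div, mul_inv]
      _ ≤ _ := by gcongr
  · intro a _ b _ hab
    have h : a.1 / k = b.1 / k := congrArg Subtype.val hab
    apply Subtype.ext
    rw [(hinj a.1 a.2).2, (hinj b.1 b.2).2, h]

lemma half_prod (n : ℕ) (hn : n ≠ 0) :
    ∏ p ∈ n.primeFactors, (1 - ((p:ℝ)^(-(1/2:ℝ))))⁻¹ ≤ Real.exp (8 * √(2 * Real.log n)) := by
  have hcard : ∀ k : ℕ, ∀ S : Finset ℕ, S.card = k → (∀ p ∈ S, 1 ≤ p) → ∑ p ∈ S, (p:ℝ)^(-(1/2:ℝ)) ≤ 2 * √k := by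
    intro k
    induction k with
    | zero => intro S hS _; rw [Finset.card_eq_zero] at hS; simp [hS]
    | succ k ih =>
      intro S hS h1
      have hne : S.Nonempty := by rw [← Finset.card_pos]; omega
      have hmax := S.max'_mem hne
      rw [← Finset.add_sum_erase S _ hmax]
      have := ih (S.erase (S.max' hne)) (by rw [Finset.card_erase_of_mem hmax]; omega) (fun p hp => h1 p (Finset.mem_of_mem_erase hp))
      have hk : k + 1 ≤ S.max' hne := by
        have : S ⊆ Finset.Icc 1 (S.max' hne) := fun p hp => Finset.mem_Icc.2 ⟨h1 p hp, S.le_max' p hp⟩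
        have := Finset.card_le_card this
        rw [Nat.card_Icc] at this; omega
      have h2 : ((S.max' hne : ℕ):ℝ)^(-(1/2:ℝ)) ≤ 1 / √(k+1) := by
        rw [Real.rpow_neg (by positivity), ← Real.sqrt_eq_rpow, one_div]
        gcongr
        exact_mod_cast hk
      have h3 : 1 / √((k:ℝ)+1) ≤ 2 * √(k+1) - 2 * √k := by
        have a1 : 0 < √((k:ℝ)+1) := by positivity
        have a2 := Real.sq_sqrt (show (0:ℝ) ≤ k + 1 by positivity)
        have a3 := Real.sq_sqrt (show (0:ℝ) ≤ k by positivity)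
        rw [div_le_iff₀ a1]
        nlinarith [sq_nonneg (√((k:ℝ)+1) - √k)]
      push_cast
      linarith
  have hpt : ∀ p ∈ n.primeFactors, (1 - ((p:ℝ)^(-(1/2:ℝ))))⁻¹ ≤ Real.exp (4 * (p:ℝ)^(-(1/2:ℝ))) := by
    intro p hp
    have hp2 := (Nat.prime_of_mem_primeFactors hp).two_le
    set x := (p:ℝ)^(-(1/2:ℝ)) with hx
    have hx0 : 0 < x := by have : (0:ℝ) < p := by exact_mod_cast (by omega : 0 < p)
                           positivity
    have hx1 : x^2 ≤ 1/2 := by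
      rw [hx, ← Real.rpow_natCast, ← Real.rpow_mul (by positivity)]
      norm_num
      rw [Real.rpow_neg_one]
      have hp2' : (2:ℝ) ≤ p := by exact_mod_cast hp2
      have := inv_anti₀ (by norm_num) hp2'
      linarith
    have hx2 : x ≤ 3/4 := by nlinarith
    have : (1 - x)⁻¹ ≤ 1 + 4 * x := by
      rw [inv_le_iff_one_le_mul₀ (by linarith)]
      nlinarith
    linarith [Real.add_one_le_exp (4*x)]
  refine (Finset.prod_le_prod (fun p hp => ?_) hpt).trans ?_
  · have hp2 := (Nat.prime_of_mem_primeFactors hp).two_le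
    rw [inv_nonneg, sub_nonneg]
    exact Real.rpow_le_one_of_one_le_of_nonpos (by exact_mod_cast (by omega : 1 ≤ p)) (by norm_num)
  rw [← Real.exp_sum, ← Finset.mul_sum]
  apply Real.exp_le_exp.2
  have h1 := hcard _ n.primeFactors rfl (fun p hp => (Nat.prime_of_mem_primeFactors hp).one_lt.le)
  have h2 : ((n.primeFactors.card:ℕ):ℝ) ≤ 2 * Real.log n := by
    have : 2 ^ n.primeFactors.card ≤ n := by
      calc _ ≤ ∏ p ∈ n.primeFactors, p := by
            rw [← Finset.prod_const]
            exact Finset.prod_le_prod' (fun p hp => (Nat.prime_of_mem_primeFactors hp).two_le)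
        _ ≤ n := Nat.le_of_dvd (Nat.pos_of_ne_zero hn) (Nat.prod_primeFactors_dvd n)
    have h3 : ((n.primeFactors.card:ℕ):ℝ) * Real.log 2 ≤ Real.log n := by
      rw [← Real.log_pow]; exact Real.log_le_log (by positivity) (by exact_mod_cast this)
    have := Real.log_two_gt_d9
    have h0 : (0:ℝ) ≤ (n.primeFactors.card:ℕ) := by positivity
    nlinarith
  have h3 := Real.sqrt_le_sqrt h2
  linarith

lemma GG_upper (M : ℕ) (hM : M ≠ 0) (v Δ : ℝ) (hv : 1 ≤ v) (hΔ : 1 ≤ Δ) :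
    GG M v * (M / M.totient) ≤ (1 + Real.log v + Real.log Δ) +
      (1 + Real.log v) * (Δ^(-(1/2:ℝ)) * Real.exp (8 * √(2 * (Real.log v + Real.log M)))) := by
  have hv0 : (0:ℝ) ≤ v := by linarith
  have hΔ0 : (0:ℝ) < Δ := by linarith
  set T := fun k => (Finset.Icc 1 ⌊Δ⌋₊).filter (fun j => j.primeFactors ⊆ (k*M).primeFactors) with hT
  have step : ∀ k ∈ sqc M v, 1 / (k.totient:ℝ) * (M / M.totient) ≤
      ∑ j ∈ T k, 1 / ((k:ℝ) * j) + 1 / k * (Δ^(-(1/2:ℝ)) * Real.exp (8 * √(2 * (Real.log v + Real.log M)))) := by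
    intro k hk
    rw [mem_sqc hv0] at hk
    obtain ⟨hk0, hkv, hsq, hc⟩ := hk
    have hk' : (0:ℝ) < k := by exact_mod_cast hk0
    have hM' : (0:ℝ) < M := by exact_mod_cast Nat.pos_of_ne_zero hM
    rw [gk_eq k M hk0.ne' hM hc]
    have e1 : ∑ j ∈ T k, 1 / ((k:ℝ) * j) = 1 / k * ∑ j ∈ T k, 1 / (j:ℝ) := by
      rw [Finset.mul_sum]; refine Finset.sum_congr rfl fun j _ => ?_
      rw [one_div_mul_one_div]
    rw [e1, ← mul_add]
    gcongr
    have hs := fn_sum 1 one_pos (k*M)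
    have hs2 := (fn_sum (1/2) (by norm_num) (k*M)).mul_left (Δ^(-(1/2:ℝ)))
    simp only [Real.rpow_neg_one] at hs
    classical
    have hfin : HasSum (fun j : Nat.factoredNumbers (k*M).primeFactors => if (j:ℕ) ∈ T k then 1/((j:ℕ):ℝ) else 0)
        (∑ j ∈ T k, 1 / (j:ℝ)) := by
      have hmem : ∀ j ∈ T k, j ∈ Nat.factoredNumbers (k*M).primeFactors := by
        intro j hj
        rw [hT, Finset.mem_filter, Finset.mem_Icc] at hj
        rw [Nat.mem_factoredNumbers_iff_primeFactors_subset]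
        exact ⟨by omega, hj.2⟩
      have := hasSum_sum_of_ne_finset_zero (L := SummationFilter.unconditional _) (f := fun j : Nat.factoredNumbers (k*M).primeFactors => if (j:ℕ) ∈ T k then 1/((j:ℕ):ℝ) else 0)
        (s := (T k).attach.image (fun j => (⟨j.1, hmem j.1 j.2⟩ : Nat.factoredNumbers (k*M).primeFactors))) (by
          intro b hb
          rw [if_neg]
          intro h
          exact hb (Finset.mem_image.2 ⟨⟨b.1, h⟩, Finset.mem_attach _ _, rfl⟩))
      rw [Finset.sum_image] at this
      · rw [← Finset.sum_attach (T k)]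
        convert this using 1
        exact Finset.sum_congr rfl fun j _ => by rw [if_pos j.2]
      · intro a _ b _ hab
        exact Subtype.ext (congrArg (fun z : Nat.factoredNumbers (k*M).primeFactors => (z:ℕ)) hab)
    have hle := hasSum_le (fun j => ?_) hs (hfin.add hs2)
    · refine hle.trans ?_
      gcongr
      refine (half_prod (k*M) (mul_ne_zero hk0.ne' hM)).trans ?_
      gcongr
      rw [Nat.cast_mul, Real.log_mul hk'.ne' hM'.ne']
      gcongr
    · obtain ⟨j, hj⟩ := j
      have hj' := hj
      rw [Nat.mem_factoredNumbers_iff_primeFactors_subset] at hj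
      have hj0 : (0:ℝ) < j := by exact_mod_cast Nat.pos_of_ne_zero hj.1
      simp only
      by_cases h : j ∈ T k
      · rw [if_pos h, one_div]
        have : 0 ≤ Δ^(-(1/2:ℝ)) * (j:ℝ)^(-(1/2:ℝ)) := by positivity
        linarith
      · rw [if_neg h, zero_add]
        have hjD : Δ ≤ j := by
          by_contra hlt
          apply h
          rw [hT, Finset.mem_filter, Finset.mem_Icc, Nat.le_floor_iff hΔ0.le]
          exact ⟨⟨Nat.pos_of_ne_zero hj.1, (not_le.1 hlt).le⟩, hj.2⟩
        have e : (j:ℝ)⁻¹ = (j:ℝ)^(-(1/2:ℝ)) * (j:ℝ)^(-(1/2:ℝ)) := by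
          rw [← Real.rpow_add hj0]; norm_num; rw [Real.rpow_neg_one]
        rw [e]
        gcongr ?_ * _
        exact Real.rpow_le_rpow_of_nonpos hΔ0 hjD (by norm_num)
  have harm : ∀ w : ℝ, 1 ≤ w → ∑ n ∈ Finset.Icc 1 ⌊w⌋₊, 1 / (n:ℝ) ≤ 1 + Real.log w := by
    intro w hw
    have := harmonic_le_one_add_log ⌊w⌋₊
    rw [harmonic_eq_sum_Icc] at this
    push_cast at this
    simp only [one_div]
    have h1 : 1 ≤ ⌊w⌋₊ := (Nat.one_le_floor_iff w).2 hw
    have := Real.log_le_log (by exact_mod_cast h1) (Nat.floor_le (by linarith : (0:ℝ) ≤ w))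
    linarith
  rw [GG, Finset.sum_mul]
  refine (Finset.sum_le_sum step).trans ?_
  rw [Finset.sum_add_distrib, ← Finset.sum_mul]
  gcongr
  · rw [Finset.sum_sigma']
    have hinj : Set.InjOn (fun x : (_ : ℕ) × ℕ => x.1 * x.2) ((sqc M v).sigma T : Finset ((_ : ℕ) × ℕ)) := by
      have hrc : ∀ k j : ℕ, k ∈ sqc M v → j ∈ T k → rc M (k*j) = k := by
        intro k j hk hj
        rw [mem_sqc hv0] at hk
        obtain ⟨hk0, hkv, hsq, hc⟩ := hk
        rw [hT, Finset.mem_filter, Finset.mem_Icc] at hj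
        have : (k*j).primeFactors \ M.primeFactors = k.primeFactors := by
          rw [Nat.primeFactors_mul hk0.ne' (by omega)]
          have d := (Nat.disjoint_primeFactors hk0.ne' hM).2 hc
          have s := hj.2
          rw [Nat.primeFactors_mul hk0.ne' hM] at s
          ext p
          simp only [Finset.mem_sdiff, Finset.mem_union]
          have s' : p ∈ j.primeFactors → p ∈ k.primeFactors ∨ p ∈ M.primeFactors := fun h => Finset.mem_union.1 (s h)
          have d' : p ∈ k.primeFactors → p ∉ M.primeFactors := fun h => Finset.disjoint_left.1 d h
          tauto
        rw [rc, this, Nat.prod_primeFactors_of_squarefree hsq]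
      rintro ⟨k, j⟩ h1 ⟨k', j'⟩ h2 he
      simp only [Finset.coe_sigma, Set.mem_sigma_iff, Finset.mem_coe] at h1 h2
      simp only at he
      have a := hrc k j h1.1 h1.2
      have b := hrc k' j' h2.1 h2.2
      have hkk : k = k' := by rw [← a, ← b, he]
      subst hkk
      have hk0 := ((mem_sqc hv0).1 h1.1).1
      have := Nat.eq_of_mul_eq_mul_left hk0 he
      rw [this]
    have : ∑ x ∈ (sqc M v).sigma T, 1 / ((x.1:ℝ) * x.2) = ∑ n ∈ ((sqc M v).sigma T).image (fun x : (_ : ℕ) × ℕ => x.1 * x.2), 1 / ((n:ℕ):ℝ) := by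
      rw [Finset.sum_image hinj]
      refine Finset.sum_congr rfl fun x _ => by push_cast; rfl
    rw [this]
    have h2 := harm (v*Δ) (by nlinarith)
    rw [Real.log_mul (by positivity) (by positivity)] at h2
    refine le_trans (Finset.sum_le_sum_of_subset_of_nonneg ?_ fun _ _ _ => by positivity) (h2.trans (by linarith))
    intro n hn
    rw [Finset.mem_image] at hn
    obtain ⟨⟨k, j⟩, hkj, rfl⟩ := hn
    rw [Finset.mem_sigma, mem_sqc hv0, hT, Finset.mem_filter, Finset.mem_Icc, Nat.le_floor_iff hΔ0.le] at hkj
    rw [Finset.mem_Icc, Nat.le_floor_iff (by positivity)]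
    have hk := hkj.1.1
    refine ⟨Nat.mul_pos hk hkj.2.1.1, ?_⟩
    push_cast
    exact mul_le_mul hkj.1.2.1 hkj.2.1.2 (by positivity) hv0
  · exact le_trans (Finset.sum_le_sum_of_subset_of_nonneg (Finset.filter_subset _ _) fun _ _ _ => by positivity) (harm v hv)

lemma GG_asymp : ∃ C : ℝ, 0 < C ∧ ∀ᶠ m : ℕ in atTop, ∀ M : ℕ, M ≠ 0 → (M:ℝ) ≤ (m:ℝ)^(20:ℝ) → ∀ v : ℝ, 1 ≤ v → v ≤ (m:ℝ)^(2:ℝ) →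
    Real.log v ≤ GG M v * (M / M.totient) ∧ GG M v * (M / M.totient) ≤ Real.log v + C * √(Real.log m) := by
  refine ⟨204, by norm_num, ?_⟩
  filter_upwards [eventually_ge_atTop 3] with m hm M hM hMm v hv hvm
  refine ⟨GG_lower M hM v hv, ?_⟩
  have hm0 : (0:ℝ) < m := by positivity
  set L := Real.log m with hL
  have hL1 : 1 ≤ L := by
    rw [hL, Real.le_log_iff_exp_le hm0]
    have := Real.exp_one_lt_d9
    have : (3:ℝ) ≤ m := by exact_mod_cast hm
    linarith
  set s := √L with hs
  have hss : s * s = L := Real.mul_self_sqrt (by linarith)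
  have hs1 : 1 ≤ s := by rw [hs]; exact Real.one_le_sqrt.2 hL1
  have h := GG_upper M hM v (Real.exp (200 * s)) hv (Real.one_le_exp (by linarith))
  refine h.trans ?_
  have lv : Real.log v ≤ 2 * L := by
    have := Real.log_le_log (by linarith) hvm
    rwa [Real.log_rpow hm0] at this
  have lM : Real.log M ≤ 20 * L := by
    have := Real.log_le_log (by exact_mod_cast Nat.pos_of_ne_zero hM) hMm
    rwa [Real.log_rpow hm0] at this
  have hsq : √(2 * (Real.log v + Real.log M)) ≤ 7 * s := by
    apply Real.sqrt_le_iff.2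
    constructor
    · positivity
    · nlinarith
  rw [Real.log_exp, ← Real.exp_mul]
  have : (1 + Real.log v) * (Real.exp (200 * s * -(1/2)) * Real.exp (8 * √(2 * (Real.log v + Real.log M)))) ≤ 1 := by
    rw [← Real.exp_add]
    have e1 : Real.exp (200 * s * -(1/2) + 8 * √(2 * (Real.log v + Real.log M))) ≤ Real.exp (-(2*L)/L * (2*s)) := by
      apply Real.exp_le_exp.2
      have : -(2*L)/L = -2 := by field_simp
      rw [this]; linarith
    have e3 : -(2*L)/L * (2*s) = -(4*s) := by field_simp; ring
    rw [e3, Real.exp_neg] at e1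
    have e2 := Real.quadratic_le_exp_of_nonneg (show 0 ≤ 4*s by linarith)
    have e4 : (1 + Real.log v) ≤ Real.exp (4*s) := by nlinarith
    calc _ ≤ Real.exp (4*s) * (Real.exp (4*s))⁻¹ := by
            have : 0 ≤ 1 + Real.log v := by linarith [Real.log_nonneg hv]
            gcongr
      _ = 1 := mul_inv_cancel₀ (Real.exp_pos _).ne'
  linarith
end

section
open Filter Topology

noncomputable def lam (M : ℕ) (R : ℝ) (Y : ℕ → ℝ) (d : ℕ) : ℝ :=
  (ArithmeticFunction.moebius d : ℝ) * d * ∑ r ∈ (sqc M R).filter (fun r => d ∣ r), Y r / r.totient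

noncomputable def fS (M : ℕ) (R : ℝ) (Y : ℕ → ℝ) (n : ℕ) : ℝ :=
  ∑ d ∈ (sqc M R).filter (fun d => d ∣ n), lam M R Y d

noncomputable def hh (k : ℕ) : ℝ := ∏ p ∈ k.primeFactors, (1 - (p:ℝ))

lemma sqc_dvd {M : ℕ} {R : ℝ} (hR : 0 ≤ R) {d r : ℕ} (hr : r ∈ sqc M R) (hd : d ∣ r) : d ∈ sqc M R := by
  rw [mem_sqc hR] at hr ⊢
  refine ⟨Nat.pos_of_dvd_of_pos hd hr.1, le_trans ?_ hr.2.1, hr.2.2.1.squarefree_of_dvd hd, hr.2.2.2.coprime_dvd_left hd⟩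
  exact_mod_cast Nat.le_of_dvd hr.1 hd

lemma hh_eq (k : ℕ) (hk : Squarefree k) : hh k = ∑ d ∈ k.divisors, (ArithmeticFunction.moebius d : ℝ) * d := by
  let f : ArithmeticFunction ℝ := ⟨fun n => (n:ℝ), by simp⟩
  have hf : f.IsMultiplicative := by
    rw [ArithmeticFunction.IsMultiplicative.iff_ne_zero]
    refine ⟨by simp [f], fun {m n} _ _ _ => by simp [f]⟩
  have := ArithmeticFunction.IsMultiplicative.prodPrimeFactors_one_sub_of_squarefree f hf hk
  simpa [hh, f] using this

lemma fS_eq (M : ℕ) (R : ℝ) (hR : 0 ≤ R) (Y : ℕ → ℝ) (n : ℕ) :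
    fS M R Y n = ∑ r ∈ sqc M R, Y r / r.totient * hh (Nat.gcd n r) := by
  unfold fS lam
  have e1 : ∀ r ∈ sqc M R, Y r / r.totient * hh (Nat.gcd n r) =
      ∑ d ∈ sqc M R, if d ∣ n ∧ d ∣ r then (ArithmeticFunction.moebius d : ℝ) * d * (Y r / r.totient) else 0 := by
    intro r hr
    have hr' := (mem_sqc hR).1 hr
    rw [hh_eq _ (hr'.2.2.1.squarefree_of_dvd (Nat.gcd_dvd_right n r)), Finset.mul_sum, ← Finset.sum_filter]
    have : (Nat.gcd n r).divisors = (sqc M R).filter (fun d => d ∣ n ∧ d ∣ r) := by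
      ext d
      rw [Nat.mem_divisors, Finset.mem_filter, Nat.dvd_gcd_iff]
      constructor
      · rintro ⟨h, _⟩; exact ⟨sqc_dvd hR hr h.2, h⟩
      · rintro ⟨_, h⟩; exact ⟨h, (Nat.gcd_pos_of_pos_right n hr'.1).ne'⟩
    rw [this]
    exact Finset.sum_congr rfl fun d _ => by ring
  rw [Finset.sum_congr rfl e1, Finset.sum_comm, Finset.sum_filter]
  refine Finset.sum_congr rfl fun d _ => ?_
  split_ifs with h
  · rw [Finset.mul_sum, Finset.sum_filter]
    exact Finset.sum_congr rfl fun r _ => by simp [h]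
  · simp [h]

lemma lam_sum (M : ℕ) (R : ℝ) (hR : 0 ≤ R) (Y : ℕ → ℝ) (k : ℕ) (hk : k ∈ sqc M R) :
    ∑ d ∈ (sqc M R).filter (fun d => k ∣ d), lam M R Y d / d = (ArithmeticFunction.moebius k : ℝ) * Y k / k.totient := by
  have hk' := (mem_sqc hR).1 hk
  have e0 : ∀ d ∈ (sqc M R).filter (fun d => k ∣ d), lam M R Y d / d =
      ∑ r ∈ sqc M R, if d ∣ r then (ArithmeticFunction.moebius d : ℝ) * (Y r / r.totient) else 0 := by
    intro d hd
    have hd' := (mem_sqc hR).1 (Finset.mem_filter.1 hd).1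
    have : (d:ℝ) ≠ 0 := by exact_mod_cast hd'.1.ne'
    rw [← Finset.sum_filter, ← Finset.mul_sum, lam]
    field_simp
  rw [Finset.sum_congr rfl e0, Finset.sum_comm]
  have e1 : ∀ r ∈ sqc M R, (∑ d ∈ (sqc M R).filter (fun d => k ∣ d), if d ∣ r then (ArithmeticFunction.moebius d : ℝ) * (Y r / r.totient) else 0)
      = if r = k then (ArithmeticFunction.moebius k : ℝ) * (Y k / k.totient) else 0 := by
    intro r hr
    have hr' := (mem_sqc hR).1 hr
    rw [← Finset.sum_filter, ← Finset.sum_mul]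
    by_cases hkr : k ∣ r
    · obtain ⟨s, rfl⟩ := hkr
      have hs0 : s ≠ 0 := by rintro rfl; simp at hr'
      have hks : k.Coprime s := Nat.coprime_of_squarefree_mul hr'.2.2.1
      have : ((sqc M R).filter (fun d => k ∣ d)).filter (fun d => d ∣ k * s) = s.divisors.image (fun t => k * t) := by
        ext d
        simp only [Finset.mem_filter, Finset.mem_image, Nat.mem_divisors]
        constructor
        · rintro ⟨⟨_, t, rfl⟩, h2⟩
          exact ⟨t, ⟨Nat.dvd_of_mul_dvd_mul_left hk'.1 h2, hs0⟩, rfl⟩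
        · rintro ⟨t, ⟨ht, _⟩, rfl⟩
          exact ⟨⟨sqc_dvd hR hr (Nat.mul_dvd_mul_left k ht), Dvd.intro _ rfl⟩, Nat.mul_dvd_mul_left k ht⟩
      rw [this, Finset.sum_image (fun a _ b _ h => Nat.eq_of_mul_eq_mul_left hk'.1 h)]
      have e2 : ∀ t ∈ s.divisors, (ArithmeticFunction.moebius (k*t) : ℝ) = (ArithmeticFunction.moebius k : ℝ) * (ArithmeticFunction.moebius t : ℝ) := by
        intro t ht
        rw [ArithmeticFunction.isMultiplicative_moebius.map_mul_of_coprime (hks.coprime_dvd_right (Nat.dvd_of_mem_divisors ht))]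
        push_cast; rfl
      rw [Finset.sum_congr rfl e2, ← Finset.mul_sum]
      have e3 : ∑ t ∈ s.divisors, (ArithmeticFunction.moebius t : ℝ) = if s = 1 then 1 else 0 := by
        have := congrArg (fun f => f s) ArithmeticFunction.moebius_mul_coe_zeta
        simp only [ArithmeticFunction.coe_mul_zeta_apply, ArithmeticFunction.one_apply] at this
        exact_mod_cast this
      rw [e3]
      by_cases h1 : s = 1
      · subst h1; simp
      · have : k * s ≠ k := by
          intro h; apply h1
          exact Nat.eq_of_mul_eq_mul_left hk'.1 (by rw [h, mul_one])
        simp [h1, this]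
    · have : ((sqc M R).filter (fun d => k ∣ d)).filter (fun d => d ∣ r) = ∅ := by
        rw [Finset.filter_eq_empty_iff]
        intro d hd h
        exact hkr ((Finset.mem_filter.1 hd).2.trans h)
      rw [this, if_neg (by rintro rfl; exact hkr dvd_rfl)]; simp
  rw [Finset.sum_congr rfl e1, Finset.sum_ite_eq' , if_pos hk, mul_div_assoc]

lemma Z_eq (M : ℕ) (R : ℝ) (hR : 0 ≤ R) (Y : ℕ → ℝ) :
    ∑ d ∈ sqc M R, ∑ e ∈ sqc M R, lam M R Y d * lam M R Y e / (Nat.lcm d e : ℝ) =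
      ∑ k ∈ sqc M R, Y k ^ 2 / k.totient := by
  have e1 : ∀ d ∈ sqc M R, ∀ e ∈ sqc M R, lam M R Y d * lam M R Y e / (Nat.lcm d e : ℝ) =
      ∑ k ∈ sqc M R, (k.totient:ℝ) * ((if k ∣ d then lam M R Y d / d else 0) * (if k ∣ e then lam M R Y e / e else 0)) := by
    intro d hd e he
    have hd' := (mem_sqc hR).1 hd
    have he' := (mem_sqc hR).1 he
    have h1 : (d:ℝ) ≠ 0 := by exact_mod_cast hd'.1.ne'
    have h2 : (e:ℝ) ≠ 0 := by exact_mod_cast he'.1.ne'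
    have hg : (Nat.gcd d e : ℝ) = ∑ k ∈ (sqc M R).filter (fun k => k ∣ d ∧ k ∣ e), (k.totient:ℝ) := by
      have := Nat.sum_totient (Nat.gcd d e)
      rw [← this]
      push_cast
      refine Finset.sum_congr ?_ fun _ _ => rfl
      ext k
      rw [Nat.mem_divisors, Finset.mem_filter, Nat.dvd_gcd_iff]
      constructor
      · rintro ⟨h, _⟩; exact ⟨sqc_dvd hR hd h.1, h⟩
      · rintro ⟨_, h⟩; exact ⟨h, (Nat.gcd_pos_of_pos_right d he'.1).ne'⟩
    have hl : (Nat.gcd d e : ℝ) * (Nat.lcm d e : ℝ) = d * e := by exact_mod_cast Nat.gcd_mul_lcm d e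
    have hl0 : (Nat.lcm d e : ℝ) ≠ 0 := by exact_mod_cast (Nat.lcm_pos hd'.1 he'.1).ne'
    have : lam M R Y d * lam M R Y e / (Nat.lcm d e : ℝ) = (Nat.gcd d e : ℝ) * (lam M R Y d / d * (lam M R Y e / e)) := by
      field_simp
      linear_combination (-lam M R Y d * lam M R Y e) * hl
    rw [this, hg, Finset.sum_mul, Finset.sum_filter]
    refine Finset.sum_congr rfl fun k _ => ?_
    by_cases a : k ∣ d <;> by_cases b : k ∣ e <;> simp [a, b]
  rw [Finset.sum_congr rfl fun d hd => Finset.sum_congr rfl fun e he => e1 d hd e he]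
  have e2 : ∀ d ∈ sqc M R, (∑ e ∈ sqc M R, ∑ k ∈ sqc M R, (k.totient:ℝ) * ((if k ∣ d then lam M R Y d / d else 0) * (if k ∣ e then lam M R Y e / e else 0)))
     = ∑ k ∈ sqc M R, ∑ e ∈ sqc M R, (k.totient:ℝ) * ((if k ∣ d then lam M R Y d / d else 0) * (if k ∣ e then lam M R Y e / e else 0)) :=
    fun d _ => Finset.sum_comm
  rw [Finset.sum_congr rfl e2, Finset.sum_comm]
  refine Finset.sum_congr rfl fun k hk => ?_
  have hk' := (mem_sqc hR).1 hk
  have e3 := lam_sum M R hR Y k hk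
  rw [Finset.sum_filter] at e3
  simp_rw [← Finset.mul_sum, ← Finset.sum_mul]
  rw [e3]
  have hp : (k.totient:ℝ) ≠ 0 := by exact_mod_cast (Nat.totient_pos.2 hk'.1).ne'
  have hmu : (ArithmeticFunction.moebius k : ℝ)^2 = 1 := by
    have := ArithmeticFunction.moebius_sq_eq_one_of_squarefree hk'.2.2.1
    exact_mod_cast this
  field_simp
  linear_combination (Y k)^2 * hmu

lemma fS_step (M : ℕ) (R : ℝ) (hR : 0 ≤ R) (Y : ℕ → ℝ) (hY : ∀ r : ℕ, R < r → Y r = 0) (q n : ℕ) (hq : q.Prime)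
    (hqM : ¬ q ∣ M) (hqn : q ∣ n) :
    fS M R Y n = fS (M*q) R (fun r => Y r - Y (r*q)) n := by
  rw [fS_eq M R hR, fS_eq (M*q) R hR]
  have hq0 : (0:ℝ) < q := by exact_mod_cast hq.pos
  have hS1 : (sqc M R).filter (fun r => ¬ q ∣ r) = sqc (M*q) R := by
    ext r
    rw [Finset.mem_filter, mem_sqc hR, mem_sqc hR, Nat.coprime_mul_iff_right, Nat.coprime_comm (n := r) (m := q), hq.coprime_iff_not_dvd]
    tauto
  have hS2 : (sqc M R).filter (fun r => q ∣ r) = ((sqc (M*q) R).filter (fun r => ((r*q:ℕ):ℝ) ≤ R)).image (fun r => r * q) := by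
    ext r
    rw [Finset.mem_filter, Finset.mem_image, mem_sqc hR]
    constructor
    · rintro ⟨⟨h0, h1, h2, h3⟩, s, rfl⟩
      have hc := Nat.coprime_of_squarefree_mul h2
      have hs0 : 0 < s := Nat.pos_of_mul_pos_left h0
      refine ⟨s, ?_, mul_comm _ _⟩
      rw [Finset.mem_filter, mem_sqc hR, mul_comm s q]
      refine ⟨⟨hs0, le_trans ?_ h1, h2.squarefree_of_dvd (Dvd.intro_left _ rfl), ?_⟩, h1⟩
      · exact_mod_cast Nat.le_mul_of_pos_left s hq.pos
      · exact Nat.Coprime.mul_right (h3.coprime_dvd_left (Dvd.intro_left _ rfl)) hc.symm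
    · rintro ⟨s, hs, rfl⟩
      rw [Finset.mem_filter, mem_sqc hR, Nat.coprime_mul_iff_right] at hs
      obtain ⟨⟨h0, h1, h2, h3, h4⟩, h5⟩ := hs
      refine ⟨⟨Nat.mul_pos h0 hq.pos, h5, ?_, ?_⟩, Dvd.intro_left _ rfl⟩
      · exact (Nat.squarefree_mul h4).2 ⟨h2, hq.prime.squarefree⟩
      · exact Nat.Coprime.mul_left h3 ((hq.coprime_iff_not_dvd).2 hqM)
  rw [← Finset.sum_filter_add_sum_filter_not (sqc M R) (fun r => q ∣ r), hS1, hS2,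
    Finset.sum_image (fun a _ b _ h => Nat.eq_of_mul_eq_mul_right hq.pos h), Finset.sum_filter, ← Finset.sum_add_distrib]
  refine Finset.sum_congr rfl fun r hr => ?_
  rw [mem_sqc hR, Nat.coprime_mul_iff_right] at hr
  obtain ⟨h0, h1, h2, h3, h4⟩ := hr
  have hp : (r.totient:ℝ) ≠ 0 := by exact_mod_cast (Nat.totient_pos.2 h0).ne'
  have hq1 : ((q:ℝ) - 1) ≠ 0 := by have : (1:ℝ) < q := by exact_mod_cast hq.one_lt
                                   linarith
  have hgcd : hh (Nat.gcd n (r*q)) = (1 - (q:ℝ)) * hh (Nat.gcd n r) := by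
    have : Nat.gcd n (r*q) = Nat.gcd n r * q := by
      rw [Nat.Coprime.gcd_mul n h4, Nat.gcd_eq_right hqn]
    rw [this, hh, hh, Nat.primeFactors_mul (Nat.gcd_pos_of_pos_right n h0).ne' hq.ne_zero, hq.primeFactors,
      Finset.prod_union, Finset.prod_singleton, mul_comm]
    rw [Finset.disjoint_singleton_right]
    intro h
    have := (Nat.dvd_of_mem_primeFactors h).trans (Nat.gcd_dvd_right n r)
    exact (hq.coprime_iff_not_dvd.1 h4.symm) this
  have htot : ((r*q).totient:ℝ) = r.totient * (q - 1) := by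
    rw [Nat.totient_mul h4, Nat.totient_prime hq, Nat.cast_mul, Nat.cast_sub hq.one_lt.le, Nat.cast_one]
  split_ifs with h
  · rw [hgcd, htot]; field_simp; ring
  · have hz : Y (r*q) = 0 := hY _ (not_le.1 h)
    rw [hz]; ring

lemma inv_tot_le (r : ℕ) (hr : r ≠ 0) : 1 / (r.totient:ℝ) ≤ r.divisors.card / r := by
  have h := tot_prod r hr
  have hr0 : (0:ℝ) < r := by exact_mod_cast Nat.pos_of_ne_zero hr
  have : (r:ℝ) / r.totient ≤ r.divisors.card := by
    rw [h, Nat.card_divisors hr]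
    push_cast
    refine Finset.prod_le_prod (fun p hp => ?_) (fun p hp => ?_)
    · have : (1:ℝ) ≤ p := by exact_mod_cast (Nat.prime_of_mem_primeFactors hp).one_lt.le
      rw [inv_nonneg, sub_nonneg]; exact inv_le_one_of_one_le₀ this
    · have hp' := Nat.prime_of_mem_primeFactors hp
      have h2 : (2:ℝ) ≤ p := by exact_mod_cast hp'.two_le
      have h3 : 1 ≤ r.factorization p := (hp'.dvd_iff_one_le_factorization hr).1 (Nat.dvd_of_mem_primeFactors hp)
      have h3' : (1:ℝ) ≤ r.factorization p := by exact_mod_cast h3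
      have h4 : (p:ℝ)⁻¹ ≤ 1/2 := by rw [one_div]; exact inv_anti₀ (by norm_num) h2
      have h5 : (1 - (p:ℝ)⁻¹)⁻¹ ≤ 2 := by
        rw [inv_le_iff_one_le_mul₀ (by linarith)]; linarith
      linarith
  rw [le_div_iff₀ hr0]
  calc _ = (r:ℝ) / r.totient := by ring
    _ ≤ _ := this

lemma ev_lam (κ : ℝ) (hκ : 0 < κ) : ∀ᶠ m : ℕ in atTop, ∀ (M : ℕ) (R : ℝ) (Y : ℕ → ℝ), 0 ≤ R → R ≤ m → (∀ r, |Y r| ≤ 4) →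
    ∀ d : ℕ, 0 < d → |lam M R Y d| ≤ (m:ℝ)^κ := by
  filter_upwards [ev_div (κ/3) (by positivity) 1, ev_rec (κ/3) (by positivity) 1, ev_const_le 4 (κ/3) (by positivity), eventually_ge_atTop 2] with m h1 h2 h3 hm M R Y hR hRm hY d hd
  have hd0 : (0:ℝ) < d := by exact_mod_cast hd
  have hA : 0 < (m:ℝ)^(κ/3) := rp_pos hm _
  set A := (m:ℝ)^(κ/3) with hAdef
  have e : (m:ℝ)^κ = A * A * A := by rw [← rp_add hm, ← rp_add hm]; congr 1; ring
  rw [lam, abs_mul, abs_mul, Nat.abs_cast]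
  have hmu : |(ArithmeticFunction.moebius d : ℝ)| ≤ 1 := by
    have := ArithmeticFunction.abs_moebius_le_one (n := d)
    exact_mod_cast this
  set T := (sqc M R).filter (fun r => d ∣ r) with hT
  have hTm : ∀ r ∈ T, 0 < r ∧ (r:ℝ) ≤ m ∧ d ∣ r := by
    intro r hr
    rw [hT, Finset.mem_filter, mem_sqc hR] at hr
    exact ⟨hr.1.1, hr.1.2.1.trans hRm, hr.2⟩
  have hb : ∀ r ∈ T, |Y r / r.totient| ≤ A * A * (1 / (r:ℝ)) := by
    intro r hr
    obtain ⟨a, b, c⟩ := hTm r hr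
    rw [abs_div, Nat.abs_cast, div_eq_mul_one_div]
    have t := inv_tot_le r a.ne'
    have t2 : (r.divisors.card:ℝ) ≤ A := h1 r a.ne' (by simpa using b)
    have hr0 : (0:ℝ) < r := by exact_mod_cast a
    calc |Y r| * (1 / (r.totient:ℝ)) ≤ A * (A / r) := by
          apply mul_le_mul ((hY r).trans h3) (t.trans (by gcongr)) (by positivity) hA.le
      _ = _ := by ring
  have hs : |∑ r ∈ T, Y r / r.totient| ≤ A * A * (A / d) := by
    refine (Finset.abs_sum_le_sum_abs _ _).trans ((Finset.sum_le_sum hb).trans ?_)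
    rw [← Finset.mul_sum]
    gcongr
    have hinj : Set.InjOn (fun r => r / d) (T : Set ℕ) := by
      intro a ha b hb hab
      have h1 := (hTm a ha).2.2
      have h2 := (hTm b hb).2.2
      simp only at hab
      rw [← Nat.div_mul_cancel h1, ← Nat.div_mul_cancel h2, hab]
    have := h2 (T.image (fun r => r / d)) (by
      intro k hk
      obtain ⟨r, hr, rfl⟩ := Finset.mem_image.1 hk
      obtain ⟨a, b, c⟩ := hTm r hr
      refine ⟨Nat.div_pos (Nat.le_of_dvd a c) hd, ?_⟩
      simp only [Nat.cast_one, Real.rpow_one, pow_one]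
      exact le_trans (by exact_mod_cast Nat.div_le_self r d) b)
    rw [Finset.sum_image hinj] at this
    rw [le_div_iff₀ hd0, Finset.sum_mul]
    refine le_trans (le_of_eq (Finset.sum_congr rfl fun r hr => ?_)) this
    obtain ⟨a, b, c⟩ := hTm r hr
    rw [Nat.cast_div c hd0.ne']
    field_simp
  rw [e]
  calc _ ≤ 1 * d * (A * A * (A / d)) := by gcongr
    _ = _ := by field_simp

lemma ev_fS (κ : ℝ) (hκ : 0 < κ) : ∀ᶠ m : ℕ in atTop, ∀ (M : ℕ) (R : ℝ) (Y : ℕ → ℝ), 0 ≤ R → R ≤ m → (∀ r, |Y r| ≤ 4) →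
    ∀ n : ℕ, 0 < n → (n:ℝ) ≤ (m:ℝ)^3 → |fS M R Y n| ≤ (m:ℝ)^κ := by
  filter_upwards [ev_div (κ/2) (by positivity) 3, ev_lam (κ/2) (by positivity), eventually_ge_atTop 2] with m h1 h2 hm M R Y hR hRm hY n hn hnm
  have e : (m:ℝ)^κ = (m:ℝ)^(κ/2) * (m:ℝ)^(κ/2) := by rw [← rp_add hm]; congr 1; ring
  rw [fS, e]
  refine (Finset.abs_sum_le_sum_abs _ _).trans ?_
  refine (Finset.sum_le_card_nsmul _ _ ((m:ℝ)^(κ/2)) fun d hd => ?_).trans ?_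
  · have := (mem_sqc hR).1 (Finset.mem_filter.1 hd).1
    exact h2 M R Y hR hRm hY d this.1
  · rw [nsmul_eq_mul]
    gcongr
    refine le_trans ?_ (h1 n hn.ne' (by exact_mod_cast hnm))
    norm_cast
    apply Finset.card_le_card
    intro d hd
    rw [Nat.mem_divisors]; exact ⟨(Finset.mem_filter.1 hd).2, hn.ne'⟩
end

section
open Filter Topology

/-- level of distribution property for the weight u -/
def LevX (X : ℝ) (m : ℕ) (κ dd : ℝ) (I : Finset ℕ) (u : ℕ → ℝ) : Prop :=
  ∀ (DD : Finset ℕ) (cd : ℕ → ℝ), (∀ d ∈ DD, d.Coprime m ∧ 0 < d ∧ (d:ℝ) ≤ (m:ℝ)^dd ∧ |cd d| ≤ (m:ℝ)^κ) →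
    |∑ n ∈ I, u n * (∑ d ∈ DD.filter (fun d => d ∣ n), cd d) - X * ∑ d ∈ DD, cd d / d| ≤ (m:ℝ)^(-(κ/2))

lemma Lev_fam {X : ℝ} {m : ℕ} {κ dd : ℝ} {I : Finset ℕ} {u : ℕ → ℝ} (h : LevX X m κ dd I u) {ι : Type*} [DecidableEq ι]
    (T : Finset ι) (D : ι → ℕ) (c : ι → ℝ) (h1 : ∀ i ∈ T, (D i).Coprime m ∧ 0 < D i ∧ (D i : ℝ) ≤ (m:ℝ)^dd)
    (h2 : ∀ d ∈ T.image D, ∑ i ∈ T.filter (fun i => D i = d), |c i| ≤ (m:ℝ)^κ) :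
    |∑ n ∈ I, u n * (∑ i ∈ T, if D i ∣ n then c i else 0) - X * ∑ i ∈ T, c i / D i| ≤ (m:ℝ)^(-(κ/2)) := by
  have := h (T.image D) (fun d => ∑ i ∈ T.filter (fun i => D i = d), c i) (by
    intro d hd
    obtain ⟨i, hi, rfl⟩ := Finset.mem_image.1 hd
    refine ⟨(h1 i hi).1, (h1 i hi).2.1, (h1 i hi).2.2, ?_⟩
    exact (Finset.abs_sum_le_sum_abs _ _).trans (h2 _ hd))
  have hm : ∀ i ∈ T, D i ∈ T.image D := fun i hi => Finset.mem_image_of_mem D hi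
  convert this using 3
  · refine Finset.sum_congr rfl fun n _ => ?_
    congr 1
    rw [Finset.sum_filter, ← Finset.sum_fiberwise_of_maps_to hm]
    refine Finset.sum_congr rfl fun d _ => ?_
    split_ifs with hd
    · refine Finset.sum_congr rfl fun i hi => ?_
      rw [(Finset.mem_filter.1 hi).2, if_pos hd]
    · refine Finset.sum_eq_zero fun i hi => ?_
      rw [(Finset.mem_filter.1 hi).2, if_neg hd]
  · congr 1
    rw [← Finset.sum_fiberwise_of_maps_to hm]
    refine Finset.sum_congr rfl fun d _ => ?_
    rw [Finset.sum_div]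
    refine Finset.sum_congr rfl fun i hi => ?_
    rw [(Finset.mem_filter.1 hi).2]

lemma QFam (κ : ℝ) (hκ : 0 < κ) : ∀ᶠ m : ℕ in atTop, ∀ (X dd : ℝ) (I : Finset ℕ) (u : ℕ → ℝ), dd ≤ 3 → LevX X m κ dd I u →
    ∀ (Q : Finset ℕ) (D0 : ℕ → ℕ) (w : ℕ → ℝ) (S : ℕ → Finset ℕ) (l : ℕ → ℕ → ℝ),
      (Set.InjOn D0 (Q : Set ℕ)) → (∀ q ∈ Q, 0 < D0 q ∧ (D0 q).Coprime m ∧ |w q| ≤ 1) →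
      (∀ q ∈ Q, ∀ d ∈ S q, 0 < d ∧ d.Coprime (m * D0 q) ∧ |l q d| ≤ (m:ℝ)^(κ/5)) →
      (∀ q ∈ Q, ∀ d ∈ S q, ∀ e ∈ S q, (D0 q : ℝ) * (d * e) ≤ (m:ℝ)^dd) →
      |∑ n ∈ I, u n * (∑ q ∈ Q, if D0 q ∣ n then w q * (∑ d ∈ (S q).filter (fun d => d ∣ n), l q d)^2 else 0) -
        X * ∑ q ∈ Q, w q / D0 q * (∑ d ∈ S q, ∑ e ∈ S q, l q d * l q e / (Nat.lcm d e : ℝ))| ≤ (m:ℝ)^(-(κ/2)) := by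
  filter_upwards [ev_div (κ/5) (by positivity) 3, eventually_ge_atTop 2] with m hdiv hm X dd I u hdd hL Q D0 w S l hinj hQ hS hlev
  classical
  set T : Finset (ℕ × ℕ × ℕ) := Q.biUnion (fun q => ((S q) ×ˢ (S q)).image (fun x => (q, x))) with hT
  have hTs : ∀ F : ℕ × ℕ × ℕ → ℝ, ∑ i ∈ T, F i = ∑ q ∈ Q, ∑ d ∈ S q, ∑ e ∈ S q, F (q, d, e) := by
    intro F
    rw [hT, Finset.sum_biUnion]
    · refine Finset.sum_congr rfl fun q _ => ?_
      rw [Finset.sum_image (fun a _ b _ h => (Prod.mk.inj h).2), Finset.sum_product]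
    · intro q _ q' _ hne
      rw [Function.onFun, Finset.disjoint_left]
      intro x hx hx'
      obtain ⟨y, _, rfl⟩ := Finset.mem_image.1 hx
      obtain ⟨z, _, h⟩ := Finset.mem_image.1 hx'
      exact hne (Prod.mk.inj h).1.symm
  have hTm : ∀ i ∈ T, i.1 ∈ Q ∧ i.2.1 ∈ S i.1 ∧ i.2.2 ∈ S i.1 := by
    intro i hi
    rw [hT, Finset.mem_biUnion] at hi
    obtain ⟨q, hq, hi⟩ := hi
    obtain ⟨y, hy, rfl⟩ := Finset.mem_image.1 hi
    exact ⟨hq, Finset.mem_product.1 hy⟩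
  have h1 : ∀ i ∈ T, (D0 i.1 * Nat.lcm i.2.1 i.2.2).Coprime m ∧ 0 < D0 i.1 * Nat.lcm i.2.1 i.2.2 ∧
      ((D0 i.1 * Nat.lcm i.2.1 i.2.2 : ℕ) : ℝ) ≤ (m:ℝ)^dd := by
    intro i hi
    obtain ⟨a, b, c⟩ := hTm i hi
    have b' := hS _ a _ b
    have c' := hS _ a _ c
    have hle : Nat.lcm i.2.1 i.2.2 ≤ i.2.1 * i.2.2 := Nat.le_of_dvd (Nat.mul_pos b'.1 c'.1) (Nat.lcm_dvd_mul _ _)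
    refine ⟨?_, Nat.mul_pos (hQ _ a).1 (Nat.lcm_pos b'.1 c'.1), le_trans ?_ (hlev _ a _ b _ c)⟩
    · refine Nat.Coprime.mul_left (hQ _ a).2.1 ?_
      refine Nat.Coprime.coprime_dvd_left (Nat.lcm_dvd_mul _ _) ?_
      exact Nat.Coprime.mul_left (b'.2.1.coprime_dvd_right (Dvd.intro _ rfl)) (c'.2.1.coprime_dvd_right (Dvd.intro _ rfl))
    · push_cast
      gcongr
      exact_mod_cast hle
  have hA : 0 < (m:ℝ)^(κ/5) := rp_pos hm _
  set A := (m:ℝ)^(κ/5) with hAdef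
  have hAe : (m:ℝ)^κ = A * A * A * (A * A) := by
    simp only [hAdef, ← rp_add hm]; congr 1; ring
  have := Lev_fam hL T (fun i => D0 i.1 * Nat.lcm i.2.1 i.2.2) (fun i => w i.1 * (l i.1 i.2.1 * l i.1 i.2.2)) h1 (by
    intro D hD
    obtain ⟨i0, hi0, rfl⟩ := Finset.mem_image.1 hD
    set D := D0 i0.1 * Nat.lcm i0.2.1 i0.2.2 with hDd
    obtain ⟨_, hD0, hDm⟩ := h1 i0 hi0
    have hτ : (D.divisors.card:ℝ) ≤ A := hdiv D hD0.ne' (hDm.trans (rp_mono hm hdd))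
    have hb : ∀ i ∈ T.filter (fun i => D0 i.1 * Nat.lcm i.2.1 i.2.2 = D), |w i.1 * (l i.1 i.2.1 * l i.1 i.2.2)| ≤ A * A := by
      intro i hi
      obtain ⟨a, b, c⟩ := hTm i (Finset.mem_filter.1 hi).1
      rw [abs_mul, abs_mul]
      calc _ ≤ 1 * (A * A) := by
            refine mul_le_mul (hQ _ a).2.2 (mul_le_mul (hS _ a _ b).2.2 (hS _ a _ c).2.2 (abs_nonneg _) hA.le) (by positivity) (by norm_num)
        _ = _ := one_mul _
    refine (Finset.sum_le_card_nsmul _ _ _ hb).trans ?_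
    rw [nsmul_eq_mul, hAe]
    gcongr
    have hc : (T.filter (fun i => D0 i.1 * Nat.lcm i.2.1 i.2.2 = D)).card ≤ (D.divisors ×ˢ (D.divisors ×ˢ D.divisors)).card := by
      apply Finset.card_le_card_of_injOn (fun i => (D0 i.1, i.2.1, i.2.2))
      · intro i hi
        rw [Finset.mem_coe, Finset.mem_filter] at hi
        simp only [Finset.coe_product, Set.mem_prod, Finset.mem_coe, Nat.mem_divisors]
        have e := hi.2
        refine ⟨⟨⟨_, e.symm⟩, hD0.ne'⟩, ⟨?_, hD0.ne'⟩, ⟨?_, hD0.ne'⟩⟩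
        · rw [← e]; exact (Nat.dvd_lcm_left _ _).trans (Dvd.intro_left _ rfl)
        · rw [← e]; exact (Nat.dvd_lcm_right _ _).trans (Dvd.intro_left _ rfl)
      · intro i hi j hj hij
        rw [Finset.mem_coe, Finset.mem_filter] at hi hj
        simp only [Prod.mk.injEq] at hij
        have := hinj (hTm i hi.1).1 (hTm j hj.1).1 hij.1
        exact Prod.ext this (Prod.ext hij.2.1 hij.2.2)
    rw [Finset.card_product, Finset.card_product] at hc
    calc ((T.filter (fun i => D0 i.1 * Nat.lcm i.2.1 i.2.2 = D)).card:ℝ) ≤ (D.divisors.card:ℝ) * (D.divisors.card * D.divisors.card) := by exact_mod_cast hc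
      _ ≤ A * (A * A) := by gcongr
      _ = _ := by ring)
  convert this using 3
  · refine Finset.sum_congr rfl fun n _ => ?_
    congr 1
    rw [hTs]
    refine Finset.sum_congr rfl fun q hq => ?_
    have hcop : ∀ d ∈ S q, ∀ e ∈ S q, (D0 q).Coprime (Nat.lcm d e) := by
      intro d hd e he
      have b' := hS _ hq _ hd
      have c' := hS _ hq _ he
      refine Nat.Coprime.coprime_dvd_right (Nat.lcm_dvd_mul _ _) ?_
      exact Nat.Coprime.mul_right (b'.2.1.coprime_dvd_right (Dvd.intro_left _ rfl)).symm (c'.2.1.coprime_dvd_right (Dvd.intro_left _ rfl)).symm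
    rw [sq, Finset.sum_mul_sum, Finset.sum_filter]
    split_ifs with h0
    · rw [Finset.mul_sum]
      refine Finset.sum_congr rfl fun d hd => ?_
      simp only
      by_cases hdn : d ∣ n
      · rw [if_pos hdn, Finset.sum_filter, Finset.mul_sum]
        refine Finset.sum_congr rfl fun e he => ?_
        have : (D0 q * Nat.lcm d e ∣ n) ↔ e ∣ n := by
          constructor
          · intro h; exact ((Nat.dvd_lcm_right d e).trans (Dvd.intro_left _ rfl)).trans h
          · intro h; exact (hcop d hd e he).mul_dvd_of_dvd_of_dvd h0 (Nat.lcm_dvd hdn h)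
        simp only [this]
        split_ifs <;> simp
      · rw [if_neg hdn, mul_zero]
        symm
        refine Finset.sum_eq_zero fun e he => ?_
        rw [if_neg]
        intro h
        exact hdn (((Nat.dvd_lcm_left d e).trans (Dvd.intro_left _ rfl)).trans h)
    · symm
      refine Finset.sum_eq_zero fun d hd => Finset.sum_eq_zero fun e he => ?_
      rw [if_neg]
      intro h
      exact h0 ((Dvd.intro _ rfl).trans h)
  · congr 1
    rw [hTs]
    refine Finset.sum_congr rfl fun q hq => ?_
    rw [Finset.mul_sum]
    refine Finset.sum_congr rfl fun d hd => ?_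
    rw [Finset.mul_sum]
    refine Finset.sum_congr rfl fun e he => ?_
    simp only [Nat.cast_mul]
    rw [div_mul_div_comm]

/-- Y restricted below R -/
noncomputable def Yq (Y : ℕ → ℝ) (q : ℕ) : ℕ → ℝ := fun r => Y r - Y (r*q)

/-- evaluation of the plain quadratic form -/
lemma Qzero (κ : ℝ) (hκ : 0 < κ) : ∀ᶠ m : ℕ in atTop, ∀ (X dd : ℝ) (I : Finset ℕ) (u : ℕ → ℝ), dd ≤ 3 → LevX X m κ dd I u →
    ∀ (R : ℝ) (Y : ℕ → ℝ), 0 ≤ R → R ≤ m → R * R ≤ (m:ℝ)^dd → (∀ r, |Y r| ≤ 2) →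
    |∑ n ∈ I, u n * (fS m R Y n)^2 - X * ∑ k ∈ sqc m R, Y k ^ 2 / k.totient| ≤ (m:ℝ)^(-(κ/2)) := by
  filter_upwards [QFam κ hκ, ev_lam (κ/5) (by positivity)] with m hQ hl X dd I u hdd hL R Y hR hRm hRR hY
  have := hQ X dd I u hdd hL {1} (fun _ => 1) (fun _ => 1) (fun _ => sqc m R) (fun _ => lam m R Y) (by simp) (by simp) (by
    intro q _ d hd
    rw [mem_sqc hR] at hd
    exact ⟨hd.1, by simpa using hd.2.2.2, hl m R Y hR hRm (fun r => (hY r).trans (by norm_num)) d hd.1⟩) (by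
    intro q _ d hd e he
    rw [mem_sqc hR] at hd he
    rw [Nat.cast_one, one_mul]
    exact (mul_le_mul hd.2.1 he.2.1 (by positivity) hR).trans hRR)
  simp only [Finset.sum_singleton, one_dvd, if_true, one_mul, Nat.cast_one, div_one, Z_eq m R hR Y] at this
  exact this

/-- evaluation with a prime (power) condition -/
lemma Qone (κ : ℝ) (hκ : 0 < κ) (j : ℕ) (hj : 0 < j) : ∀ᶠ m : ℕ in atTop, ∀ (X dd : ℝ) (I : Finset ℕ) (u : ℕ → ℝ), dd ≤ 3 → LevX X m κ dd I u →
    ∀ (R z : ℝ) (Y : ℕ → ℝ), 0 ≤ R → R ≤ m → 0 ≤ z → z^j * (R * R) ≤ (m:ℝ)^dd → (∀ r, |Y r| ≤ 2) → (∀ r : ℕ, R < r → Y r = 0) →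
    ∀ (Q : Finset ℕ) (w : ℕ → ℝ), (∀ q ∈ Q, q.Prime ∧ ¬ q ∣ m ∧ (q:ℝ) ≤ z ∧ |w q| ≤ 1) →
    |∑ n ∈ I, u n * ((fS m R Y n)^2 * ∑ q ∈ Q, if q^j ∣ n then w q else 0) -
      X * ∑ q ∈ Q, w q / (q:ℝ)^j * ∑ k ∈ sqc (m*q) R, (Yq Y q k)^2 / k.totient| ≤ (m:ℝ)^(-(κ/2)) := by
  filter_upwards [QFam κ hκ, ev_lam (κ/5) (by positivity)] with m hQ hl X dd I u hdd hL R z Y hR hRm hz hRR hY hY0 Q w hw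
  have hY4 : ∀ q r, |Yq Y q r| ≤ 4 := by
    intro q r
    have := abs_sub (Y r) (Y (r*q))
    unfold Yq; linarith [hY r, hY (r*q)]
  have := hQ X dd I u hdd hL Q (fun q => q^j) w (fun q => sqc (m*q) R) (fun q => lam (m*q) R (Yq Y q))
    (fun a _ b _ h => Nat.pow_left_injective hj.ne' h) (by
      intro q hq
      obtain ⟨h1, h2, h3, h4⟩ := hw q hq
      exact ⟨pow_pos h1.pos _, Nat.Coprime.pow_left _ ((h1.coprime_iff_not_dvd).2 h2), h4⟩) (by
      intro q hq d hd
      rw [mem_sqc hR] at hd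
      refine ⟨hd.1, ?_, hl _ R _ hR hRm (hY4 q) d hd.1⟩
      rw [Nat.coprime_mul_iff_right] at hd
      exact Nat.Coprime.mul_right hd.2.2.2.1 (Nat.Coprime.pow_right _ hd.2.2.2.2)) (by
      intro q hq d hd e he
      rw [mem_sqc hR] at hd he
      push_cast
      refine le_trans ?_ hRR
      have := (hw q hq).2.2.1
      gcongr
      · exact hd.2.1
      · exact he.2.1)
  have e1 : ∀ n ∈ I, u n * (∑ q ∈ Q, if q^j ∣ n then w q * (∑ d ∈ (sqc (m*q) R).filter (fun d => d ∣ n), lam (m*q) R (Yq Y q) d)^2 else 0) =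
      u n * ((fS m R Y n)^2 * ∑ q ∈ Q, if q^j ∣ n then w q else 0) := by
    intro n _
    congr 1
    rw [Finset.mul_sum]
    refine Finset.sum_congr rfl fun q hq => ?_
    obtain ⟨h1, h2, h3, h4⟩ := hw q hq
    split_ifs with h
    · rw [fS_step m R hR Y hY0 q n h1 h2 ((dvd_pow_self q hj.ne').trans h)]
      rw [mul_comm]; rfl
    · simp
  have e2 : ∀ q ∈ Q, w q / ((q^j:ℕ):ℝ) * (∑ d ∈ sqc (m*q) R, ∑ e ∈ sqc (m*q) R, lam (m*q) R (Yq Y q) d * lam (m*q) R (Yq Y q) e / (Nat.lcm d e : ℝ)) =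
      w q / (q:ℝ)^j * ∑ k ∈ sqc (m*q) R, (Yq Y q k)^2 / k.totient := by
    intro q hq
    rw [Z_eq (m*q) R hR, Nat.cast_pow]
  rw [Finset.sum_congr rfl e1, Finset.sum_congr rfl e2] at this
  exact this
end

section
open Filter Topology

noncomputable def wp (p : ℕ) : ℝ := Real.log p / p
noncomputable def PP (α κ : ℝ) (m : ℕ) : Finset ℕ := prs m ((m:ℝ)^α) ((m:ℝ)^(α+κ))
noncomputable def Mp (α κ : ℝ) (m : ℕ) : ℝ := ∑ p ∈ PP α κ m, wp p
noncomputable def II (β κ : ℝ) (m : ℕ) : Finset ℕ := Finset.Ioc ⌊(m:ℝ)^β⌋₊ ⌊(m:ℝ)^(β+κ)⌋₊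
noncomputable def uu (α β κ : ℝ) (m : ℕ) (a0 : (ZMod m)ˣ) (n : ℕ) : ℝ :=
  (m / (Mp α κ m ^ 2 * (κ * Real.log m))) * ∑ p ∈ PP α κ m, ∑ q ∈ PP α κ m,
    if ((p * q * n : ℕ) : ZMod m) = (a0 : ZMod m) then wp p * wp q / n else 0
noncomputable def eo (κ : ℝ) (m n : ℕ) : ℝ :=
  if n.Coprime m then m / (m.totient * (κ * Real.log m)) / n else 0

lemma mem_PP {α κ : ℝ} {m p : ℕ} : p ∈ PP α κ m ↔ ((m:ℝ)^α < p ∧ (p:ℝ) ≤ (m:ℝ)^(α+κ)) ∧ p.Prime ∧ ¬ p ∣ m :=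
  mem_prs (by positivity) (by positivity)
lemma mem_II {β κ : ℝ} {m n : ℕ} : n ∈ II β κ m ↔ (m:ℝ)^β < n ∧ (n:ℝ) ≤ (m:ℝ)^(β+κ) := by
  rw [II, Finset.mem_Ioc, Nat.floor_lt (by positivity), Nat.le_floor_iff (by positivity)]

lemma wp_nonneg (p : ℕ) : 0 ≤ wp p := by
  unfold wp; exact div_nonneg (Real.log_natCast_nonneg p) (by positivity)

lemma Mp_asymp (α κ δ : ℝ) (hα : 0 < α) (hκ : 0 < κ) (hδ : 0 < δ) : ∀ᶠ m : ℕ in atTop,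
    (1 - δ) * (κ * Real.log m) ≤ Mp α κ m ∧ Mp α κ m ≤ (1 + δ) * (κ * Real.log m) := by
  obtain ⟨C, hC, h⟩ := plog_upper
  obtain ⟨C', hC', h'⟩ := plog_lower
  filter_upwards [h' α hα, ev_log_ge (C / (δ * κ)), ev_log_ge (C' / (δ * κ)), eventually_ge_atTop 2] with m h2 h3 h4 hm
  have hm0 : (0:ℝ) < m := by positivity
  have e : Real.log ((m:ℝ)^(α+κ) / (m:ℝ)^α) = κ * Real.log m := by
    rw [← Real.rpow_sub hm0, Real.log_rpow hm0]; ring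
  have a1 := h m ((m:ℝ)^α) ((m:ℝ)^(α+κ)) (Real.one_le_rpow (by exact_mod_cast (by omega : 1 ≤ m)) hα.le) (rp_mono hm (by linarith))
  have a2 := h2 ((m:ℝ)^α) ((m:ℝ)^(α+κ)) le_rfl (rp_mono hm (by linarith))
  rw [e] at a1 a2
  rw [div_le_iff₀ (by positivity)] at h3 h4
  change _ ≤ Mp α κ m at a2
  change Mp α κ m ≤ _ at a1
  constructor <;> nlinarith

lemma uu_nonneg {α β κ : ℝ} {m : ℕ} (hκ : 0 < κ) (hm : 2 ≤ m) (a0 : (ZMod m)ˣ) (n : ℕ) : 0 ≤ uu α β κ m a0 n := by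
  unfold uu
  have : 0 ≤ Real.log m := Real.log_natCast_nonneg m
  refine mul_nonneg (by positivity) (Finset.sum_nonneg fun p _ => Finset.sum_nonneg fun q _ => ?_)
  split_ifs
  · have := wp_nonneg p; have := wp_nonneg q; positivity
  · exact le_rfl

lemma eo_nonneg {κ : ℝ} {m : ℕ} (hκ : 0 < κ) (n : ℕ) : 0 ≤ eo κ m n := by
  unfold eo
  have : 0 ≤ Real.log m := Real.log_natCast_nonneg m
  split_ifs <;> positivity

lemma uu_pos {α β κ : ℝ} {m : ℕ} (a0 : (ZMod m)ˣ) (n : ℕ) (h : uu α β κ m a0 n ≠ 0) :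
    n.Coprime m ∧ ∃ p ∈ PP α κ m, ∃ q ∈ PP α κ m, ((p * q * n : ℕ) : ZMod m) = (a0 : ZMod m) := by
  have : ∃ p ∈ PP α κ m, ∃ q ∈ PP α κ m, ((p * q * n : ℕ) : ZMod m) = (a0 : ZMod m) := by
    by_contra hne
    push Not at hne
    apply h
    unfold uu
    rw [Finset.sum_eq_zero, mul_zero]
    intro p hp
    refine Finset.sum_eq_zero fun q hq => ?_
    rw [if_neg (hne p hp q hq)]
  refine ⟨?_, this⟩
  obtain ⟨p, _, q, _, e⟩ := this
  have hu : IsUnit ((p * q * n : ℕ) : ZMod m) := by rw [e]; exact a0.isUnit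
  rw [ZMod.isUnit_iff_coprime] at hu
  exact hu.coprime_dvd_left (Dvd.intro_left _ rfl)

lemma wp_bound {α κ : ℝ} (hκ : 0 < κ) (hα1 : α ≤ 1) (hκ1 : κ ≤ 1) : ∀ᶠ m : ℕ in atTop, ∀ p ∈ PP α κ m,
    p.Coprime m ∧ (m:ℝ)^α < p ∧ (p:ℝ) ≤ (m:ℝ)^(α+κ) ∧ |wp p| ≤ (m:ℝ)^κ / p := by
  filter_upwards [ev_log_le 2 κ hκ, eventually_ge_atTop 2] with m h hm p hp
  rw [mem_PP] at hp
  obtain ⟨⟨h1, h2⟩, h3, h4⟩ := hp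
  refine ⟨(h3.coprime_iff_not_dvd).2 h4, h1, h2, ?_⟩
  rw [abs_of_nonneg (wp_nonneg p), wp]
  gcongr
  have hp0 : (0:ℝ) < p := by exact_mod_cast h3.pos
  have := Real.log_le_log hp0 h2
  rw [Real.log_rpow (by positivity)] at this
  have hL : 0 ≤ Real.log m := Real.log_natCast_nonneg m
  nlinarith

/-- distribution of u in progressions -/
lemma uu_lev (α β κ dd q : ℝ) (hα : 0 < α) (hα1 : α ≤ 1) (hβ : 0 ≤ β) (hβ1 : β ≤ 1) (hκ : 0 < κ) (hκ1 : κ ≤ 1)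
    (hq : 0 ≤ q) (hdd : 0 ≤ dd) (h1 : q + dd + 100 * κ < α + 2 * β - 2) (h2 : q + 100 * κ < 2 * α + 2 * β - 3) :
    ∀ᶠ m : ℕ in atTop, ∀ (a0 : (ZMod m)ˣ) (DD : Finset ℕ) (cd : ℕ → ℝ),
      (∀ d ∈ DD, d.Coprime m ∧ 0 < d ∧ (d:ℝ) ≤ (m:ℝ) ^ dd ∧ |cd d| ≤ (m:ℝ) ^ κ) → ((DD.card : ℝ) ≤ (m:ℝ) ^ q) →
      |∑ n ∈ II β κ m, uu α β κ m a0 n * (∑ d ∈ DD.filter (fun d => d ∣ n), cd d) - ∑ d ∈ DD, cd d / d| ≤ (m:ℝ)^(-(κ/2)) := by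
  filter_upwards [propT α α β dd q κ hα.le hα1 hα.le hα1 hβ hβ1 hq hdd hκ h1 (by linarith), wp_bound hκ hα1 hκ1,
    Mp_asymp α κ (1/2) hα hκ (by norm_num), ev_log_ge (4 / κ ^ 3 + 1), eventually_ge_atTop 2] with m hT hw hM hlg hm a0 DD cd hD hc
  have hm0 : (0:ℝ) < m := by positivity
  have := hT a0 (PP α κ m) (PP α κ m) DD wp wp cd hw hw hD hc
  set L := Real.log m with hL
  have hk3 : 0 < 4 / κ ^ 3 := by positivity
  have hL1 : 1 ≤ L := by linarith
  have hMp : κ * L / 2 ≤ Mp α κ m := by linarith [hM.1]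
  have hMp0 : 0 < Mp α κ m := lt_of_lt_of_le (by positivity) hMp
  set c := (m / (Mp α κ m ^ 2 * (κ * L)) : ℝ) with hcdef
  have hc0 : 0 < c := by positivity
  have e1 : ∑ n ∈ II β κ m, uu α β κ m a0 n * (∑ d ∈ DD.filter (fun d => d ∣ n), cd d) = c * ∑ x ∈ PP α κ m, ∑ y ∈ PP α κ m, ∑ n ∈ II β κ m,
        (if ((x * y * n : ℕ) : ZMod m) = (a0 : ZMod m) then
          wp x * wp y * (∑ d ∈ DD with d ∣ n, cd d) / n else 0) := by
    have r1 : ∀ x ∈ PP α κ m, (∑ y ∈ PP α κ m, ∑ n ∈ II β κ m,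
        (if ((x * y * n : ℕ) : ZMod m) = (a0 : ZMod m) then
          wp x * wp y * (∑ d ∈ DD with d ∣ n, cd d) / n else 0)) = ∑ n ∈ II β κ m, ∑ y ∈ PP α κ m,
        (if ((x * y * n : ℕ) : ZMod m) = (a0 : ZMod m) then
          wp x * wp y * (∑ d ∈ DD with d ∣ n, cd d) / n else 0) := fun x _ => Finset.sum_comm
    rw [Finset.sum_congr rfl r1, Finset.sum_comm, Finset.mul_sum]
    refine Finset.sum_congr rfl fun n _ => ?_
    unfold uu
    rw [mul_assoc, Finset.sum_mul]
    congr 1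
    refine Finset.sum_congr rfl fun x _ => ?_
    rw [Finset.sum_mul]
    refine Finset.sum_congr rfl fun y _ => ?_
    split_ifs
    · ring
    · ring
  have e2 : ∑ d ∈ DD, cd d / (d:ℝ) = c * (1 / m * (∑ x ∈ PP α κ m, wp x) * (∑ y ∈ PP α κ m, wp y) * (κ * L) * (∑ d ∈ DD, cd d / d)) := by
    change _ = c * (1 / m * Mp α κ m * Mp α κ m * (κ * L) * _)
    rw [hcdef]; field_simp
  rw [e1, e2, ← mul_sub, abs_mul, abs_of_pos hc0]
  calc _ ≤ c * (m:ℝ)^(-1-κ) := by gcongr; exact this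
    _ ≤ (m:ℝ) * 1 * (m:ℝ)^(-1-κ) := by
        gcongr
        rw [hcdef, mul_one]
        apply div_le_self hm0.le
        have : 1 ≤ (κ*L/2)^2 * (κ * L) := by
          have : (κ*L/2)^2 * (κ * L) = κ^3 / 4 * (L^3) := by ring
          rw [this]
          have h5 : 4 / κ^3 ≤ L^3 := by nlinarith [sq_nonneg L, mul_nonneg (sub_nonneg.2 hL1) (sq_nonneg L), sq_nonneg (L-1)]
          rw [div_le_iff₀ (by positivity)] at h5
          linarith
        refine this.trans ?_
        gcongr
    _ = (m:ℝ)^(-κ) := by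
        rw [mul_one]; nth_rewrite 1 [← Real.rpow_one (m:ℝ)]; rw [← rp_add hm]; congr 1; ring
    _ ≤ _ := rp_mono hm (by linarith)

lemma uu_Lev (α β κ dd : ℝ) (hα : 0 < α) (hα1 : α ≤ 1) (hβ : 0 ≤ β) (hβ1 : β ≤ 1) (hκ : 0 < κ) (hκ1 : κ ≤ 1)
    (hdd : 0 ≤ dd) (h1 : dd + dd + 100 * κ < α + 2 * β - 2) (h2 : dd + 100 * κ < 2 * α + 2 * β - 3) :
    ∀ᶠ m : ℕ in atTop, ∀ (a0 : (ZMod m)ˣ), LevX 1 m κ dd (II β κ m) (uu α β κ m a0) := by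
  filter_upwards [uu_lev α β κ dd dd hα hα1 hβ hβ1 hκ hκ1 hdd hdd h1 h2] with m h a0 DD cd hD
  rw [one_mul]
  apply h a0 DD cd hD
  have : DD ⊆ Finset.Icc 1 ⌊(m:ℝ)^dd⌋₊ := by
    intro d hd
    rw [Finset.mem_Icc, Nat.le_floor_iff (by positivity)]
    exact ⟨(hD d hd).2.1, (hD d hd).2.2.1⟩
  have := Finset.card_le_card this
  rw [Nat.card_Icc, Nat.add_sub_cancel] at this
  exact le_trans (by exact_mod_cast this) (Nat.floor_le (by positivity))

/-- indicator r ≤ R -/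
noncomputable def YR (R : ℝ) : ℕ → ℝ := fun r => if (r:ℝ) ≤ R then 1 else 0

lemma fS_free (M : ℕ) (R : ℝ) (hR : 0 ≤ R) (Y : ℕ → ℝ) (n : ℕ) (h : ∀ r ∈ sqc M R, Nat.gcd n r = 1) :
    fS M R Y n = ∑ r ∈ sqc M R, Y r / r.totient := by
  rw [fS_eq M R hR]
  refine Finset.sum_congr rfl fun r hr => ?_
  rw [h r hr]; simp [hh]

lemma sumYR (M : ℕ) (R : ℝ) (hR : 0 ≤ R) (j : ℕ) (hj : j ≠ 0) : ∑ r ∈ sqc M R, (YR R r)^j / r.totient = GG M R := by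
  refine Finset.sum_congr rfl fun r hr => ?_
  rw [YR, if_pos ((mem_sqc hR).1 hr).2.1, one_pow]

lemma GG_one_le (M : ℕ) (R : ℝ) (hR : 1 ≤ R) : 1 ≤ GG M R := by
  have h1 : 1 ∈ sqc M R := by rw [mem_sqc (by linarith)]; simp [hR]
  have := Finset.single_le_sum (f := fun k : ℕ => 1 / (k.totient:ℝ)) (fun i _ => by positivity) h1
  simpa [GG] using this

lemma KT (α β κ e0 : ℝ) (hα : 0 < α) (hα1 : α ≤ 1) (hβ : 0 ≤ β) (hβ1 : β ≤ 1) (hκ : 0 < κ) (hκ1 : κ ≤ 1) (he0 : 0 ≤ e0)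
    (hAB : (e0 + e0 + 100 * κ < 3 * α - 2 ∨ e0 + e0 + 100 * κ < β + 2 * α - 2) ∧ e0 + 100 * κ < 3 * α + β - 3) :
    ∀ᶠ m : ℕ in atTop, ∀ (a0 : (ZMod m)ˣ) (Φ : ℕ → ℝ), (∀ n, |Φ n| ≤ (m:ℝ)^κ) → ∀ (DD : Finset ℕ) (cd : ℕ → ℝ),
      (∀ d ∈ DD, d.Coprime m ∧ 0 < d ∧ (d:ℝ) ≤ (m:ℝ) ^ e0 ∧ |cd d| ≤ (m:ℝ) ^ κ) → ((DD.card : ℝ) ≤ (m:ℝ) ^ e0) →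
      |∑ p ∈ PP α κ m, ∑ n ∈ (II β κ m).filter (fun n => n.Coprime m), ∑ x ∈ II α κ m,
        (if ((p * n * x : ℕ) : ZMod m) = (a0 : ZMod m) then
          wp p * (Φ n / n) * (∑ d ∈ DD with d ∣ x, cd d) / x else 0) -
        1 / m * (Mp α κ m) * (∑ n ∈ (II β κ m).filter (fun n => n.Coprime m), Φ n / n) * (κ * Real.log m) * (∑ d ∈ DD, cd d / d)| ≤
      (m:ℝ) ^ (-1 - κ) := by
  have hn : ∀ m : ℕ, ∀ (Φ : ℕ → ℝ), (∀ n, |Φ n| ≤ (m:ℝ)^κ) → ∀ n ∈ (II β κ m).filter (fun n => n.Coprime m),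
      n.Coprime m ∧ (m:ℝ)^β < n ∧ (n:ℝ) ≤ (m:ℝ)^(β+κ) ∧ |Φ n / n| ≤ (m:ℝ)^κ / n := by
    intro m Φ hΦ n hn
    rw [Finset.mem_filter, mem_II] at hn
    refine ⟨hn.2, hn.1.1, hn.1.2, ?_⟩
    rw [abs_div, Nat.abs_cast]
    gcongr
    exact hΦ n
  rcases hAB with ⟨h1 | h1, h2⟩
  · filter_upwards [propT α β α e0 e0 κ hα.le hα1 hβ hβ1 hα.le hα1 he0 he0 hκ (by linarith) (by linarith), wp_bound hκ hα1 hκ1] with m h hw a0 Φ hΦ DD cd hD hc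
    exact h a0 (PP α κ m) _ DD wp (fun n => Φ n / n) cd hw (hn m Φ hΦ) hD hc
  · filter_upwards [propT β α α e0 e0 κ hβ hβ1 hα.le hα1 hα.le hα1 he0 he0 hκ (by linarith) (by linarith), wp_bound hκ hα1 hκ1] with m h hw a0 Φ hΦ DD cd hD hc
    have := h a0 _ (PP α κ m) DD (fun n => Φ n / n) wp cd (hn m Φ hΦ) hw hD hc
    rw [Finset.sum_comm] at this
    convert this using 3
    · refine Finset.sum_congr rfl fun p _ => Finset.sum_congr rfl fun n _ => Finset.sum_congr rfl fun x _ => ?_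
      rw [mul_comm p n, mul_comm (wp p)]
    · change _ = 1 / (m:ℝ) * _ * Mp α κ m * _ * _
      ring

lemma K_lemma (α β κ e0 δ : ℝ) (hα : 1/2 ≤ α) (hα1 : α ≤ 1) (hβ : 0 ≤ β) (hβ1 : β ≤ 1) (hκ : 0 < κ) (hκ1 : κ ≤ 1) (he0 : 0 < e0)
    (hδ : 0 < δ) (hδ1 : δ ≤ 1/2)
    (hAB : (e0 + e0 + 100 * κ < 3 * α - 2 ∨ e0 + e0 + 100 * κ < β + 2 * α - 2) ∧ e0 + 100 * κ < 3 * α + β - 3) :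
    ∀ᶠ m : ℕ in atTop, ∀ (a0 : (ZMod m)ˣ) (Φ : ℕ → ℝ), (∀ n ∈ II β κ m, 0 ≤ Φ n ∧ Φ n ≤ (m:ℝ)^κ) →
      ∑ n ∈ II β κ m, uu α β κ m a0 n * Φ n ≤ (1/(1-δ)) * (2 * (α + κ) / e0) * ∑ n ∈ II β κ m, eo κ m n * Φ n + (m:ℝ)^(-(κ/2)) := by
  have he1 : e0 ≤ 1 := by rcases hAB with ⟨_, h⟩; linarith
  filter_upwards [KT α β κ e0 (by linarith) hα1 hβ hβ1 hκ hκ1 he0.le hAB, Qzero κ hκ,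
    Mp_asymp α κ δ (by linarith) hκ hδ, ev_log_ge (8 / κ ^ 3 + 1), eventually_ge_atTop 2] with m hT hQ hM hlg hm a0 Φ0 hΦ0
  classical
  set Φ : ℕ → ℝ := fun n => if n ∈ II β κ m then Φ0 n else 0 with hΦdef
  have hΦ : ∀ n, 0 ≤ Φ n ∧ Φ n ≤ (m:ℝ)^κ := by
    intro n
    simp only [hΦdef]
    split_ifs with h
    · exact hΦ0 n h
    · exact ⟨le_rfl, by positivity⟩
  have hsame : ∀ F : ℕ → ℝ, ∑ n ∈ II β κ m, F n * Φ0 n = ∑ n ∈ II β κ m, F n * Φ n := by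
    intro F; refine Finset.sum_congr rfl fun n hn => ?_
    simp only [hΦdef, if_pos hn]
  rw [hsame, hsame]
  have hm0 : (0:ℝ) < m := by positivity
  have hm1 : (1:ℝ) ≤ m := by exact_mod_cast (by omega : 1 ≤ m)
  have : NeZero m := ⟨by omega⟩
  set L := Real.log m with hL
  have hk3 : 0 < 8 / κ ^ 3 := by positivity
  have hL1 : 1 ≤ L := by linarith
  have hMp : κ * L / 2 ≤ Mp α κ m := by nlinarith [hM.1, mul_pos hκ (by linarith : 0 < L)]
  have hMp0 : 0 < Mp α κ m := lt_of_lt_of_le (by positivity) hMp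
  set R := (m:ℝ)^(e0/2) with hR
  have hR1 : 1 ≤ R := Real.one_le_rpow hm1 (by positivity)
  set I' := (II β κ m).filter (fun n => n.Coprime m) with hI'
  set SΦ := ∑ n ∈ I', Φ n / n with hSΦ
  set u' : ℕ → ℝ := fun x => m * ∑ p ∈ PP α κ m, ∑ n ∈ I', (if ((p * n * x : ℕ) : ZMod m) = (a0 : ZMod m) then wp p * (Φ n / n) / x else 0) with hu'
  have hLev : LevX (Mp α κ m * SΦ * (κ * L)) m κ e0 (II α κ m) u' := by
    intro DD cd hD
    have hc : (DD.card:ℝ) ≤ (m:ℝ)^e0 := by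
      have : DD ⊆ Finset.Icc 1 ⌊(m:ℝ)^e0⌋₊ := by
        intro d hd
        rw [Finset.mem_Icc, Nat.le_floor_iff (by positivity)]
        exact ⟨(hD d hd).2.1, (hD d hd).2.2.1⟩
      have := Finset.card_le_card this
      rw [Nat.card_Icc, Nat.add_sub_cancel] at this
      exact le_trans (by exact_mod_cast this) (Nat.floor_le (by positivity))
    have := hT a0 Φ (fun n => by rw [abs_of_nonneg (hΦ n).1]; exact (hΦ n).2) DD cd hD hc
    have e1 : ∑ x ∈ II α κ m, u' x * (∑ d ∈ DD.filter (fun d => d ∣ x), cd d) = m * ∑ p ∈ PP α κ m, ∑ n ∈ I', ∑ x ∈ II α κ m,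
        (if ((p * n * x : ℕ) : ZMod m) = (a0 : ZMod m) then
          wp p * (Φ n / n) * (∑ d ∈ DD with d ∣ x, cd d) / x else 0) := by
      have r1 : ∀ p ∈ PP α κ m, (∑ n ∈ I', ∑ x ∈ II α κ m,
        (if ((p * n * x : ℕ) : ZMod m) = (a0 : ZMod m) then
          wp p * (Φ n / n) * (∑ d ∈ DD with d ∣ x, cd d) / x else 0)) = ∑ x ∈ II α κ m, ∑ n ∈ I',
        (if ((p * n * x : ℕ) : ZMod m) = (a0 : ZMod m) then
          wp p * (Φ n / n) * (∑ d ∈ DD with d ∣ x, cd d) / x else 0) := fun p _ => Finset.sum_comm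
      rw [Finset.sum_congr rfl r1, Finset.sum_comm, Finset.mul_sum]
      refine Finset.sum_congr rfl fun x _ => ?_
      simp only [hu']
      rw [mul_assoc, Finset.sum_mul]
      congr 1
      refine Finset.sum_congr rfl fun p _ => ?_
      rw [Finset.sum_mul]
      refine Finset.sum_congr rfl fun n _ => ?_
      split_ifs
      · ring
      · ring
    have e2 : Mp α κ m * SΦ * (κ * L) * ∑ d ∈ DD, cd d / (d:ℝ) = m * (1 / m * (Mp α κ m) * SΦ * (κ * L) * (∑ d ∈ DD, cd d / d)) := by
      field_simp
    rw [e1, e2, ← mul_sub, abs_mul, abs_of_pos hm0]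
    calc _ ≤ (m:ℝ) * (m:ℝ)^(-1-κ) := by gcongr
      _ = (m:ℝ)^(-κ) := by
        nth_rewrite 1 [← Real.rpow_one (m:ℝ)]; rw [← rp_add hm]; congr 1; ring
      _ ≤ _ := rp_mono hm (by linarith)
  have hRm : R ≤ m := by
    have := rp_mono hm (show e0/2 ≤ 1 by linarith); rwa [Real.rpow_one] at this
  have hq := hQ _ e0 (II α κ m) u' (by linarith) hLev R (YR R) (by positivity) hRm (by rw [hR, ← rp_add hm]; apply rp_mono hm; linarith) (by
    intro r; unfold YR; split_ifs <;> norm_num)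
  rw [sumYR m R (by positivity) 2 (by norm_num)] at hq
  set G := GG m R with hG
  have hG1 : 1 ≤ G := GG_one_le m R hR1
  have hGl := GG_lower m (by omega) R hR1
  rw [← hG, hR, Real.log_rpow hm0, ← hL] at hGl
  have hφ : (0:ℝ) < m.totient := by exact_mod_cast Nat.totient_pos.2 (by omega)
  have hSΦ0 : 0 ≤ SΦ := Finset.sum_nonneg fun n _ => div_nonneg (hΦ n).1 (by positivity)
  -- the upper bound for the u sum
  set c := (m / (Mp α κ m ^ 2 * (κ * L)) : ℝ) with hcdef
  have hc0 : 0 < c := by positivity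
  have hu'0 : ∀ x, 0 ≤ u' x := by
    intro x
    refine mul_nonneg hm0.le (Finset.sum_nonneg fun p _ => Finset.sum_nonneg fun n _ => ?_)
    split_ifs
    · have := wp_nonneg p; have := (hΦ n).1; positivity
    · exact le_rfl
  have main : ∑ n ∈ II β κ m, uu α β κ m a0 n * Φ n ≤ c / m * ((α + κ) * L) / G^2 * ∑ x ∈ II α κ m, u' x * (fS m R (YR R) x)^2 := by
    have s1 : ∑ n ∈ II β κ m, uu α β κ m a0 n * Φ n = ∑ n ∈ I', uu α β κ m a0 n * Φ n := by
      rw [hI', Finset.sum_filter]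
      refine Finset.sum_congr rfl fun n _ => ?_
      split_ifs with h
      · rfl
      · have : uu α β κ m a0 n = 0 := by
          by_contra hne; exact h (uu_pos a0 n hne).1
        rw [this, zero_mul]
    have s2 : ∑ n ∈ I', uu α β κ m a0 n * Φ n = c / m * ∑ x ∈ PP α κ m, Real.log x * u' x := by
      have t : ∀ x ∈ PP α κ m, Real.log x * u' x = m * ∑ n ∈ I', ∑ p ∈ PP α κ m, (if ((x * p * n : ℕ) : ZMod m) = (a0 : ZMod m) then wp x * wp p / n * Φ n else 0) := by
        intro x _
        have hcomm : (∑ n ∈ I', ∑ p ∈ PP α κ m, (if ((x * p * n : ℕ) : ZMod m) = (a0 : ZMod m) then wp x * wp p / n * Φ n else 0)) =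
          ∑ p ∈ PP α κ m, ∑ n ∈ I', (if ((x * p * n : ℕ) : ZMod m) = (a0 : ZMod m) then wp x * wp p / n * Φ n else 0) := Finset.sum_comm
        rw [hcomm]
        simp only [hu']
        rw [mul_left_comm, Finset.mul_sum]
        congr 1
        refine Finset.sum_congr rfl fun p _ => ?_
        rw [Finset.mul_sum]
        refine Finset.sum_congr rfl fun n _ => ?_
        have : p * n * x = x * p * n := by ring
        rw [this]
        split_ifs
        · unfold wp; ring
        · ring
      rw [Finset.sum_congr rfl t, ← Finset.mul_sum, ← mul_assoc, div_mul_cancel₀ _ hm0.ne', Finset.sum_comm, Finset.mul_sum]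
      refine Finset.sum_congr rfl fun n _ => ?_
      unfold uu
      rw [← hL, ← hcdef, mul_assoc, Finset.sum_mul]
      congr 1
      refine Finset.sum_congr rfl fun x _ => ?_
      rw [Finset.sum_mul]
      refine Finset.sum_congr rfl fun p _ => ?_
      split_ifs <;> simp
    rw [s1, s2]
    have s3 : ∀ x ∈ PP α κ m, Real.log x * u' x ≤ ((α + κ) * L) / G^2 * (u' x * (fS m R (YR R) x)^2) := by
      intro x hx
      rw [mem_PP] at hx
      have hf : fS m R (YR R) x = G := by
        rw [fS_free m R (by positivity)]
        · have := sumYR m R (by positivity) 1 one_ne_zero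
          simpa using this
        · intro r hr
          rw [mem_sqc (by positivity)] at hr
          rw [← Nat.coprime_iff_gcd_eq_one, hx.2.1.coprime_iff_not_dvd]
          intro hd
          have h1 : (x:ℝ) ≤ r := by exact_mod_cast Nat.le_of_dvd hr.1 hd
          have h2 : R ≤ (m:ℝ)^α := rp_mono hm (by linarith)
          linarith [hx.1.1, hr.2.1]
      rw [hf]
      have hlx : Real.log x ≤ (α + κ) * L := by
        have := Real.log_le_log (by exact_mod_cast hx.2.1.pos) hx.1.2
        rwa [Real.log_rpow hm0] at this
      have : ((α + κ) * L) / G^2 * (u' x * G^2) = ((α + κ) * L) * u' x := by field_simp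
      rw [this]
      exact mul_le_mul_of_nonneg_right hlx (hu'0 x)
    have s4 : ∑ x ∈ PP α κ m, Real.log x * u' x ≤ ((α + κ) * L) / G^2 * ∑ x ∈ II α κ m, u' x * (fS m R (YR R) x)^2 := by
      refine (Finset.sum_le_sum s3).trans ?_
      rw [← Finset.mul_sum]
      refine mul_le_mul_of_nonneg_left (Finset.sum_le_sum_of_subset_of_nonneg ?_ ?_) (by positivity)
      · intro x hx
        rw [mem_PP] at hx; rw [mem_II]; exact hx.1
      · intro x _ _; have := hu'0 x; positivity
    calc _ ≤ c / m * (((α + κ) * L) / G^2 * ∑ x ∈ II α κ m, u' x * (fS m R (YR R) x)^2) := by gcongr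
      _ = _ := by ring
  have hq2 := (abs_le.1 hq).2
  set err := (m:ℝ)^(-(κ/2)) with herr
  have herr0 : 0 < err := rp_pos hm _
  have hee : ∑ n ∈ II β κ m, eo κ m n * Φ n = m / (m.totient * (κ * L)) * SΦ := by
    rw [hSΦ, hI', Finset.sum_filter, Finset.mul_sum]
    refine Finset.sum_congr rfl fun n _ => ?_
    unfold eo
    split_ifs
    · ring
    · ring
  rw [hee]
  refine main.trans ?_
  calc _ ≤ c / m * ((α + κ) * L) / G^2 * (Mp α κ m * SΦ * (κ * L) * G + err) := by
        gcongr; linarith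
    _ = (α + κ) * L * SΦ / (Mp α κ m * G) + ((α + κ) / (Mp α κ m ^ 2 * κ) / G^2) * err := by
        rw [hcdef]; field_simp
    _ ≤ _ := by
        apply add_le_add
        · have g1 : e0 / 2 * L * m.totient / m ≤ G := by
            rw [div_le_iff₀ hm0]
            have := mul_le_mul_of_nonneg_right hGl hφ.le
            have e : G * (m / m.totient) * m.totient = G * m := by field_simp
            linarith
          have g2 : (1-δ) * (κ * L) ≤ Mp α κ m := hM.1
          have h1d : 0 < 1 - δ := by linarith
          calc (α + κ) * L * SΦ / (Mp α κ m * G) ≤ (α + κ) * L * SΦ / ((1-δ) * (κ * L) * (e0 / 2 * L * m.totient / m)) := by gcongr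
            _ = _ := by field_simp
        · have : (α + κ) / (Mp α κ m ^ 2 * κ) / G^2 ≤ 1 := by
            apply div_le_one_of_le₀ _ (by positivity)
            have h5 : (α + κ) / (Mp α κ m ^ 2 * κ) ≤ 1 := by
              rw [div_le_one (by positivity)]
              have : 2 ≤ (κ*L/2)^2 * κ := by
                have e : (κ*L/2)^2 * κ = κ^3 / 4 * (L^2) := by ring
                rw [e]
                have h5 : 8 / κ^3 ≤ L^2 := by
                  have hL8 : 8 / κ^3 ≤ L := by linarith
                  calc _ ≤ L := hL8
                    _ ≤ L^2 := by rw [pow_two]; exact le_mul_of_one_le_left (by linarith) hL1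
                rw [div_le_iff₀ (by positivity)] at h5
                linarith
              calc α + κ ≤ 2 := by linarith
                _ ≤ _ := this
                _ ≤ _ := by gcongr
            have hG2 : 1 ≤ G^2 := one_le_pow₀ hG1
            exact h5.trans hG2
          calc _ ≤ 1 * err := mul_le_mul_of_nonneg_right this herr0.le
            _ = err := one_mul _
end

section
open Filter Topology

lemma mu_cop (m k : ℕ) (hm : m ≠ 0) : ∑ j ∈ m.divisors with j ∣ k, (ArithmeticFunction.moebius j : ℝ) = if k.Coprime m then 1 else 0 := by
  have h1 : (m.divisors.filter (fun j => j ∣ k)) = (Nat.gcd k m).divisors := by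
    ext j
    simp [Nat.dvd_gcd_iff, hm, and_comm]
  have h2 := congrArg (fun f : ArithmeticFunction ℤ => f (Nat.gcd k m)) ArithmeticFunction.moebius_mul_coe_zeta
  simp only [ArithmeticFunction.mul_zeta_apply, ArithmeticFunction.one_apply] at h2
  rw [h1]
  have h3 : ((∑ j ∈ (Nat.gcd k m).divisors, ArithmeticFunction.moebius j : ℤ) : ℝ) = if k.Coprime m then 1 else 0 := by
    rw [ArithmeticFunction.coe_mul_zeta_apply] at h2
    rw [h2]
    unfold Nat.Coprime
    split_ifs <;> simp
  rw [← h3]; push_cast; rfl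

lemma mu_tot (m : ℕ) (hm : 0 < m) : ∑ j ∈ m.divisors, (ArithmeticFunction.moebius j : ℝ) / j = m.totient / m := by
  have h := (ArithmeticFunction.sum_eq_iff_sum_mul_moebius_eq (f := fun n => (n.totient : ℝ)) (g := fun n => (n:ℝ))).1 (by
    intro n hn
    exact_mod_cast Nat.sum_totient n) m hm
  rw [← h, Finset.sum_div, Nat.sum_divisorsAntidiagonal (f := fun a b => (ArithmeticFunction.moebius a : ℝ) * b / m)]
  refine Finset.sum_congr rfl fun j hj => ?_
  have hd := Nat.dvd_of_mem_divisors hj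
  have hj0 : (j:ℝ) ≠ 0 := by exact_mod_cast (Nat.pos_of_mem_divisors hj).ne'
  have hm0 : (m:ℝ) ≠ 0 := by exact_mod_cast hm.ne'
  rw [Nat.cast_div hd hj0]
  field_simp

lemma cop_harm (m : ℕ) (hm : 0 < m) (A B : ℝ) (hA : 1 ≤ A) (hAB : A ≤ B) :
    |∑ k ∈ (Finset.Ioc ⌊A⌋₊ ⌊B⌋₊).filter (fun k => k.Coprime m), 1 / (k:ℝ) - m.totient / m * Real.log (B / A)| ≤
      m.divisors.card * ((2 + 2 * Real.log B) / A) := by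
  have hB : 1 ≤ B := by linarith
  have hlB : 0 ≤ Real.log B := Real.log_nonneg hB
  have hlAB : Real.log (B / A) = Real.log B - Real.log A := Real.log_div (by linarith) (by linarith)
  have hlA : 0 ≤ Real.log A := Real.log_nonneg hA
  have hlAB' : Real.log A ≤ Real.log B := Real.log_le_log (by linarith) hAB
  have e1 : ∑ k ∈ (Finset.Ioc ⌊A⌋₊ ⌊B⌋₊).filter (fun k => k.Coprime m), 1 / (k:ℝ) =
      ∑ j ∈ m.divisors, (ArithmeticFunction.moebius j : ℝ) * ∑ k ∈ Finset.Ioc ⌊A⌋₊ ⌊B⌋₊ with j ∣ k, 1 / (k:ℝ) := by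
    rw [Finset.sum_filter]
    have : ∀ k ∈ Finset.Ioc ⌊A⌋₊ ⌊B⌋₊, (if k.Coprime m then 1 / (k:ℝ) else 0) =
        ∑ j ∈ m.divisors, if j ∣ k then (ArithmeticFunction.moebius j : ℝ) * (1 / (k:ℝ)) else 0 := by
      intro k _
      have := mu_cop m k hm.ne'
      rw [← Finset.sum_filter, ← Finset.sum_mul, this]
      split_ifs <;> simp
    rw [Finset.sum_congr rfl this, Finset.sum_comm]
    refine Finset.sum_congr rfl fun j _ => ?_
    rw [Finset.mul_sum, Finset.sum_filter]
  rw [e1, ← mu_tot m hm, Finset.sum_mul, ← Finset.sum_sub_distrib]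
  refine (Finset.abs_sum_le_sum_abs _ _).trans ?_
  rw [← nsmul_eq_mul]
  refine Finset.sum_le_card_nsmul _ _ _ fun j hj => ?_
  have hj := Nat.pos_of_mem_divisors hj
  have hj0 : (0:ℝ) < j := by exact_mod_cast hj
  have e2 : ∑ k ∈ Finset.Ioc ⌊A⌋₊ ⌊B⌋₊ with j ∣ k, 1 / (k:ℝ) = (1 / j) * ∑ l ∈ Finset.Ioc ⌊A / j⌋₊ ⌊B / j⌋₊, 1 / (l:ℝ) := by
    rw [nsum_dvd _ _ _ hj, Nat.floor_div_natCast, Nat.floor_div_natCast, Finset.mul_sum]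
    refine Finset.sum_congr rfl fun l _ => ?_
    push_cast
    rw [one_div_mul_one_div]
  rw [e2]
  set H := ∑ l ∈ Finset.Ioc ⌊A / j⌋₊ ⌊B / j⌋₊, 1 / (l:ℝ) with hH
  have hmu : |(ArithmeticFunction.moebius j : ℝ)| ≤ 1 := by exact_mod_cast ArithmeticFunction.abs_moebius_le_one
  have e3 : (ArithmeticFunction.moebius j : ℝ) * (1 / j * H) - (ArithmeticFunction.moebius j : ℝ) / j * Real.log (B / A) =
    (ArithmeticFunction.moebius j : ℝ) * ((H - Real.log (B/A)) / j) := by ring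
  rw [e3, abs_mul]
  have key : |(H - Real.log (B/A)) / j| ≤ (2 + 2 * Real.log B) / A := by
    rw [abs_div, abs_of_pos hj0, div_le_iff₀ hj0]
    by_cases hjA : (j:ℝ) ≤ A
    · have := harm_block (A / j) (B / j) (by rwa [le_div_iff₀ hj0, one_mul]) (by gcongr)
      rw [div_div_div_cancel_right₀ hj0.ne'] at this
      refine this.trans ?_
      rw [div_div_eq_mul_div, div_mul_eq_mul_div]
      gcongr
      nlinarith
    · push Not at hjA
      have h0 : 0 ≤ H := Finset.sum_nonneg fun _ _ => by positivity
      have h1 : H ≤ 1 + Real.log B := by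
        have hf : 1 ≤ ⌊B⌋₊ := Nat.one_le_floor_iff _ |>.2 hB
        have := recip_sum (Finset.Ioc ⌊A / j⌋₊ ⌊B / j⌋₊) ⌊B⌋₊ hf (by
          intro n hn
          rw [Finset.mem_Ioc] at hn
          refine ⟨by omega, hn.2.trans (Nat.floor_le_floor ?_)⟩
          exact div_le_self (by linarith) (by exact_mod_cast hj))
        refine this.trans ?_
        gcongr
        exact Nat.floor_le (by linarith)
      have h2 : |H - Real.log (B/A)| ≤ 2 + 2 * Real.log B := by rw [hlAB, abs_le]; constructor <;> linarith
      refine h2.trans ?_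
      rw [div_mul_eq_mul_div, le_div_iff₀ (by linarith)]
      gcongr
  calc _ ≤ 1 * ((2 + 2 * Real.log B) / A) := mul_le_mul hmu key (abs_nonneg _) zero_le_one
    _ = _ := one_mul _
end

section
open Filter Topology

lemma ev_mphi (κ0 : ℝ) (h : 0 < κ0) : ∀ᶠ m : ℕ in atTop, (m:ℝ) / m.totient ≤ (m:ℝ)^κ0 := by
  filter_upwards [ev_div κ0 h 1, eventually_ge_atTop 2] with m h1 hm
  have h2 := inv_tot_le m (by omega)
  have hm0 : (0:ℝ) < m := by positivity
  have h3 := h1 m (by omega) (by rw [Real.rpow_one])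
  calc (m:ℝ) / m.totient = m * (1 / m.totient) := by ring
    _ ≤ m * (m.divisors.card / m) := by gcongr
    _ = m.divisors.card := by field_simp
    _ ≤ _ := h3

lemma ev_eo_c (κ κ0 : ℝ) (hκ : 0 < κ) (h : 0 < κ0) : ∀ᶠ m : ℕ in atTop,
    0 ≤ (m:ℝ) / (m.totient * (κ * Real.log m)) ∧ (m:ℝ) / (m.totient * (κ * Real.log m)) ≤ (m:ℝ)^κ0 := by
  filter_upwards [ev_mphi κ0 h, ev_log_ge (1/κ), eventually_ge_atTop 2] with m h1 h2 hm
  have hL : 0 ≤ Real.log m := Real.log_natCast_nonneg m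
  have hφ : (0:ℝ) < m.totient := by exact_mod_cast Nat.totient_pos.2 (by omega)
  rw [div_le_iff₀ hκ] at h2
  refine ⟨by positivity, ?_⟩
  calc (m:ℝ) / (m.totient * (κ * Real.log m)) ≤ m / (m.totient * 1) := by gcongr; linarith
    _ ≤ _ := by rwa [mul_one]

lemma ev_eo_dvd (β κ κ0 : ℝ) (hβ1 : β ≤ 1) (hκ : 0 < κ) (hκ1 : κ ≤ 1) (h : 0 < κ0) : ∀ᶠ m : ℕ in atTop, ∀ d : ℕ, 0 < d →
    ∑ n ∈ II β κ m with d ∣ n, eo κ m n ≤ (m:ℝ)^κ0 / d := by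
  filter_upwards [ev_eo_c κ (κ0/2) hκ (by positivity), ev_rec (κ0/2) (by positivity) 2, eventually_ge_atTop 2] with m h1 h2 hm d hd
  have hd0 : (0:ℝ) < d := by exact_mod_cast hd
  have hd1 : (1:ℝ) ≤ d := by exact_mod_cast hd
  set c := (m:ℝ) / (m.totient * (κ * Real.log m)) with hc
  have s1 : ∑ n ∈ II β κ m with d ∣ n, eo κ m n ≤ c * ∑ n ∈ II β κ m with d ∣ n, 1 / (n:ℝ) := by
    rw [Finset.mul_sum]
    refine Finset.sum_le_sum fun n _ => ?_
    unfold eo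
    rw [← hc]
    split_ifs
    · exact le_of_eq (by ring)
    · exact mul_nonneg h1.1 (by positivity)
  have s2 : ∑ n ∈ II β κ m with d ∣ n, 1 / (n:ℝ) = 1 / d * ∑ k ∈ Finset.Ioc (⌊(m:ℝ)^β⌋₊ / d) (⌊(m:ℝ)^(β+κ)⌋₊ / d), 1 / (k:ℝ) := by
    unfold II
    rw [nsum_dvd _ _ _ hd, Finset.mul_sum]
    refine Finset.sum_congr rfl fun l _ => ?_
    push_cast
    rw [one_div_mul_one_div]
  have s3 : ∑ k ∈ Finset.Ioc (⌊(m:ℝ)^β⌋₊ / d) (⌊(m:ℝ)^(β+κ)⌋₊ / d), 1 / (k:ℝ) ≤ (m:ℝ)^(κ0/2) := by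
    apply h2
    intro n hn
    rw [Finset.mem_Ioc] at hn
    refine ⟨lt_of_le_of_lt (Nat.zero_le _) hn.1, ?_⟩
    have : n ≤ ⌊(m:ℝ)^(β+κ)⌋₊ := hn.2.trans (Nat.div_le_self _ _)
    rw [Nat.le_floor_iff (by positivity)] at this
    exact this.trans (rp_mono hm (by linarith))
  calc _ ≤ c * (1 / d * (m:ℝ)^(κ0/2)) := by
        refine s1.trans ?_
        rw [s2]
        have := h1.1
        gcongr
    _ ≤ (m:ℝ)^(κ0/2) * (1 / d * (m:ℝ)^(κ0/2)) := by gcongr; exact h1.2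
    _ = (m:ℝ)^(κ0/2 + κ0/2) / d := by rw [rp_add hm]; ring
    _ = _ := by rw [add_halves]

lemma eo_Lev (β κ dd : ℝ) (hβ1 : β ≤ 1) (hκ : 0 < κ) (hκ1 : κ ≤ 1) (hdd : dd + 10 * κ < β) :
    ∀ᶠ m : ℕ in atTop, LevX 1 m κ dd (II β κ m) (eo κ m) := by
  filter_upwards [ev_eo_c κ κ hκ hκ, ev_div κ hκ 1, ev_log_le 8 κ hκ, ev_log_ge 1, eventually_ge_atTop 2] with m h1 h2 h3 hL1 hm DD cd hD
  have hm0 : (0:ℝ) < m := by positivity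
  have hφ : (0:ℝ) < m.totient := by exact_mod_cast Nat.totient_pos.2 (by omega)
  set L := Real.log m with hL
  set c := (m:ℝ) / (m.totient * (κ * L)) with hc
  have e1 : ∑ n ∈ II β κ m, eo κ m n * (∑ d ∈ DD.filter (fun d => d ∣ n), cd d) =
      ∑ d ∈ DD, cd d * ∑ n ∈ II β κ m with d ∣ n, eo κ m n := by
    have : ∀ n ∈ II β κ m, eo κ m n * (∑ d ∈ DD.filter (fun d => d ∣ n), cd d) = ∑ d ∈ DD, if d ∣ n then cd d * eo κ m n else 0 := by
      intro n _
      rw [← Finset.sum_filter, Finset.mul_sum]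
      exact Finset.sum_congr rfl fun d _ => mul_comm _ _
    rw [Finset.sum_congr rfl this, Finset.sum_comm]
    refine Finset.sum_congr rfl fun d _ => ?_
    rw [Finset.mul_sum, Finset.sum_filter]
  rw [e1, one_mul, ← Finset.sum_sub_distrib]
  refine (Finset.abs_sum_le_sum_abs _ _).trans ?_
  have hterm : ∀ d ∈ DD, |cd d * ∑ n ∈ II β κ m with d ∣ n, eo κ m n - cd d / d| ≤ (m:ℝ)^(κ + κ + κ + κ - β) := by
    intro d hd
    obtain ⟨hcop, hd0, hdm, hcd⟩ := hD d hd
    have hd0' : (0:ℝ) < d := by exact_mod_cast hd0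
    have hd1' : (1:ℝ) ≤ d := by exact_mod_cast hd0
    have a1 : ∑ n ∈ II β κ m with d ∣ n, eo κ m n = c / d * ∑ k ∈ (Finset.Ioc ⌊(m:ℝ)^β / d⌋₊ ⌊(m:ℝ)^(β+κ) / d⌋₊).filter (fun k => k.Coprime m), 1 / (k:ℝ) := by
      unfold II
      rw [nsum_dvd _ _ _ hd0, Nat.floor_div_natCast, Nat.floor_div_natCast, Finset.mul_sum, Finset.sum_filter]
      refine Finset.sum_congr rfl fun k _ => ?_
      unfold eo
      rw [← hL, ← hc]
      have : (d * k).Coprime m ↔ k.Coprime m := by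
        rw [Nat.coprime_mul_iff_left]; exact ⟨fun h => h.2, fun h => ⟨hcop, h⟩⟩
      simp only [this]
      split_ifs
      · push_cast; field_simp
      · rfl
    have hA1 : 1 ≤ (m:ℝ)^β / d := by
      rw [le_div_iff₀ hd0', one_mul]
      exact hdm.trans (rp_mono hm (by linarith))
    have a2 := cop_harm m (by omega) ((m:ℝ)^β / d) ((m:ℝ)^(β+κ) / d) hA1 (div_le_div_of_nonneg_right (rp_mono hm (by linarith)) hd0'.le)
    rw [div_div_div_cancel_right₀ hd0'.ne', ← Real.rpow_sub hm0, Real.log_rpow hm0, add_sub_cancel_left, ← hL] at a2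
    rw [a1]
    set H := ∑ k ∈ (Finset.Ioc ⌊(m:ℝ)^β / d⌋₊ ⌊(m:ℝ)^(β+κ) / d⌋₊).filter (fun k => k.Coprime m), 1 / (k:ℝ) with hH
    have a3 : cd d * (c / d * H) - cd d / d = cd d * (c / d) * (H - m.totient / m * (κ * L)) := by
      rw [hc]; field_simp
    have hlB : Real.log ((m:ℝ)^(β+κ) / d) ≤ 2 * L := by
      calc Real.log ((m:ℝ)^(β+κ) / d) ≤ Real.log ((m:ℝ)^(2:ℝ)) := by
            apply Real.log_le_log (by positivity)
            exact (div_le_self (by positivity) hd1').trans (rp_mono hm (by linarith))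
        _ = 2 * L := by rw [Real.log_rpow hm0]
    have a4 : |H - m.totient / m * (κ * L)| ≤ (m:ℝ)^κ * ((m:ℝ)^κ / ((m:ℝ)^β / d)) := by
      refine a2.trans ?_
      have hn : 2 + 2 * Real.log ((m:ℝ)^(β+κ) / d) ≤ (m:ℝ)^κ := by linarith
      have hτ := h2 m (by omega) (by rw [Real.rpow_one])
      have hn0 : 0 ≤ Real.log ((m:ℝ)^(β+κ) / d) := Real.log_nonneg (hA1.trans (div_le_div_of_nonneg_right (rp_mono hm (by linarith)) hd0'.le))
      exact mul_le_mul hτ (div_le_div_of_nonneg_right hn (by positivity)) (by positivity) (by positivity)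
    rw [a3, abs_mul, abs_mul, abs_of_nonneg (div_nonneg h1.1 hd0'.le)]
    calc |cd d| * (c / d) * |H - m.totient / m * (κ * L)| ≤ (m:ℝ)^κ * ((m:ℝ)^κ / d) * ((m:ℝ)^κ * ((m:ℝ)^κ / ((m:ℝ)^β / d))) := by
          have := h1.1
          gcongr
          exact h1.2
      _ = (m:ℝ)^(κ + κ + κ + κ - β) := by
          rw [Real.rpow_sub hm0, rp_add hm, rp_add hm, rp_add hm]
          field_simp
  have hcard : (DD.card:ℝ) ≤ (m:ℝ)^dd := by
    have : DD ⊆ Finset.Icc 1 ⌊(m:ℝ)^dd⌋₊ := by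
      intro d hd
      rw [Finset.mem_Icc, Nat.le_floor_iff (by positivity)]
      exact ⟨(hD d hd).2.1, (hD d hd).2.2.1⟩
    have := Finset.card_le_card this
    rw [Nat.card_Icc, Nat.add_sub_cancel] at this
    exact le_trans (by exact_mod_cast this) (Nat.floor_le (by positivity))
  refine (Finset.sum_le_card_nsmul _ _ _ hterm).trans ?_
  rw [nsmul_eq_mul]
  calc _ ≤ (m:ℝ)^dd * (m:ℝ)^(κ + κ + κ + κ - β) := by gcongr
    _ = (m:ℝ)^(dd + (κ + κ + κ + κ - β)) := (rp_add hm _ _).symm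
    _ ≤ _ := rp_mono hm (by linarith)

/-- number of primes whose square divides n -/
noncomputable def sqn (m : ℕ) (δ Q : ℝ) (n : ℕ) : ℝ := ∑ q ∈ prs m ((m:ℝ)^δ) ((m:ℝ)^Q), if q^2 ∣ n then 1 else 0

lemma sqn_nonneg (m : ℕ) (δ Q : ℝ) (n : ℕ) : 0 ≤ sqn m δ Q n :=
  Finset.sum_nonneg fun q _ => by split_ifs <;> norm_num

lemma sqn_le (m : ℕ) (δ Q : ℝ) (n : ℕ) (hn : n ≠ 0) : sqn m δ Q n ≤ n.divisors.card := by
  unfold sqn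
  rw [← Finset.sum_filter, Finset.sum_const, nsmul_eq_mul, mul_one]
  have : (prs m ((m:ℝ)^δ) ((m:ℝ)^Q)).filter (fun q => q^2 ∣ n) ⊆ n.divisors := by
    intro q hq
    rw [Finset.mem_filter] at hq
    rw [Nat.mem_divisors]
    exact ⟨(dvd_pow_self q two_ne_zero).trans hq.2, hn⟩
  exact_mod_cast Finset.card_le_card this

lemma sum_inv_sq (m : ℕ) (hm : 2 ≤ m) (δ Q : ℝ) (hδ : 0 ≤ δ) : ∑ q ∈ prs m ((m:ℝ)^δ) ((m:ℝ)^Q), 1 / (q:ℝ)^2 ≤ 2 * (m:ℝ)^(-δ) := by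
  have hX : 1 ≤ (m:ℝ)^δ := Real.one_le_rpow (by exact_mod_cast (by omega : 1 ≤ m)) hδ
  have hf : 1 ≤ ⌊(m:ℝ)^δ⌋₊ := Nat.one_le_floor_iff _ |>.2 hX
  have key : ∀ a b : ℕ, 1 ≤ a → ∑ q ∈ Finset.Ioc a b, 1 / (q:ℝ)^2 ≤ 1 / (a:ℝ) := by
    intro a b ha
    have : ∀ b, a ≤ b → ∑ q ∈ Finset.Ioc a b, 1 / (q:ℝ)^2 ≤ 1 / (a:ℝ) - 1 / (b:ℝ) := by
      intro b hb
      induction b, hb using Nat.le_induction with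
      | base => simp
      | succ b hb ih =>
        rw [Finset.sum_Ioc_succ_top (by omega)]
        have hb0 : (0:ℝ) < b := by exact_mod_cast (by omega : 0 < b)
        have : 1 / ((b+1:ℕ):ℝ)^2 ≤ 1 / (b:ℝ) - 1 / ((b+1:ℕ):ℝ) := by
          push_cast
          rw [div_sub_div _ _ (by positivity) (by positivity), div_le_div_iff₀ (by positivity) (by positivity)]
          nlinarith
        linarith
    by_cases hab : a ≤ b
    · have h1 := this b hab
      have : (0:ℝ) ≤ 1 / (b:ℝ) := by positivity
      linarith
    · rw [Finset.Ioc_eq_empty (by omega), Finset.sum_empty]; positivity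
  have h1 : ∑ q ∈ prs m ((m:ℝ)^δ) ((m:ℝ)^Q), 1 / (q:ℝ)^2 ≤ 1 / (⌊(m:ℝ)^δ⌋₊ : ℝ) := by
    refine le_trans (Finset.sum_le_sum_of_subset_of_nonneg (Finset.filter_subset _ _) fun _ _ _ => by positivity) (key _ _ hf)
  refine h1.trans ?_
  rw [Real.rpow_neg (by positivity), ← div_eq_mul_inv, div_le_div_iff₀ (by exact_mod_cast hf) (by linarith)]
  have := Nat.lt_floor_add_one ((m:ℝ)^δ)
  have : (1:ℝ) ≤ ⌊(m:ℝ)^δ⌋₊ := by exact_mod_cast hf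
  linarith

lemma Hsq_K (α β κ δ Q K : ℝ) (hβ1 : β ≤ 1) (hβ : 0 ≤ β) (hκ : 0 < κ) (hκ1 : κ ≤ 1) (hδ : 0 < δ) (hδκ : δ ≤ κ/2) (hK : 0 < K)
    (hKb : ∀ᶠ m : ℕ in atTop, ∀ (a0 : (ZMod m)ˣ) (Φ : ℕ → ℝ), (∀ n ∈ II β κ m, 0 ≤ Φ n ∧ Φ n ≤ (m:ℝ)^κ) →
      ∑ n ∈ II β κ m, uu α β κ m a0 n * Φ n ≤ K * ∑ n ∈ II β κ m, eo κ m n * Φ n + (m:ℝ)^(-(κ/2))) :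
    ∀ᶠ m : ℕ in atTop, ∀ a0 : (ZMod m)ˣ, ∑ n ∈ II β κ m, uu α β κ m a0 n * sqn m δ Q n ≤ (m:ℝ)^(-(δ/2)) := by
  filter_upwards [hKb, ev_div κ hκ 2, ev_eo_dvd β κ (δ/4) hβ1 hκ hκ1 (by positivity), ev_const_le (K * 2 + 1) (δ/4) (by positivity), eventually_ge_atTop 2] with m h1 h2 h3 h4 hm a0
  have hm0 : (0:ℝ) < m := by positivity
  have b1 := h1 a0 (sqn m δ Q) (by
    intro n hn
    rw [mem_II] at hn
    have hn0 : n ≠ 0 := by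
      rintro rfl
      have := rp_pos hm β
      simp at hn; linarith [hn.1]
    exact ⟨sqn_nonneg _ _ _ _, (sqn_le _ _ _ _ hn0).trans (h2 n hn0 (hn.2.trans (rp_mono hm (by linarith))))⟩)
  have b2 : ∑ n ∈ II β κ m, eo κ m n * sqn m δ Q n ≤ (m:ℝ)^(δ/4) * (2 * (m:ℝ)^(-δ)) := by
    have e : ∑ n ∈ II β κ m, eo κ m n * sqn m δ Q n = ∑ q ∈ prs m ((m:ℝ)^δ) ((m:ℝ)^Q), ∑ n ∈ II β κ m with q^2 ∣ n, eo κ m n := by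
      have : ∀ n ∈ II β κ m, eo κ m n * sqn m δ Q n = ∑ q ∈ prs m ((m:ℝ)^δ) ((m:ℝ)^Q), if q^2 ∣ n then eo κ m n else 0 := by
        intro n _
        unfold sqn
        rw [Finset.mul_sum]
        refine Finset.sum_congr rfl fun q _ => ?_
        split_ifs <;> simp
      rw [Finset.sum_congr rfl this, Finset.sum_comm]
      refine Finset.sum_congr rfl fun q _ => ?_
      rw [Finset.sum_filter]
    rw [e]
    calc _ ≤ ∑ q ∈ prs m ((m:ℝ)^δ) ((m:ℝ)^Q), (m:ℝ)^(δ/4) * (1 / (q:ℝ)^2) := by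
          refine Finset.sum_le_sum fun q hq => ?_
          rw [mem_prs (by positivity) (by positivity)] at hq
          have := h3 (q^2) (by have := hq.2.1.pos; positivity)
          push_cast at this
          rw [mul_one_div]; exact this
      _ ≤ _ := by
          rw [← Finset.mul_sum]
          gcongr
          exact sum_inv_sq m hm δ Q hδ.le
  calc _ ≤ K * ((m:ℝ)^(δ/4) * (2 * (m:ℝ)^(-δ))) + (m:ℝ)^(-(κ/2)) := by
        refine b1.trans ?_
        gcongr
    _ ≤ (K * 2) * (m:ℝ)^(-(3*δ/4)) + 1 * (m:ℝ)^(-(3*δ/4)) := by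
        have e1 : K * ((m:ℝ)^(δ/4) * (2 * (m:ℝ)^(-δ))) = (K * 2) * (m:ℝ)^(-(3*δ/4)) := by
          have : (m:ℝ)^(-(3*δ/4)) = (m:ℝ)^(δ/4) * (m:ℝ)^(-δ) := by rw [← rp_add hm]; congr 1; ring
          rw [this]; ring
        have e2 : (m:ℝ)^(-(κ/2)) ≤ (m:ℝ)^(-(3*δ/4)) := rp_mono hm (by linarith)
        rw [e1]; linarith
    _ = (K * 2 + 1) * (m:ℝ)^(-(3*δ/4)) := by ring
    _ ≤ (m:ℝ)^(δ/4) * (m:ℝ)^(-(3*δ/4)) := by gcongr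
    _ = _ := by rw [← rp_add hm]; congr 1; ring

lemma Hsq_X (α β κ δ Q : ℝ) (hα : 0 < α) (hα1 : α ≤ 1) (hβ : 0 ≤ β) (hβ1 : β ≤ 1) (hκ : 0 < κ) (hκ1 : κ ≤ 1)
    (hδ : 0 < δ) (hδκ : δ ≤ κ/2) (hQ : 0 ≤ Q)
    (h1 : 3 * Q + 100 * κ < α + 2 * β - 2) (h2 : Q + 100 * κ < 2 * α + 2 * β - 3) :
    ∀ᶠ m : ℕ in atTop, ∀ a0 : (ZMod m)ˣ, ∑ n ∈ II β κ m, uu α β κ m a0 n * sqn m δ Q n ≤ (m:ℝ)^(-(δ/2)) := by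
  filter_upwards [uu_lev α β κ (2*Q) Q hα hα1 hβ hβ1 hκ hκ1 hQ (by linarith) (by linarith) h2, ev_const_le 3 (δ/4) (by positivity), eventually_ge_atTop 2] with m h3 h4 hm a0
  set P := prs m ((m:ℝ)^δ) ((m:ℝ)^Q) with hP
  have inj : Set.InjOn (fun q : ℕ => q^2) (P : Set ℕ) := fun a _ b _ h => Nat.pow_left_injective two_ne_zero h
  have hmem : ∀ q ∈ P, ((m:ℝ)^δ < q ∧ (q:ℝ) ≤ (m:ℝ)^Q) ∧ q.Prime ∧ ¬ q ∣ m := fun q hq => (mem_prs (by positivity) (by positivity)).1 hq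
  have b := h3 a0 (P.image (fun q => q^2)) (fun _ => 1) (by
    intro d hd
    rw [Finset.mem_image] at hd
    obtain ⟨q, hq, rfl⟩ := hd
    obtain ⟨⟨_, q2⟩, q3, q4⟩ := hmem q hq
    refine ⟨((q3.coprime_iff_not_dvd).2 q4).pow_left 2, by have := q3.pos; positivity, ?_, ?_⟩
    · push_cast
      calc (q:ℝ)^2 ≤ ((m:ℝ)^Q)^2 := by gcongr
        _ = _ := by rw [← Real.rpow_natCast, ← Real.rpow_mul (by positivity)]; congr 1; push_cast; ring
    · simp; exact Real.one_le_rpow (by exact_mod_cast (by omega : 1 ≤ m)) hκ.le) (by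
    refine le_trans (Nat.cast_le.2 Finset.card_image_le) ?_
    have : P ⊆ Finset.Icc 1 ⌊(m:ℝ)^Q⌋₊ := by
      intro d hd
      rw [Finset.mem_Icc, Nat.le_floor_iff (by positivity)]
      exact ⟨(hmem d hd).2.1.pos, (hmem d hd).1.2⟩
    have := Finset.card_le_card this
    rw [Nat.card_Icc, Nat.add_sub_cancel] at this
    exact le_trans (by exact_mod_cast this) (Nat.floor_le (by positivity)))
  have e1 : ∀ n ∈ II β κ m, uu α β κ m a0 n * ∑ d ∈ (P.image (fun q => q^2)).filter (fun d => d ∣ n), (1:ℝ) = uu α β κ m a0 n * sqn m δ Q n := by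
    intro n _
    unfold sqn
    rw [Finset.sum_filter, Finset.sum_image inj]
  rw [Finset.sum_congr rfl e1, Finset.sum_image inj] at b
  have e2 : ∑ q ∈ P, 1 / ((q^2 : ℕ) : ℝ) ≤ 2 * (m:ℝ)^(-δ) := by
    push_cast
    exact sum_inv_sq m hm δ Q hδ.le
  have e3 : (m:ℝ)^(-(κ/2)) ≤ (m:ℝ)^(-δ) := rp_mono hm (by linarith)
  have b' := (abs_le.1 b).2
  calc _ ≤ 3 * (m:ℝ)^(-δ) := by linarith
    _ ≤ (m:ℝ)^(δ/4) * (m:ℝ)^(-δ) := by gcongr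
    _ = (m:ℝ)^(δ/4 + -δ) := (rp_add hm _ _).symm
    _ ≤ _ := rp_mono hm (by linarith)
end

section
open Filter Topology

lemma seg_le {C : ℝ} (h : ∀ m : ℕ, ∀ A B : ℝ, 1 ≤ A → A ≤ B → ∑ p ∈ prs m A B, Real.log p / p ≤ Real.log (B / A) + C)
    (m : ℕ) (A B a : ℝ) (hA : 1 ≤ A) (hAB : A ≤ B) (ha : 0 < a) (haq : ∀ q ∈ prs m A B, a ≤ Real.log q) :
    ∑ q ∈ prs m A B, 1 / (q:ℝ) ≤ (Real.log (B / A) + C) / a := by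
  rw [le_div_iff₀ ha, Finset.sum_mul]
  refine le_trans (Finset.sum_le_sum fun q hq => ?_) (h m A B hA hAB)
  have := haq q hq
  rw [div_mul_eq_mul_div, one_mul]
  gcongr

lemma pinv_small (η : ℝ) (hη : 0 < η) : ∀ᶠ m : ℕ in atTop,
    Real.sqrt (Real.log m) * ∑ q ∈ prs m 1 ((m:ℝ)^(2:ℝ)), 1 / (q:ℝ) ≤ η * Real.log m := by
  obtain ⟨C, hC, h⟩ := plog_upper
  filter_upwards [ev_log_ge 1, ev_log_ge ((((5 + 4 * C)/η)^2) ^ 3), eventually_ge_atTop 2] with m hL1 hL2 hm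
  have hm0 : (0:ℝ) < m := by positivity
  set L := Real.log m with hL
  set w := L^((1:ℝ)/3) with hw
  have hw3 : w^3 = L := by
    rw [hw, ← Real.rpow_natCast, ← Real.rpow_mul (by linarith)]; norm_num
  have hw1 : 1 ≤ w := Real.one_le_rpow hL1 (by norm_num)
  have hwη : ((5 + 4 * C)/η)^2 ≤ w := by
    rw [← hw3] at hL2
    exact le_of_pow_le_pow_left₀ three_ne_zero (by linarith) hL2
  have hw12 : w ≤ w^2 := by nlinarith
  have hw23 : w^2 ≤ 2 * w^3 := by nlinarith [pow_pos (by linarith : 0 < w) 2]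
  have hmexp : (m:ℝ)^(2:ℝ) = Real.exp (2 * w^3) := by
    rw [Real.rpow_def_of_pos hm0, hw3, mul_comm]
  have s1 := seg_le h m 1 (Real.exp w) (1/2) le_rfl (Real.one_le_exp (by linarith)) (by norm_num) (by
    intro q hq
    rw [mem_prs (by norm_num) (by positivity)] at hq
    have h2 : (2:ℝ) ≤ q := by exact_mod_cast hq.2.1.two_le
    have := Real.log_le_log (by norm_num) h2
    linarith [Real.log_two_gt_d9])
  have s2 := seg_le h m (Real.exp w) (Real.exp (w^2)) w (Real.one_le_exp (by linarith)) (Real.exp_le_exp.2 hw12) (by linarith) (by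
    intro q hq
    rw [mem_prs (by positivity) (by positivity)] at hq
    exact (Real.le_log_iff_exp_le (by exact_mod_cast hq.2.1.pos)).2 hq.1.1.le)
  have s3 := seg_le h m (Real.exp (w^2)) (Real.exp (2*w^3)) (w^2) (Real.one_le_exp (by positivity)) (Real.exp_le_exp.2 hw23) (by positivity) (by
    intro q hq
    rw [mem_prs (by positivity) (by positivity)] at hq
    exact (Real.le_log_iff_exp_le (by exact_mod_cast hq.2.1.pos)).2 hq.1.1.le)
  rw [div_one, Real.log_exp] at s1
  rw [← Real.exp_sub, Real.log_exp] at s2 s3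
  have e : ∑ q ∈ prs m 1 ((m:ℝ)^(2:ℝ)), 1 / (q:ℝ) ≤ (5 + 4 * C) * w := by
    rw [hmexp, prs_union (Real.one_le_exp (by linarith : 0 ≤ w)) (Real.exp_le_exp.2 (hw12.trans hw23)),
      prs_union (Real.exp_le_exp.2 hw12) (Real.exp_le_exp.2 hw23)]
    have t1 : (w + C) / (1/2) ≤ 2 * w + 2 * C * w := by
      rw [div_le_iff₀ (by norm_num)]; nlinarith
    have t2 : (w^2 - w + C) / w ≤ w + C * w := by
      rw [div_le_iff₀ (by linarith)]; nlinarith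
    have t3 : (2 * w^3 - w^2 + C) / w^2 ≤ 2 * w + C * w := by
      rw [div_le_iff₀ (by positivity)]
      have : C ≤ C * w * w^2 := by
        have : 1 ≤ w * w^2 := one_le_mul_of_one_le_of_one_le hw1 (one_le_pow₀ hw1)
        nlinarith
      nlinarith
    linarith
  have hs : Real.sqrt L ≤ η / (5 + 4 * C) * w^2 := by
    rw [Real.sqrt_le_iff]
    refine ⟨by positivity, ?_⟩
    have : ((5 + 4 * C)/η)^2 * (η / (5 + 4 * C))^2 = 1 := by
      rw [← mul_pow]; field_simp
    rw [← hw3]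
    have h4 : (η / (5 + 4 * C) * w^2)^2 = (η / (5 + 4 * C))^2 * w * w^3 := by ring
    rw [h4]
    have : 1 ≤ (η / (5 + 4 * C))^2 * w := by
      rw [← this, mul_comm]; gcongr
    nlinarith [pow_pos (by linarith : 0 < w) 3]
  calc _ ≤ (η / (5 + 4 * C) * w^2) * ((5 + 4 * C) * w) := by gcongr
    _ = η * w^3 := by field_simp
    _ = _ := by rw [hw3]

lemma tot_ratio (m q : ℕ) (hm : 0 < m) (hq : q.Prime) (hqm : ¬ q ∣ m) :
    ((m*q : ℕ).totient : ℝ) / ((m*q : ℕ):ℝ) ≤ m.totient / m := by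
  have hc : m.Coprime q := ((hq.coprime_iff_not_dvd).2 hqm).symm
  rw [Nat.totient_mul hc, Nat.totient_prime hq]
  have hm0 : (0:ℝ) < m := by exact_mod_cast hm
  have hq0 : (0:ℝ) < q := by exact_mod_cast hq.pos
  push_cast
  rw [div_le_div_iff₀ (by positivity) hm0]
  have : ((q-1:ℕ):ℝ) ≤ q := by exact_mod_cast Nat.sub_le q 1
  have h0 : (0:ℝ) ≤ m.totient := by positivity
  nlinarith [mul_nonneg h0 hm0.le]

lemma Zq_bound : ∃ C : ℝ, 0 < C ∧ ∀ᶠ m : ℕ in atTop, ∀ q : ℕ, q.Prime → ¬ q ∣ m → (q:ℝ) ≤ (m:ℝ)^(2:ℝ) → ∀ R : ℝ, 1 ≤ R → R ≤ m →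
    ∑ k ∈ sqc (m*q) R, (Yq (YR R) q k)^2 / (k.totient:ℝ) ≤ (m.totient / m : ℝ) * (min (Real.log q) (Real.log R) + C * Real.sqrt (Real.log m)) := by
  obtain ⟨C, hC, h⟩ := GG_asymp
  refine ⟨C, hC, ?_⟩
  filter_upwards [h, eventually_ge_atTop 2] with m h1 hm q hq hqm hqm2 R hR hRm
  have hm0 : (0:ℝ) < m := by positivity
  have hm1 : (1:ℝ) ≤ m := by exact_mod_cast (by omega : 1 ≤ m)
  have hq0 : (0:ℝ) < q := by exact_mod_cast hq.pos
  have hq1 : (1:ℝ) ≤ q := by exact_mod_cast hq.one_le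
  have hMq : m * q ≠ 0 := Nat.mul_ne_zero (by omega) hq.ne_zero
  have hMle : ((m*q:ℕ):ℝ) ≤ (m:ℝ)^(20:ℝ) := by
    push_cast
    calc (m:ℝ) * q ≤ (m:ℝ)^(1:ℝ) * (m:ℝ)^(2:ℝ) := by rw [Real.rpow_one]; gcongr
      _ = (m:ℝ)^(1+2:ℝ) := (rp_add hm _ _).symm
      _ ≤ _ := rp_mono hm (by norm_num)
  have hR2 : R ≤ (m:ℝ)^(2:ℝ) := hRm.trans (by have := rp_mono hm (show (1:ℝ) ≤ 2 by norm_num); rwa [Real.rpow_one] at this)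
  have hφ : (0:ℝ) < (m*q).totient := by exact_mod_cast Nat.totient_pos.2 (Nat.pos_of_ne_zero hMq)
  have hMq0 : (0:ℝ) < ((m*q:ℕ):ℝ) := by exact_mod_cast Nat.pos_of_ne_zero hMq
  set ρ := ((m*q:ℕ):ℝ) / (m*q).totient with hρ
  have hρ0 : 0 < ρ := by positivity
  have hratio := tot_ratio m q (by omega) hq hqm
  have hfin : ∀ S T : ℝ, 0 ≤ T → S * ρ ≤ T → S ≤ (m.totient / m : ℝ) * T := by
    intro S T hT hS
    have h3 : S ≤ (((m*q : ℕ).totient : ℝ) / ((m*q : ℕ):ℝ)) * T := by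
      have : ((m*q : ℕ).totient : ℝ) / ((m*q : ℕ):ℝ) = 1 / ρ := by rw [hρ]; field_simp
      rw [this, one_div_mul_eq_div, le_div_iff₀ hρ0]; exact hS
    exact h3.trans (mul_le_mul_of_nonneg_right hratio hT)
  have g1 := (h1 (m*q) hMq hMle R hR hR2)
  have hval : ∀ k ∈ sqc (m*q) R, Yq (YR R) q k = if (k:ℝ) ≤ R / q then 0 else 1 := by
    intro k hk
    rw [mem_sqc (by linarith)] at hk
    simp only [Yq, YR]
    rw [if_pos hk.2.1]
    push_cast
    simp only [← le_div_iff₀ hq0]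
    split_ifs <;> norm_num
  have hs0 : 0 ≤ Real.sqrt (Real.log m) := Real.sqrt_nonneg _
  have hlR : 0 ≤ Real.log R := Real.log_nonneg hR
  have hlq : 0 ≤ Real.log q := Real.log_nonneg hq1
  have bA : ∑ k ∈ sqc (m*q) R, (Yq (YR R) q k)^2 / (k.totient:ℝ) ≤ (m.totient / m : ℝ) * (Real.log R + C * Real.sqrt (Real.log m)) := by
    have : ∑ k ∈ sqc (m*q) R, (Yq (YR R) q k)^2 / (k.totient:ℝ) ≤ GG (m*q) R := by
      unfold GG
      refine Finset.sum_le_sum fun k hk => ?_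
      rw [hval k hk]
      gcongr
      split_ifs <;> norm_num
    exact this.trans (hfin _ _ (by positivity) g1.2)
  by_cases hqR : (q:ℝ) ≤ R
  · rw [min_eq_left (Real.log_le_log hq0 hqR)]
    have hRq : 1 ≤ R / q := by rwa [le_div_iff₀ hq0, one_mul]
    have hRq' : R / q ≤ R := div_le_self (by linarith) hq1
    have g2 := (h1 (m*q) hMq hMle (R/q) hRq (hRq'.trans hR2)).1
    have hsub : sqc (m*q) (R/q) ⊆ sqc (m*q) R := by
      intro k hk
      rw [mem_sqc (by positivity)] at hk ⊢
      exact ⟨hk.1, hk.2.1.trans hRq', hk.2.2⟩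
    have e1 : ∑ k ∈ sqc (m*q) R, (Yq (YR R) q k)^2 / (k.totient:ℝ) = GG (m*q) R - GG (m*q) (R/q) := by
      unfold GG
      rw [eq_sub_iff_add_eq, ← Finset.sum_sdiff hsub, ← Finset.sum_sdiff hsub]
      have z : ∑ k ∈ sqc (m*q) (R/q), (Yq (YR R) q k)^2 / (k.totient:ℝ) = 0 := by
        refine Finset.sum_eq_zero fun k hk => ?_
        rw [hval k (hsub hk), if_pos ((mem_sqc (by positivity)).1 hk).2.1]; simp
      rw [z, add_zero]
      congr 1
      refine Finset.sum_congr rfl fun k hk => ?_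
      rw [Finset.mem_sdiff] at hk
      rw [hval k hk.1, if_neg, one_pow]
      intro hle
      apply hk.2
      have := (mem_sqc (by linarith)).1 hk.1
      exact (mem_sqc (by positivity)).2 ⟨this.1, hle, this.2.2⟩
    rw [e1]
    apply hfin _ _ (by positivity)
    rw [sub_mul]
    rw [Real.log_div (by linarith) hq0.ne'] at g2
    linarith [g1.2]
  · rw [min_eq_right (Real.log_le_log (by linarith) (by linarith))]
    exact bA
end

section
open Filter Topology

lemma Zsum_bound (η : ℝ) (hη : 0 < η) : ∀ᶠ m : ℕ in atTop, ∀ R : ℝ, 1 ≤ R → R ≤ m → ∀ (Q : Finset ℕ) (w : ℕ → ℝ),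
    Q ⊆ prs m 1 ((m:ℝ)^(2:ℝ)) → (∀ q ∈ Q, 0 ≤ w q ∧ w q ≤ 1) →
    ∑ q ∈ Q, w q / (q:ℝ) * ∑ k ∈ sqc (m*q) R, (Yq (YR R) q k)^2 / (k.totient:ℝ) ≤
      (m.totient / m : ℝ) * (∑ q ∈ Q, w q / q * min (Real.log q) (Real.log R) + η * Real.log m) := by
  obtain ⟨C, hC, h⟩ := Zq_bound
  filter_upwards [h, pinv_small (η/C) (by positivity), eventually_ge_atTop 2] with m h1 h2 hm R hR hRm Q w hQ hw
  have hmem : ∀ q ∈ Q, ((1:ℝ) < q ∧ (q:ℝ) ≤ (m:ℝ)^(2:ℝ)) ∧ q.Prime ∧ ¬ q ∣ m := fun q hq =>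
    (mem_prs (by norm_num) (by positivity)).1 (hQ hq)
  set s := Real.sqrt (Real.log m) with hs
  have hs0 : 0 ≤ s := Real.sqrt_nonneg _
  calc _ ≤ ∑ q ∈ Q, ((m.totient / m : ℝ) * (w q / q * min (Real.log q) (Real.log R)) + (m.totient / m : ℝ) * (C * (s * (1 / q)))) := by
        refine Finset.sum_le_sum fun q hq => ?_
        obtain ⟨⟨a1, a2⟩, a3, a4⟩ := hmem q hq
        obtain ⟨w0, w1⟩ := hw q hq
        have b := h1 q a3 a4 a2 R hR hRm
        have hq0 : (0:ℝ) < q := by linarith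
        calc _ ≤ w q / (q:ℝ) * ((m.totient / m : ℝ) * (min (Real.log q) (Real.log R) + C * s)) := by gcongr
          _ = (m.totient / m : ℝ) * (w q / q * min (Real.log q) (Real.log R)) + (m.totient / m : ℝ) * (C * (s * (w q / q))) := by ring
          _ ≤ _ := by gcongr
    _ = (m.totient / m : ℝ) * (∑ q ∈ Q, w q / q * min (Real.log q) (Real.log R) + C * (s * ∑ q ∈ Q, 1 / (q:ℝ))) := by
        rw [Finset.sum_add_distrib, ← Finset.mul_sum, ← Finset.mul_sum, ← Finset.mul_sum, ← Finset.mul_sum]; ring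
    _ ≤ _ := by
        have : s * ∑ q ∈ Q, 1 / (q:ℝ) ≤ s * ∑ q ∈ prs m 1 ((m:ℝ)^(2:ℝ)), 1 / (q:ℝ) := by
          gcongr
        have h3 : C * (s * ∑ q ∈ Q, 1 / (q:ℝ)) ≤ η * Real.log m := by
          calc _ ≤ C * (η / C * Real.log m) := mul_le_mul_of_nonneg_left (this.trans h2) hC.le
            _ = _ := by field_simp
        gcongr

lemma seg_w (r y a b η : ℝ) (hr : 0 < r) (hy : 0 < y) (ha : 0 < a) (hab : a ≤ b) (hη : 0 < η) : ∀ᶠ m : ℕ in atTop,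
    ∑ q ∈ prs m ((m:ℝ)^(a*r)) ((m:ℝ)^(b*r)), (1 - Real.log q / (y * (r * Real.log m))) / (q:ℝ) ≤ Real.log (b/a) - (b-a)/y + η := by
  obtain ⟨C, hC, h⟩ := plog_lower
  filter_upwards [h (a*r) (by positivity), pinv_asymp (a*r) (b*r) (η/2) (by positivity) (by gcongr) (by positivity),
    ev_log_ge (C / (y * r * (η/2)) + 1), eventually_ge_atTop 2] with m h1 h2 h3 hm
  have hm0 : (0:ℝ) < m := by positivity
  set L := Real.log m with hL
  have hpos : 0 < C / (y * r * (η/2)) := by positivity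
  have hL0 : 0 < L := by linarith
  have h1' := h1 ((m:ℝ)^(a*r)) ((m:ℝ)^(b*r)) le_rfl (rp_mono hm (by gcongr))
  rw [← Real.rpow_sub hm0, Real.log_rpow hm0, ← hL] at h1'
  rw [mul_div_mul_right _ _ hr.ne'] at h2
  have h2' := (abs_le.1 h2).2
  have e : ∀ q ∈ prs m ((m:ℝ)^(a*r)) ((m:ℝ)^(b*r)), (1 - Real.log q / (y * (r * L))) / (q:ℝ) = 1 / (q:ℝ) - (1 / (y * (r * L))) * (Real.log q / q) := by
    intro q _; ring
  rw [Finset.sum_congr rfl e, Finset.sum_sub_distrib, ← Finset.mul_sum]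
  have k1 : (1 / (y * (r * L))) * ((b * r - a * r) * L - C) ≤ (1 / (y * (r * L))) * ∑ q ∈ prs m ((m:ℝ)^(a*r)) ((m:ℝ)^(b*r)), Real.log q / (q:ℝ) := by gcongr
  have k2 : (1 / (y * (r * L))) * ((b * r - a * r) * L - C) = (b-a)/y - C / (y * r) / L := by field_simp
  have k3 : C / (y * r) / L ≤ η/2 := by
    rw [div_le_iff₀ hL0]
    have : C / (y * r * (η/2)) ≤ L := by linarith
    rw [div_le_iff₀ (by positivity)] at this
    rw [div_le_iff₀ (by positivity)]
    linarith
  linarith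

noncomputable def Elow (y1 y : ℝ) : ℝ := 1 - 1/(4*y) + Real.log y1 - (y1-1)/y
noncomputable def Ehigh (y1 y : ℝ) : ℝ := Real.log (y/y1) - 1 + y1/y

lemma Elow_nonneg (y1 y : ℝ) (h1 : 1 ≤ y1) (h2 : y1 ≤ y) : 0 ≤ Elow y1 y := by
  unfold Elow
  have a := Real.one_sub_inv_le_log_of_pos (by linarith : 0 < y1)
  have b : 1/(4*y) ≤ 1 := by rw [div_le_one (by linarith)]; linarith
  have c : (y1-1)/y ≤ 1 - y1⁻¹ := by
    have : 1 - y1⁻¹ = (y1 - 1)/y1 := by field_simp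
    rw [this]
    exact div_le_div_of_nonneg_left (by linarith) (by linarith) h2
  linarith

lemma Ehigh_nonneg (y1 y : ℝ) (h1 : 1 ≤ y1) (h2 : y1 ≤ y) : 0 ≤ Ehigh y1 y := by
  unfold Ehigh
  have a := Real.one_sub_inv_le_log_of_pos (div_pos (by linarith : 0 < y) (by linarith : 0 < y1))
  rw [inv_div] at a
  linarith

noncomputable def wM (r y : ℝ) (m q : ℕ) : ℝ := 1 - Real.log q / (y * (r * Real.log m))

lemma low_sum (r y1 y η : ℝ) (hr : 0 < r) (h1 : 1 ≤ y1) (h2 : y1 ≤ y) (hη : 0 < η) : ∀ᶠ m : ℕ in atTop,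
    ∑ q ∈ prs m 1 ((m:ℝ)^(y1*r)), wM r y m q / q * min (Real.log q) (Real.log ((m:ℝ)^r)) ≤ (r * Real.log m) * (Elow y1 y + η) := by
  obtain ⟨C, hC, h⟩ := plog_upper
  filter_upwards [seg_w r y 1 y1 (η/2) hr (by linarith) one_pos h1 (by positivity), ev_log_ge (2 * C / (r * (η/2)) + 1), eventually_ge_atTop 2] with m h3 h4 hm
  have hm0 : (0:ℝ) < m := by positivity
  have hm1 : (1:ℝ) ≤ m := by exact_mod_cast (by omega : 1 ≤ m)
  have hy : 0 < y := by linarith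
  set L := Real.log m with hL
  have hpos : 0 < 2 * C / (r * (η/2)) := by positivity
  have hL0 : 0 < L := by linarith
  have hrL : 0 < r * L := by positivity
  rw [Real.log_rpow hm0, ← hL]
  have o1 : 1 ≤ (m:ℝ)^(r/2) := Real.one_le_rpow hm1 (by positivity)
  have o2 : (m:ℝ)^(r/2) ≤ (m:ℝ)^r := rp_mono hm (by linarith)
  have o3 : (m:ℝ)^r ≤ (m:ℝ)^(y1*r) := rp_mono hm (by nlinarith)
  rw [prs_union o1 (o2.trans o3), prs_union o2 o3]
  have a1 := h m 1 _ le_rfl o1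
  have a2 := h m _ _ o1 o2
  rw [div_one, Real.log_rpow hm0, ← hL] at a1
  rw [← Real.rpow_sub hm0, Real.log_rpow hm0, ← hL] at a2
  have b1 : ∑ q ∈ prs m 1 ((m:ℝ)^(r/2)), wM r y m q / q * min (Real.log q) (r * L) ≤ r/2 * L + C := by
    refine le_trans (Finset.sum_le_sum fun q hq => ?_) a1
    rw [mem_prs (by norm_num) (by positivity)] at hq
    have hq0 : (0:ℝ) < q := by linarith [hq.1.1]
    have hlq : 0 < Real.log q := Real.log_pos hq.1.1
    have hw : wM r y m q ≤ 1 := by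
      unfold wM; have : 0 ≤ Real.log q / (y * (r * L)) := by positivity
      linarith
    calc wM r y m q / q * min (Real.log q) (r * L) ≤ 1 / q * min (Real.log q) (r * L) := by
          have : 0 ≤ min (Real.log q) (r * L) := le_min hlq.le hrL.le
          gcongr
      _ ≤ 1 / q * Real.log q := by gcongr; exact min_le_left _ _
      _ = _ := by ring
  have b2 : ∑ q ∈ prs m ((m:ℝ)^(r/2)) ((m:ℝ)^r), wM r y m q / q * min (Real.log q) (r * L) ≤ (1 - 1/(2*y)) * ((r - r/2) * L + C) := by
    have y2 : 0 ≤ 1 - 1/(2*y) := by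
      have : 1/(2*y) ≤ 1 := by rw [div_le_one (by linarith)]; linarith
      linarith
    refine le_trans ?_ (mul_le_mul_of_nonneg_left a2 y2)
    rw [Finset.mul_sum]
    refine Finset.sum_le_sum fun q hq => ?_
    rw [mem_prs (by positivity) (by positivity)] at hq
    have hq0 : (0:ℝ) < q := by linarith [hq.1.1]
    have hlq : r/2 * L ≤ Real.log q := by
      have := Real.log_le_log (by positivity) hq.1.1.le
      rwa [Real.log_rpow hm0] at this
    have hlq0 : 0 < Real.log q := lt_of_lt_of_le (by positivity) hlq
    have hw : wM r y m q ≤ 1 - 1/(2*y) := by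
      unfold wM; have : 1/(2*y) ≤ Real.log q / (y * (r * L)) := by
        rw [div_le_div_iff₀ (by positivity) (by positivity)]; nlinarith
      linarith
    calc wM r y m q / q * min (Real.log q) (r * L) ≤ (1 - 1/(2*y)) / q * min (Real.log q) (r * L) := by
          have : 0 ≤ min (Real.log q) (r * L) := le_min hlq0.le hrL.le
          gcongr
      _ ≤ (1 - 1/(2*y)) / q * Real.log q := by gcongr; exact min_le_left _ _
      _ = _ := by ring
  have b3 : ∑ q ∈ prs m ((m:ℝ)^r) ((m:ℝ)^(y1*r)), wM r y m q / q * min (Real.log q) (r * L) ≤ (r * L) * (Real.log (y1/1) - (y1-1)/y + η/2) := by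
    rw [one_mul] at h3
    refine le_trans (le_of_eq ?_) (mul_le_mul_of_nonneg_left h3 hrL.le)
    rw [Finset.mul_sum]
    refine Finset.sum_congr rfl fun q hq => ?_
    rw [mem_prs (by positivity) (by positivity)] at hq
    have hlq : r * L ≤ Real.log q := by
      have := Real.log_le_log (by positivity) hq.1.1.le
      rwa [Real.log_rpow hm0] at this
    rw [min_eq_right hlq]; unfold wM; ring
  rw [div_one] at b3
  have k : 2 * C ≤ r * L * (η/2) := by
    have : 2 * C / (r * (η/2)) ≤ L := by linarith
    rw [div_le_iff₀ (by positivity)] at this; linarith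
  have k2 : (1 - 1/(2*y)) * ((r - r/2) * L + C) ≤ r/2 * L - r * L * (1/(4*y)) + C := by
    have : 0 ≤ 1/(2*y) * C := by positivity
    have e : (1 - 1/(2*y)) * ((r - r/2) * L + C) = r/2 * L - r * L * (1/(4*y)) + C - 1/(2*y) * C := by field_simp; ring
    linarith
  unfold Elow
  nlinarith

lemma high_sum (r y1 y η : ℝ) (hr : 0 < r) (h1 : 1 ≤ y1) (h2 : y1 ≤ y) (hη : 0 < η) : ∀ᶠ m : ℕ in atTop,
    ∑ q ∈ prs m ((m:ℝ)^(y1*r)) ((m:ℝ)^(y*r)), wM r y m q / q * min (Real.log q) (Real.log ((m:ℝ)^r)) ≤ (r * Real.log m) * (Ehigh y1 y + η) := by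
  filter_upwards [seg_w r y y1 y η hr (by linarith) (by linarith) h2 hη, eventually_ge_atTop 2] with m h3 hm
  have hm0 : (0:ℝ) < m := by positivity
  have hm1 : (1:ℝ) < m := by exact_mod_cast (by omega : 1 < m)
  have hL0 : 0 < Real.log m := Real.log_pos hm1
  rw [Real.log_rpow hm0]
  have e : Real.log (y/y1) - (y-y1)/y + η = Ehigh y1 y + η := by
    unfold Ehigh; have : 0 < y := by linarith
    field_simp; ring
  rw [e] at h3
  refine le_trans (le_of_eq ?_) (mul_le_mul_of_nonneg_left h3 (by positivity : 0 ≤ r * Real.log m))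
  rw [Finset.mul_sum]
  refine Finset.sum_congr rfl fun q hq => ?_
  rw [mem_prs (by positivity) (by positivity)] at hq
  have hlq : r * Real.log m ≤ Real.log q := by
    have := Real.log_le_log (by positivity) hq.1.1.le
    rw [Real.log_rpow hm0] at this
    have : r * Real.log m ≤ y1 * r * Real.log m := by
      have : 0 < r * Real.log m := by positivity
      nlinarith
    linarith
  rw [min_eq_right hlq]; unfold wM; ring
end

section
open Filter Topology

lemma pointwise (m n l : ℕ) (r y t : ℝ) (hm : 2 ≤ m) (hr : 0 < r) (hy : 0 < y) (hn : n ≠ 0) (hcop : n.Coprime m)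
    (hnm : (n:ℝ) ≤ (m:ℝ)^t) (hl : l + 1 ≤ n.primeFactorsList.length) (hB : 0 ≤ l + 1 - t/(r*y)) :
    l + 1 - t/(r*y) ≤ ∑ q ∈ prs m 1 ((m:ℝ)^(y*r)), (if q ∣ n then wM r y m q else 0) +
      (l + 1 - t/(r*y)) * ∑ q ∈ prs m 1 ((m:ℝ)^(y*r)), (if q^2 ∣ n then (1:ℝ) else 0) := by
  have hm0 : (0:ℝ) < m := by positivity
  have hm1 : (1:ℝ) < m := by exact_mod_cast (by omega : 1 < m)
  set L := Real.log m with hL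
  have hL0 : 0 < L := Real.log_pos hm1
  set P := prs m 1 ((m:ℝ)^(y*r)) with hP
  have hmem : ∀ q, q ∈ P ↔ ((1:ℝ) < q ∧ (q:ℝ) ≤ (m:ℝ)^(y*r)) ∧ q.Prime ∧ ¬ q ∣ m := fun q => mem_prs (by norm_num) (by positivity)
  have hw0 : ∀ q ∈ P, 0 ≤ wM r y m q := by
    intro q hq
    rw [hmem] at hq
    have hq0 : (0:ℝ) < q := by linarith [hq.1.1]
    have := Real.log_le_log hq0 hq.1.2
    rw [Real.log_rpow hm0] at this
    unfold wM
    rw [sub_nonneg, div_le_one (by positivity)]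
    linarith
  have hS0 : 0 ≤ ∑ q ∈ P, (if q ∣ n then wM r y m q else 0) := Finset.sum_nonneg fun q hq => by
    split_ifs
    · exact hw0 q hq
    · exact le_rfl
  have hQ0 : 0 ≤ ∑ q ∈ P, (if q^2 ∣ n then (1:ℝ) else 0) := Finset.sum_nonneg fun q hq => by split_ifs <;> norm_num
  by_cases hex : ∃ q ∈ P, q^2 ∣ n
  · obtain ⟨q, hq, hqn⟩ := hex
    have h1 : 1 ≤ ∑ q ∈ P, (if q^2 ∣ n then (1:ℝ) else 0) := by
      have := Finset.single_le_sum (f := fun q => if q^2 ∣ n then (1:ℝ) else 0) (fun q _ => by split_ifs <;> norm_num) hq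
      simpa [hqn] using this
    nlinarith
  · push Not at hex
    have key : l + 1 - t/(r*y) ≤ ∑ q ∈ P, (if q ∣ n then wM r y m q else 0) := by
      have e1 : ((n.primeFactorsList.length : ℕ) : ℝ) = ∑ q ∈ n.primeFactors, (n.factorization q : ℝ) := by
        rw [← ArithmeticFunction.cardFactors_apply, ArithmeticFunction.cardFactors_eq_sum_factorization, Finsupp.sum]
        push_cast; rfl
      have e2 : Real.log n = ∑ q ∈ n.primeFactors, (n.factorization q : ℝ) * Real.log q := by
        rw [Real.log_nat_eq_sum_factorization, Finsupp.sum]; rfl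
      have e3 : ∑ q ∈ n.primeFactors, (n.factorization q : ℝ) * wM r y m q = n.primeFactorsList.length - Real.log n / (y * (r * L)) := by
        rw [e1, e2, Finset.sum_div, ← Finset.sum_sub_distrib]
        refine Finset.sum_congr rfl fun q _ => ?_
        unfold wM; ring
      have e4 : l + 1 - t/(r*y) ≤ n.primeFactorsList.length - Real.log n / (y * (r * L)) := by
        have h1 : (l:ℝ) + 1 ≤ n.primeFactorsList.length := by exact_mod_cast hl
        have h2 : Real.log n ≤ t * L := by
          have := Real.log_le_log (by exact_mod_cast Nat.pos_of_ne_zero hn) hnm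
          rwa [Real.log_rpow hm0] at this
        have h3 : Real.log n / (y * (r * L)) ≤ t/(r*y) := by
          rw [div_le_div_iff₀ (by positivity) (by positivity)]
          have : 0 < r * y := by positivity
          nlinarith
        linarith
      rw [← e3] at e4
      refine e4.trans ?_
      have e5 : ∑ q ∈ P, (if q ∣ n then wM r y m q else 0) = ∑ q ∈ n.primeFactors, (if q ∈ P then wM r y m q else 0) := by
        rw [← Finset.sum_filter, ← Finset.sum_filter]
        refine Finset.sum_congr ?_ fun _ _ => rfl
        ext q
        simp only [Finset.mem_filter, Nat.mem_primeFactors]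
        constructor
        · rintro ⟨a, b⟩; exact ⟨⟨((hmem q).1 a).2.1, b, hn⟩, a⟩
        · rintro ⟨⟨_, b, _⟩, a⟩; exact ⟨a, b⟩
      rw [e5]
      refine Finset.sum_le_sum fun q hq => ?_
      have hqp := Nat.prime_of_mem_primeFactors hq
      have hqn := Nat.dvd_of_mem_primeFactors hq
      have hqm : ¬ q ∣ m := fun h => by
        have := Nat.dvd_gcd hqn h
        rw [hcop] at this
        exact hqp.one_lt.ne' (Nat.dvd_one.1 this)
      split_ifs with h
      · have : n.factorization q ≤ 1 := by
          by_contra hlt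
          push Not at hlt
          exact hex q h ((hqp.pow_dvd_iff_le_factorization hn).2 hlt)
        have h0 := hw0 q h
        have : (n.factorization q : ℝ) ≤ 1 := by exact_mod_cast this
        nlinarith
      · have hgt : (m:ℝ)^(y*r) < q := by
          by_contra hle
          push Not at hle
          exact h ((hmem q).2 ⟨⟨by exact_mod_cast hqp.one_lt, hle⟩, hqp, hqm⟩)
        have : wM r y m q ≤ 0 := by
          have := Real.log_le_log (by positivity) hgt.le
          rw [Real.log_rpow hm0] at this
          unfold wM
          rw [sub_nonpos, one_le_div (by positivity)]
          linarith
        exact mul_nonpos_of_nonneg_of_nonpos (by positivity) this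
    have := mul_nonneg hB hQ0
    linarith
end

section
open Filter Topology

/-- Upper bound for the sieve-weighted sum over primes dividing n. -/
lemma Vb (κ r η : ℝ) (hκ : 0 < κ) (hr : 0 < r) (hr1 : r ≤ 1) (hη : 0 < η) : ∀ᶠ m : ℕ in atTop,
    ∀ (dd : ℝ) (I : Finset ℕ) (u : ℕ → ℝ), dd ≤ 3 → LevX 1 m κ dd I u → ∀ z : ℝ, 0 ≤ z → z + 2 * r ≤ dd → z ≤ 2 →
    ∀ (Q : Finset ℕ) (w : ℕ → ℝ), Q ⊆ prs m 1 ((m:ℝ)^z) → (∀ q ∈ Q, 0 ≤ w q ∧ w q ≤ 1) → ∀ E : ℝ,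
    ∑ q ∈ Q, w q / q * min (Real.log q) (Real.log ((m:ℝ)^r)) ≤ (r * Real.log m) * E →
    0 ≤ E →
    ∑ n ∈ I, u n * ((fS m ((m:ℝ)^r) (YR ((m:ℝ)^r)) n)^2 * ∑ q ∈ Q, if q ∣ n then w q else 0) ≤
      (E + 2 * η) * GG m ((m:ℝ)^r) := by
  filter_upwards [Qone κ hκ 1 one_pos, Zsum_bound (η * r) (by positivity), ev_const_le (1/η) (κ/2) (by positivity), eventually_ge_atTop 2] with
    m h1 h2 h3 hm dd I u hdd hLev z hz hzr hz2 Q w hQ hw E hE hE0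
  have hm0 : (0:ℝ) < m := by positivity
  have hm1 : (1:ℝ) ≤ m := by exact_mod_cast (by omega : 1 ≤ m)
  have hL0 : 0 ≤ Real.log m := Real.log_nonneg hm1
  set R := (m:ℝ)^r with hR
  have hR1 : 1 ≤ R := Real.one_le_rpow hm1 hr.le
  have hRm : R ≤ m := by simpa using Real.rpow_le_rpow_of_exponent_le hm1 hr1
  have hmem : ∀ q ∈ Q, ((1:ℝ) < q ∧ (q:ℝ) ≤ (m:ℝ)^z) ∧ q.Prime ∧ ¬ q ∣ m := fun q hq =>
    (mem_prs (by norm_num) (by positivity)).1 (hQ hq)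
  have b1 := h1 1 dd I u hdd hLev R ((m:ℝ)^z) (YR R) (by linarith) hRm (by positivity) (by
    rw [pow_one, hR, ← rp_add hm, ← rp_add hm]
    exact rp_mono hm (by linarith)) (by intro n; unfold YR; split_ifs <;> norm_num) (by
    intro n hn; unfold YR; rw [if_neg (by linarith)]) Q w (by
    intro q hq
    obtain ⟨⟨_, h⟩, hp, hd⟩ := hmem q hq
    exact ⟨hp, hd, h, by rw [abs_of_nonneg (hw q hq).1]; exact (hw q hq).2⟩)
  have b2 := h2 R hR1 hRm Q w (by
    intro q hq
    obtain ⟨⟨h, h'⟩, hp, hd⟩ := hmem q hq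
    rw [mem_prs (by norm_num) (by positivity)]
    exact ⟨⟨h, h'.trans (rp_mono hm hz2)⟩, hp, hd⟩) hw
  simp only [pow_one, one_mul] at b1
  have b3 := (abs_le.1 b1).2
  have hφ : (0:ℝ) < m.totient := by exact_mod_cast Nat.totient_pos.2 (by omega)
  have hG := GG_lower m (by omega) R hR1
  have hG1 := GG_one_le m R hR1
  have hlogR : Real.log R = r * Real.log m := by rw [hR, Real.log_rpow hm0]
  rw [hlogR] at hG
  have hG2 : (m.totient / m : ℝ) * (r * Real.log m) ≤ GG m R := by
    calc (m.totient / m : ℝ) * (r * Real.log m) ≤ (m.totient / m : ℝ) * (GG m R * (m / m.totient)) := by gcongr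
      _ = GG m R := by field_simp
  have hsmall : (m:ℝ)^(-(κ/2)) ≤ η := by
    rw [Real.rpow_neg hm0.le, inv_le_comm₀ (by positivity) hη]
    simpa using h3
  calc _ ≤ (m.totient / m : ℝ) * (r * Real.log m * E + η * r * Real.log m) + η := by
        have : (m.totient / m : ℝ) * (∑ q ∈ Q, w q / q * min (Real.log q) (Real.log R) + η * r * Real.log m) ≤ (m.totient / m : ℝ) * (r * Real.log m * E + η * r * Real.log m) := by
          gcongr
        linarith
    _ = ((m.totient / m : ℝ) * (r * Real.log m)) * (E + η) + η := by ring
    _ ≤ GG m R * (E + η) + η * GG m R := by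
        have : η ≤ η * GG m R := le_mul_of_one_le_right hη.le hG1
        have := mul_le_mul_of_nonneg_right hG2 (by linarith : 0 ≤ E + η)
        linarith
    _ = _ := by ring

def KBd (α β κ K : ℝ) : Prop := ∀ᶠ m : ℕ in atTop, ∀ (a0 : (ZMod m)ˣ) (Φ : ℕ → ℝ), (∀ n ∈ II β κ m, 0 ≤ Φ n ∧ Φ n ≤ (m:ℝ)^κ) →
      ∑ n ∈ II β κ m, uu α β κ m a0 n * Φ n ≤ K * ∑ n ∈ II β κ m, eo κ m n * Φ n + (m:ℝ)^(-(κ/2))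

lemma wM_mem {r y : ℝ} {m q : ℕ} (hm : 2 ≤ m) (hr : 0 < r) (hy : 0 < y) (hq : (1:ℝ) < q) (hq2 : (q:ℝ) ≤ (m:ℝ)^(y*r)) :
    0 ≤ wM r y m q ∧ wM r y m q ≤ 1 := by
  have hm0 : (0:ℝ) < m := by positivity
  have hL0 : 0 < Real.log m := Real.log_pos (by exact_mod_cast (by omega : 1 < m))
  have h1 := Real.log_le_log (by linarith) hq2
  rw [Real.log_rpow hm0] at h1
  have h2 : 0 ≤ Real.log q := Real.log_nonneg hq.le
  unfold wM
  constructor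
  · rw [sub_nonneg, div_le_one (by positivity)]; linarith
  · have : 0 ≤ Real.log q / (y * (r * Real.log m)) := by positivity
    linarith

/-- a sum of weights over prime divisors is bounded by the divisor function -/
lemma wsum_le (Q : Finset ℕ) (w : ℕ → ℝ) (n : ℕ) (hn : n ≠ 0) (hw : ∀ q ∈ Q, 0 ≤ w q ∧ w q ≤ 1) :
    0 ≤ (∑ q ∈ Q, if q ∣ n then w q else 0) ∧ (∑ q ∈ Q, if q ∣ n then w q else 0) ≤ n.divisors.card := by
  constructor
  · exact Finset.sum_nonneg fun q hq => by
      split_ifs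
      · exact (hw q hq).1
      · exact le_rfl
  · rw [← Finset.sum_filter]
    have h1 : ∑ q ∈ Q with q ∣ n, w q ≤ ∑ q ∈ Q with q ∣ n, (1:ℝ) :=
      Finset.sum_le_sum fun q hq => (hw q (Finset.mem_filter.1 hq).1).2
    rw [Finset.sum_const, nsmul_eq_mul, mul_one] at h1
    refine h1.trans ?_
    have : Q.filter (fun q => q ∣ n) ⊆ n.divisors := fun q hq => Nat.mem_divisors.2 ⟨(Finset.mem_filter.1 hq).2, hn⟩
    exact_mod_cast Finset.card_le_card this

lemma II_pos {β κ : ℝ} {m n : ℕ} (h : n ∈ II β κ m) : 0 < n := by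
  have := (mem_II.1 h).1
  have h2 : 0 ≤ (m:ℝ)^β := by positivity
  exact_mod_cast lt_of_le_of_lt h2 this

lemma high_part (α β κ r y1 y K dd η : ℝ) (hκ : 0 < κ) (hκ1 : κ ≤ 1) (hβ1 : β ≤ 1) (hr : 0 < r) (hr1 : r ≤ 1) (h1 : 1 ≤ y1) (h2 : y1 ≤ y)
    (hη : 0 < η) (hdd : dd ≤ 3) (hy2 : y * r ≤ 2) (hydd : y * r + 2 * r ≤ dd) (hK : 0 < K)
    (hKb : y1 = y ∨ (KBd α β κ K ∧ ∀ᶠ m : ℕ in atTop, LevX 1 m κ dd (II β κ m) (eo κ m))) :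
    ∀ᶠ m : ℕ in atTop, ∀ a0 : (ZMod m)ˣ,
    ∑ n ∈ II β κ m, uu α β κ m a0 n * ((fS m ((m:ℝ)^r) (YR ((m:ℝ)^r)) n)^2 * ∑ q ∈ prs m ((m:ℝ)^(y1*r)) ((m:ℝ)^(y*r)), if q ∣ n then wM r y m q else 0) ≤
      (K * Ehigh y1 y + (3 * K + 1) * η) * GG m ((m:ℝ)^r) := by
  rcases hKb with rfl | ⟨hKb, hLev⟩
  · filter_upwards [eventually_ge_atTop 2] with m hm a0
    have hm1 : (1:ℝ) ≤ m := by exact_mod_cast (by omega : 1 ≤ m)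
    have e : prs m ((m:ℝ)^(y1*r)) ((m:ℝ)^(y1*r)) = ∅ := by simp [prs]
    have hE := Ehigh_nonneg y1 y1 h1 le_rfl
    have hG := GG_one_le m ((m:ℝ)^r) (Real.one_le_rpow hm1 hr.le)
    simp only [e, Finset.sum_empty, mul_zero, Finset.sum_const_zero]
    positivity
  · filter_upwards [hKb, hLev, Vb κ r η hκ hr hr1 hη, high_sum r y1 y η hr h1 h2 hη, ev_const_le (1/η) (κ/2) (by positivity),
      ev_fS (κ/4) (by positivity), ev_div (κ/2) (by positivity) 3, eventually_ge_atTop 2] with m b1 b2 b3 b4 b5 b6 b7 hm a0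
    have hm0 : (0:ℝ) < m := by positivity
    have hm1 : (1:ℝ) ≤ m := by exact_mod_cast (by omega : 1 ≤ m)
    have hR1 : 1 ≤ (m:ℝ)^r := Real.one_le_rpow hm1 hr.le
    have hRm : (m:ℝ)^r ≤ m := by simpa using Real.rpow_le_rpow_of_exponent_le hm1 hr1
    have hG1 := GG_one_le m ((m:ℝ)^r) hR1
    have hE := Ehigh_nonneg y1 y h1 h2
    have hmem : ∀ q ∈ prs m ((m:ℝ)^(y1*r)) ((m:ℝ)^(y*r)), ((1:ℝ) < q ∧ (q:ℝ) ≤ (m:ℝ)^(y*r)) ∧ q.Prime ∧ ¬ q ∣ m := by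
      intro q hq
      obtain ⟨⟨h, h'⟩, h''⟩ := (mem_prs (by positivity) (by positivity)).1 hq
      exact ⟨⟨lt_of_le_of_lt (Real.one_le_rpow hm1 (by positivity)) h, h'⟩, h''⟩
    have hw : ∀ q ∈ prs m ((m:ℝ)^(y1*r)) ((m:ℝ)^(y*r)), 0 ≤ wM r y m q ∧ wM r y m q ≤ 1 := fun q hq =>
      wM_mem hm hr (by linarith) (hmem q hq).1.1 (hmem q hq).1.2
    have c1 := b1 a0 (fun n => (fS m ((m:ℝ)^r) (YR ((m:ℝ)^r)) n)^2 * ∑ q ∈ prs m ((m:ℝ)^(y1*r)) ((m:ℝ)^(y*r)), if q ∣ n then wM r y m q else 0) (by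
      intro n hn
      have hn0 := II_pos hn
      have hn3 : (n:ℝ) ≤ (m:ℝ)^(3:ℝ) := (mem_II.1 hn).2.trans (rp_mono hm (by linarith))
      obtain ⟨s0, s1⟩ := wsum_le _ (wM r y m) n hn0.ne' hw
      refine ⟨by positivity, ?_⟩
      have e : (m:ℝ)^κ = ((m:ℝ)^(κ/4))^2 * (m:ℝ)^(κ/2) := by rw [pow_two, ← rp_add hm, ← rp_add hm]; congr 1; ring
      rw [e]
      have f1 := b6 m ((m:ℝ)^r) (YR ((m:ℝ)^r)) (by positivity) hRm (by intro n; unfold YR; split_ifs <;> norm_num) n hn0 (by exact_mod_cast hn3)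
      have f2 : (fS m ((m:ℝ)^r) (YR ((m:ℝ)^r)) n)^2 ≤ ((m:ℝ)^(κ/4))^2 := by
        rw [← sq_abs]; exact pow_le_pow_left₀ (abs_nonneg _) f1 2
      exact mul_le_mul f2 (s1.trans (b7 n hn0.ne' hn3)) s0 (by positivity))
    have c2 := b3 dd _ _ hdd b2 (y*r) (by nlinarith) hydd hy2 (prs m ((m:ℝ)^(y1*r)) ((m:ℝ)^(y*r))) (wM r y m) (by
      intro q hq
      rw [mem_prs (by norm_num) (by positivity)]
      exact hmem q hq) hw _ b4 (by linarith)
    have hsmall : (m:ℝ)^(-(κ/2)) ≤ η := by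
      rw [Real.rpow_neg hm0.le, inv_le_comm₀ (by positivity) hη]
      simpa using b5
    have c3 := mul_le_mul_of_nonneg_left c2 hK.le
    have : η ≤ η * GG m ((m:ℝ)^r) := le_mul_of_one_le_right hη.le hG1
    calc _ ≤ _ := c1
      _ ≤ K * ((Ehigh y1 y + η + 2 * η) * GG m ((m:ℝ)^r)) + η * GG m ((m:ℝ)^r) := by linarith
      _ = _ := by ring

set_option maxHeartbeats 800000 in
lemma critM (α β κ r y1 y K dd1 dd2 : ℝ) (l : ℕ) (hκ : 0 < κ) (hκ1 : κ ≤ 1) (hβ1 : β ≤ 1) (hr : 0 < r) (hr1 : r ≤ 1)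
    (h1 : 1 ≤ y1) (h2 : y1 ≤ y) (hdd1 : dd1 ≤ 3) (hdd2 : dd2 ≤ 3) (hy2 : y * r ≤ 2) (hydd1 : y1 * r + 2 * r ≤ dd1)
    (hydd2 : y * r + 2 * r ≤ dd2) (hK : 0 < K)
    (hU : ∀ᶠ m : ℕ in atTop, ∀ (a0 : (ZMod m)ˣ), LevX 1 m κ dd1 (II β κ m) (uu α β κ m a0))
    (hKb : y1 = y ∨ (KBd α β κ K ∧ ∀ᶠ m : ℕ in atTop, LevX 1 m κ dd2 (II β κ m) (eo κ m)))
    (hsq : ∀ δ : ℝ, 0 < δ → δ ≤ κ/2 → ∀ᶠ m : ℕ in atTop, ∀ a0 : (ZMod m)ˣ, ∑ n ∈ II β κ m, uu α β κ m a0 n * sqn m δ (y*r) n ≤ (m:ℝ)^(-(δ/2)))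
    (hnum : Elow y1 y + K * Ehigh y1 y < l + 1 - (β+κ)/(r*y)) :
    ∀ᶠ m : ℕ in atTop, ∀ a0 : (ZMod m)ˣ, ∃ n ∈ II β κ m, uu α β κ m a0 n ≠ 0 ∧ n.primeFactorsList.length ≤ l := by
  have hEl := Elow_nonneg y1 y h1 h2
  have hEh := Ehigh_nonneg y1 y h1 h2
  set B := (l:ℝ) + 1 - (β+κ)/(r*y) with hB
  have hB0 : 0 < B := by
    have : 0 ≤ K * Ehigh y1 y := by positivity
    linarith
  set T := 4 + 3 * K + 6 * B with hT
  have hT0 : 0 < T := by positivity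
  set η := (B - Elow y1 y - K * Ehigh y1 y) / (2 * T) with hηd
  have hη : 0 < η := by apply div_pos <;> linarith
  have hηT : η * T < B - Elow y1 y - K * Ehigh y1 y := by
    have : η * T = (B - Elow y1 y - K * Ehigh y1 y) / 2 := by rw [hηd]; field_simp
    rw [this]; linarith
  set δ := min (min (η * r) (κ/2)) r with hδd
  have hy0 : 0 < y := by linarith
  have hδ : 0 < δ := by positivity
  have hδ1 : δ ≤ η * r := (min_le_left _ _).trans (min_le_left _ _)
  have hδ2 : δ ≤ κ/2 := (min_le_left _ _).trans (min_le_right _ _)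
  have hδ5 : δ ≤ r := min_le_right _ _
  have hry : r ≤ y1 * r := le_mul_of_one_le_left hr.le h1
  have hδ3 : δ ≤ y * r := hδ5.trans (le_mul_of_one_le_left hr.le (h1.trans h2))
  obtain ⟨C, hC, hplog⟩ := plog_upper
  filter_upwards [hU, high_part α β κ r y1 y K dd2 η hκ hκ1 hβ1 hr hr1 h1 h2 hη hdd2 hy2 hydd2 hK hKb, hsq δ hδ hδ2,
    Vb κ r η hκ hr hr1 hη, low_sum r y1 y η hr h1 h2 hη, Qzero κ hκ, ev_fS (δ/8) (by positivity), ev_const_le (1/η) (δ/4) (by positivity),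
    ev_log_ge (C/(η*r)), eventually_ge_atTop 2] with m bU bH bS bV bL bQ bf bc bC hm a0
  by_contra hcon
  push Not at hcon
  have hm0 : (0:ℝ) < m := by positivity
  have hm1 : (1:ℝ) ≤ m := by exact_mod_cast (by omega : 1 ≤ m)
  set R := (m:ℝ)^r with hRd
  have hR1 : 1 ≤ R := Real.one_le_rpow hm1 hr.le
  have hRm : R ≤ m := by simpa using Real.rpow_le_rpow_of_exponent_le hm1 hr1
  have hG1 := GG_one_le m R hR1
  set G := GG m R with hG
  set f := fS m R (YR R) with hf
  have hYR : ∀ n, |YR R n| ≤ 2 := by intro n; unfold YR; split_ifs <;> norm_num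
  have hsmall : (m:ℝ)^(-(δ/4)) ≤ η := by
    rw [Real.rpow_neg hm0.le, inv_le_comm₀ (by positivity) hη]
    simpa using bc
  have hηG : η ≤ η * G := le_mul_of_one_le_right hη.le hG1
  have hmlow : ∀ q ∈ prs m 1 ((m:ℝ)^(y1*r)), ((1:ℝ) < q ∧ (q:ℝ) ≤ (m:ℝ)^(y*r)) := by
    intro q hq
    obtain ⟨⟨h, h'⟩, h''⟩ := (mem_prs (by norm_num) (by positivity)).1 hq
    exact ⟨h, h'.trans (rp_mono hm (by gcongr))⟩
  have t1 := bV dd1 _ _ hdd1 (bU a0) (y1*r) (by positivity) (by linarith) (by nlinarith) _ (wM r y m) subset_rfl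
    (fun q hq => wM_mem hm hr hy0 (hmlow q hq).1 (hmlow q hq).2) _ bL (by linarith)
  have t2 := bH a0
  have t3 := bV dd1 _ _ hdd1 (bU a0) δ hδ.le (by linarith) (by linarith) (prs m 1 ((m:ℝ)^δ)) (fun _ => 1) subset_rfl
    (fun q hq => by norm_num) (2 * η) (by
      have := hplog m 1 ((m:ℝ)^δ) le_rfl (Real.one_le_rpow hm1 hδ.le)
      rw [div_one, Real.log_rpow hm0] at this
      rw [div_le_iff₀ (by positivity)] at bC
      calc _ ≤ ∑ q ∈ prs m 1 ((m:ℝ)^δ), Real.log q / q := by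
            refine Finset.sum_le_sum fun q hq => ?_
            have : 1 / (q:ℝ) * min (Real.log q) (Real.log R) ≤ 1 / q * Real.log q := by
              gcongr; exact min_le_left _ _
            calc _ ≤ _ := this
              _ = _ := by ring
        _ ≤ δ * Real.log m + C := this
        _ ≤ _ := by
            have := mul_le_mul_of_nonneg_right hδ1 (Real.log_nonneg hm1)
            linarith) (by positivity)
  have t0 := bQ 1 dd1 _ _ hdd1 (bU a0) R (YR R) (by positivity) hRm (by
    rw [hRd, ← rp_add hm]; exact rp_mono hm (by nlinarith)) hYR
  rw [sumYR m R (by positivity) 2 (by norm_num), one_mul] at t0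
  have t0' := (abs_le.1 t0).1
  have hsm2 : (m:ℝ)^(-(κ/2)) ≤ η := (rp_mono hm (by linarith)).trans hsmall
  have t4 : ∑ n ∈ II β κ m, uu α β κ m a0 n * ((f n)^2 * sqn m δ (y*r) n) ≤ η := by
    have e : (m:ℝ)^(-(δ/4)) = ((m:ℝ)^(δ/8))^2 * (m:ℝ)^(-(δ/2)) := by rw [pow_two, ← rp_add hm, ← rp_add hm]; congr 1; ring
    refine le_trans ?_ hsmall
    rw [e]
    refine le_trans ?_ (mul_le_mul_of_nonneg_left (bS a0) (by positivity))
    rw [Finset.mul_sum]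
    refine Finset.sum_le_sum fun n hn => ?_
    have hn0 := II_pos hn
    have hn3 : (n:ℝ) ≤ (m:ℝ)^(3:ℝ) := (mem_II.1 hn).2.trans (rp_mono hm (by linarith))
    have f1 := bf m R (YR R) (by positivity) hRm (fun r => (hYR r).trans (by norm_num)) n hn0 (by exact_mod_cast hn3)
    have f2 : (f n)^2 ≤ ((m:ℝ)^(δ/8))^2 := by
      rw [← sq_abs]; exact pow_le_pow_left₀ (abs_nonneg _) f1 2
    have u0 := uu_nonneg (α := α) (β := β) hκ hm a0 n
    have s0 := sqn_nonneg m δ (y*r) n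
    have := mul_le_mul_of_nonneg_right f2 (mul_nonneg u0 s0)
    linarith
  have pw : ∀ n ∈ II β κ m, uu α β κ m a0 n * (f n)^2 * B ≤
      uu α β κ m a0 n * ((f n)^2 * ∑ q ∈ prs m 1 ((m:ℝ)^(y1*r)), if q ∣ n then wM r y m q else 0) +
      uu α β κ m a0 n * ((f n)^2 * ∑ q ∈ prs m ((m:ℝ)^(y1*r)) ((m:ℝ)^(y*r)), if q ∣ n then wM r y m q else 0) +
      B * (uu α β κ m a0 n * ((f n)^2 * ∑ q ∈ prs m 1 ((m:ℝ)^δ), if q ∣ n then 1 else 0)) +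
      B * (uu α β κ m a0 n * ((f n)^2 * sqn m δ (y*r) n)) := by
    intro n hn
    have hn0 := II_pos hn
    by_cases hu : uu α β κ m a0 n = 0
    · simp [hu]
    · have hlen := hcon n hn hu
      have u0 := uu_nonneg (α := α) (β := β) hκ hm a0 n
      have := pointwise m n l r y (β+κ) hm hr hy0 hn0.ne' (uu_pos a0 n hu).1 (mem_II.1 hn).2 hlen hB0.le
      have hA : (1:ℝ) ≤ (m:ℝ)^(y1*r) := Real.one_le_rpow hm1 (by positivity)
      rw [prs_union hA (rp_mono hm (by gcongr : y1 * r ≤ y * r)), prs_union (Real.one_le_rpow hm1 hδ.le) (rp_mono hm hδ3)] at this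
      have s1 : ∑ q ∈ prs m 1 ((m:ℝ)^δ), (if q^2 ∣ n then (1:ℝ) else 0) ≤ ∑ q ∈ prs m 1 ((m:ℝ)^δ), (if q ∣ n then (1:ℝ) else 0) := by
        refine Finset.sum_le_sum fun q _ => ?_
        by_cases h : q^2 ∣ n
        · rw [if_pos h, if_pos ((dvd_pow_self q two_ne_zero).trans h)]
        · rw [if_neg h]; split_ifs <;> norm_num
      have s2 := mul_le_mul_of_nonneg_left s1 hB0.le
      rw [← hB] at this
      have s3 : B ≤ (∑ q ∈ prs m 1 ((m:ℝ)^(y1*r)), if q ∣ n then wM r y m q else 0) +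
        (∑ q ∈ prs m ((m:ℝ)^(y1*r)) ((m:ℝ)^(y*r)), if q ∣ n then wM r y m q else 0) +
        B * (∑ q ∈ prs m 1 ((m:ℝ)^δ), if q ∣ n then 1 else 0) + B * sqn m δ (y*r) n := by
        unfold sqn; linarith
      have := mul_le_mul_of_nonneg_left s3 (mul_nonneg u0 (sq_nonneg (f n)))
      linarith
  have tot := Finset.sum_le_sum pw
  rw [Finset.sum_add_distrib, Finset.sum_add_distrib, Finset.sum_add_distrib, ← Finset.mul_sum, ← Finset.mul_sum, ← Finset.sum_mul] at tot
  have m1 := mul_le_mul_of_nonneg_left t3 hB0.le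
  have m2 := mul_le_mul_of_nonneg_left (t4.trans hηG) hB0.le
  have m3 := mul_le_mul_of_nonneg_right (by linarith : G - η * G ≤ ∑ n ∈ II β κ m, uu α β κ m a0 n * (f n)^2) hB0.le
  have fin : G * (B - Elow y1 y - K * Ehigh y1 y) ≤ G * (η * T) := by
    rw [hT]; linarith
  have := le_of_mul_le_mul_left fin (by linarith)
  linarith
end

section
open Filter Topology

/-- existence of an almost-prime solution, for arbitrarily small κ -/
def Good (l : ℕ) (α β : ℝ) : Prop := ∀ κ0 : ℝ, 0 < κ0 → ∃ κ, 0 < κ ∧ κ ≤ κ0 ∧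
  ∀ᶠ m : ℕ in atTop, ∀ a0 : (ZMod m)ˣ, ∃ n ∈ II β κ m, uu α β κ m a0 n ≠ 0 ∧ n.primeFactorsList.length ≤ l

lemma Good_adm (l : ℕ) (α β : ℝ) (h : Good l α β) : ∀ ε : ℝ, 0 < ε → ∃ M : ℕ, ∀ m : ℕ, M ≤ m → ∀ a : ℤ, Int.gcd a m = 1 →
      ∃ p₁ p₂ s : ℕ, p₁.Prime ∧ p₂.Prime ∧
        (p₁ : ℝ) ≤ (m : ℝ) ^ (α + ε) ∧ (p₂ : ℝ) ≤ (m : ℝ) ^ (α + ε) ∧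
        0 < s ∧ (s : ℝ) ≤ (m : ℝ) ^ (β + ε) ∧ s.primeFactorsList.length ≤ l ∧
        ((p₁ * p₂ * s : ℕ) : ℤ) ≡ a [ZMOD (m : ℤ)] := by
  intro ε hε
  obtain ⟨κ, hκ, hκε, hev⟩ := h ε hε
  obtain ⟨M, hM⟩ := eventually_atTop.1 (hev.and (eventually_ge_atTop 2))
  refine ⟨M, fun m hm a ha => ?_⟩
  obtain ⟨h1, hm2⟩ := hM m hm
  have hc : IsCoprime a (m:ℤ) := Int.isCoprime_iff_gcd_eq_one.2 ha
  have hu : IsUnit ((a : ℤ) : ZMod m) := by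
    obtain ⟨u, v, huv⟩ := hc
    refine IsUnit.of_mul_eq_one (u : ZMod m) ?_
    have := congrArg (Int.cast : ℤ → ZMod m) huv
    push_cast at this
    rw [ZMod.natCast_self, mul_zero, add_zero] at this
    rw [mul_comm]; exact this
  obtain ⟨a0, ha0⟩ := hu
  obtain ⟨n, hn, hun, hlen⟩ := h1 a0
  obtain ⟨_, p, hp, q, hq, heq⟩ := uu_pos a0 n hun
  rw [mem_PP] at hp hq
  have mono : ∀ t : ℝ, (m:ℝ)^(t+κ) ≤ (m:ℝ)^(t+ε) := fun t => rp_mono hm2 (by linarith)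
  refine ⟨p, q, n, hp.2.1, hq.2.1, hp.1.2.trans (mono _), hq.1.2.trans (mono _), II_pos hn, (mem_II.1 hn).2.trans (mono _), hlen, ?_⟩
  rw [← ZMod.intCast_eq_intCast_iff, ← ha0, ← heq]
  push_cast; rfl

lemma ev_lt (F : ℝ → ℝ) (c : ℝ) (hF : ContinuousAt F 0) (h : F 0 < c) : ∀ᶠ κ in 𝓝[>] (0:ℝ), F κ < c :=
  (hF.eventually (Iio_mem_nhds h)).filter_mono nhdsWithin_le_nhds

lemma Good_of_ev {l : ℕ} {α β : ℝ} (P : ℝ → Prop) (hP : ∀ᶠ κ in 𝓝[>] (0:ℝ), P κ)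
    (h : ∀ κ, 0 < κ → κ ≤ 1/2 → P κ → ∀ᶠ m : ℕ in atTop, ∀ a0 : (ZMod m)ˣ, ∃ n ∈ II β κ m, uu α β κ m a0 n ≠ 0 ∧ n.primeFactorsList.length ≤ l) :
    Good l α β := by
  intro κ0 hκ0
  have h1 : ∀ᶠ κ in 𝓝[>] (0:ℝ), κ < min κ0 (1/2) := ev_lt (fun κ => κ) _ continuousAt_id (by positivity)
  obtain ⟨κ, ⟨hp, hlt⟩, hpos⟩ := ((hP.and h1).and self_mem_nhdsWithin).exists
  exact ⟨κ, hpos, hlt.le.trans (min_le_left _ _), h κ hpos (hlt.le.trans (min_le_right _ _)) hp⟩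

def KHyp (α β e0 : ℝ) : Prop := (e0 + e0 < 3 * α - 2 ∨ e0 + e0 < β + 2 * α - 2) ∧ e0 < 3 * α + β - 3

lemma ev_KBd (α β e0 K : ℝ) (hα : 1/2 ≤ α) (hα1 : α ≤ 1) (hβ : 0 ≤ β) (hβ1 : β ≤ 1) (he0 : 0 < e0) (hH : KHyp α β e0) (hK : 2 * α / e0 < K) :
    ∀ᶠ κ in 𝓝[>] (0:ℝ), KBd α β κ K := by
  have a1 : ∀ᶠ κ in 𝓝[>] (0:ℝ), (1/(1-κ)) * (2 * (α + κ) / e0) < K := by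
    refine ev_lt (fun κ => (1/(1-κ)) * (2 * (α + κ) / e0)) K ?_ (by simpa using hK)
    have : (1:ℝ) - 0 ≠ 0 := by norm_num
    fun_prop (disch := assumption)
  have a2 : ∀ᶠ κ in 𝓝[>] (0:ℝ), e0 + 100 * κ < 3 * α + β - 3 :=
    ev_lt (fun κ => e0 + 100 * κ) _ (by fun_prop) (by simpa using hH.2)
  have a3 : ∀ᶠ κ in 𝓝[>] (0:ℝ), (e0 + e0 + 100 * κ < 3 * α - 2 ∨ e0 + e0 + 100 * κ < β + 2 * α - 2) := by
    rcases hH.1 with h | h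
    · exact (ev_lt (fun κ => e0 + e0 + 100 * κ) _ (by fun_prop) (by simpa using h)).mono fun κ h => Or.inl h
    · exact (ev_lt (fun κ => e0 + e0 + 100 * κ) _ (by fun_prop) (by simpa using h)).mono fun κ h => Or.inr h
  have a4 : ∀ᶠ κ in 𝓝[>] (0:ℝ), κ < 1/2 := ev_lt (fun κ => κ) _ continuousAt_id (by norm_num)
  filter_upwards [a1, a2, a3, a4, self_mem_nhdsWithin] with κ b1 b2 b3 b4 b5
  have hκ : 0 < κ := b5
  filter_upwards [K_lemma α β κ e0 κ hα hα1 hβ hβ1 hκ (by linarith) he0 hκ b4.le ⟨b3, b2⟩] with m h a0 Φ hΦ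
  refine (h a0 Φ hΦ).trans ?_
  have : 0 ≤ ∑ n ∈ II β κ m, eo κ m n * Φ n := Finset.sum_nonneg fun n hn => mul_nonneg (eo_nonneg hκ n) (hΦ n hn).1
  have := mul_le_mul_of_nonneg_right b1.le this
  linarith

lemma ev_num (β r y E : ℝ) (l : ℕ) (hr : 0 < r) (hy : 0 < y) (h : E < l + 1 - β/(r*y)) :
    ∀ᶠ κ in 𝓝[>] (0:ℝ), E < l + 1 - (β+κ)/(r*y) := by
  have := ev_lt (fun κ => E - ((l:ℝ) + 1 - (β+κ)/(r*y))) 0 (by fun_prop) (by simp only [add_zero]; linarith)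
  filter_upwards [this] with κ h
  linarith

lemma critM_K (α β r y1 y e0 K : ℝ) (l : ℕ) (hα : 1/2 ≤ α) (hα1 : α ≤ 1) (hβ : 0 ≤ β) (hβ1 : β ≤ 1) (hr : 0 < r)
    (h1 : 1 ≤ y1) (h2 : y1 ≤ y) (d1 : 2 * ((2 + y1) * r) < α + 2 * β - 2) (d2 : (2 + y1) * r < 2 * α + 2 * β - 3) (d3 : (2 + y) * r < β)
    (he0 : 0 < e0) (hH : KHyp α β e0) (hK : 2 * α / e0 < K) (hnum : Elow y1 y + K * Ehigh y1 y < l + 1 - β/(r*y)) : Good l α β := by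
  have hy0 : 0 < y := by linarith
  have hyr : 0 < y * r := by positivity
  have hy1r : 0 < y1 * r := by positivity
  have hK0 : 0 < K := lt_of_le_of_lt (by positivity) hK
  refine Good_of_ev (fun κ => KBd α β κ K ∧ Elow y1 y + K * Ehigh y1 y < l + 1 - (β+κ)/(r*y) ∧
    ((2 + y1) * r + (2 + y1) * r + 100 * κ < α + 2 * β - 2 ∧ (2 + y1) * r + 100 * κ < 2 * α + 2 * β - 3 ∧ (2 + y) * r + 10 * κ < β)) ?_ ?_
  · exact (ev_KBd α β e0 K hα hα1 hβ hβ1 he0 hH hK).and ((ev_num β r y _ l hr hy0 hnum).and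
      ((ev_lt (fun κ => (2 + y1) * r + (2 + y1) * r + 100 * κ) _ (by fun_prop) (by simp only [mul_zero, add_zero]; linarith)).and
      ((ev_lt (fun κ => (2 + y1) * r + 100 * κ) _ (by fun_prop) (by simp only [mul_zero, add_zero]; linarith)).and
      (ev_lt (fun κ => (2 + y) * r + 10 * κ) _ (by fun_prop) (by simp only [mul_zero, add_zero]; linarith)))))
  · rintro κ hκ hκ1 ⟨hKb, hn, c1, c2, c3⟩
    exact critM α β κ r y1 y K ((2+y1)*r) ((2+y)*r) l hκ (by linarith) hβ1 hr (by linarith) h1 h2 (by linarith) (by linarith) (by linarith) (by linarith) (by linarith)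
      hK0 (uu_Lev α β κ _ (by linarith) hα1 hβ hβ1 hκ (by linarith) (by positivity) c1 c2) (Or.inr ⟨hKb, eo_Lev β κ _ hβ1 hκ (by linarith) c3⟩)
      (fun δ hδ hδ2 => Hsq_K α β κ δ (y*r) K hβ1 hβ hκ (by linarith) hδ hδ2 hK0 hKb) hn

lemma critM_X (α β r y : ℝ) (l : ℕ) (hα : 1/2 ≤ α) (hα1 : α ≤ 1) (hβ : 0 ≤ β) (hβ1 : β ≤ 1) (hr : 0 < r)
    (h1 : 1 ≤ y) (d1 : 2 * ((2 + y) * r) < α + 2 * β - 2) (d2 : (2 + y) * r < 2 * α + 2 * β - 3) (d3 : (2 + y) * r < β)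
    (d4 : 3 * (y * r) < α + 2 * β - 2) (hnum : Elow y y < l + 1 - β/(r*y)) : Good l α β := by
  have hy0 : 0 < y := by linarith
  have hyr : 0 < y * r := by positivity
  refine Good_of_ev (fun κ => Elow y y < l + 1 - (β+κ)/(r*y) ∧
    ((2 + y) * r + (2 + y) * r + 100 * κ < α + 2 * β - 2 ∧ (2 + y) * r + 100 * κ < 2 * α + 2 * β - 3 ∧ 3 * (y * r) + 100 * κ < α + 2 * β - 2)) ?_ ?_
  · exact (ev_num β r y _ l hr hy0 hnum).and
      ((ev_lt (fun κ => (2 + y) * r + (2 + y) * r + 100 * κ) _ (by fun_prop) (by simp only [mul_zero, add_zero]; linarith)).and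
      ((ev_lt (fun κ => (2 + y) * r + 100 * κ) _ (by fun_prop) (by simp only [mul_zero, add_zero]; linarith)).and
      (ev_lt (fun κ => 3 * (y * r) + 100 * κ) _ (by fun_prop) (by simp only [mul_zero, add_zero]; linarith))))
  · rintro κ hκ hκ1 ⟨hn, c1, c2, c3⟩
    refine critM α β κ r y y 1 ((2+y)*r) ((2+y)*r) l hκ (by linarith) hβ1 hr (by linarith) h1 le_rfl (by linarith) (by linarith) (by linarith) (by linarith) (by linarith)
      one_pos (uu_Lev α β κ _ (by linarith) hα1 hβ hβ1 hκ (by linarith) (by positivity) c1 c2) (Or.inl rfl)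
      (fun δ hδ hδ2 => Hsq_X α β κ δ (y*r) (by linarith) hα1 hβ hβ1 hκ (by linarith) hδ hδ2 hyr.le c3 (by linarith)) ?_
    have : Ehigh y y = 0 := by unfold Ehigh; rw [div_self hy0.ne', Real.log_one]; ring
    rw [this]; linarith
end

section
open Filter Topology

open Classical in
/-- integers in (A,B], coprime to m, with exactly k prime factors, all exceeding z -/
noncomputable def TT (m k : ℕ) (z A B : ℝ) : Finset ℕ :=
  (Finset.Ioc ⌊A⌋₊ ⌊B⌋₊).filter (fun n => n.Coprime m ∧ n.primeFactorsList.length = k ∧ ∀ p, p.Prime → p ∣ n → z < (p:ℝ))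

lemma mem_TT {m k n : ℕ} {z A B : ℝ} (hA : 0 ≤ A) (hB : 0 ≤ B) : n ∈ TT m k z A B ↔
    (A < n ∧ (n:ℝ) ≤ B) ∧ n.Coprime m ∧ n.primeFactorsList.length = k ∧ ∀ p, p.Prime → p ∣ n → z < (p:ℝ) := by
  simp only [TT, Finset.mem_filter, Finset.mem_Ioc, Nat.floor_lt hA, Nat.le_floor_iff hB]

lemma TT_mono {m k : ℕ} {z z' A B : ℝ} (h : z ≤ z') : TT m k z' A B ⊆ TT m k z A B := by
  intro n hn
  simp only [TT, Finset.mem_filter] at hn ⊢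
  exact ⟨hn.1, hn.2.1, hn.2.2.1, fun p hp hd => lt_of_le_of_lt h (hn.2.2.2 p hp hd)⟩

lemma TT_one {m : ℕ} {z A B : ℝ} (hA : 0 ≤ A) (hB : 0 ≤ B) (hz : z ≤ A) (F : ℕ → ℝ) (hF : ∀ n, 0 ≤ F n) :
    ∑ p ∈ prs m A B, F p ≤ ∑ n ∈ TT m 1 z A B, F n := by
  refine Finset.sum_le_sum_of_subset_of_nonneg ?_ (fun n _ _ => hF n)
  intro p hp
  rw [mem_prs hA hB] at hp
  rw [mem_TT hA hB]
  refine ⟨hp.1, (Nat.Prime.coprime_iff_not_dvd hp.2.1).2 hp.2.2, by rw [Nat.primeFactorsList_prime hp.2.1]; rfl, ?_⟩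
  intro q hq hd
  rw [(Nat.prime_dvd_prime_iff_eq hq hp.2.1).1 hd]
  linarith [hp.1.1]

lemma TT_rec {m k : ℕ} {z W A B : ℝ} (hz : 0 ≤ z) (hW : 0 ≤ W) (hA : 0 ≤ A) (hB : 0 ≤ B) (F : ℕ → ℝ) (hF : ∀ n, 0 ≤ F n) :
    ∑ q ∈ prs m z W, ∑ n ∈ TT m k q (A/q) (B/q), F (q*n) ≤ ∑ n ∈ TT m (k+1) z A B, F n := by
  rw [Finset.sum_sigma']
  set S := (prs m z W).sigma (fun q => TT m k q (A/q) (B/q)) with hS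
  have hmem : ∀ x ∈ S, ((z < x.1 ∧ (x.1:ℝ) ≤ W) ∧ x.1.Prime ∧ ¬ x.1 ∣ m) ∧ ((A/x.1 < x.2 ∧ (x.2:ℝ) ≤ B/x.1) ∧ x.2.Coprime m ∧
      x.2.primeFactorsList.length = k ∧ ∀ p, p.Prime → p ∣ x.2 → (x.1:ℝ) < (p:ℝ)) := by
    intro x hx
    rw [hS, Finset.mem_sigma, mem_prs hz hW, mem_TT (by positivity) (by positivity)] at hx
    exact hx
  have hpos : ∀ x ∈ S, 0 < x.2 := by
    intro x hx
    have := (hmem x hx).2.1.1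
    have h2 : 0 ≤ A / (x.1:ℝ) := by positivity
    exact_mod_cast lt_of_le_of_lt h2 this
  have hmf : ∀ x ∈ S, (x.1 * x.2).minFac = x.1 := by
    intro x hx
    have hp := (hmem x hx).1.2.1
    have h1 : x.1 * x.2 ≠ 1 := fun h => hp.one_lt.ne' (Nat.eq_one_of_mul_eq_one_right h)
    have h2 := Nat.minFac_prime h1
    have h3 : (x.1 * x.2).minFac ≤ x.1 := Nat.minFac_le_of_dvd hp.two_le (dvd_mul_right _ _)
    rcases (Nat.Prime.dvd_mul h2).1 (Nat.minFac_dvd _) with h | h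
    · exact (Nat.prime_dvd_prime_iff_eq h2 hp).1 h
    · have := (hmem x hx).2.2.2.2 _ h2 h
      have h4 : x.1 < (x.1 * x.2).minFac := by exact_mod_cast this
      omega
  have inj : Set.InjOn (fun x : (_ : ℕ) × ℕ => x.1 * x.2) (S : Set ((_ : ℕ) × ℕ)) := by
    intro x hx x' hx' h
    have e1 : x.1 = x'.1 := by rw [← hmf x hx, ← hmf x' hx']; exact congrArg _ h
    have e2 : x.2 = x'.2 := by
      have h' : x.1 * x.2 = x'.1 * x'.2 := h
      rw [e1] at h'
      exact Nat.eq_of_mul_eq_mul_left (hmem x' hx').1.2.1.pos h'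
    exact Sigma.ext e1 (heq_of_eq e2)
  rw [← Finset.sum_image (f := F) (g := fun x : (_ : ℕ) × ℕ => x.1 * x.2) inj]
  refine Finset.sum_le_sum_of_subset_of_nonneg ?_ (fun n _ _ => hF n)
  intro n hn
  obtain ⟨x, hx, rfl⟩ := Finset.mem_image.1 hn
  obtain ⟨⟨⟨h1, h2⟩, hp, hd⟩, ⟨h3, h4⟩, h5, h6, h7⟩ := hmem x hx
  have hq0 : (0:ℝ) < x.1 := by exact_mod_cast hp.pos
  rw [mem_TT hA hB]
  push_cast
  rw [div_lt_iff₀ hq0] at h3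
  rw [le_div_iff₀ hq0] at h4
  refine ⟨⟨by linarith, by linarith⟩, Nat.Coprime.mul_left ((Nat.Prime.coprime_iff_not_dvd hp).2 hd) h5, ?_, ?_⟩
  · rw [(Nat.perm_primeFactorsList_mul hp.ne_zero (hpos x hx).ne').length_eq, List.length_append, h6, Nat.primeFactorsList_prime hp]
    simp [add_comm]
  · intro p hpp hpd
    rcases (Nat.Prime.dvd_mul hpp).1 hpd with h | h
    · rw [(Nat.prime_dvd_prime_iff_eq hpp hp).1 h]; exact h1
    · linarith [h7 p hpp h]
end

section
open Filter Topology

lemma sumYR_shift (M : ℕ) (R v : ℝ) (hR : 0 ≤ R) (hv : 0 ≤ v) (hvR : v ≤ R) (q : ℕ) (hq : 0 < q) :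
    ∑ k ∈ sqc M R, YR v (k*q) / k.totient = GG M (v/q) := by
  have hq0 : (0:ℝ) < q := by exact_mod_cast hq
  have hq1 : (1:ℝ) ≤ q := by exact_mod_cast hq
  have e : sqc M (v/q) = (sqc M R).filter (fun k : ℕ => (((k*q : ℕ)) : ℝ) ≤ v) := by
    ext k
    rw [Finset.mem_filter, mem_sqc (by positivity), mem_sqc hR, le_div_iff₀ hq0]
    push_cast
    constructor
    · rintro ⟨h1, h2, h3⟩
      refine ⟨⟨h1, ?_, h3⟩, h2⟩
      have : (k:ℝ) ≤ k * q := le_mul_of_one_le_right (by positivity) hq1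
      linarith
    · rintro ⟨⟨h1, h2, h3⟩, h4⟩
      exact ⟨h1, h4, h3⟩
  rw [GG, e, Finset.sum_filter]
  refine Finset.sum_congr rfl fun k _ => ?_
  unfold YR
  split_ifs <;> simp

lemma GG_ratio (s η : ℝ) (hs : 0 < s) (hs1 : s ≤ 1) (hη : 0 < η) : ∀ᶠ m : ℕ in atTop, ∀ M : ℕ, M ≠ 0 → (M:ℝ) ≤ (m:ℝ)^(20:ℝ) →
    (1 - η) * (m.totient / m : ℝ) ≤ M.totient / M → (M.totient / M : ℝ) ≤ m.totient / m → ∀ v : ℝ, 0 < v → v ≤ (m:ℝ)^s →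
    |GG M v / GG m ((m:ℝ)^s) - max 0 (Real.log v) / (s * Real.log m)| ≤ 2 * η := by
  obtain ⟨C, hC, h⟩ := GG_asymp
  filter_upwards [h, ev_log_ge ((C/(s*η))^2 + 1), eventually_ge_atTop 2] with m h1 h2 hm M hM hMm hlo hhi v hv hvm
  have hm0 : (0:ℝ) < m := by positivity
  have hm1 : (1:ℝ) ≤ m := by exact_mod_cast (by omega : 1 ≤ m)
  have hφm : (0:ℝ) < m.totient := by exact_mod_cast Nat.totient_pos.2 (by omega)
  have hφM : (0:ℝ) < M.totient := by exact_mod_cast Nat.totient_pos.2 (by omega)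
  have hM0 : (0:ℝ) < M := by exact_mod_cast Nat.pos_of_ne_zero hM
  set L := Real.log m with hL
  have hL0 : 0 < L := by have := sq_nonneg (C/(s*η)); linarith
  set c := C * √L with hc
  have hc0 : 0 ≤ c := by positivity
  have hcs : c ≤ η * (s * L) := by
    have a1 : C/(s*η) ≤ √L := Real.le_sqrt_of_sq_le (by linarith)
    rw [div_le_iff₀ (by positivity)] at a1
    have : √L * √L = L := Real.mul_self_sqrt hL0.le
    calc c ≤ (√L * (s*η)) * √L := by rw [hc]; gcongr
      _ = η * (s * (√L*√L)) := by ring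
      _ = _ := by rw [this]
  have hms : (1:ℝ) ≤ (m:ℝ)^s := Real.one_le_rpow hm1 hs.le
  have g0 := h1 m (by omega) (by simpa using rp_mono hm (by norm_num : (1:ℝ) ≤ 20)) ((m:ℝ)^s) hms (rp_mono hm (by linarith))
  rw [Real.log_rpow hm0, ← hL] at g0
  set G0 := GG m ((m:ℝ)^s) with hG0
  have hG1 : 1 ≤ G0 := GG_one_le m _ hms
  set am := (m.totient / m : ℝ) with ham
  set aM := (M.totient / M : ℝ) with haM
  have ham0 : 0 < am := by positivity
  have haM0 : 0 < aM := by positivity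
  have e1 : (m / m.totient : ℝ) = 1/am := by rw [ham, one_div_div]
  rw [e1, mul_one_div, le_div_iff₀ ham0, div_le_iff₀ ham0] at g0
  by_cases hv1 : v < 1
  · have : GG M v = 0 := by
      have : sqc M v = ∅ := by
        ext k
        rw [mem_sqc hv.le]
        simp only [Finset.notMem_empty, iff_false]
        rintro ⟨h1, h2, _⟩
        have : (1:ℝ) ≤ k := by exact_mod_cast h1
        linarith
      rw [GG, this, Finset.sum_empty]
    rw [this, max_eq_left (Real.log_nonpos hv.le hv1.le)]
    simp; linarith
  · push Not at hv1
    have gv := h1 M hM hMm v hv1 (hvm.trans (rp_mono hm (by linarith)))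
    have e2 : (M / M.totient : ℝ) = 1/aM := by rw [haM, one_div_div]
    rw [e2, mul_one_div, le_div_iff₀ haM0, div_le_iff₀ haM0] at gv
    have hlv : 0 ≤ Real.log v := Real.log_nonneg hv1
    rw [max_eq_right hlv]
    set lv := Real.log v with hlvd
    have hlv2 : lv ≤ s * L := by
      have := Real.log_le_log hv hvm
      rwa [Real.log_rpow hm0] at this
    set l0 := s * L with hl0
    have hl00 : 0 < l0 := by positivity
    have hG00 : 0 < G0 := by linarith
    rw [abs_le]
    constructor
    · have : lv / l0 - 2 * η ≤ GG M v / G0 := by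
        rw [le_div_iff₀ hG00]
        by_cases hneg : lv / l0 - 2 * η ≤ 0
        · have : 0 ≤ GG M v := le_trans (by positivity) gv.1
          nlinarith
        · push Not at hneg
          have a1 : lv / l0 ≤ 1 := by rw [div_le_one hl00]; exact hlv2
          calc (lv / l0 - 2 * η) * G0 ≤ (lv / l0 - 2*η) * ((l0 + c) * am) := by gcongr; exact g0.2
            _ ≤ (lv/l0 - 2*η) * ((l0 + η * l0) * am) := by gcongr
            _ = am * l0 * ((lv/l0 - 2*η) * (1+η)) := by ring
            _ ≤ am * l0 * ((1-η) * (lv/l0)) := by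
                refine mul_le_mul_of_nonneg_left ?_ (by positivity)
                nlinarith
            _ = lv * ((1-η) * am) := by field_simp
            _ ≤ lv * aM := by gcongr
            _ ≤ _ := gv.1
      linarith
    · have : GG M v / G0 ≤ lv / l0 + 2 * η := by
        rw [div_le_iff₀ hG00]
        calc GG M v ≤ (lv + c) * aM := gv.2
          _ ≤ (lv + η * l0) * am := by gcongr
          _ = (lv / l0 + η) * (l0 * am) := by field_simp
          _ ≤ (lv / l0 + η) * G0 := by gcongr; exact g0.1
          _ ≤ _ := by gcongr; linarith
      linarith

noncomputable def YG (m : ℕ) (r : ℝ) : ℕ → ℝ := fun k =>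
  4/5 * (YR ((m:ℝ)^r) k / GG m ((m:ℝ)^r)) + 1/5 * (YR ((m:ℝ)^(r/2)) k / GG m ((m:ℝ)^(r/2)))

lemma YG_bd {m : ℕ} (hm : 2 ≤ m) {r : ℝ} (hr : 0 < r) (k : ℕ) : 0 ≤ YG m r k ∧ YG m r k ≤ 1 := by
  have hm1 : (1:ℝ) ≤ m := by exact_mod_cast (by omega : 1 ≤ m)
  have key : ∀ s : ℝ, 0 < s → 0 ≤ YR ((m:ℝ)^s) k / GG m ((m:ℝ)^s) ∧ YR ((m:ℝ)^s) k / GG m ((m:ℝ)^s) ≤ 1 := by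
    intro s hs
    have hG := GG_one_le m ((m:ℝ)^s) (Real.one_le_rpow hm1 hs.le)
    have h1 : 0 ≤ YR ((m:ℝ)^s) k ∧ YR ((m:ℝ)^s) k ≤ 1 := by unfold YR; split_ifs <;> norm_num
    refine ⟨div_nonneg h1.1 (by linarith), ?_⟩
    rw [div_le_one (by linarith)]; linarith
  have a := key r hr
  have b := key (r/2) (by positivity)
  unfold YG
  constructor <;> linarith [a.1, a.2, b.1, b.2]

lemma YG_zero {m : ℕ} (hm : 2 ≤ m) {r : ℝ} (hr : 0 < r) (k : ℕ) (hk : (m:ℝ)^r < k) : YG m r k = 0 := by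
  have h2 : (m:ℝ)^(r/2) ≤ (m:ℝ)^r := rp_mono hm (by linarith)
  unfold YG YR
  rw [if_neg (by linarith), if_neg (by linarith)]
  simp

/-- the sum of YG with a shift -/
lemma YG_shift {m : ℕ} (hm : 2 ≤ m) {r : ℝ} (hr : 0 < r) (M q : ℕ) (hq : 0 < q) :
    ∑ k ∈ sqc M ((m:ℝ)^r), YG m r (k*q) / k.totient =
      4/5 * (GG M ((m:ℝ)^r/q) / GG m ((m:ℝ)^r)) + 1/5 * (GG M ((m:ℝ)^(r/2)/q) / GG m ((m:ℝ)^(r/2))) := by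
  have h2 : (m:ℝ)^(r/2) ≤ (m:ℝ)^r := rp_mono hm (by linarith)
  rw [← sumYR_shift M ((m:ℝ)^r) ((m:ℝ)^r) (by positivity) (by positivity) le_rfl q hq,
    ← sumYR_shift M ((m:ℝ)^r) ((m:ℝ)^(r/2)) (by positivity) (by positivity) h2 q hq, Finset.sum_div, Finset.sum_div, Finset.mul_sum, Finset.mul_sum,
    ← Finset.sum_add_distrib]
  refine Finset.sum_congr rfl fun k _ => ?_
  unfold YG; ring

/-- limiting value of the shifted sum -/
noncomputable def QQ (t : ℝ) : ℝ := 4/5 * max 0 (1 - t) + 1/5 * max 0 (1 - 2*t)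

lemma YG_asymp (r η : ℝ) (hr : 0 < r) (hr1 : r ≤ 1) (hη : 0 < η) : ∀ᶠ m : ℕ in atTop, ∀ M : ℕ, M ≠ 0 → (M:ℝ) ≤ (m:ℝ)^(20:ℝ) →
    (1 - η) * (m.totient / m : ℝ) ≤ M.totient / M → (M.totient / M : ℝ) ≤ m.totient / m → ∀ q : ℕ, 0 < q →
    |∑ k ∈ sqc M ((m:ℝ)^r), YG m r (k*q) / k.totient - QQ (Real.log q / (r * Real.log m))| ≤ 2 * η := by
  filter_upwards [GG_ratio r η hr hr1 hη, GG_ratio (r/2) η (by positivity) (by linarith) hη, eventually_ge_atTop 2] with m h1 h2 hm M hM hM1 hlo hhi q hq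
  have hm0 : (0:ℝ) < m := by positivity
  have hL0 : 0 < Real.log m := Real.log_pos (by exact_mod_cast (by omega : 1 < m))
  have hq0 : (0:ℝ) < q := by exact_mod_cast hq
  have hq1 : (1:ℝ) ≤ q := by exact_mod_cast hq
  rw [YG_shift hm hr M q hq]
  have key : ∀ s : ℝ, 0 < s → max 0 (Real.log ((m:ℝ)^s/q)) / (s * Real.log m) = max 0 (1 - Real.log q / (s * Real.log m)) := by
    intro s hs
    rw [Real.log_div (by positivity) hq0.ne', Real.log_rpow hm0, ← max_div_div_right (by positivity), zero_div, sub_div, div_self (by positivity)]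
  have a := h1 M hM hM1 hlo hhi ((m:ℝ)^r/q) (by positivity) (div_le_self (by positivity) hq1)
  have b := h2 M hM hM1 hlo hhi ((m:ℝ)^(r/2)/q) (by positivity) (div_le_self (by positivity) hq1)
  rw [key r hr] at a
  rw [key (r/2) (by positivity)] at b
  have e : Real.log q / (r/2 * Real.log m) = 2 * (Real.log q / (r * Real.log m)) := by field_simp
  rw [e] at b
  unfold QQ
  rw [abs_le] at a b ⊢
  constructor <;> linarith [a.1, a.2, b.1, b.2]
end

section
open Filter Topology

lemma tot_ratio_eq (m q : ℕ) (hm : 0 < m) (hq : q.Prime) (hqm : ¬ q ∣ m) :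
    ((m*q : ℕ).totient : ℝ) / ((m*q : ℕ):ℝ) = m.totient / m * (1 - 1/q) := by
  have hc : m.Coprime q := ((hq.coprime_iff_not_dvd).2 hqm).symm
  rw [Nat.totient_mul hc, Nat.totient_prime hq]
  have hm0 : (0:ℝ) < m := by exact_mod_cast hm
  have hq0 : (0:ℝ) < q := by exact_mod_cast hq.pos
  push_cast [Nat.cast_sub hq.one_le]
  field_simp

lemma fS_free' (M : ℕ) (R : ℝ) (hR : 0 ≤ R) (Y : ℕ → ℝ) (n : ℕ) (h : ∀ p, p.Prime → p ∣ n → p ∣ M ∨ R < p) :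
    fS M R Y n = ∑ r ∈ sqc M R, Y r / r.totient := by
  refine fS_free M R hR Y n fun r hr => ?_
  rw [mem_sqc hR] at hr
  by_contra hne
  obtain ⟨p, hp, hpd⟩ := Nat.exists_prime_and_dvd hne
  have h1 : p ∣ r := hpd.trans (Nat.gcd_dvd_right _ _)
  rcases h p hp (hpd.trans (Nat.gcd_dvd_left _ _)) with h2 | h2
  · exact Nat.not_coprime_of_dvd_of_dvd hp.one_lt h1 h2 hr.2.2.2
  · have : (p:ℝ) ≤ r := by exact_mod_cast Nat.le_of_dvd hr.1 h1
    linarith [hr.2.1]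

noncomputable def g1 (t : ℝ) : ℝ := 1 - QQ t
noncomputable def g2 (t s : ℝ) : ℝ := 1 - QQ t - QQ s + QQ (t + s)

lemma QQ_zero : QQ 0 = 1 := by unfold QQ; norm_num

lemma g1_eq (t : ℝ) : g1 t = 4/5 * min t 1 + 1/5 * min (2*t) 1 := by
  unfold g1 QQ
  rcases le_total t 1 with h | h <;> rcases le_total (2*t) 1 with h' | h' <;>
  simp only [max_def, min_def] <;> split_ifs <;> linarith

lemma aux_g2 (t s : ℝ) (ht : 0 ≤ t) (hs : 0 ≤ s) : 1 - max 0 (1-t) - max 0 (1-s) + max 0 (1-(t+s)) = max 0 (min t 1 + min s 1 - 1) := by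
  simp only [max_def, min_def]
  split_ifs <;> linarith

lemma g2_eq (t s : ℝ) (ht : 0 ≤ t) (hs : 0 ≤ s) :
    g2 t s = 4/5 * max 0 (min t 1 + min s 1 - 1) + 1/5 * max 0 (min (2*t) 1 + min (2*s) 1 - 1) := by
  rw [← aux_g2 t s ht hs, ← aux_g2 (2*t) (2*s) (by linarith) (by linarith)]
  unfold g2 QQ
  rw [mul_add 2 t s]
  ring

lemma g1_mono {t t' : ℝ} (h : t ≤ t') : g1 t ≤ g1 t' := by
  rw [g1_eq, g1_eq]
  gcongr

lemma g1_mem {t : ℝ} (h : 0 ≤ t) : 0 ≤ g1 t ∧ g1 t ≤ 1 := by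
  rw [g1_eq]
  have := min_le_right t 1
  have := min_le_right (2*t) 1
  have : 0 ≤ min t 1 := le_min h zero_le_one
  have : 0 ≤ min (2*t) 1 := le_min (by linarith) zero_le_one
  constructor <;> linarith

lemma g2_mono {t t' s s' : ℝ} (ht : 0 ≤ t) (hs : 0 ≤ s) (h : t ≤ t') (h' : s ≤ s') : g2 t s ≤ g2 t' s' := by
  rw [g2_eq t s ht hs, g2_eq t' s' (by linarith) (by linarith)]
  gcongr

lemma g2_mem {t s : ℝ} (h : 0 ≤ t) (h' : 0 ≤ s) : 0 ≤ g2 t s ∧ g2 t s ≤ 1 := by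
  rw [g2_eq t s h h']
  have a : max 0 (min t 1 + min s 1 - 1) ≤ 1 := max_le zero_le_one (by linarith [min_le_right t 1, min_le_right s 1])
  have b : max 0 (min (2*t) 1 + min (2*s) 1 - 1) ≤ 1 := max_le zero_le_one (by linarith [min_le_right (2*t) 1, min_le_right (2*s) 1])
  have a' : 0 ≤ max 0 (min t 1 + min s 1 - 1) := le_max_left _ _
  have b' : 0 ≤ max 0 (min (2*t) 1 + min (2*s) 1 - 1) := le_max_left _ _
  constructor <;> linarith

lemma sq_low {f g η : ℝ} (hg : 0 ≤ g ∧ g ≤ 1) (hη : 0 ≤ η) (h : g - η ≤ f) : g^2 - 2 * η ≤ f^2 := by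
  nlinarith [sq_nonneg (f - g), mul_le_mul_of_nonneg_left h hg.1, hg.1, hg.2, mul_le_mul_of_nonneg_right hg.2 hη]

lemma log_scale {m q : ℕ} {a r : ℝ} (hm : 2 ≤ m) (hr : 0 < r) (hq : (m:ℝ)^(a*r) < q) : a ≤ Real.log q / (r * Real.log m) := by
  have hm0 : (0:ℝ) < m := by positivity
  have hL0 : 0 < Real.log m := Real.log_pos (by exact_mod_cast (by omega : 1 < m))
  rw [le_div_iff₀ (by positivity)]
  have := Real.log_le_log (by positivity) hq.le
  rw [Real.log_rpow hm0] at this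
  linarith

lemma fG0 {m n : ℕ} {r : ℝ} (hm : 2 ≤ m) (hr : 0 < r) (h : ∀ p, p.Prime → p ∣ n → (m:ℝ)^r < p) : fS m ((m:ℝ)^r) (YG m r) n = 1 := by
  have hm1 : (1:ℝ) ≤ m := by exact_mod_cast (by omega : 1 ≤ m)
  rw [fS_free' m _ (by positivity) _ n (fun p hp hd => Or.inr (h p hp hd))]
  have := YG_shift hm hr m 1 one_pos
  simp only [mul_one, Nat.cast_one, div_one] at this
  have hG1 := GG_one_le m ((m:ℝ)^r) (Real.one_le_rpow hm1 hr.le)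
  have hG2 := GG_one_le m ((m:ℝ)^(r/2)) (Real.one_le_rpow hm1 (by positivity))
  rw [this, div_self (by linarith), div_self (by linarith)]
  norm_num

lemma fG1 (r a η : ℝ) (hr : 0 < r) (hr1 : r ≤ 1) (ha : 0 < a) (hη : 0 < η) : ∀ᶠ m : ℕ in atTop, ∀ q n : ℕ, q.Prime → ¬ q ∣ m → q ∣ n →
    (m:ℝ)^(a*r) < q → (q:ℝ) ≤ (m:ℝ)^(4:ℝ) → (∀ p, p.Prime → p ∣ n → p = q ∨ (m:ℝ)^r < p) →
    (g1 a)^2 - η ≤ (fS m ((m:ℝ)^r) (YG m r) n)^2 := by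
  filter_upwards [YG_asymp r (η/8) hr hr1 (by positivity), ev_const_le (1/(η/8)) (a*r) (by positivity), eventually_ge_atTop 2] with m h1 h2 hm q n hq hqm hqn hqa hq4 hp
  have hm0 : (0:ℝ) < m := by positivity
  have hq0 : (0:ℝ) < q := by exact_mod_cast hq.pos
  have hφm : (0:ℝ) < m.totient := by exact_mod_cast Nat.totient_pos.2 (by omega)
  have e1 : fS m ((m:ℝ)^r) (YG m r) n = ∑ k ∈ sqc (m*q) ((m:ℝ)^r), YG m r (k*1) / k.totient - ∑ k ∈ sqc (m*q) ((m:ℝ)^r), YG m r (k*q) / k.totient := by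
    rw [fS_step m _ (by positivity) _ (fun k hk => YG_zero hm hr k hk) q n hq hqm hqn, fS_free' _ _ (by positivity), ← Finset.sum_sub_distrib]
    · exact Finset.sum_congr rfl fun k _ => by rw [mul_one, sub_div]
    · intro p hpp hpd
      rcases hp p hpp hpd with rfl | h
      · exact Or.inl (dvd_mul_left _ _)
      · exact Or.inr h
  have hMle : ((m*q : ℕ):ℝ) ≤ (m:ℝ)^(20:ℝ) := by
    push_cast
    calc (m:ℝ) * q ≤ (m:ℝ)^(1:ℝ) * (m:ℝ)^(4:ℝ) := by rw [Real.rpow_one]; gcongr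
      _ = (m:ℝ)^((1:ℝ)+4) := (rp_add hm _ _).symm
      _ ≤ _ := rp_mono hm (by norm_num)
  have hqη : 1/(q:ℝ) ≤ η/8 := by
    rw [one_div_le hq0 (by positivity)]; linarith
  have hr1' : (1 - η/8) * (m.totient / m : ℝ) ≤ ((m*q : ℕ).totient : ℝ) / ((m*q : ℕ):ℝ) := by
    rw [tot_ratio_eq m q (by omega) hq hqm, mul_comm]
    gcongr
  have hM := h1 (m*q) (mul_ne_zero (by omega) hq.ne_zero) hMle hr1' (tot_ratio m q (by omega) hq hqm)
  have a1 := (abs_le.1 (hM 1 one_pos)).1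
  have a2 := (abs_le.1 (hM q hq.pos)).2
  rw [Nat.cast_one, Real.log_one, zero_div, QQ_zero] at a1
  have hg := g1_mono (log_scale hm hr hqa)
  have : g1 a - η/2 ≤ fS m ((m:ℝ)^r) (YG m r) n := by
    rw [e1]; unfold g1 at hg ⊢; linarith
  have := sq_low (g1_mem ha.le) (by positivity) this
  linarith

lemma fG2 (r a b η : ℝ) (hr : 0 < r) (hr1 : r ≤ 1) (ha : 0 < a) (hab : a ≤ b) (hη : 0 < η) : ∀ᶠ m : ℕ in atTop, ∀ q q' n : ℕ, q.Prime → ¬ q ∣ m →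
    q'.Prime → ¬ q' ∣ m → q ≠ q' → q ∣ n → q' ∣ n →
    (m:ℝ)^(a*r) < q → (q:ℝ) ≤ (m:ℝ)^(4:ℝ) → (m:ℝ)^(b*r) < q' → (q':ℝ) ≤ (m:ℝ)^(4:ℝ) → (∀ p, p.Prime → p ∣ n → p = q ∨ p = q' ∨ (m:ℝ)^r < p) →
    (g2 a b)^2 - η ≤ (fS m ((m:ℝ)^r) (YG m r) n)^2 := by
  filter_upwards [YG_asymp r (η/16) hr hr1 (by positivity), ev_const_le (1/(η/32)) (a*r) (by positivity), eventually_ge_atTop 2] with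
    m h1 h2 hm q q' n hq hqm hq' hqm' hne hqn hqn' hqa hq4 hqa' hq4' hp
  have hm0 : (0:ℝ) < m := by positivity
  have hq0 : (0:ℝ) < q := by exact_mod_cast hq.pos
  have hq0' : (0:ℝ) < q' := by exact_mod_cast hq'.pos
  have hφm : (0:ℝ) < m.totient := by exact_mod_cast Nat.totient_pos.2 (by omega)
  have hmq : 0 < m * q := Nat.mul_pos (by omega) hq.pos
  have hqmq' : ¬ q' ∣ m * q := by
    rw [Nat.Prime.dvd_mul hq']
    rintro (h | h)
    · exact hqm' h
    · exact hne ((Nat.prime_dvd_prime_iff_eq hq' hq).1 h).symm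
  have hz := fun k hk => YG_zero (r := r) hm hr k hk
  have e1 : fS m ((m:ℝ)^r) (YG m r) n = ∑ k ∈ sqc (m*q*q') ((m:ℝ)^r), YG m r (k*1) / k.totient - ∑ k ∈ sqc (m*q*q') ((m:ℝ)^r), YG m r (k*q) / k.totient
      - ∑ k ∈ sqc (m*q*q') ((m:ℝ)^r), YG m r (k*q') / k.totient + ∑ k ∈ sqc (m*q*q') ((m:ℝ)^r), YG m r (k*(q'*q)) / k.totient := by
    rw [fS_step m _ (by positivity) _ hz q n hq hqm hqn, fS_step (m*q) _ (by positivity) _ ?_ q' n hq' hqmq' hqn', fS_free' _ _ (by positivity), ← Finset.sum_sub_distrib, ← Finset.sum_sub_distrib, ← Finset.sum_add_distrib]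
    · refine Finset.sum_congr rfl fun k _ => ?_
      rw [mul_one, mul_assoc k q' q]; ring
    · intro p hpp hpd
      rcases hp p hpp hpd with rfl | rfl | h
      · exact Or.inl (dvd_mul_of_dvd_left (dvd_mul_left _ _) _)
      · exact Or.inl (dvd_mul_left _ _)
      · exact Or.inr h
    · intro k hk
      rw [hz k hk, hz (k*q), sub_zero]
      push_cast
      have : (1:ℝ) ≤ q := by exact_mod_cast hq.one_le
      exact lt_of_lt_of_le hk (le_mul_of_one_le_right (by positivity) this)
  have hMle : ((m*q*q' : ℕ):ℝ) ≤ (m:ℝ)^(20:ℝ) := by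
    push_cast
    calc (m:ℝ) * q * q' ≤ (m:ℝ)^(1:ℝ) * (m:ℝ)^(4:ℝ) * (m:ℝ)^(4:ℝ) := by rw [Real.rpow_one]; gcongr
      _ = (m:ℝ)^((1:ℝ)+4+4) := by rw [← rp_add hm, ← rp_add hm]
      _ ≤ _ := rp_mono hm (by norm_num)
  have hqη : 1/(q:ℝ) ≤ η/32 := by
    rw [one_div_le hq0 (by positivity)]; linarith
  have hqη' : 1/(q':ℝ) ≤ η/32 := by
    rw [one_div_le hq0' (by positivity)]
    have : (m:ℝ)^(a*r) ≤ (m:ℝ)^(b*r) := rp_mono hm (by gcongr)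
    linarith
  have hq1 : 1/(q:ℝ) ≤ 1 := by rw [div_le_one hq0]; exact_mod_cast hq.one_le
  have hq1' : 1/(q':ℝ) ≤ 1 := by rw [div_le_one hq0']; exact_mod_cast hq'.one_le
  have hr1' : (1 - η/16) * (m.totient / m : ℝ) ≤ ((m*q*q' : ℕ).totient : ℝ) / ((m*q*q' : ℕ):ℝ) := by
    rw [tot_ratio_eq (m*q) q' hmq hq' hqmq', tot_ratio_eq m q (by omega) hq hqm, mul_comm, mul_assoc]
    refine mul_le_mul_of_nonneg_left ?_ (by positivity)
    have : 0 ≤ 1/(q:ℝ) * (1/(q':ℝ)) := by positivity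
    nlinarith
  have hM := h1 (m*q*q') (Nat.mul_pos hmq hq'.pos).ne' hMle hr1' ((tot_ratio (m*q) q' hmq hq' hqmq').trans (tot_ratio m q (by omega) hq hqm))
  have a1 := (abs_le.1 (hM 1 one_pos)).1
  have a2 := (abs_le.1 (hM q hq.pos)).2
  have a3 := (abs_le.1 (hM q' hq'.pos)).2
  have a4 := (abs_le.1 (hM (q'*q) (Nat.mul_pos hq'.pos hq.pos))).1
  rw [Nat.cast_one, Real.log_one, zero_div, QQ_zero] at a1
  rw [Nat.cast_mul, Real.log_mul hq0'.ne' hq0.ne', add_comm (Real.log q'), add_div] at a4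
  have hg := g2_mono ha.le (ha.le.trans hab) (log_scale hm hr hqa) (log_scale hm hr hqa')
  have : g2 a b - η/2 ≤ fS m ((m:ℝ)^r) (YG m r) n := by
    rw [e1]; unfold g2 at hg ⊢; linarith
  have := sq_low (g2_mem ha.le (ha.le.trans hab)) (by positivity) this
  linarith
end

section
open Filter Topology

lemma mu_low (r a b η : ℝ) (hr : 0 < r) (ha : 0 < a) (hab : a < b) (hη : 0 < η) : ∀ᶠ m : ℕ in atTop,
    (1 - η) * Real.log (b/a) ≤ ∑ q ∈ prs m ((m:ℝ)^(a*r)) ((m:ℝ)^(b*r)), 1/(q:ℝ) := by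
  have hl : 0 < Real.log (b/a) := Real.log_pos (by rw [lt_div_iff₀ ha]; linarith)
  filter_upwards [pinv_asymp (a*r) (b*r) (η * Real.log (b/a)) (by positivity) (by gcongr) (by positivity)] with m h
  rw [mul_div_mul_right _ _ hr.ne'] at h
  have := (abs_le.1 h).1
  linarith

lemma psum (β κ r N N1 Sa Sb η : ℝ) (hκ : 0 < κ) (hr : 0 < r) (hN : r * N = β) (hN1 : β + κ ≤ r * N1) (hSb : Sb + 1 ≤ N) (hSa : Sa ≤ Sb)
    (hη : 0 < η) : ∀ᶠ m : ℕ in atTop, ∀ Q : ℝ, (m:ℝ)^(Sa*r) ≤ Q → Q ≤ (m:ℝ)^(Sb*r) →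
      (1 - η) * (κ/r / (N1 - Sa)) ≤ ∑ p ∈ prs m ((m:ℝ)^β/Q) ((m:ℝ)^(β+κ)/Q), 1/(p:ℝ) := by
  obtain ⟨C, hC, h⟩ := plog_lower
  filter_upwards [h r hr, ev_log_ge (C/(η*κ) + 1), eventually_ge_atTop 2] with m h1 h2 hm Q hQ1 hQ2
  have hm0 : (0:ℝ) < m := by positivity
  have hm1 : (1:ℝ) ≤ m := by exact_mod_cast (by omega : 1 ≤ m)
  set L := Real.log m with hL
  have hL0 : 0 < L := by have : 0 < C/(η*κ) := by positivity
                         linarith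
  have hQ0 : 0 < Q := lt_of_lt_of_le (by positivity) hQ1
  set A := (m:ℝ)^β/Q with hA
  set B := (m:ℝ)^(β+κ)/Q with hB
  have hAr : (m:ℝ)^r ≤ A := by
    rw [hA, le_div_iff₀ hQ0]
    calc (m:ℝ)^r * Q ≤ (m:ℝ)^r * (m:ℝ)^(Sb*r) := by gcongr
      _ = (m:ℝ)^(r + Sb*r) := (rp_add hm _ _).symm
      _ ≤ _ := rp_mono hm (by nlinarith)
  have hA0 : 0 < A := lt_of_lt_of_le (by positivity) hAr
  have hAB : A ≤ B := by
    rw [hA, hB]; gcongr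
    linarith
  have b := h1 A B hAr hAB
  have eBA : B / A = (m:ℝ)^κ := by
    rw [hA, hB, rp_add hm]; field_simp
  rw [eBA, Real.log_rpow hm0, ← hL] at b
  have d0 : 0 < N1 - Sa := by nlinarith
  have hB0 : 0 < B := by positivity
  have hlB : Real.log B ≤ r * (N1 - Sa) * L := by
    rw [hB, Real.log_div (by positivity) hQ0.ne', Real.log_rpow hm0]
    have := Real.log_le_log (by positivity) hQ1
    rw [Real.log_rpow hm0] at this
    have := mul_le_mul_of_nonneg_right hN1 hL0.le
    linarith
  have hs : ∑ p ∈ prs m A B, Real.log p / p ≤ (r * (N1 - Sa) * L) * ∑ p ∈ prs m A B, 1/(p:ℝ) := by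
    rw [Finset.mul_sum]
    refine Finset.sum_le_sum fun p hp => ?_
    rw [mem_prs hA0.le hB0.le] at hp
    have hp0 : (0:ℝ) < p := by exact_mod_cast hp.2.1.pos
    rw [mul_one_div]
    have := Real.log_le_log hp0 hp.1.2
    gcongr
    linarith
  have hC2 : C ≤ η * (κ * L) := by
    have : C/(η*κ) ≤ L := by linarith
    rw [div_le_iff₀ (by positivity)] at this
    linarith
  have : (1-η) * (κ * L) ≤ (r * (N1 - Sa) * L) * ∑ p ∈ prs m A B, 1/(p:ℝ) := by linarith
  calc (1 - η) * (κ/r / (N1 - Sa)) = ((1-η) * (κ * L)) / (r * (N1 - Sa) * L) := by field_simp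
    _ ≤ _ := by rw [div_le_iff₀ (by positivity)]; linarith

lemma nest (P : Finset ℕ) (H : ℕ → ℝ) (X c : ℝ) (hc : 0 ≤ c) (hX : X ≤ ∑ q ∈ P, 1/(q:ℝ)) (h : ∀ q ∈ P, 1/(q:ℝ) * c ≤ H q) :
    X * c ≤ ∑ q ∈ P, H q := by
  calc X * c ≤ (∑ q ∈ P, 1/(q:ℝ)) * c := by gcongr
    _ = ∑ q ∈ P, 1/(q:ℝ) * c := by rw [Finset.sum_mul]
    _ ≤ _ := Finset.sum_le_sum h

lemma grid_split (m : ℕ) (r : ℝ) (hm : 2 ≤ m) (hr : 0 < r) (a : ℕ → ℝ) (ha : Monotone a) (f : ℕ → ℝ) (i n : ℕ) (hin : i ≤ n) :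
    ∑ q ∈ prs m ((m:ℝ)^(a i*r)) ((m:ℝ)^(a n*r)), f q = ∑ j ∈ Finset.Ico i n, ∑ q ∈ prs m ((m:ℝ)^(a j*r)) ((m:ℝ)^(a (j+1)*r)), f q := by
  induction n, hin using Nat.le_induction with
  | base => simp [prs]
  | succ n hn ih =>
    rw [Finset.sum_Ico_succ_top hn, ← ih]
    exact prs_union (rp_mono hm (mul_le_mul_of_nonneg_right (ha hn) hr.le)) (rp_mono hm (mul_le_mul_of_nonneg_right (ha (Nat.le_succ n)) hr.le)) f

/-- the weight used in criterion G -/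
noncomputable def FG (m : ℕ) (r : ℝ) (n : ℕ) : ℝ := (fS m ((m:ℝ)^r) (YG m r) n)^2 / n

lemma FG_nonneg (m : ℕ) (r : ℝ) (n : ℕ) : 0 ≤ FG m r n := by unfold FG; positivity

lemma pat0 (β κ r N N1 η : ℝ) (hκ : 0 < κ) (hr : 0 < r) (hN : r * N = β) (hN1 : β + κ ≤ r * N1) (h1 : 1 ≤ N) (hη : 0 < η) :
    ∀ᶠ m : ℕ in atTop, (1 - η) * (κ/r / N1) ≤ ∑ n ∈ TT m 1 1 ((m:ℝ)^β) ((m:ℝ)^(β+κ)), FG m r n := by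
  filter_upwards [psum β κ r N N1 0 0 η hκ hr hN hN1 (by linarith) le_rfl hη, eventually_ge_atTop 2] with m h hm
  have hm1 : (1:ℝ) ≤ m := by exact_mod_cast (by omega : 1 ≤ m)
  have hβ : r ≤ β := by nlinarith
  have b := h 1 (by simp) (by simp)
  rw [sub_zero, div_one, div_one] at b
  refine b.trans (le_trans (Finset.sum_le_sum fun p hp => ?_) (TT_one (by positivity) (by positivity) (Real.one_le_rpow hm1 (by linarith)) (FG m r) (FG_nonneg m r)))
  rw [mem_prs (by positivity) (by positivity)] at hp
  unfold FG
  rw [fG0 hm hr, one_pow]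
  intro q hq hd
  rw [(Nat.prime_dvd_prime_iff_eq hq hp.2.1).1 hd]
  exact lt_of_le_of_lt (rp_mono hm hβ) hp.1.1

/-- common facts on a cell -/
lemma cell_mem {m q : ℕ} {a b r : ℝ} (hm : 2 ≤ m) (hr : 0 < r) (ha : 0 < a) (hb : b * r ≤ 4)
    (hq : q ∈ prs m ((m:ℝ)^(a*r)) ((m:ℝ)^(b*r))) : q.Prime ∧ ¬ q ∣ m ∧ (0:ℝ) < q ∧ (m:ℝ)^(a*r) < q ∧ (q:ℝ) ≤ (m:ℝ)^(b*r) ∧ (q:ℝ) ≤ (m:ℝ)^(4:ℝ) := by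
  rw [mem_prs (by positivity) (by positivity)] at hq
  exact ⟨hq.2.1, hq.2.2, by exact_mod_cast hq.2.1.pos, hq.1.1, hq.1.2, hq.1.2.trans (rp_mono hm hb)⟩

lemma mul_low {f g η : ℝ} (hg : 0 < g → g - η * g ≤ f) (hf : 0 ≤ f) (hg0 : 0 ≤ g) : (1-η) * g ≤ f := by
  rcases hg0.eq_or_lt with h | h
  · rw [← h]; simpa using hf
  · have := hg h; linarith
end

section
open Filter Topology

lemma FGlow1 (r a η : ℝ) (hr : 0 < r) (hr1 : r ≤ 1) (ha : 0 < a) (hη : 0 < η) : ∀ᶠ m : ℕ in atTop,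
    ∀ q n : ℕ, q.Prime → ¬ q ∣ m → q ∣ n → (m:ℝ)^(a*r) < q → (q:ℝ) ≤ (m:ℝ)^(4:ℝ) → (∀ p, p.Prime → p ∣ n → p = q ∨ (m:ℝ)^r < p) →
      (1-η) * (g1 a)^2 ≤ (fS m ((m:ℝ)^r) (YG m r) n)^2 := by
  rcases (sq_nonneg (g1 a)).eq_or_lt with h | h
  · rw [← h]
    refine Eventually.of_forall fun m q n _ _ _ _ _ _ => ?_
    rw [mul_zero]; positivity
  · filter_upwards [fG1 r a (η * (g1 a)^2) hr hr1 ha (by positivity)] with m hm q n h1 h2 h3 h4 h5 h6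
    have := hm q n h1 h2 h3 h4 h5 h6
    linarith

lemma FGlow2 (r a b η : ℝ) (hr : 0 < r) (hr1 : r ≤ 1) (ha : 0 < a) (hab : a ≤ b) (hη : 0 < η) : ∀ᶠ m : ℕ in atTop,
    ∀ q q' n : ℕ, q.Prime → ¬ q ∣ m → q'.Prime → ¬ q' ∣ m → q ≠ q' → q ∣ n → q' ∣ n → (m:ℝ)^(a*r) < q → (q:ℝ) ≤ (m:ℝ)^(4:ℝ) →
      (m:ℝ)^(b*r) < q' → (q':ℝ) ≤ (m:ℝ)^(4:ℝ) → (∀ p, p.Prime → p ∣ n → p = q ∨ p = q' ∨ (m:ℝ)^r < p) →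
      (1-η) * (g2 a b)^2 ≤ (fS m ((m:ℝ)^r) (YG m r) n)^2 := by
  rcases (sq_nonneg (g2 a b)).eq_or_lt with h | h
  · rw [← h]
    refine Eventually.of_forall fun m q q' n _ _ _ _ _ _ _ _ _ _ _ _ => ?_
    rw [mul_zero]; positivity
  · filter_upwards [fG2 r a b (η * (g2 a b)^2) hr hr1 ha hab (by positivity)] with m hm q q' n h1 h2 h3 h4 h5 h6 h7 h8 h9 h10 h11 h12
    have := hm q q' n h1 h2 h3 h4 h5 h6 h7 h8 h9 h10 h11 h12
    linarith

lemma innerG {m Q : ℕ} {r A B z c S : ℝ} (hA : 0 ≤ A) (hB : 0 ≤ B) (hz : z ≤ A) (hQ : 0 < Q) (hc : 0 ≤ c)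
    (h : ∀ p ∈ prs m A B, c ≤ (fS m ((m:ℝ)^r) (YG m r) (Q*p))^2) (hS : S ≤ ∑ p ∈ prs m A B, 1/(p:ℝ)) :
    1/(Q:ℝ) * (c * S) ≤ ∑ n ∈ TT m 1 z A B, FG m r (Q*n) := by
  have hQ0 : (0:ℝ) < Q := by exact_mod_cast hQ
  refine le_trans ?_ (TT_one hA hB hz (fun n => FG m r (Q*n)) (fun n => FG_nonneg m r _))
  calc 1/(Q:ℝ) * (c * S) ≤ 1/(Q:ℝ) * (c * ∑ p ∈ prs m A B, 1/(p:ℝ)) := by gcongr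
    _ = ∑ p ∈ prs m A B, 1/(Q:ℝ) * (c * (1/(p:ℝ))) := by rw [Finset.mul_sum, Finset.mul_sum]
    _ ≤ _ := by
      refine Finset.sum_le_sum fun p hp => ?_
      have hp' := h p hp
      rw [mem_prs hA hB] at hp
      have hp0 : (0:ℝ) < p := by exact_mod_cast hp.2.1.pos
      unfold FG
      rw [Nat.cast_mul]
      calc 1/(Q:ℝ) * (c * (1/(p:ℝ))) = c / (Q*p) := by field_simp
        _ ≤ _ := by gcongr

lemma pat1 (β κ r N N1 a b η : ℝ) (hκ : 0 < κ) (hr : 0 < r) (hr1 : r ≤ 1) (hβ1 : β ≤ 1) (hN : r * N = β) (hN1 : β + κ ≤ r * N1)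
    (ha : 0 < a) (hab : a < b) (h2 : 2*b ≤ N) (h3 : b + 1 ≤ N) (hη : 0 < η) (hη1 : η < 1) : ∀ᶠ m : ℕ in atTop,
    (1-η)^3 * (κ/r) * (Real.log (b/a) * (g1 a)^2/(N1-a)) ≤
      ∑ q ∈ prs m ((m:ℝ)^(a*r)) ((m:ℝ)^(b*r)), ∑ n ∈ TT m 1 q ((m:ℝ)^β/q) ((m:ℝ)^(β+κ)/q), FG m r (q*n) := by
  filter_upwards [FGlow1 r a η hr hr1 ha hη, mu_low r a b η hr ha hab hη, psum β κ r N N1 a b η hκ hr hN hN1 h3 hab.le hη,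
    eventually_ge_atTop 2] with m hf hmu hp hm
  have hd : 0 < N1 - a := by nlinarith
  have hη2 : 0 < 1 - η := by linarith
  have hbr : b * r ≤ 4 := by nlinarith
  have hlog : 0 < Real.log (b/a) := Real.log_pos (by rw [lt_div_iff₀ ha]; linarith)
  calc (1-η)^3 * (κ/r) * (Real.log (b/a) * (g1 a)^2/(N1-a)) = ((1 - η) * Real.log (b/a)) * (((1-η)*(g1 a)^2) * ((1-η)*(κ/r/(N1-a)))) := by
        field_simp
    _ ≤ _ := by
      refine nest _ _ _ _ (by positivity) hmu fun q hq => ?_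
      obtain ⟨q1, q2, q3, q4, q5, q6⟩ := cell_mem hm hr ha hbr hq
      have hz : (q:ℝ) ≤ (m:ℝ)^β/q := by
        rw [le_div_iff₀ q3]
        calc (q:ℝ)*q ≤ (m:ℝ)^(b*r) * (m:ℝ)^(b*r) := by gcongr
          _ = (m:ℝ)^(b*r+b*r) := (rp_add hm _ _).symm
          _ ≤ _ := rp_mono hm (by nlinarith)
      have hz2 : (m:ℝ)^r ≤ (m:ℝ)^β/q := by
        rw [le_div_iff₀ q3]
        calc (m:ℝ)^r*q ≤ (m:ℝ)^r * (m:ℝ)^(b*r) := by gcongr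
          _ = (m:ℝ)^(r+b*r) := (rp_add hm _ _).symm
          _ ≤ _ := rp_mono hm (by nlinarith)
      refine innerG (by positivity) (by positivity) hz q1.pos (by positivity) (fun p hp2 => ?_) (hp q q4.le q5)
      rw [mem_prs (by positivity) (by positivity)] at hp2
      refine hf q (q*p) q1 q2 (dvd_mul_right _ _) q4 q6 fun s hs hsd => ?_
      rcases (Nat.Prime.dvd_mul hs).1 hsd with h | h
      · exact Or.inl ((Nat.prime_dvd_prime_iff_eq hs q1).1 h)
      · rw [(Nat.prime_dvd_prime_iff_eq hs hp2.2.1).1 h]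
        exact Or.inr (lt_of_le_of_lt hz2 hp2.1.1)

lemma pat2 (β κ r N N1 a b a' b' η : ℝ) (hκ : 0 < κ) (hr : 0 < r) (hr1 : r ≤ 1) (hβ1 : β ≤ 1) (hN : r * N = β) (hN1 : β + κ ≤ r * N1)
    (ha : 0 < a) (hab : a < b) (hba : b ≤ a') (hab' : a' < b') (h2 : b + 2*b' ≤ N) (h3 : b + b' + 1 ≤ N) (hη : 0 < η) (hη1 : η < 1) :
    ∀ᶠ m : ℕ in atTop,
    (1-η)^4 * (κ/r) * (Real.log (b/a) * Real.log (b'/a') * (g2 a a')^2/(N1-a-a')) ≤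
      ∑ q ∈ prs m ((m:ℝ)^(a*r)) ((m:ℝ)^(b*r)), ∑ q' ∈ prs m ((m:ℝ)^(a'*r)) ((m:ℝ)^(b'*r)),
        ∑ n ∈ TT m 1 q' ((m:ℝ)^β/q/q') ((m:ℝ)^(β+κ)/q/q'), FG m r (q*(q'*n)) := by
  have ha' : 0 < a' := by linarith
  filter_upwards [FGlow2 r a a' η hr hr1 ha (by linarith) hη, mu_low r a b η hr ha hab hη, mu_low r a' b' η hr ha' hab' hη,
    psum β κ r N N1 (a+a') (b+b') η hκ hr hN hN1 h3 (by linarith) hη,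
    eventually_ge_atTop 2] with m hf hmu hmu' hp hm
  have hd : 0 < N1 - (a+a') := by nlinarith
  have hη2 : 0 < 1 - η := by linarith
  have hbr : b * r ≤ 4 := by nlinarith
  have hbr' : b' * r ≤ 4 := by nlinarith
  have hlog : 0 < Real.log (b/a) := Real.log_pos (by rw [lt_div_iff₀ ha]; linarith)
  have hlog' : 0 < Real.log (b'/a') := Real.log_pos (by rw [lt_div_iff₀ ha']; linarith)
  rw [sub_sub]
  calc (1-η)^4 * (κ/r) * (Real.log (b/a) * Real.log (b'/a') * (g2 a a')^2/(N1-(a+a')))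
      = ((1 - η) * Real.log (b/a)) * (((1 - η) * Real.log (b'/a')) * (((1-η)*(g2 a a')^2) * ((1-η)*(κ/r/(N1-(a+a')))))) := by
        field_simp
    _ ≤ _ := by
      refine nest _ _ _ _ (by positivity) hmu fun q hq => ?_
      obtain ⟨q1, q2, q3, q4, q5, q6⟩ := cell_mem hm hr ha hbr hq
      rw [mul_left_comm]
      refine nest _ _ _ _ (by positivity) hmu' fun q' hq' => ?_
      obtain ⟨q1', q2', q3', q4', q5', q6'⟩ := cell_mem hm hr ha' hbr' hq'
      have hqq : (q:ℝ) < q' := lt_of_le_of_lt (q5.trans (rp_mono hm (by nlinarith))) q4'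
      have hz : (q':ℝ) ≤ (m:ℝ)^β/q/q' := by
        rw [le_div_iff₀ q3', le_div_iff₀ q3]
        calc (q':ℝ)*q'*q ≤ (m:ℝ)^(b'*r) * (m:ℝ)^(b'*r) * (m:ℝ)^(b*r) := by gcongr
          _ = (m:ℝ)^(b'*r+b'*r+b*r) := by rw [rp_add hm, rp_add hm]
          _ ≤ _ := rp_mono hm (by nlinarith)
      have hz2 : (m:ℝ)^r ≤ (m:ℝ)^β/q/q' := by
        rw [le_div_iff₀ q3', le_div_iff₀ q3]
        calc (m:ℝ)^r*q'*q ≤ (m:ℝ)^r * (m:ℝ)^(b'*r)* (m:ℝ)^(b*r) := by gcongr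
          _ = (m:ℝ)^(r+b'*r+b*r) := by rw [rp_add hm, rp_add hm]
          _ ≤ _ := rp_mono hm (by nlinarith)
      have e1 : (1:ℝ)/q' * (1/q * (((1-η)*(g2 a a')^2) * ((1-η)*(κ/r/(N1-(a+a')))))) =
          1/((q*q' : ℕ):ℝ) * (((1-η)*(g2 a a')^2) * ((1-η)*(κ/r/(N1-(a+a'))))) := by push_cast; field_simp
      rw [e1]
      have e2 : ∀ n : ℕ, FG m r (q*(q'*n)) = FG m r ((q*q')*n) := fun n => by rw [mul_assoc]
      simp only [e2]
      refine innerG (by positivity) (by positivity) hz (Nat.mul_pos q1.pos q1'.pos) (by positivity) (fun p hp2 => ?_) ?_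
      · rw [mem_prs (by positivity) (by positivity)] at hp2
        refine hf q q' (q*q'*p) q1 q2 q1' q2' (fun h => by rw [h] at hqq; exact lt_irrefl _ hqq) ⟨q'*p, by ring⟩ ⟨q*p, by ring⟩ q4 q6 q4' q6' fun s hs hsd => ?_
        rcases (Nat.Prime.dvd_mul hs).1 hsd with h | h
        · rcases (Nat.Prime.dvd_mul hs).1 h with h | h
          · exact Or.inl ((Nat.prime_dvd_prime_iff_eq hs q1).1 h)
          · exact Or.inr (Or.inl ((Nat.prime_dvd_prime_iff_eq hs q1').1 h))
        · rw [(Nat.prime_dvd_prime_iff_eq hs hp2.2.1).1 h]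
          exact Or.inr (Or.inr (lt_of_le_of_lt hz2 hp2.1.1))
      · refine le_trans (hp (q*q') ?_ ?_) (le_of_eq ?_)
        · rw [add_mul, rp_add hm]; gcongr
        · rw [add_mul, rp_add hm]; gcongr
        · simp only [div_div]

set_option maxHeartbeats 800000 in
lemma pat3 (β κ r N N1 a b a' b' a'' b'' η : ℝ) (hκ : 0 < κ) (hr : 0 < r) (hr1 : r ≤ 1) (hβ1 : β ≤ 1) (hN : r * N = β) (hN1 : β + κ ≤ r * N1)
    (ha : 0 < a) (hab : a < b) (hba : b ≤ a') (hab' : a' < b') (hba' : b' ≤ a'') (hab'' : a'' < b'') (h1 : 1 ≤ a'')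
    (h2 : b + b' + 2*b'' ≤ N) (hη : 0 < η) (hη1 : η < 1) :
    ∀ᶠ m : ℕ in atTop,
    (1-η)^5 * (κ/r) * (Real.log (b/a) * Real.log (b'/a') * Real.log (b''/a'') * (g2 a a')^2/(N1-a-a'-a'')) ≤
      ∑ q ∈ prs m ((m:ℝ)^(a*r)) ((m:ℝ)^(b*r)), ∑ q' ∈ prs m ((m:ℝ)^(a'*r)) ((m:ℝ)^(b'*r)), ∑ q'' ∈ prs m ((m:ℝ)^(a''*r)) ((m:ℝ)^(b''*r)),
        ∑ n ∈ TT m 1 q'' ((m:ℝ)^β/q/q'/q'') ((m:ℝ)^(β+κ)/q/q'/q''), FG m r (q*(q'*(q''*n))) := by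
  have ha' : 0 < a' := by linarith
  have ha'' : 0 < a'' := by linarith
  filter_upwards [FGlow2 r a a' η hr hr1 ha (by linarith) hη, mu_low r a b η hr ha hab hη, mu_low r a' b' η hr ha' hab' hη,
    mu_low r a'' b'' η hr ha'' hab'' hη,
    psum β κ r N N1 (a+a'+a'') (b+b'+b'') η hκ hr hN hN1 (by linarith) (by linarith) hη,
    eventually_ge_atTop 2] with m hf hmu hmu' hmu'' hp hm
  have hd : 0 < N1 - (a+a'+a'') := by nlinarith
  have hη2 : 0 < 1 - η := by linarith
  have hbr : b * r ≤ 4 := by nlinarith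
  have hbr' : b' * r ≤ 4 := by nlinarith
  have hbr'' : b'' * r ≤ 4 := by nlinarith
  have hlog : 0 < Real.log (b/a) := Real.log_pos (by rw [lt_div_iff₀ ha]; linarith)
  have hlog' : 0 < Real.log (b'/a') := Real.log_pos (by rw [lt_div_iff₀ ha']; linarith)
  have hlog'' : 0 < Real.log (b''/a'') := Real.log_pos (by rw [lt_div_iff₀ ha'']; linarith)
  have ed : N1 - a - a' - a'' = N1 - (a+a'+a'') := by ring
  rw [ed]
  set c0 := (((1-η)*(g2 a a')^2) * ((1-η)*(κ/r/(N1-(a+a'+a''))))) with hc0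
  have hc0' : 0 ≤ c0 := by positivity
  calc (1-η)^5 * (κ/r) * (Real.log (b/a) * Real.log (b'/a') * Real.log (b''/a'') * (g2 a a')^2/(N1-(a+a'+a'')))
      = ((1 - η) * Real.log (b/a)) * (((1 - η) * Real.log (b'/a')) * (((1 - η) * Real.log (b''/a'')) * c0)) := by
        rw [hc0]; field_simp
    _ ≤ _ := by
      refine nest _ _ _ _ (by positivity) hmu fun q hq => ?_
      obtain ⟨q1, q2, q3, q4, q5, q6⟩ := cell_mem hm hr ha hbr hq
      rw [mul_left_comm]
      refine nest _ _ _ _ (by positivity) hmu' fun q' hq' => ?_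
      obtain ⟨q1', q2', q3', q4', q5', q6'⟩ := cell_mem hm hr ha' hbr' hq'
      rw [mul_left_comm (1/(q:ℝ)), mul_left_comm]
      refine nest _ _ _ _ (by positivity) hmu'' fun q'' hq'' => ?_
      obtain ⟨q1'', q2'', q3'', q4'', q5'', q6''⟩ := cell_mem hm hr ha'' hbr'' hq''
      have hqq : (q:ℝ) < q' := lt_of_le_of_lt (q5.trans (rp_mono hm (by nlinarith))) q4'
      have hz : (q'':ℝ) ≤ (m:ℝ)^β/q/q'/q'' := by
        rw [le_div_iff₀ q3'', le_div_iff₀ q3', le_div_iff₀ q3]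
        calc (q'':ℝ)*q''*q'*q ≤ (m:ℝ)^(b''*r) * (m:ℝ)^(b''*r) * (m:ℝ)^(b'*r) * (m:ℝ)^(b*r) := by gcongr
          _ = (m:ℝ)^(b''*r+b''*r+b'*r+b*r) := by rw [rp_add hm, rp_add hm, rp_add hm]
          _ ≤ _ := rp_mono hm (by nlinarith)
      have hz1 : (m:ℝ)^r < q'' := lt_of_le_of_lt (rp_mono hm (by nlinarith)) q4''
      have e1 : (1:ℝ)/q'' * (1/q' * (1/q * c0)) =
          1/((q*q'*q'' : ℕ):ℝ) * c0 := by push_cast; field_simp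
      rw [e1]
      have e2 : ∀ n : ℕ, FG m r (q*(q'*(q''*n))) = FG m r ((q*q'*q'')*n) := fun n => by rw [mul_assoc, mul_assoc]
      simp only [e2]
      rw [hc0]
      refine innerG (by positivity) (by positivity) hz (Nat.mul_pos (Nat.mul_pos q1.pos q1'.pos) q1''.pos) (by positivity) (fun p hp2 => ?_) ?_
      · rw [mem_prs (by positivity) (by positivity)] at hp2
        refine hf q q' (q*q'*q''*p) q1 q2 q1' q2' (fun h => by rw [h] at hqq; exact lt_irrefl _ hqq) ⟨q'*q''*p, by ring⟩ ⟨q*q''*p, by ring⟩ q4 q6 q4' q6' fun s hs hsd => ?_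
        rcases (Nat.Prime.dvd_mul hs).1 hsd with h | h
        · rcases (Nat.Prime.dvd_mul hs).1 h with h | h
          · rcases (Nat.Prime.dvd_mul hs).1 h with h | h
            · exact Or.inl ((Nat.prime_dvd_prime_iff_eq hs q1).1 h)
            · exact Or.inr (Or.inl ((Nat.prime_dvd_prime_iff_eq hs q1').1 h))
          · rw [(Nat.prime_dvd_prime_iff_eq hs q1'').1 h]
            exact Or.inr (Or.inr hz1)
        · rw [(Nat.prime_dvd_prime_iff_eq hs hp2.2.1).1 h]
          exact Or.inr (Or.inr (lt_of_lt_of_le hz1 (hz.trans hp2.1.1.le)))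
      · refine le_trans (hp (q*q'*q'') ?_ ?_) (le_of_eq ?_)
        · rw [add_mul, add_mul, rp_add hm, rp_add hm]; gcongr
        · rw [add_mul, add_mul, rp_add hm, rp_add hm]; gcongr
        · simp only [div_div, mul_assoc]
end

section
open Filter Topology

lemma stepTT {m k : ℕ} {r z A B : ℝ} (hm : 2 ≤ m) (hr : 0 < r) (a : ℕ → ℝ) (ha : Monotone a) {i n : ℕ} (hin : i ≤ n)
    (hz0 : 0 ≤ z) (hz : z ≤ (m:ℝ)^(a i * r)) (hA : 0 ≤ A) (hB : 0 ≤ B) (F : ℕ → ℝ) (hF : ∀ n, 0 ≤ F n) :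
    ∑ j ∈ Finset.Ico i n, ∑ q ∈ prs m ((m:ℝ)^(a j*r)) ((m:ℝ)^(a (j+1)*r)), ∑ x ∈ TT m k q (A/q) (B/q), F (q*x)
      ≤ ∑ x ∈ TT m (k+1) z A B, F x := by
  rw [← grid_split m r hm hr a ha (fun q => ∑ x ∈ TT m k q (A/q) (B/q), F (q*x)) i n hin]
  refine le_trans ?_ (TT_rec (W := (m:ℝ)^(a n * r)) hz0 (by positivity) hA hB F hF)
  refine Finset.sum_le_sum_of_subset_of_nonneg ?_ (fun q _ _ => Finset.sum_nonneg fun x _ => hF _)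
  intro q hq
  rw [mem_prs (by positivity) (by positivity)] at hq
  rw [mem_prs hz0 (by positivity)]
  exact ⟨⟨lt_of_le_of_lt hz hq.1.1, hq.1.2⟩, hq.2⟩

lemma pow_eta {η : ℝ} (h0 : 0 < η) (h1 : η < 1) (k : ℕ) (hk : k ≤ 5) {x y c : ℝ} (hc : 0 ≤ c) (hx : x ≤ 0 ∨ x ≤ y) (hy : 0 ≤ y) :
    (1-η)^5 * c * x ≤ (1-η)^k * c * y := by
  have e : (1-η)^5 ≤ (1-η)^k := pow_le_pow_of_le_one (by linarith) (by linarith) hk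
  have e0 : 0 ≤ (1-η)^5 := pow_nonneg (by linarith) _
  calc (1-η)^5 * c * x ≤ (1-η)^5 * c * y := by
        gcongr
        rcases hx with h | h <;> linarith
    _ ≤ _ := by gcongr

lemma asm1 (β κ r N N1 η : ℝ) (hκ : 0 < κ) (hr : 0 < r) (hr1 : r ≤ 1) (hβ1 : β ≤ 1) (hN : r * N = β) (hN1 : β + κ ≤ r * N1)
    (a : ℕ → ℝ) (ha : StrictMono a) (ha0 : 0 < a 0) (n : ℕ) (w : ℕ → ℝ)
    (hw : ∀ i, i < n → w i ≤ 0 ∨ (2*a (i+1) ≤ N ∧ a (i+1) + 1 ≤ N ∧ w i ≤ Real.log (a (i+1)/a i) * (g1 (a i))^2/(N1-a i)))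
    (hη : 0 < η) (hη1 : η < 1) : ∀ᶠ m : ℕ in atTop,
    (1-η)^5 * (κ/r) * ∑ i ∈ Finset.Ico 0 n, w i ≤ ∑ x ∈ TT m 2 1 ((m:ℝ)^β) ((m:ℝ)^(β+κ)), FG m r x := by
  have hap : ∀ i, 0 < a i := fun i => lt_of_lt_of_le ha0 (ha.monotone (Nat.zero_le i))
  have key : ∀ᶠ m : ℕ in atTop, ∀ i ∈ Finset.Ico 0 n, (1-η)^5 * (κ/r) * w i ≤
      ∑ q ∈ prs m ((m:ℝ)^(a i*r)) ((m:ℝ)^(a (i+1)*r)), ∑ x ∈ TT m 1 q ((m:ℝ)^β/q) ((m:ℝ)^(β+κ)/q), FG m r (q*x) := by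
    refine (Filter.eventually_all_finset _).2 fun i hi => ?_
    rcases hw i (Finset.mem_Ico.1 hi).2 with h | ⟨h1, h2, h3⟩
    · refine Eventually.of_forall fun m => le_trans ?_ (Finset.sum_nonneg fun q _ => Finset.sum_nonneg fun x _ => FG_nonneg _ _ _)
      have : 0 ≤ (1-η)^5 * (κ/r) := by have := pow_nonneg (by linarith : 0 ≤ 1-η) 5
                                       positivity
      nlinarith
    · have hab := ha (Nat.lt_succ_self i)
      have hd : 0 < N1 - a i := by nlinarith
      have hl := Real.log_nonneg (by rw [le_div_iff₀ (hap i)]; linarith : 1 ≤ a (i+1)/a i)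
      filter_upwards [pat1 β κ r N N1 (a i) (a (i+1)) η hκ hr hr1 hβ1 hN hN1 (hap i) hab h1 h2 hη hη1] with m hm
      exact (pow_eta hη hη1 3 (by norm_num) (by positivity) (Or.inr h3) (by positivity)).trans hm
  filter_upwards [key, eventually_ge_atTop 2] with m hk hm
  have hm1 : (1:ℝ) ≤ m := by exact_mod_cast (by omega : 1 ≤ m)
  rw [Finset.mul_sum]
  refine (Finset.sum_le_sum hk).trans ?_
  exact stepTT hm hr a ha.monotone (Nat.zero_le n) zero_le_one (Real.one_le_rpow hm1 (by have := hap 0; positivity)) (by positivity) (by positivity)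
    (FG m r) (FG_nonneg m r)

lemma asm2 (β κ r N N1 η : ℝ) (hκ : 0 < κ) (hr : 0 < r) (hr1 : r ≤ 1) (hβ1 : β ≤ 1) (hN : r * N = β) (hN1 : β + κ ≤ r * N1)
    (a : ℕ → ℝ) (ha : StrictMono a) (ha0 : 0 < a 0) (n : ℕ) (w : ℕ → ℕ → ℝ)
    (hw : ∀ i j, i < j → j < n → w i j ≤ 0 ∨ (a (i+1) + 2*a (j+1) ≤ N ∧ a (i+1) + a (j+1) + 1 ≤ N ∧
      w i j ≤ Real.log (a (i+1)/a i) * Real.log (a (j+1)/a j) * (g2 (a i) (a j))^2/(N1-a i-a j)))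
    (hη : 0 < η) (hη1 : η < 1) : ∀ᶠ m : ℕ in atTop,
    (1-η)^5 * (κ/r) * ∑ i ∈ Finset.Ico 0 n, ∑ j ∈ Finset.Ico (i+1) n, w i j ≤ ∑ x ∈ TT m 3 1 ((m:ℝ)^β) ((m:ℝ)^(β+κ)), FG m r x := by
  have hap : ∀ i, 0 < a i := fun i => lt_of_lt_of_le ha0 (ha.monotone (Nat.zero_le i))
  have key : ∀ᶠ m : ℕ in atTop, ∀ i ∈ Finset.Ico 0 n, ∀ j ∈ Finset.Ico (i+1) n, (1-η)^5 * (κ/r) * w i j ≤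
      ∑ q ∈ prs m ((m:ℝ)^(a i*r)) ((m:ℝ)^(a (i+1)*r)), ∑ q' ∈ prs m ((m:ℝ)^(a j*r)) ((m:ℝ)^(a (j+1)*r)),
        ∑ x ∈ TT m 1 q' ((m:ℝ)^β/q/q') ((m:ℝ)^(β+κ)/q/q'), FG m r (q*(q'*x)) := by
    refine (Filter.eventually_all_finset _).2 fun i hi => (Filter.eventually_all_finset _).2 fun j hj => ?_
    rw [Finset.mem_Ico] at hj
    rcases hw i j hj.1 hj.2 with h | ⟨h1, h2, h3⟩
    · refine Eventually.of_forall fun m => le_trans ?_ (Finset.sum_nonneg fun q _ => Finset.sum_nonneg fun x _ => Finset.sum_nonneg fun x _ => FG_nonneg _ _ _)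
      have : 0 ≤ (1-η)^5 * (κ/r) := by have := pow_nonneg (by linarith : 0 ≤ 1-η) 5
                                       positivity
      nlinarith
    · have hab := ha (Nat.lt_succ_self i)
      have hab' := ha (Nat.lt_succ_self j)
      have hd : 0 < N1 - a i - a j := by nlinarith
      have hl := Real.log_nonneg (by rw [le_div_iff₀ (hap i)]; linarith : 1 ≤ a (i+1)/a i)
      have hl' := Real.log_nonneg (by rw [le_div_iff₀ (hap j)]; linarith : 1 ≤ a (j+1)/a j)
      filter_upwards [pat2 β κ r N N1 (a i) (a (i+1)) (a j) (a (j+1)) η hκ hr hr1 hβ1 hN hN1 (hap i) hab (ha.monotone hj.1) hab' h1 h2 hη hη1] with m hm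
      exact (pow_eta hη hη1 4 (by norm_num) (by positivity) (Or.inr h3) (by positivity)).trans hm
  filter_upwards [key, eventually_ge_atTop 2] with m hk hm
  have hm1 : (1:ℝ) ≤ m := by exact_mod_cast (by omega : 1 ≤ m)
  refine le_trans ?_ (stepTT hm hr a ha.monotone (Nat.zero_le n) zero_le_one (Real.one_le_rpow hm1 (by have := hap 0; positivity)) (by positivity) (by positivity)
    (FG m r) (FG_nonneg m r))
  rw [Finset.mul_sum]
  refine Finset.sum_le_sum fun i hi => ?_
  rw [Finset.mul_sum]
  refine (Finset.sum_le_sum (hk i hi)).trans ?_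
  rw [Finset.sum_comm]
  refine Finset.sum_le_sum fun q hq => ?_
  rw [mem_prs (by positivity) (by positivity)] at hq
  rw [Finset.mem_Ico] at hi
  exact stepTT hm hr a ha.monotone hi.2 (by positivity) hq.1.2 (by positivity) (by positivity)
    (fun x => FG m r (q*x)) (fun x => FG_nonneg m r _)

set_option maxHeartbeats 800000 in
lemma asm3 (β κ r N N1 η : ℝ) (hκ : 0 < κ) (hr : 0 < r) (hr1 : r ≤ 1) (hβ1 : β ≤ 1) (hN : r * N = β) (hN1 : β + κ ≤ r * N1)
    (a : ℕ → ℝ) (ha : StrictMono a) (ha0 : 0 < a 0) (n : ℕ) (w : ℕ → ℕ → ℕ → ℝ)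
    (hw : ∀ i j l, i < j → j < l → l < n → w i j l ≤ 0 ∨ (1 ≤ a l ∧ a (i+1) + a (j+1) + 2*a (l+1) ≤ N ∧
      w i j l ≤ Real.log (a (i+1)/a i) * Real.log (a (j+1)/a j) * Real.log (a (l+1)/a l) * (g2 (a i) (a j))^2/(N1-a i-a j-a l)))
    (hη : 0 < η) (hη1 : η < 1) : ∀ᶠ m : ℕ in atTop,
    (1-η)^5 * (κ/r) * ∑ i ∈ Finset.Ico 0 n, ∑ j ∈ Finset.Ico (i+1) n, ∑ l ∈ Finset.Ico (j+1) n, w i j l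
      ≤ ∑ x ∈ TT m 4 1 ((m:ℝ)^β) ((m:ℝ)^(β+κ)), FG m r x := by
  have hap : ∀ i, 0 < a i := fun i => lt_of_lt_of_le ha0 (ha.monotone (Nat.zero_le i))
  have key : ∀ᶠ m : ℕ in atTop, ∀ i ∈ Finset.Ico 0 n, ∀ j ∈ Finset.Ico (i+1) n, ∀ l ∈ Finset.Ico (j+1) n, (1-η)^5 * (κ/r) * w i j l ≤
      ∑ q ∈ prs m ((m:ℝ)^(a i*r)) ((m:ℝ)^(a (i+1)*r)), ∑ q' ∈ prs m ((m:ℝ)^(a j*r)) ((m:ℝ)^(a (j+1)*r)),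
      ∑ q'' ∈ prs m ((m:ℝ)^(a l*r)) ((m:ℝ)^(a (l+1)*r)),
        ∑ x ∈ TT m 1 q'' ((m:ℝ)^β/q/q'/q'') ((m:ℝ)^(β+κ)/q/q'/q''), FG m r (q*(q'*(q''*x))) := by
    refine (Filter.eventually_all_finset _).2 fun i hi => (Filter.eventually_all_finset _).2 fun j hj => (Filter.eventually_all_finset _).2 fun l hl => ?_
    rw [Finset.mem_Ico] at hj hl
    rcases hw i j l hj.1 hl.1 hl.2 with h | ⟨h1, h2, h3⟩
    · refine Eventually.of_forall fun m => le_trans ?_ (Finset.sum_nonneg fun q _ => Finset.sum_nonneg fun x _ => Finset.sum_nonneg fun x _ => Finset.sum_nonneg fun x _ => FG_nonneg _ _ _)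
      have : 0 ≤ (1-η)^5 * (κ/r) := by have := pow_nonneg (by linarith : 0 ≤ 1-η) 5
                                       positivity
      nlinarith
    · have hab := ha (Nat.lt_succ_self i)
      have hab' := ha (Nat.lt_succ_self j)
      have hab'' := ha (Nat.lt_succ_self l)
      have hp := hap l
      have hd : 0 < N1 - a i - a j - a l := by nlinarith
      have hl0 := Real.log_nonneg (by rw [le_div_iff₀ (hap i)]; linarith : 1 ≤ a (i+1)/a i)
      have hl' := Real.log_nonneg (by rw [le_div_iff₀ (hap j)]; linarith : 1 ≤ a (j+1)/a j)
      have hl'' := Real.log_nonneg (by rw [le_div_iff₀ (hap l)]; linarith : 1 ≤ a (l+1)/a l)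
      filter_upwards [pat3 β κ r N N1 (a i) (a (i+1)) (a j) (a (j+1)) (a l) (a (l+1)) η hκ hr hr1 hβ1 hN hN1 (hap i) hab (ha.monotone hj.1) hab'
        (ha.monotone hl.1) hab'' h1 h2 hη hη1] with m hm
      exact (pow_eta hη hη1 5 (by norm_num) (by positivity) (Or.inr h3) (by positivity)).trans hm
  filter_upwards [key, eventually_ge_atTop 2] with m hk hm
  have hm1 : (1:ℝ) ≤ m := by exact_mod_cast (by omega : 1 ≤ m)
  refine le_trans ?_ (stepTT hm hr a ha.monotone (Nat.zero_le n) zero_le_one (Real.one_le_rpow hm1 (by have := hap 0; positivity)) (by positivity) (by positivity)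
    (FG m r) (FG_nonneg m r))
  rw [Finset.mul_sum]
  refine Finset.sum_le_sum fun i hi => ?_
  rw [Finset.mul_sum]
  have s1 : ∀ j ∈ Finset.Ico (i+1) n, (1-η)^5 * (κ/r) * ∑ l ∈ Finset.Ico (j+1) n, w i j l ≤
      ∑ q ∈ prs m ((m:ℝ)^(a i*r)) ((m:ℝ)^(a (i+1)*r)), ∑ q' ∈ prs m ((m:ℝ)^(a j*r)) ((m:ℝ)^(a (j+1)*r)),
        ∑ x ∈ TT m 2 q' ((m:ℝ)^β/q/q') ((m:ℝ)^(β+κ)/q/q'), FG m r (q*(q'*x)) := by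
    intro j hj
    rw [Finset.mul_sum]
    refine (Finset.sum_le_sum (hk i hi j hj)).trans ?_
    rw [Finset.sum_comm]
    refine Finset.sum_le_sum fun q hq => ?_
    rw [Finset.sum_comm]
    refine Finset.sum_le_sum fun q' hq' => ?_
    rw [mem_prs (by positivity) (by positivity)] at hq'
    rw [Finset.mem_Ico] at hj
    exact stepTT hm hr a ha.monotone hj.2 (by positivity) hq'.1.2 (by positivity) (by positivity)
      (fun x => FG m r (q*(q'*x))) (fun x => FG_nonneg m r _)
  refine (Finset.sum_le_sum s1).trans ?_
  rw [Finset.sum_comm]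
  refine Finset.sum_le_sum fun q hq => ?_
  rw [mem_prs (by positivity) (by positivity)] at hq
  rw [Finset.mem_Ico] at hi
  exact stepTT hm hr a ha.monotone hi.2 (by positivity) hq.1.2 (by positivity) (by positivity)
    (fun x => FG m r (q*x)) (fun x => FG_nonneg m r _)
end

section
open Filter Topology

lemma ZG_eq {m : ℕ} (hm : 2 ≤ m) {r : ℝ} (hr : 0 < r) : ∑ k ∈ sqc m ((m:ℝ)^r), YG m r k ^ 2 / k.totient =
    24/25 / GG m ((m:ℝ)^r) + 1/25 / GG m ((m:ℝ)^(r/2)) := by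
  have hm1 : (1:ℝ) ≤ m := by exact_mod_cast (by omega : 1 ≤ m)
  have hA := GG_one_le m ((m:ℝ)^r) (Real.one_le_rpow hm1 hr.le)
  have hB := GG_one_le m ((m:ℝ)^(r/2)) (Real.one_le_rpow hm1 (by positivity))
  have s1 := sumYR m ((m:ℝ)^r) (by positivity) 1 one_ne_zero
  have s2 := sumYR_shift m ((m:ℝ)^r) ((m:ℝ)^(r/2)) (by positivity) (by positivity) (rp_mono hm (by linarith)) 1 one_pos
  simp only [mul_one, Nat.cast_one, div_one] at s2
  simp only [pow_one] at s1
  set A := GG m ((m:ℝ)^r) with hAd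
  set B := GG m ((m:ℝ)^(r/2)) with hBd
  have e : ∀ k ∈ sqc m ((m:ℝ)^r), YG m r k ^ 2 / k.totient = 16/25/A^2 * (YR ((m:ℝ)^r) k / k.totient) +
      (8/25/(A*B) + 1/25/B^2) * (YR ((m:ℝ)^(r/2)) k / k.totient) := by
    intro k hk
    have hk2 := ((mem_sqc (by positivity)).1 hk).2.1
    have hφ : (0:ℝ) < k.totient := by exact_mod_cast Nat.totient_pos.2 ((mem_sqc (by positivity)).1 hk).1
    unfold YG
    rw [← hAd, ← hBd]
    unfold YR
    rw [if_pos hk2]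
    split_ifs
    · field_simp; ring
    · field_simp; ring
  rw [Finset.sum_congr rfl e, Finset.sum_add_distrib, ← Finset.mul_sum, ← Finset.mul_sum, s1, s2]
  field_simp; ring

lemma ZG_le {m : ℕ} (hm : 2 ≤ m) {r : ℝ} (hr : 0 < r) : (m.totient/m * (r * Real.log m)) * ∑ k ∈ sqc m ((m:ℝ)^r), YG m r k ^ 2 / k.totient ≤ 26/25 := by
  have hm1 : (1:ℝ) ≤ m := by exact_mod_cast (by omega : 1 ≤ m)
  have hm0 : (0:ℝ) < m := by positivity
  have hφ : (0:ℝ) < m.totient := by exact_mod_cast Nat.totient_pos.2 (by omega)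
  rw [ZG_eq hm hr]
  have hA := GG_one_le m ((m:ℝ)^r) (Real.one_le_rpow hm1 hr.le)
  have hB := GG_one_le m ((m:ℝ)^(r/2)) (Real.one_le_rpow hm1 (by positivity))
  have a := GG_lower m (by omega) ((m:ℝ)^r) (Real.one_le_rpow hm1 hr.le)
  have b := GG_lower m (by omega) ((m:ℝ)^(r/2)) (Real.one_le_rpow hm1 (by positivity))
  rw [Real.log_rpow hm0] at a b
  set A := GG m ((m:ℝ)^r) with hAd
  set B := GG m ((m:ℝ)^(r/2)) with hBd
  have a' : m.totient/m * (r * Real.log m) ≤ A := by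
    calc _ ≤ m.totient/m * (A * (m/m.totient)) := by gcongr
      _ = A := by field_simp
  have b' : m.totient/m * (r * Real.log m) ≤ 2 * B := by
    calc _ = 2 * (m.totient/m * (r/2 * Real.log m)) := by ring
      _ ≤ 2 * (m.totient/m * (B * (m/m.totient))) := by gcongr
      _ = 2 * B := by field_simp
  set c := m.totient/m * (r * Real.log m) with hc
  have a2 : c / A ≤ 1 := by rw [div_le_one (by linarith)]; exact a'
  have b2 : c / B ≤ 2 := by rw [div_le_iff₀ (by linarith)]; exact b'
  calc c * (24/25/A + 1/25/B) = 24/25 * (c/A) + 1/25 * (c/B) := by ring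
    _ ≤ _ := by linarith

/-- lower bound for the total mass of good integers -/
def VLow (β r N1 : ℝ) (l : ℕ) (V : ℝ) : Prop := ∀ κ η : ℝ, 0 < κ → β + κ ≤ r * N1 → 0 < η → η < 1 → ∀ᶠ m : ℕ in atTop,
  (1-η)^5 * (κ/r) * V ≤ ∑ k ∈ Finset.Icc 1 l, ∑ x ∈ TT m k 1 ((m:ℝ)^β) ((m:ℝ)^(β+κ)), FG m r x

lemma good_sum {β κ r : ℝ} {m : ℕ} (hm : 2 ≤ m) (hκ : 0 < κ) (hr : 0 < r) (l : ℕ) :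
    (r/κ) * ∑ k ∈ Finset.Icc 1 l, ∑ x ∈ TT m k 1 ((m:ℝ)^β) ((m:ℝ)^(β+κ)), FG m r x ≤
     (m.totient/m * (r * Real.log m)) * ∑ n ∈ II β κ m, eo κ m n * (if n.primeFactorsList.length ≤ l then (fS m ((m:ℝ)^r) (YG m r) n)^2 else 0) := by
  have hm0 : (0:ℝ) < m := by positivity
  have hφ : (0:ℝ) < m.totient := by exact_mod_cast Nat.totient_pos.2 (by omega)
  have hL0 : 0 < Real.log m := Real.log_pos (by exact_mod_cast (by omega : 1 < m))
  have hdis : Set.PairwiseDisjoint (↑(Finset.Icc 1 l)) (fun k => TT m k 1 ((m:ℝ)^β) ((m:ℝ)^(β+κ))) := by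
    intro k _ k' _ hkk
    refine Finset.disjoint_left.2 fun x hx hx' => hkk ?_
    rw [mem_TT (by positivity) (by positivity)] at hx hx'
    rw [← hx.2.2.1, ← hx'.2.2.1]
  rw [← Finset.sum_biUnion hdis, Finset.mul_sum, Finset.mul_sum]
  have hsub : (Finset.Icc 1 l).biUnion (fun k => TT m k 1 ((m:ℝ)^β) ((m:ℝ)^(β+κ))) ⊆ II β κ m := by
    intro x hx
    rw [Finset.mem_biUnion] at hx
    obtain ⟨k, hk, hx⟩ := hx
    rw [mem_TT (by positivity) (by positivity)] at hx
    rw [mem_II]; exact hx.1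
  refine le_trans (Finset.sum_le_sum fun x hx => ?_) (Finset.sum_le_sum_of_subset_of_nonneg hsub fun x _ _ => ?_)
  · rw [Finset.mem_biUnion] at hx
    obtain ⟨k, hk, hx⟩ := hx
    rw [mem_TT (by positivity) (by positivity)] at hx
    rw [Finset.mem_Icc] at hk
    rw [if_pos (by rw [hx.2.2.1]; exact hk.2), eo, if_pos hx.2.1]
    have hx0 : (0:ℝ) < x := lt_of_le_of_lt (by positivity) hx.1.1
    unfold FG
    apply le_of_eq
    field_simp
  · have := eo_nonneg (m := m) hκ x
    refine mul_nonneg (by positivity) (mul_nonneg this ?_)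
    split_ifs <;> positivity

set_option maxHeartbeats 800000 in
lemma critG (α β r N1 e0 K V : ℝ) (l : ℕ) (hα : 1/2 ≤ α) (hα1 : α ≤ 1) (hβ : 0 ≤ β) (hβ1 : β ≤ 1) (hr : 0 < r) 
    (d1 : 2 * (2 * r) < α + 2 * β - 2) (d2 : 2 * r < 2 * α + 2 * β - 3) (d3 : 2 * r < β)
    (he0 : 0 < e0) (hH : KHyp α β e0) (hK : 2 * α / e0 < K) (hK1 : 1 ≤ K) (hN1 : β < r * N1) (hV : VLow β r N1 l V)
    (hnum : 26/25 * (K - 1) < K * V) : Good l α β := by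
  have hr1 : r ≤ 1 := by linarith
  refine Good_of_ev (fun κ => KBd α β κ K ∧ β + κ < r * N1 ∧
    (2 * r + 2 * r + 100 * κ < α + 2 * β - 2 ∧ 2 * r + 100 * κ < 2 * α + 2 * β - 3 ∧ 2 * r + 10 * κ < β)) ?_ ?_
  · exact (ev_KBd α β e0 K hα hα1 hβ hβ1 he0 hH hK).and ((ev_lt (fun κ => β + κ) _ (by fun_prop) (by simpa using hN1)).and
      ((ev_lt (fun κ => 2 * r + 2 * r + 100 * κ) _ (by fun_prop) (by simp only [mul_zero, add_zero]; linarith)).and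
      ((ev_lt (fun κ => 2 * r + 100 * κ) _ (by fun_prop) (by simp only [mul_zero, add_zero]; linarith)).and
      (ev_lt (fun κ => 2 * r + 10 * κ) _ (by fun_prop) (by simp only [mul_zero, add_zero]; linarith)))))
  rintro κ hκ hκ2 ⟨hKB, hκN, c1, c2, c3⟩
  have hη : ∀ᶠ η in 𝓝[>] (0:ℝ), 26/25 * (K-1) + (K+2) * η - K * ((1-η)^5 * V) < 0 :=
    ev_lt (fun η => 26/25 * (K-1) + (K+2) * η - K * ((1-η)^5 * V)) 0 (by fun_prop) (by simp; linarith)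
  have h1 : ∀ᶠ κ in 𝓝[>] (0:ℝ), κ < 1 := ev_lt (fun κ => κ) _ continuousAt_id (by positivity)
  obtain ⟨η, ⟨hη, hη1⟩, hη0⟩ := ((hη.and h1).and self_mem_nhdsWithin).exists
  have hη0 : 0 < η := hη0
  filter_upwards [hKB, hV κ η hκ hκN.le hη0 hη1, Qzero κ hκ, ev_fS (κ/2) (by positivity),
    uu_Lev α β κ (2*r) (by linarith) hα1 hβ hβ1 hκ (by linarith) (by linarith) (by linarith) (by linarith),
    eo_Lev β κ (2*r) hβ1 hκ (by linarith) (by linarith), ev_log_le 1 (κ/4) (by positivity), ev_const_le (1/η) (κ/4) (by positivity),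
    eventually_ge_atTop 2] with m bK bV bQ bf bU bE bl bc hm a0
  by_contra hcon
  push Not at hcon
  have hm0 : (0:ℝ) < m := by positivity
  have hm1 : (1:ℝ) ≤ m := by exact_mod_cast (by omega : 1 ≤ m)
  have hφ : (0:ℝ) < m.totient := by exact_mod_cast Nat.totient_pos.2 (by omega)
  have hφ1 : (m.totient:ℝ)/m ≤ 1 := by rw [div_le_one hm0]; exact_mod_cast Nat.totient_le m
  have hL0 : 0 < Real.log m := Real.log_pos (by exact_mod_cast (by omega : 1 < m))
  have hRm : (m:ℝ)^r ≤ m := by simpa using Real.rpow_le_rpow_of_exponent_le hm1 hr1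
  have hRR : (m:ℝ)^r * (m:ℝ)^r ≤ (m:ℝ)^(2*r) := by rw [← rp_add hm]; exact rp_mono hm (by linarith)
  have hY : ∀ k, |YG m r k| ≤ 1 := fun k => abs_le.2 ⟨by have := (YG_bd hm hr k).1; linarith, (YG_bd hm hr k).2⟩
  have q1 := bQ 1 (2*r) _ _ (by linarith) (bU a0) ((m:ℝ)^r) (YG m r) (by positivity) hRm hRR (fun k => (hY k).trans (by norm_num))
  have q2 := bQ 1 (2*r) _ _ (by linarith) bE ((m:ℝ)^r) (YG m r) (by positivity) hRm hRR (fun k => (hY k).trans (by norm_num))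
  have z1 := ZG_le hm hr
  have g0 := good_sum (β := β) hm hκ hr l
  set f := fS m ((m:ℝ)^r) (YG m r) with hf
  set Z := ∑ k ∈ sqc m ((m:ℝ)^r), YG m r k ^ 2 / k.totient with hZ
  set ε := (m:ℝ)^(-(κ/2)) with hε
  set c := m.totient/m * (r * Real.log m) with hc
  have hc0 : 0 < c := by positivity
  have q3 := bK a0 (fun n => if n.primeFactorsList.length ≤ l then 0 else (f n)^2) (by
    intro n hn
    have hn0 : 0 < n := II_pos hn
    have hn3 : (n:ℝ) ≤ (m:ℝ)^3 := by
      refine (mem_II.1 hn).2.trans ?_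
      have := rp_mono hm (by push_cast; linarith : β + κ ≤ ((3:ℕ):ℝ))
      rwa [Real.rpow_natCast] at this
    have := bf m ((m:ℝ)^r) (YG m r) (by positivity) hRm (fun k => (hY k).trans (by norm_num)) n hn0 hn3
    have h2 : (f n)^2 ≤ (m:ℝ)^κ := by
      calc (f n)^2 = |f n| * |f n| := by rw [← pow_two, sq_abs]
        _ ≤ (m:ℝ)^(κ/2) * (m:ℝ)^(κ/2) := by gcongr
        _ = (m:ℝ)^κ := by rw [← rp_add hm, add_halves]
    split_ifs
    · exact ⟨le_rfl, by positivity⟩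
    · exact ⟨by positivity, h2⟩)
  have eU : ∑ n ∈ II β κ m, uu α β κ m a0 n * (if n.primeFactorsList.length ≤ l then 0 else (f n)^2) = ∑ n ∈ II β κ m, uu α β κ m a0 n * (f n)^2 := by
    refine Finset.sum_congr rfl fun n hn => ?_
    by_cases hu : uu α β κ m a0 n = 0
    · rw [hu]; simp
    · rw [if_neg (by have := hcon n hn hu; omega)]
  have eE : ∑ n ∈ II β κ m, eo κ m n * (f n)^2 = ∑ n ∈ II β κ m, eo κ m n * (if n.primeFactorsList.length ≤ l then 0 else (f n)^2) +
      ∑ n ∈ II β κ m, eo κ m n * (if n.primeFactorsList.length ≤ l then (f n)^2 else 0) := by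
    rw [← Finset.sum_add_distrib]
    refine Finset.sum_congr rfl fun n hn => ?_
    split_ifs <;> simp
  rw [eU] at q3
  rw [one_mul] at q1 q2
  set U := ∑ n ∈ II β κ m, uu α β κ m a0 n * (f n)^2
  set E := ∑ n ∈ II β κ m, eo κ m n * (f n)^2
  set E1 := ∑ n ∈ II β κ m, eo κ m n * (if n.primeFactorsList.length ≤ l then 0 else (f n)^2)
  set E2 := ∑ n ∈ II β κ m, eo κ m n * (if n.primeFactorsList.length ≤ l then (f n)^2 else 0)
  have hE2 : (1-η)^5 * V ≤ c * E2 := by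
    refine le_trans ?_ g0
    calc (1-η)^5 * V = r/κ * ((1-η)^5 * (κ/r) * V) := by field_simp
      _ ≤ _ := by gcongr
  have hce : c * ε ≤ η := by
    have e1 : ε = (m:ℝ)^(-(κ/4)) * (m:ℝ)^(-(κ/4)) := by rw [hε, ← rp_add hm]; congr 1; ring
    have e2 : (m:ℝ)^(-(κ/4)) ≤ η := by
      rw [Real.rpow_neg hm0.le, inv_le_comm₀ (by positivity) hη0]; simpa using bc
    have e3 : c ≤ (m:ℝ)^(κ/4) := by
      calc c ≤ 1 * (1 * Real.log m) := by rw [hc]; gcongr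
        _ ≤ _ := by simpa using bl
    have e4 : (m:ℝ)^(κ/4) * (m:ℝ)^(-(κ/4)) = 1 := by rw [← rp_add hm]; simp
    calc c * ε ≤ (m:ℝ)^(κ/4) * ((m:ℝ)^(-(κ/4)) * (m:ℝ)^(-(κ/4))) := by rw [e1]; gcongr
      _ = (m:ℝ)^(-(κ/4)) := by rw [← mul_assoc, e4, one_mul]
      _ ≤ _ := e2
  have r1 := (abs_le.1 q1).1
  have r2 := (abs_le.1 q2).2
  have main : K * E2 ≤ (K-1) * Z + (K+2) * ε := by
    have : E1 ≤ Z + ε - E2 := by linarith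
    have := mul_le_mul_of_nonneg_left this (by linarith : 0 ≤ K)
    linarith
  have main2 := mul_le_mul_of_nonneg_left main hc0.le
  have w1 : K * ((1-η)^5 * V) ≤ K * (c * E2) := by gcongr
  have w2 : (K-1) * (c * Z) ≤ (K-1) * (26/25) := mul_le_mul_of_nonneg_left z1 (by linarith)
  have w3 : (K+2) * (c * ε) ≤ (K+2) * η := mul_le_mul_of_nonneg_left hce (by linarith)
  linarith
end

section
open Filter Topology

/-- numerical grid -/
def gr (t0 c : ℕ) (i : ℕ) : ℕ := Nat.rec t0 (fun _ x => x + x * c / 1000 + 1) i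

def sumR (f : ℕ → ℕ) (n : ℕ) : ℕ := Nat.rec 0 (fun i s => s + f i) n

def mnN (t : ℕ) : ℕ := t - (t - 100000)

def G1N (t : ℕ) : ℕ := 4 * mnN t + mnN (2*t)

def G2N (t s : ℕ) : ℕ := 4 * (mnN t + mnN s - 100000) + (mnN (2*t) + mnN (2*s) - 100000)

def W1 (N N1 a b : ℕ) : ℕ := bif Nat.ble (2*b) N && Nat.ble (b + 100000) N then
  (2 * (b - a) * (G1N a * G1N a)) * 400 / ((a+b) * (N1 - a)) else 0

def W2 (N N1 a b a' b' : ℕ) : ℕ := bif Nat.ble (b + 2*b') N && Nat.ble (b + b' + 100000) N then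
  (4 * (b - a) * (b' - a') * (G2N a a' * G2N a a')) * 400 / ((a+b) * (a'+b') * (N1 - a - a')) else 0

def W3 (N N1 a b a' b' a'' b'' : ℕ) : ℕ := bif Nat.ble (b + b' + 2*b'') N && Nat.ble 100000 a'' then
  (8 * (b - a) * (b' - a') * (b'' - a'') * (G2N a a' * G2N a a')) * 400 / ((a+b) * (a'+b') * (a''+b'') * (N1 - a - a' - a'')) else 0

def SW1 (N N1 t0 c n : ℕ) : ℕ := sumR (fun i => W1 N N1 (gr t0 c i) (gr t0 c (i+1))) n
def SW2 (N N1 t0 c n : ℕ) : ℕ := sumR (fun i => sumR (fun j => W2 N N1 (gr t0 c i) (gr t0 c (i+1)) (gr t0 c (i+1+j)) (gr t0 c (i+1+j+1))) (n - (i+1))) n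
def SW3 (N N1 t0 c n : ℕ) : ℕ := sumR (fun i => sumR (fun j => sumR (fun l => 
  W3 N N1 (gr t0 c i) (gr t0 c (i+1)) (gr t0 c (i+1+j)) (gr t0 c (i+1+j+1)) (gr t0 c (i+1+j+1+l)) (gr t0 c (i+1+j+1+l+1))) (n - (i+1+j+1))) (n - (i+1))) n

lemma gr_strict (t0 c : ℕ) : StrictMono (gr t0 c) := by
  refine strictMono_nat_of_lt_succ fun n => ?_
  show gr t0 c n < gr t0 c n + gr t0 c n * c / 1000 + 1
  omega

lemma sumR_eq (f : ℕ → ℕ) (n : ℕ) : sumR f n = ∑ i ∈ Finset.range n, f i := by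
  induction n with
  | zero => rfl
  | succ n ih => rw [Finset.sum_range_succ, ← ih]; rfl

noncomputable def grR (t0 c : ℕ) (i : ℕ) : ℝ := (gr t0 c i : ℝ) / 100000

lemma grR_strict (t0 c : ℕ) : StrictMono (grR t0 c) := by
  intro i j h
  have : (gr t0 c i : ℝ) < gr t0 c j := by exact_mod_cast gr_strict t0 c h
  unfold grR; gcongr

lemma mnN_cast (t : ℕ) : (mnN t : ℝ) / 100000 = min ((t:ℝ)/100000) 1 := by
  unfold mnN
  rcases le_total t 100000 with h | h
  · have h' : (t:ℝ) ≤ 100000 := by exact_mod_cast h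
    rw [min_eq_left (by linarith), Nat.sub_eq_zero_of_le h, Nat.sub_zero]
  · have h' : (100000:ℝ) ≤ t := by exact_mod_cast h
    rw [min_eq_right (by linarith), Nat.sub_sub_self h]; norm_num

lemma subT_cast (x : ℕ) : ((x - 100000 : ℕ) : ℝ) / 100000 = max 0 ((x:ℝ)/100000 - 1) := by
  rcases le_total x 100000 with h | h
  · have h' : (x:ℝ) ≤ 100000 := by exact_mod_cast h
    rw [max_eq_left (by linarith), Nat.sub_eq_zero_of_le h]; simp
  · have h' : (100000:ℝ) ≤ x := by exact_mod_cast h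
    rw [max_eq_right (by linarith), Nat.cast_sub h]; push_cast; ring

lemma g1_cast (t : ℕ) : g1 ((t:ℝ)/100000) = (G1N t : ℝ)/500000 := by
  rw [g1_eq, ← mnN_cast]
  have : 2 * ((t:ℝ)/100000) = ((2*t : ℕ):ℝ)/100000 := by push_cast; ring
  rw [this, ← mnN_cast]
  unfold G1N; push_cast; ring

lemma g2_cast (t s : ℕ) : g2 ((t:ℝ)/100000) ((s:ℝ)/100000) = (G2N t s : ℝ)/500000 := by
  rw [g2_eq _ _ (by positivity) (by positivity), ← mnN_cast, ← mnN_cast]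
  have e : ∀ t : ℕ, 2 * ((t:ℝ)/100000) = ((2*t : ℕ):ℝ)/100000 := by intro t; push_cast; ring
  rw [e, e, ← mnN_cast, ← mnN_cast]
  have e2 : ∀ x y : ℕ, (x:ℝ)/100000 + (y:ℝ)/100000 - 1 = ((x + y : ℕ):ℝ)/100000 - 1 := by intro x y; push_cast; ring
  rw [e2, e2, ← subT_cast, ← subT_cast]
  unfold G2N; push_cast; ring

lemma log_low {a b : ℕ} (ha : 0 < a) (hab : a ≤ b) : ((2 * (b - a) : ℕ):ℝ) / ((a + b : ℕ):ℝ) ≤ Real.log (((b:ℝ)/100000)/((a:ℝ)/100000)) := by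
  have ha0 : (0:ℝ) < a := by exact_mod_cast ha
  have hab' : (a:ℝ) ≤ b := by exact_mod_cast hab
  have := Real.le_log_one_add_of_nonneg (x := ((b:ℝ)-a)/a) (div_nonneg (by linarith) ha0.le)
  have e1 : 1 + ((b:ℝ)-a)/a = ((b:ℝ)/100000)/((a:ℝ)/100000) := by field_simp; ring
  have e2 : 2*(((b:ℝ)-a)/a)/(((b:ℝ)-a)/a+2) = ((2 * (b - a) : ℕ):ℝ) / ((a + b : ℕ):ℝ) := by
    push_cast [hab]
    have : (0:ℝ) < (b - a)/a + 2 := by have := div_nonneg (by linarith : 0 ≤ (b:ℝ) - a) ha0.le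
                                       linarith
    have h3 : ((b:ℝ)-a)/a+2 = (a+b)/a := by field_simp; ring
    rw [h3]; field_simp
  rw [e1, e2] at this
  exact this

lemma natdiv_low (A B G Y D R : ℕ) (hY : 0 < Y) (hD : 0 < D) (hA : A = B * (G * G) * 400) (hR : R = Y * D)
    (Q : ℝ) (hQ : (B:ℝ)/(Y:ℝ) ≤ Q) :
    ((A / R : ℕ):ℝ)/10^9 ≤ Q * ((G:ℝ)/500000)^2/((D:ℝ)/100000) := by
  refine le_trans ?_ (div_le_div_of_nonneg_right (mul_le_mul_of_nonneg_right hQ (sq_nonneg _)) (by positivity))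
  have h1 : ((A / R : ℕ):ℝ) ≤ (A:ℝ)/(R:ℝ) := Nat.cast_div_le
  have hY' : (0:ℝ) < Y := by exact_mod_cast hY
  have hD' : (0:ℝ) < D := by exact_mod_cast hD
  have hA' : (A:ℝ) = B * (G * G) * 400 := by rw [hA, Nat.cast_mul, Nat.cast_mul, Nat.cast_mul]; rfl
  have hR' : (R:ℝ) = Y * D := by rw [hR, Nat.cast_mul]
  rw [hA', hR'] at h1
  have h2 : (B:ℝ)/(Y:ℝ) * ((G:ℝ)/500000)^2/((D:ℝ)/100000) = (B * (G * G) * 400)/(Y * D)/10^9 := by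
    field_simp; ring
  rw [h2]
  exact div_le_div_of_nonneg_right h1 (by positivity)

lemma W1_low {N N1 a b : ℕ} (ha : 0 < a) (hab : a < b) (hN : N ≤ N1) : ((W1 N N1 a b : ℕ):ℝ)/10^9 ≤ 0 ∨
    (2 * ((b:ℝ)/100000) ≤ (N:ℝ)/100000 ∧ (b:ℝ)/100000 + 1 ≤ (N:ℝ)/100000 ∧
      ((W1 N N1 a b : ℕ):ℝ)/10^9 ≤ Real.log (((b:ℝ)/100000)/((a:ℝ)/100000)) * (g1 ((a:ℝ)/100000))^2/((N1:ℝ)/100000 - (a:ℝ)/100000)) := by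
  unfold W1
  cases hc : (Nat.ble (2*b) N && Nat.ble (b + 100000) N) with
  | false => left; simp
  | true =>
    right
    rw [Bool.and_eq_true, Nat.ble_eq, Nat.ble_eq] at hc
    have h1 : 2 * (b:ℝ) ≤ N := by exact_mod_cast hc.1
    have h2 : (b:ℝ) + 100000 ≤ N := by exact_mod_cast hc.2
    refine ⟨by linarith, by linarith, ?_⟩
    have hd : 0 < N1 - a := by omega
    have hd' : (0:ℝ) < ((N1 - a : ℕ):ℝ) := by exact_mod_cast hd
    have e : (N1:ℝ)/100000 - (a:ℝ)/100000 = ((N1 - a : ℕ):ℝ)/100000 := by rw [Nat.cast_sub (by omega)]; ring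
    have hab0 : (0:ℝ) < ((a + b : ℕ):ℝ) := by exact_mod_cast (by omega : 0 < a + b)
    rw [e, g1_cast, cond_true]
    have hl := log_low ha hab.le
    refine (natdiv_low _ (2 * (b - a)) (G1N a) (a + b) (N1 - a) _ (by omega) hd rfl rfl _ ?_)
    exact hl

lemma W2_low {N N1 a b a' b' : ℕ} (ha : 0 < a) (hab : a < b) (hba : b ≤ a') (hab' : a' < b') (hN : N ≤ N1) : ((W2 N N1 a b a' b' : ℕ):ℝ)/10^9 ≤ 0 ∨
    ((b:ℝ)/100000 + 2 * ((b':ℝ)/100000) ≤ (N:ℝ)/100000 ∧ (b:ℝ)/100000 + (b':ℝ)/100000 + 1 ≤ (N:ℝ)/100000 ∧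
      ((W2 N N1 a b a' b' : ℕ):ℝ)/10^9 ≤ Real.log (((b:ℝ)/100000)/((a:ℝ)/100000)) * Real.log (((b':ℝ)/100000)/((a':ℝ)/100000)) *
        (g2 ((a:ℝ)/100000) ((a':ℝ)/100000))^2/((N1:ℝ)/100000 - (a:ℝ)/100000 - (a':ℝ)/100000)) := by
  unfold W2
  cases hc : (Nat.ble (b + 2*b') N && Nat.ble (b + b' + 100000) N) with
  | false => left; simp
  | true =>
    right
    rw [Bool.and_eq_true, Nat.ble_eq, Nat.ble_eq] at hc
    have h1 : (b:ℝ) + 2 * (b':ℝ) ≤ N := by exact_mod_cast hc.1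
    have h2 : (b:ℝ) + b' + 100000 ≤ N := by exact_mod_cast hc.2
    refine ⟨by linarith, by linarith, ?_⟩
    have hd : 0 < N1 - a - a' := by omega
    have hd' : (0:ℝ) < ((N1 - a - a' : ℕ):ℝ) := by exact_mod_cast hd
    have e : (N1:ℝ)/100000 - (a:ℝ)/100000 - (a':ℝ)/100000 = ((N1 - a - a' : ℕ):ℝ)/100000 := by
      rw [Nat.cast_sub (by omega), Nat.cast_sub (by omega)]; ring
    have hab0 : (0:ℝ) < ((a + b : ℕ):ℝ) := by exact_mod_cast (by omega : 0 < a + b)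
    have hab0' : (0:ℝ) < ((a' + b' : ℕ):ℝ) := by exact_mod_cast (by omega : 0 < a' + b')
    rw [e, g2_cast, cond_true]
    have hl := log_low ha hab.le
    have hl' := log_low (by omega) hab'.le
    have e4 : 4 * (b - a) * (b' - a') = (2 * (b-a)) * (2 * (b'-a')) := by ring
    refine (natdiv_low _ ((2 * (b - a)) * (2 * (b' - a'))) (G2N a a') ((a + b) * (a' + b')) (N1 - a - a') _
      (Nat.mul_pos (by omega) (by omega)) hd (by rw [e4]) rfl _ ?_)
    rw [Nat.cast_mul, Nat.cast_mul (a + b), mul_div_mul_comm]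
    exact mul_le_mul hl hl' (div_nonneg (Nat.cast_nonneg _) hab0'.le) (le_trans (div_nonneg (Nat.cast_nonneg _) hab0.le) hl)

lemma W3_low {N N1 a b a' b' a'' b'' : ℕ} (ha : 0 < a) (hab : a < b) (hba : b ≤ a') (hab' : a' < b') (hba' : b' ≤ a'') (hab'' : a'' < b'') (hN : N ≤ N1) :
    ((W3 N N1 a b a' b' a'' b'' : ℕ):ℝ)/10^9 ≤ 0 ∨
    (1 ≤ (a'':ℝ)/100000 ∧ (b:ℝ)/100000 + (b':ℝ)/100000 + 2 * ((b'':ℝ)/100000) ≤ (N:ℝ)/100000 ∧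
      ((W3 N N1 a b a' b' a'' b'' : ℕ):ℝ)/10^9 ≤ Real.log (((b:ℝ)/100000)/((a:ℝ)/100000)) * Real.log (((b':ℝ)/100000)/((a':ℝ)/100000)) *
        Real.log (((b'':ℝ)/100000)/((a'':ℝ)/100000)) *
        (g2 ((a:ℝ)/100000) ((a':ℝ)/100000))^2/((N1:ℝ)/100000 - (a:ℝ)/100000 - (a':ℝ)/100000 - (a'':ℝ)/100000)) := by
  unfold W3
  cases hc : (Nat.ble (b + b' + 2*b'') N && Nat.ble 100000 a'') with
  | false => left; simp
  | true =>
    right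
    rw [Bool.and_eq_true, Nat.ble_eq, Nat.ble_eq] at hc
    have h1 : (b:ℝ) + b' + 2 * (b'':ℝ) ≤ N := by exact_mod_cast hc.1
    have h2 : (100000:ℝ) ≤ a'' := by exact_mod_cast hc.2
    refine ⟨by linarith, by linarith, ?_⟩
    have hd : 0 < N1 - a - a' - a'' := by omega
    have hd' : (0:ℝ) < ((N1 - a - a' - a'' : ℕ):ℝ) := by exact_mod_cast hd
    have e : (N1:ℝ)/100000 - (a:ℝ)/100000 - (a':ℝ)/100000 - (a'':ℝ)/100000 = ((N1 - a - a' - a'' : ℕ):ℝ)/100000 := by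
      rw [Nat.cast_sub (by omega), Nat.cast_sub (by omega), Nat.cast_sub (by omega)]; ring
    have hab0 : (0:ℝ) < ((a + b : ℕ):ℝ) := by exact_mod_cast (by omega : 0 < a + b)
    have hab0' : (0:ℝ) < ((a' + b' : ℕ):ℝ) := by exact_mod_cast (by omega : 0 < a' + b')
    have hab0'' : (0:ℝ) < ((a'' + b'' : ℕ):ℝ) := by exact_mod_cast (by omega : 0 < a'' + b'')
    rw [e, g2_cast, cond_true]
    have hl := log_low ha hab.le
    have hl' := log_low (by omega) hab'.le
    have hl'' := log_low (by omega) hab''.le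
    have e4 : 8 * (b - a) * (b' - a') * (b'' - a'') = (2 * (b-a)) * (2 * (b'-a')) * (2 * (b''-a'')) := by ring
    refine (natdiv_low _ ((2 * (b - a)) * (2 * (b' - a')) * (2 * (b'' - a''))) (G2N a a') ((a + b) * (a' + b') * (a'' + b'')) (N1 - a - a' - a'') _
      (Nat.mul_pos (Nat.mul_pos (by omega) (by omega)) (by omega)) hd (by rw [e4]) rfl _ ?_)
    rw [Nat.cast_mul _ (2 * (b'' - a'')), Nat.cast_mul (2 * (b - a)), Nat.cast_mul _ (a'' + b''), Nat.cast_mul (a + b), mul_div_mul_comm, mul_div_mul_comm]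
    have p := le_trans (div_nonneg (Nat.cast_nonneg _) hab0.le) hl
    have p' := le_trans (div_nonneg (Nat.cast_nonneg _) hab0'.le) hl'
    exact mul_le_mul (mul_le_mul hl hl' (div_nonneg (Nat.cast_nonneg _) hab0'.le) p) hl'' (div_nonneg (Nat.cast_nonneg _) hab0''.le) (mul_nonneg p p')
end

section
open Filter Topology

lemma SW1_eq (N N1 t0 c n : ℕ) : ((SW1 N N1 t0 c n : ℕ):ℝ)/10^9 = ∑ i ∈ Finset.Ico 0 n, ((W1 N N1 (gr t0 c i) (gr t0 c (i+1)) : ℕ):ℝ)/10^9 := by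
  rw [SW1, sumR_eq, Nat.cast_sum, Finset.sum_div, Finset.range_eq_Ico]

lemma SW2_eq (N N1 t0 c n : ℕ) : ((SW2 N N1 t0 c n : ℕ):ℝ)/10^9 = ∑ i ∈ Finset.Ico 0 n, ∑ j ∈ Finset.Ico (i+1) n,
    ((W2 N N1 (gr t0 c i) (gr t0 c (i+1)) (gr t0 c j) (gr t0 c (j+1)) : ℕ):ℝ)/10^9 := by
  rw [SW2, sumR_eq, Nat.cast_sum, Finset.sum_div, Finset.range_eq_Ico]
  refine Finset.sum_congr rfl fun i _ => ?_
  rw [sumR_eq, Nat.cast_sum, Finset.sum_div, Finset.sum_Ico_eq_sum_range]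

lemma SW3_eq (N N1 t0 c n : ℕ) : ((SW3 N N1 t0 c n : ℕ):ℝ)/10^9 = ∑ i ∈ Finset.Ico 0 n, ∑ j ∈ Finset.Ico (i+1) n, ∑ l ∈ Finset.Ico (j+1) n,
    ((W3 N N1 (gr t0 c i) (gr t0 c (i+1)) (gr t0 c j) (gr t0 c (j+1)) (gr t0 c l) (gr t0 c (l+1)) : ℕ):ℝ)/10^9 := by
  rw [SW3, sumR_eq, Nat.cast_sum, Finset.sum_div, Finset.range_eq_Ico]
  refine Finset.sum_congr rfl fun i _ => ?_
  rw [sumR_eq, Nat.cast_sum, Finset.sum_div, Finset.sum_Ico_eq_sum_range]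
  refine Finset.sum_congr rfl fun j _ => ?_
  rw [sumR_eq, Nat.cast_sum, Finset.sum_div, Finset.sum_Ico_eq_sum_range]

lemma gr_pos {t0 : ℕ} (h : 0 < t0) (c i : ℕ) : 0 < gr t0 c i :=
  lt_of_lt_of_le h ((gr_strict t0 c).monotone (Nat.zero_le i))

lemma VLow_aux (β r : ℝ) (N N1 t1 c1 n1 t2 c2 n2 t3 c3 n3 : ℕ) (hr : 0 < r) (hr1 : r ≤ 1) (hβ1 : β ≤ 1) (hN : r * ((N:ℝ)/100000) = β)
    (hN1 : N ≤ N1) (h1 : 100000 ≤ N) (ht1 : 0 < t1) (ht2 : 0 < t2) (ht3 : 0 < t3)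
    (κ η : ℝ) (hκ : 0 < κ) (hκ1 : β + κ ≤ r * ((N1:ℝ)/100000)) (hη : 0 < η) (hη1 : η < 1) : ∀ᶠ m : ℕ in atTop,
    ((1-η)^5 * (κ/r) * (1/((N1:ℝ)/100000)) ≤ ∑ x ∈ TT m 1 1 ((m:ℝ)^β) ((m:ℝ)^(β+κ)), FG m r x) ∧
    ((1-η)^5 * (κ/r) * (((SW1 N N1 t1 c1 n1 : ℕ):ℝ)/10^9) ≤ ∑ x ∈ TT m 2 1 ((m:ℝ)^β) ((m:ℝ)^(β+κ)), FG m r x) ∧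
    ((1-η)^5 * (κ/r) * (((SW2 N N1 t2 c2 n2 : ℕ):ℝ)/10^9) ≤ ∑ x ∈ TT m 3 1 ((m:ℝ)^β) ((m:ℝ)^(β+κ)), FG m r x) ∧
    ((1-η)^5 * (κ/r) * (((SW3 N N1 t3 c3 n3 : ℕ):ℝ)/10^9) ≤ ∑ x ∈ TT m 4 1 ((m:ℝ)^β) ((m:ℝ)^(β+κ)), FG m r x) := by
  have hNr : (1:ℝ) ≤ (N:ℝ)/100000 := by
    have : (100000:ℝ) ≤ N := by exact_mod_cast h1
    linarith
  have gp : ∀ t c : ℕ, 0 < t → 0 < grR t c 0 := by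
    intro t c h
    have : (0:ℝ) < gr t c 0 := by exact_mod_cast gr_pos h c 0
    unfold grR; positivity
  refine Filter.Eventually.and ?_ (Filter.Eventually.and ?_ (Filter.Eventually.and ?_ ?_))
  · filter_upwards [pat0 β κ r _ _ η hκ hr hN hκ1 hNr hη] with m hm
    refine le_trans ?_ hm
    have e : (1-η)^5 ≤ 1-η := by
      have := pow_le_pow_of_le_one (by linarith : (0:ℝ) ≤ 1-η) (by linarith : (1:ℝ)-η ≤ 1) (show 1 ≤ 5 by norm_num)
      simpa using this
    have p : (0:ℝ) ≤ κ/r/((N1:ℝ)/100000) := by positivity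
    calc (1-η)^5 * (κ/r) * (1/((N1:ℝ)/100000)) = (1-η)^5 * (κ/r/((N1:ℝ)/100000)) := by ring
      _ ≤ _ := mul_le_mul_of_nonneg_right e p
  · have := asm1 β κ r _ _ η hκ hr hr1 hβ1 hN hκ1 (grR t1 c1) (grR_strict _ _) (gp _ _ ht1) n1
      (fun i => ((W1 N N1 (gr t1 c1 i) (gr t1 c1 (i+1)) : ℕ):ℝ)/10^9)
      (fun i _ => W1_low (gr_pos ht1 c1 i) (gr_strict t1 c1 (Nat.lt_succ_self i)) hN1) hη hη1
    rw [SW1_eq]; exact this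
  · have := asm2 β κ r _ _ η hκ hr hr1 hβ1 hN hκ1 (grR t2 c2) (grR_strict _ _) (gp _ _ ht2) n2
      (fun i j => ((W2 N N1 (gr t2 c2 i) (gr t2 c2 (i+1)) (gr t2 c2 j) (gr t2 c2 (j+1)) : ℕ):ℝ)/10^9)
      (fun i j hij _ => W2_low (gr_pos ht2 c2 i) (gr_strict t2 c2 (Nat.lt_succ_self i)) ((gr_strict t2 c2).monotone hij)
        (gr_strict t2 c2 (Nat.lt_succ_self j)) hN1) hη hη1
    rw [SW2_eq]; exact this
  · have := asm3 β κ r _ _ η hκ hr hr1 hβ1 hN hκ1 (grR t3 c3) (grR_strict _ _) (gp _ _ ht3) n3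
      (fun i j l => ((W3 N N1 (gr t3 c3 i) (gr t3 c3 (i+1)) (gr t3 c3 j) (gr t3 c3 (j+1)) (gr t3 c3 l) (gr t3 c3 (l+1)) : ℕ):ℝ)/10^9)
      (fun i j l hij hjl _ => W3_low (gr_pos ht3 c3 i) (gr_strict t3 c3 (Nat.lt_succ_self i)) ((gr_strict t3 c3).monotone hij)
        (gr_strict t3 c3 (Nat.lt_succ_self j)) ((gr_strict t3 c3).monotone hjl) (gr_strict t3 c3 (Nat.lt_succ_self l)) hN1) hη hη1
    rw [SW3_eq]; exact this

lemma sumTT_nonneg (m k : ℕ) (r A B : ℝ) : 0 ≤ ∑ x ∈ TT m k 1 A B, FG m r x := Finset.sum_nonneg fun _ _ => FG_nonneg _ _ _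

/-- certified lower bound with two-dimensional sums -/
lemma VLow3 (β r V : ℝ) (N N1 c1 n1 c2 n2 C : ℕ) (hr : 0 < r) (hr1 : r ≤ 1) (hβ1 : β ≤ 1) (hN : r * ((N:ℝ)/100000) = β)
    (hN1 : N ≤ N1) (h1 : 100000 ≤ N) (hC : Nat.ble C (SW1 N N1 5000 c1 n1 + SW2 N N1 5000 c2 n2) = true)
    (hV : V ≤ 1/((N1:ℝ)/100000) + (C:ℝ)/10^9) : VLow β r ((N1:ℝ)/100000) 3 V := by
  intro κ η hκ hκ1 hη hη1
  filter_upwards [VLow_aux β r N N1 5000 c1 n1 5000 c2 n2 1 1 1 hr hr1 hβ1 hN hN1 h1 (by norm_num) (by norm_num) (by norm_num) κ η hκ hκ1 hη hη1] with m hm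
  obtain ⟨a0, a1, a2, _⟩ := hm
  have e : Finset.Icc 1 3 = {1, 2, 3} := rfl
  rw [e, Finset.sum_insert (by simp), Finset.sum_insert (by simp), Finset.sum_singleton]
  have hC' : (C:ℝ) ≤ SW1 N N1 5000 c1 n1 + SW2 N N1 5000 c2 n2 := by exact_mod_cast Nat.le_of_ble_eq_true hC
  have p : 0 ≤ (1-η)^5 * (κ/r) := mul_nonneg (pow_nonneg (by linarith) 5) (by positivity)
  have := mul_le_mul_of_nonneg_left (show V ≤ 1/((N1:ℝ)/100000) + ((SW1 N N1 5000 c1 n1 : ℕ):ℝ)/10^9 + ((SW2 N N1 5000 c2 n2 : ℕ):ℝ)/10^9 by linarith) p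
  linarith

/-- certified lower bound with three-dimensional sums -/
lemma VLow4 (l : ℕ) (hl : 4 ≤ l) (β r V : ℝ) (N N1 c1 n1 c2 n2 c3 n3 C : ℕ) (hr : 0 < r) (hr1 : r ≤ 1) (hβ1 : β ≤ 1) (hN : r * ((N:ℝ)/100000) = β)
    (hN1 : N ≤ N1) (h1 : 100000 ≤ N)
    (hC : Nat.ble C (SW1 N N1 5000 c1 n1 + SW2 N N1 5000 c2 n2 + SW3 N N1 8000 c3 n3) = true)
    (hV : V ≤ 1/((N1:ℝ)/100000) + (C:ℝ)/10^9) : VLow β r ((N1:ℝ)/100000) l V := by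
  intro κ η hκ hκ1 hη hη1
  filter_upwards [VLow_aux β r N N1 5000 c1 n1 5000 c2 n2 8000 c3 n3 hr hr1 hβ1 hN hN1 h1 (by norm_num) (by norm_num) (by norm_num) κ η hκ hκ1 hη hη1] with m hm
  obtain ⟨a0, a1, a2, a3⟩ := hm
  have e : ({1, 2, 3, 4} : Finset ℕ) ⊆ Finset.Icc 1 l := by
    intro x hx
    simp only [Finset.mem_insert, Finset.mem_singleton] at hx
    rw [Finset.mem_Icc]; omega
  refine le_trans ?_ (Finset.sum_le_sum_of_subset_of_nonneg e fun k _ _ => sumTT_nonneg m k r _ _)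
  rw [Finset.sum_insert (by simp), Finset.sum_insert (by simp), Finset.sum_insert (by simp), Finset.sum_singleton]
  have hC' : (C:ℝ) ≤ SW1 N N1 5000 c1 n1 + SW2 N N1 5000 c2 n2 + SW3 N N1 8000 c3 n3 := by exact_mod_cast Nat.le_of_ble_eq_true hC
  have p : 0 ≤ (1-η)^5 * (κ/r) := mul_nonneg (pow_nonneg (by linarith) 5) (by positivity)
  have := mul_le_mul_of_nonneg_left (show V ≤ 1/((N1:ℝ)/100000) + ((SW1 N N1 5000 c1 n1 : ℕ):ℝ)/10^9 + ((SW2 N N1 5000 c2 n2 : ℕ):ℝ)/10^9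
    + ((SW3 N N1 8000 c3 n3 : ℕ):ℝ)/10^9 by linarith) p
  linarith
end

section
open Filter Topology

set_option maxRecDepth 100000 in
lemma cert3a : Nat.ble 641956694 (SW1 585148 585150 5000 20 205 + SW2 585148 585150 5000 60 69) = true := by decide +kernel
set_option maxRecDepth 100000 in
lemma cert3b : Nat.ble 662125232 (SW1 538051 538053 5000 10 399 + SW2 538051 538053 5000 40 101) = true := by decide +kernel
set_option maxRecDepth 100000 in
lemma cert4a : Nat.ble 682437974 (SW1 779207 779209 5000 20 219 + SW2 779207 779209 5000 60 74 + SW3 779207 779209 8000 150 27) = true := by decide +kernel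
set_option maxRecDepth 100000 in
lemma cert4b : Nat.ble 696237218 (SW1 688566 688568 5000 20 213 + SW2 688566 688568 5000 43 100 + SW3 688566 688568 8000 150 26) = true := by decide +kernel
set_option maxRecDepth 100000 in
lemma cert4c : Nat.ble 718490778 (SW1 627717 627719 5000 10 415 + SW2 627717 627719 5000 36 116 + SW3 627717 627719 8000 100 38) = true := by decide +kernel
set_option maxRecDepth 100000 in
lemma cert5a : Nat.ble 695188678 (SW1 975037 975039 5000 20 231 + SW2 975037 975039 5000 50 93 + SW3 975037 975039 8000 120 36) = true := by decide +kernel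
set_option maxRecDepth 100000 in
lemma cert5b : Nat.ble 702216967 (SW1 878669 878671 5000 10 448 + SW2 878669 878671 5000 43 106 + SW3 878669 878671 8000 120 35) = true := by decide +kernel
end

section
open Filter Topology

lemma cellG (l N N1 C : ℕ) (α β K0 K : ℝ) (hα : 1/2 ≤ α) (hα1 : α ≤ 1) (hβ : 0 < β) (hβ1 : β ≤ 1)
    (hN2 : 200000 < N) (hN1 : N < N1)
    (d1 : 4 * β < (N:ℝ)/100000 * (α + 2 * β - 2)) (d2 : 2 * β < (N:ℝ)/100000 * (2 * α + 2 * β - 3))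
    (hK0 : 0 < K0) (hK : K0 < K) (hK1 : 1 ≤ K) (hH : KHyp α β (2 * α / K0))
    (hV : ∀ r, 0 < r → r ≤ 1 → r * ((N:ℝ)/100000) = β → VLow β r ((N1:ℝ)/100000) l (1/((N1:ℝ)/100000) + (C:ℝ)/10^9))
    (hnum : 26/25 * (K - 1) < K * (1/((N1:ℝ)/100000) + (C:ℝ)/10^9)) : Good l α β := by
  have hN2' : (2:ℝ) < (N:ℝ)/100000 := by
    have : (200000:ℝ) < N := by exact_mod_cast hN2
    linarith
  have hN1' : (N:ℝ)/100000 < (N1:ℝ)/100000 := by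
    have : (N:ℝ) < N1 := by exact_mod_cast hN1
    linarith
  generalize (N:ℝ)/100000 = n at *
  generalize (N1:ℝ)/100000 = n1 at *
  have hn : 0 < n := by linarith
  have er : β / n * n = β := by field_simp
  have hr : 0 < β / n := by positivity
  have hr2 : 2 * (β / n) < β := by
    rw [← mul_div_assoc, div_lt_iff₀ hn]; nlinarith
  refine critG α β (β/n) n1 (2*α/K0) K _ l hα hα1 hβ.le hβ1 hr ?_ ?_ hr2 (by positivity) hH ?_ hK1 ?_ (hV _ hr (by linarith) er) hnum
  · rw [← mul_assoc, ← mul_div_assoc, div_lt_iff₀ hn]; linarith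
  · rw [← mul_div_assoc, div_lt_iff₀ hn]; linarith
  · have : 2 * α / (2 * α / K0) = K0 := by field_simp
    linarith
  · calc β = β / n * n := er.symm
      _ < β / n * n1 := mul_lt_mul_of_pos_left hN1' hr

lemma KHyp_lin (α β K0 : ℝ) (hK0 : 0 < K0) (h : 4 * α < K0 * (3*α-2) ∨ 4 * α < K0 * (β+2*α-2)) (h2 : 2 * α < K0 * (3*α+β-3)) :
    KHyp α β (2 * α / K0) := by
  have e : 2 * α / K0 + 2 * α / K0 = 4 * α / K0 := by ring
  unfold KHyp
  rw [e, div_lt_iff₀ hK0, div_lt_iff₀ hK0, div_lt_iff₀ hK0]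
  refine ⟨h.imp ?_ ?_, ?_⟩ <;> intros <;> linarith

lemma cellG3 (N N1 c1 n1 c2 n2 C : ℕ) (hC : Nat.ble C (SW1 N N1 5000 c1 n1 + SW2 N N1 5000 c2 n2) = true)
    (α β K0 K : ℝ) (hα : 1/2 ≤ α) (hα1 : α ≤ 1) (hβ : 0 < β) (hβ1 : β ≤ 1)
    (hN2 : 200000 < N) (hN1 : N < N1)
    (d1 : 4 * β < (N:ℝ)/100000 * (α + 2 * β - 2)) (d2 : 2 * β < (N:ℝ)/100000 * (2 * α + 2 * β - 3))
    (hK0 : 0 < K0) (hK : K0 < K) (hK1 : 1 ≤ K) (hH : KHyp α β (2 * α / K0))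
    (hnum : 26/25 * (K - 1) < K * (1/((N1:ℝ)/100000) + (C:ℝ)/10^9)) : Good 3 α β :=
  cellG 3 N N1 C α β K0 K hα hα1 hβ hβ1 hN2 hN1 d1 d2 hK0 hK hK1 hH
    (fun r h1 h2 h3 => VLow3 β r _ N N1 c1 n1 c2 n2 C h1 h2 hβ1 h3 hN1.le (by omega) hC le_rfl) hnum

lemma cellG4 (l : ℕ) (hl : 4 ≤ l) (N N1 c1 n1 c2 n2 c3 n3 C : ℕ)
    (hC : Nat.ble C (SW1 N N1 5000 c1 n1 + SW2 N N1 5000 c2 n2 + SW3 N N1 8000 c3 n3) = true)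
    (α β K0 K : ℝ) (hα : 1/2 ≤ α) (hα1 : α ≤ 1) (hβ : 0 < β) (hβ1 : β ≤ 1)
    (hN2 : 200000 < N) (hN1 : N < N1)
    (d1 : 4 * β < (N:ℝ)/100000 * (α + 2 * β - 2)) (d2 : 2 * β < (N:ℝ)/100000 * (2 * α + 2 * β - 3))
    (hK0 : 0 < K0) (hK : K0 < K) (hK1 : 1 ≤ K) (hH : KHyp α β (2 * α / K0))
    (hnum : 26/25 * (K - 1) < K * (1/((N1:ℝ)/100000) + (C:ℝ)/10^9)) : Good l α β :=
  cellG l N N1 C α β K0 K hα hα1 hβ hβ1 hN2 hN1 d1 d2 hK0 hK hK1 hH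
    (fun r h1 h2 h3 => VLow4 l hl β r _ N N1 c1 n1 c2 n2 c3 n3 C h1 h2 hβ1 h3 hN1.le (by omega) hC le_rfl) hnum

lemma G3 (α β : ℝ) (hα : 1/2 ≤ α) (hα1 : α ≤ 1) (hβ1 : β ≤ 1) (hg : β = 2925733/1000000 * (α + β - 3/2)) : Good 3 α β := by
  have hb : 1925733/1000000 * β = 2925733/1000000 * (3/2 - α) := by linarith
  rcases le_total (95/100) α with h | h
  · refine cellG3 _ _ _ _ _ _ _ cert3a α β (44706/10000) (44707/10000) hα hα1 (by linarith) hβ1 (by norm_num) (by norm_num)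
      (by norm_num; linarith) (by norm_num; linarith) (by norm_num) (by norm_num) (by norm_num)
      (KHyp_lin _ _ _ (by norm_num) (Or.inl (by linarith)) (by linarith))
      (by norm_num)
  · refine cellG3 _ _ _ _ _ _ _ cert3b α β (50703/10000) (50704/10000) hα hα1 (by linarith) hβ1 (by norm_num) (by norm_num)
      (by norm_num; linarith) (by norm_num; linarith) (by norm_num) (by norm_num) (by norm_num)
      (KHyp_lin _ _ _ (by norm_num) ((le_total (905/1000) α).imp (fun _ => by linarith) (fun _ => by linarith)) (by linarith))
      (by norm_num)

lemma G4 (α β : ℝ) (hα : 1/2 ≤ α) (hα1 : α ≤ 1) (hβ1 : β ≤ 1) (hg : β = 3896026/1000000 * (α + β - 3/2)) : Good 4 α β := by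
  have hb : 2896026/1000000 * β = 3896026/1000000 * (3/2 - α) := by linarith
  rcases le_total (95/100) α with h | h
  · refine cellG4 4 (by norm_num) _ _ _ _ _ _ _ _ _ cert4a α β (44706/10000) (44707/10000) hα hα1 (by linarith) hβ1 (by norm_num) (by norm_num)
      (by norm_num; linarith) (by norm_num; linarith) (by norm_num) (by norm_num) (by norm_num)
      (KHyp_lin _ _ _ (by norm_num) (Or.inl (by linarith)) (by linarith))
      (by norm_num)
  rcases le_total (9/10) α with h' | h'
  · refine cellG4 4 (by norm_num) _ _ _ _ _ _ _ _ _ cert4b α β (51429/10000) (51430/10000) hα hα1 (by linarith) hβ1 (by norm_num) (by norm_num)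
      (by norm_num; linarith) (by norm_num; linarith) (by norm_num) (by norm_num) (by norm_num)
      (KHyp_lin _ _ _ (by norm_num) (Or.inl (by linarith)) (by linarith))
      (by norm_num)
  · refine cellG4 4 (by norm_num) _ _ _ _ _ _ _ _ _ cert4c α β (59220/10000) (59221/10000) hα hα1 (by linarith) hβ1 (by norm_num) (by norm_num)
      (by norm_num; linarith) (by norm_num; linarith) (by norm_num) (by norm_num) (by norm_num)
      (KHyp_lin _ _ _ (by norm_num) ((le_total (865/1000) α).imp (fun _ => by linarith) (fun _ => by linarith)) (by linarith))
      (by norm_num)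

lemma G5 (α β : ℝ) (hα : 94/100 ≤ α) (hα1 : α ≤ 1) (hβ1 : β ≤ 1) (hg : β = 4875179/1000000 * (α + β - 3/2)) : Good 5 α β := by
  have hb : 3875179/1000000 * β = 4875179/1000000 * (3/2 - α) := by linarith
  rcases le_total (97/100) α with h | h
  · refine cellG4 5 (by norm_num) _ _ _ _ _ _ _ _ _ cert5a α β (42638/10000) (42639/10000) (by linarith) hα1 (by linarith) hβ1 (by norm_num) (by norm_num)
      (by norm_num; linarith) (by norm_num; linarith) (by norm_num) (by norm_num) (by norm_num)
      (KHyp_lin _ _ _ (by norm_num) (Or.inl (by linarith)) (by linarith))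
      (by norm_num)
  · refine cellG4 5 (by norm_num) _ _ _ _ _ _ _ _ _ cert5b α β (45854/10000) (45855/10000) (by linarith) hα1 (by linarith) hβ1 (by norm_num) (by norm_num)
      (by norm_num; linarith) (by norm_num; linarith) (by norm_num) (by norm_num) (by norm_num)
      (KHyp_lin _ _ _ (by norm_num) (Or.inl (by linarith)) (by linarith))
      (by norm_num)
end

section
open Filter Topology

lemma log3_le : Real.log 3 ≤ 8/5 * Real.log 2 := by
  have h : Real.log ((3:ℝ)^5) ≤ Real.log ((2:ℝ)^8) := Real.log_le_log (by norm_num) (by norm_num)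
  rw [Real.log_pow, Real.log_pow] at h
  push_cast at h; linarith

lemma log52_le : Real.log (5/2) ≤ 4/3 * Real.log 2 := by
  have h : Real.log ((5/2:ℝ)^3) ≤ Real.log ((2:ℝ)^4) := Real.log_le_log (by norm_num) (by norm_num)
  rw [Real.log_pow, Real.log_pow] at h
  push_cast at h; linarith

lemma log4_eq : Real.log 4 = 2 * Real.log 2 := by
  rw [show (4:ℝ) = 2^2 by norm_num, Real.log_pow]; push_cast; ring

lemma Elow48 : Elow 4 8 ≤ 19801/10000 := by
  have := Real.log_two_lt_d9
  unfold Elow; rw [log4_eq]; norm_num; linarith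

lemma Ehigh48 : Ehigh 4 8 ≤ 1932/10000 := by
  have := Real.log_two_lt_d9
  unfold Ehigh; rw [show (8:ℝ)/4 = 2 by norm_num]; norm_num; linarith

lemma Elow410 : Elow 4 10 ≤ 20614/10000 := by
  have := Real.log_two_lt_d9
  unfold Elow; rw [log4_eq]; norm_num; linarith

lemma Ehigh410 : Ehigh 4 10 ≤ 3243/10000 := by
  have := Real.log_two_lt_d9
  have := log52_le
  unfold Ehigh; rw [show (10:ℝ)/4 = 5/2 by norm_num]; norm_num; linarith

lemma Elow66 : Elow 6 6 ≤ 1928/1000 := by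
  have := Real.log_two_lt_d9
  have := log3_le
  unfold Elow; rw [show (6:ℝ) = 2 * 3 by norm_num, Real.log_mul (by norm_num) (by norm_num)]; norm_num; linarith

lemma Ehigh66 : Ehigh 6 6 ≤ 0 := by
  unfold Ehigh; norm_num

lemma Elow44 : Elow 4 4 ≤ 1574/1000 := by
  have := Real.log_two_lt_d9
  unfold Elow; rw [log4_eq]; norm_num; linarith

lemma cellM (l : ℕ) (α β y1 y N K0 K E H : ℝ) (hE : Elow y1 y ≤ E) (hH' : Ehigh y1 y ≤ H) (hα : 1/2 ≤ α) (hα1 : α ≤ 1) (hβ : 0 < β) (hβ1 : β ≤ 1)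
    (h1 : 1 ≤ y1) (h2 : y1 ≤ y) (hN : 2 + y < N)
    (d1 : 2 * ((2 + y1) * β) < N * (α + 2 * β - 2)) (d2 : (2 + y1) * β < N * (2 * α + 2 * β - 3))
    (hK0 : 0 < K0) (hK : K0 < K) (hH : KHyp α β (2 * α / K0))
    (hnum : E + K * H < l + 1 - N / y) : Good l α β := by
  have hn : 0 < N := by linarith
  have hy : 0 < y := by linarith
  have hr : 0 < β / N := by positivity
  refine critM_K α β (β/N) y1 y (2*α/K0) K l hα hα1 hβ.le hβ1 hr h1 h2 ?_ ?_ ?_ (by positivity) hH ?_ ?_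
  · rw [← mul_div_assoc, ← mul_div_assoc, div_lt_iff₀ hn]; linarith
  · rw [← mul_div_assoc, div_lt_iff₀ hn]; linarith
  · rw [← mul_div_assoc, div_lt_iff₀ hn]; nlinarith
  · have : 2 * α / (2 * α / K0) = K0 := by field_simp
    linarith
  · have e : β / (β / N * y) = N / y := by field_simp
    rw [e]
    have := mul_le_mul_of_nonneg_left hH' (hK0.trans hK).le
    linarith

lemma M5 (α β : ℝ) (hα : 1/2 ≤ α) (hα1 : α ≤ 1) (hβ1 : β ≤ 1) (hg : β = 4875179/1000000 * (α + β - 3/2)) : Good 5 α β := by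
  have hb : 3875179/1000000 * β = 4875179/1000000 * (3/2 - α) := by linarith
  rcases le_total (94/100) α with h | h
  · exact G5 α β h hα1 hβ1 hg
  rcases le_total (91/100) α with h' | h'
  · exact cellM 5 α β 4 8 (24223/1000) (49864/10000) (49865/10000) _ _ Elow48 Ehigh48 hα hα1 (by linarith) hβ1 (by norm_num) (by norm_num) (by norm_num)
      (by linarith) (by linarith) (by norm_num) (by norm_num) (KHyp_lin _ _ _ (by norm_num) (Or.inl (by linarith)) (by linarith)) (by norm_num)
  rcases le_total (855/1000) α with h'' | h''
  · exact cellM 5 α β 4 8 (22578/1000) (60531/10000) (60532/10000) _ _ Elow48 Ehigh48 hα hα1 (by linarith) hβ1 (by norm_num) (by norm_num) (by norm_num)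
      (by linarith) (by linarith) (by norm_num) (by norm_num) (KHyp_lin _ _ _ (by norm_num) (Or.inl (by linarith)) (by linarith)) (by norm_num)
  rcases le_total (765/1000) α with h3 | h3
  · exact cellM 5 α β 4 8 (20376/1000) (69651/10000) (69652/10000) _ _ Elow48 Ehigh48 hα hα1 (by linarith) hβ1 (by norm_num) (by norm_num) (by norm_num)
      (by linarith) (by linarith) (by norm_num) (by norm_num) (KHyp_lin _ _ _ (by norm_num) (Or.inr (by linarith)) (by linarith)) (by norm_num)
  · exact cellM 5 α β 6 6 (24083/1000) 13 14 _ _ Elow66 Ehigh66 hα hα1 (by linarith) hβ1 (by norm_num) (by norm_num) (by norm_num)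
      (by linarith) (by linarith) (by norm_num) (by norm_num) (KHyp_lin _ _ _ (by norm_num) (Or.inr (by linarith)) (by linarith)) (by norm_num)

lemma M6 (α β : ℝ) (hα : 1/2 ≤ α) (hα1 : α ≤ 1) (hβ1 : β ≤ 1) (hg : β = 5875179/1000000 * (α + β - 3/2)) : Good 6 α β := by
  have hb : 4875179/1000000 * β = 5875179/1000000 * (3/2 - α) := by linarith
  rcases le_total (97/100) α with h' | h'
  · exact cellM 6 α β 4 10 (35252/1000) (42638/10000) (42639/10000) _ _ Elow410 Ehigh410 hα hα1 (by linarith) hβ1 (by norm_num) (by norm_num) (by norm_num)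
      (by linarith) (by linarith) (by norm_num) (by norm_num) (KHyp_lin _ _ _ (by norm_num) (Or.inl (by linarith)) (by linarith)) (by norm_num)
  rcases le_total (88/100) α with h'' | h''
  · exact cellM 6 α β 4 10 (30977/1000) (55001/10000) (55002/10000) _ _ Elow410 Ehigh410 hα hα1 (by linarith) hβ1 (by norm_num) (by norm_num) (by norm_num)
      (by linarith) (by linarith) (by norm_num) (by norm_num) (KHyp_lin _ _ _ (by norm_num) (Or.inl (by linarith)) (by linarith)) (by norm_num)
  rcases le_total (8/10) α with h3 | h3
  · exact cellM 6 α β 4 10 (23952/1000) (72140/10000) (72141/10000) _ _ Elow410 Ehigh410 hα hα1 (by linarith) hβ1 (by norm_num) (by norm_num) (by norm_num)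
      (by linarith) (by linarith) (by norm_num) (by norm_num) (KHyp_lin _ _ _ (by norm_num) (Or.inr (by linarith)) (by linarith)) (by norm_num)
  · exact cellM 6 α β 6 6 (27706/1000) 129 130 _ _ Elow66 Ehigh66 hα hα1 (by linarith) hβ1 (by norm_num) (by norm_num) (by norm_num)
      (by linarith) (by linarith) (by norm_num) (by norm_num) (KHyp_lin _ _ _ (by norm_num) (Or.inr (by linarith)) (by linarith)) (by norm_num)

lemma M7 (l : ℕ) (hl : 7 ≤ l) (α β : ℝ) (hα : 1/2 ≤ α) (hα1 : α ≤ 1) (hβ1 : β ≤ 1) (hD : 0 < α + β - 3/2)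
    (hg : β = (l - 124821/1000000) * (α + β - 3/2)) : Good l α β := by
  have hl' : (7:ℝ) ≤ l := by exact_mod_cast hl
  set D := α + β - 3/2 with hDd
  have hb : 6875179/1000000 * D ≤ β := by nlinarith
  have hβ : 0 < β := by linarith
  have q : ∀ c y : ℝ, 0 < c → 0 < y → β / (c * D * y) = (l - 124821/1000000) * (1/(c * y)) := by
    intro c y hc hy
    rw [hg]; field_simp
  have kk : ∀ K0 K : ℝ, 0 < K0 → K0 < K → 2 * α / (2 * α / K0) < K := by
    intro K0 K h1 h2
    have : 2 * α / (2 * α / K0) = K0 := by field_simp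
    linarith
  have hα0 : 0 < α := by linarith
  rcases le_total (1 - α) (6/10 * D) with h1 | h1
  · refine critM_K α β (1666/10000 * D) 4 10 (2*α/(455/100)) (456/100) l hα hα1 hβ.le hβ1 (by positivity) (by norm_num) (by norm_num)
      (by linarith) (by linarith) (by linarith) (by positivity)
      (KHyp_lin _ _ _ (by norm_num) (Or.inl (by linarith)) (by linarith)) (kk _ _ (by norm_num) (by norm_num)) ?_
    rw [q _ _ (by norm_num) (by norm_num)]
    have := Elow410
    have := Ehigh410
    norm_num; linarith
  rcases le_total (1 - α) (124/100 * D) with h2 | h2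
  · refine critM_K α β (2166/10000 * D) 4 10 (2*α/(58/10)) (581/100) l hα hα1 hβ.le hβ1 (by positivity) (by norm_num) (by norm_num)
      (by linarith) (by linarith) (by linarith) (by positivity)
      (KHyp_lin _ _ _ (by norm_num) (Or.inl (by linarith)) (by linarith)) (kk _ _ (by norm_num) (by norm_num)) ?_
    rw [q _ _ (by norm_num) (by norm_num)]
    have := Elow410
    have := Ehigh410
    norm_num; linarith
  · refine critM_X α β (2699/10000 * D) 4 l hα hα1 hβ.le hβ1 (by positivity) (by norm_num)
      (by linarith) (by linarith) (by linarith) (by linarith) ?_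
    rw [q _ _ (by norm_num) (by norm_num)]
    have := Elow44
    norm_num; linarith

lemma Good_all (l : ℕ) (hl : 3 ≤ l) (α β t : ℝ) (hα : 1/2 ≤ α) (hα1 : α ≤ 1) (hβ1 : β ≤ 1) (hD : 0 < α + β - 3/2)
    (ht : t = l - (if l ≤ 2 then 0.044560 else if l = 3 then 0.074267 else if l = 4 then 0.103974 else 0.124821))
    (hg : β = t * (α + β - 3/2)) : Good l α β := by
  rw [if_neg (by omega)] at ht
  rcases (by omega : l = 3 ∨ l = 4 ∨ l = 5 ∨ l = 6 ∨ 7 ≤ l) with rfl | rfl | rfl | rfl | h7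
  · norm_num at ht; rw [ht] at hg; exact G3 α β hα hα1 hβ1 (by linarith)
  · norm_num at ht; rw [ht] at hg; exact G4 α β hα hα1 hβ1 (by linarith)
  · norm_num at ht; rw [ht] at hg; exact M5 α β hα hα1 hβ1 (by linarith)
  · norm_num at ht; rw [ht] at hg; exact M6 α β hα hα1 hβ1 (by linarith)
  · rw [if_neg (by omega), if_neg (by omega)] at ht
    refine M7 l h7 α β hα hα1 hβ1 hD ?_
    rw [ht] at hg; norm_num at hg ⊢; linarith
end

theorem stmt_1 (l : ℕ) (hl : 2 ≤ l) (α β : ℝ)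
    (hα : 1/2 ≤ α) (hβ : 0 ≤ β) (hα1 : α ≤ 1) (hβ1 : β ≤ 1)
    (h1 : α + β > 3/2)
    (h2 : β / (α + β - 3/2) ≤ greavesTheta l) :
    ∀ ε : ℝ, 0 < ε → ∃ M : ℕ, ∀ m : ℕ, M ≤ m → ∀ a : ℤ, Int.gcd a m = 1 →
      ∃ p₁ p₂ s : ℕ, p₁.Prime ∧ p₂.Prime ∧
        (p₁ : ℝ) ≤ (m : ℝ) ^ (α + ε) ∧ (p₂ : ℝ) ≤ (m : ℝ) ^ (α + ε) ∧
        0 < s ∧ (s : ℝ) ≤ (m : ℝ) ^ (β + ε) ∧ s.primeFactorsList.length ≤ l ∧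
        ((p₁ * p₂ * s : ℕ) : ℤ) ≡ a [ZMOD (m : ℤ)] := by
  have hD0 : 0 < α + β - 3/2 := by linarith
  have hβ0 : 0 < β := by linarith
  have h3 : β ≤ greavesTheta l * (α + β - 3/2) := (div_le_iff₀ hD0).1 h2
  rcases (by omega : l = 2 ∨ 3 ≤ l) with rfl | hl3
  · exfalso
    have e : greavesTheta 2 = 2 - 0.044560 := by simp [greavesTheta, greavesDelta]
    rw [e] at h3
    norm_num at h3
    linarith
  have ht : 2 < greavesTheta l := by
    have hl' : (3:ℝ) ≤ l := by exact_mod_cast hl3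
    unfold greavesTheta greavesDelta
    split_ifs <;> norm_num <;> linarith
  set t := greavesTheta l with htd
  have ht1 : 0 < t - 1 := by linarith
  have hb : (t - 1) * (t * (3/2 - α) / (t - 1)) = t * (3/2 - α) := by field_simp
  set b := t * (3/2 - α) / (t - 1) with hbd
  have hb0 : 0 < b := by
    have : 0 < 3/2 - α := by linarith
    positivity
  have hbβ : b ≤ β := by
    rw [hbd, div_le_iff₀ ht1]; linarith
  have hbt : b = t * (α + b - 3/2) := by linarith
  have hD : 0 < α + b - 3/2 := by
    by_contra hh
    push Not at hh
    nlinarith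
  have hG := Good_all l hl3 α b t hα hα1 (hbβ.trans hβ1) hD (by rw [htd]; rfl) hbt
  intro ε hε
  obtain ⟨M, hM⟩ := Good_adm l α b hG ε hε
  refine ⟨max M 1, fun m hm a ha => ?_⟩
  obtain ⟨p₁, p₂, s, q1, q2, q3, q4, q5, q6, q7, q8⟩ := hM m (le_of_max_le_left hm) a ha
  refine ⟨p₁, p₂, s, q1, q2, q3, q4, q5, q6.trans ?_, q7, q8⟩
  exact Real.rpow_le_rpow_of_exponent_le (by exact_mod_cast le_of_max_le_right hm) (by linarith)
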